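/- Let n ≥ 2, p ∈ [2,∞), q ∈ [p,∞), s,t ∈ (0,1) with t ≤ s, 1/p' ≤ tq/(sp) ≤ 1, sp < n, and a measurable symmetric with 0 ≤ a ≤ M. Let ε ∈ (0, min{ s(tq/(sp) − 1/p'), s/p }), and let B = B_R(x₀) with R ≤ 1, 𝓑 = B×B. Define H(x,y) = G(x,y,U)^{(p−1)/p} and γ = p'(n+εp)/(n+sp+εp) < p'. Then there exists C depending only on n,p,q,s,t,M,‖u‖_{L^∞} such that for any bounded weak solution u ∈ W^{s,p}(ℝⁿ) ∩ L^∞(ℝⁿ) with data f and any σ ∈ (0,1): ( ⨍_{(1/4)𝓑} H^{p'} dν )^{1/p'} ≤ C σ^{−1} ε^{−(1/γ−1/p')} ( ⨍_{𝓑} H^γ dν )^{1/γ} + C σ ε^{−(1/γ−1/p')} Σ_{k=0}^∞ α_k ( ⨍_{2^k 𝓑} H^γ dν )^{1/γ} + C [ν(𝓑)]^θ ε^{−(1/p_*−1/p')} ( ⨍_{𝓑} F^{p_*} dν )^{1/p_*}, where α_k = 2^{−k(tq/(p−1) − s − ε)} and θ = (s − ε(p−1))/(n + εp). -/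

import Mathlib

open MeasureTheory Metric Set
open scoped ENNReal

noncomputable section

/-- `ℝⁿ` as a Euclidean space. -/
abbrev En (n : ℕ) := EuclideanSpace ℝ (Fin n)

/-- The Hölder conjugate `p' = p/(p−1)`. -/
def pC (p : ℝ) : ℝ := p / (p - 1)

/-- The lower Sobolev exponent `p_* = np'/(n+sp')`. -/
def pStar (n : ℕ) (p s : ℝ) : ℝ := (n : ℝ) * pC p / ((n : ℝ) + s * pC p)

/-- The integrand `P(x,y,u)` of the double phase energy `ℰ(u,u)`:
`|u(x)−u(y)|^p/|x−y|^{n+sp} + a(x,y)|u(x)−u(y)|^q/|x−y|^{n+tq}`. -/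
def energyIntegrand (n : ℕ) (p q s t : ℝ) (a : En n × En n → ℝ) (u : En n → ℝ)
    (z : En n × En n) : ℝ :=
  |u z.1 - u z.2| ^ p / ‖z.1 - z.2‖ ^ ((n : ℝ) + s * p)
    + a z * |u z.1 - u z.2| ^ q / ‖z.1 - z.2‖ ^ ((n : ℝ) + t * q)

/-- The integrand of the double phase form `ℰ(u,φ)`. -/
def formIntegrand (n : ℕ) (p q s t : ℝ) (a : En n × En n → ℝ) (u φ : En n → ℝ)
    (z : En n × En n) : ℝ :=
  |u z.1 - u z.2| ^ (p - 2) * (u z.1 - u z.2) * (φ z.1 - φ z.2)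
      / ‖z.1 - z.2‖ ^ ((n : ℝ) + s * p)
    + a z * (|u z.1 - u z.2| ^ (q - 2) * (u z.1 - u z.2) * (φ z.1 - φ z.2))
        / ‖z.1 - z.2‖ ^ ((n : ℝ) + t * q)

/-- `u ∈ W^{s,p}(ℝⁿ)`: `u` is measurable, `u ∈ L^p(ℝⁿ)`, and the Gagliardo seminorm
`∬ |u(x)−u(y)|^p/|x−y|^{n+sp} dy dx` is finite. -/
def MemWsp (n : ℕ) (s p : ℝ) (u : En n → ℝ) : Prop :=
  Measurable u ∧ (∫⁻ x, ENNReal.ofReal (|u x| ^ p)) < ⊤ ∧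
    (∫⁻ z : En n × En n,
      ENNReal.ofReal (|u z.1 - u z.2| ^ p / ‖z.1 - z.2‖ ^ ((n : ℝ) + s * p))) < ⊤

/-- `u` is a bounded weak solution of `ℒu = f`: the double phase energy `ℰ(u,u)` is finite
and `ℰ(u,φ) = ∫ fφ` for every test function `φ ∈ C_c^∞(ℝⁿ)`. -/
def IsBoundedWeakSolution (n : ℕ) (p q s t : ℝ) (a : En n × En n → ℝ)
    (u f : En n → ℝ) : Prop :=
  (∫⁻ z : En n × En n, ENNReal.ofReal (energyIntegrand n p q s t a u z)) < ⊤ ∧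
  ∀ φ : En n → ℝ, ContDiff ℝ (⊤ : ℕ∞) φ → HasCompactSupport φ →
    (∫ z : En n × En n, formIntegrand n p q s t a u φ z) = ∫ x, f x * φ x

/-- The dual-pair measure `ν` on `ℝⁿ × ℝⁿ`, with density `|x−y|^{−(n−εp)}`. -/
def nu (n : ℕ) (p ε : ℝ) : Measure (En n × En n) :=
  volume.withDensity fun z => ENNReal.ofReal (‖z.1 - z.2‖ ^ (ε * p - n))

/-- The diagonal ball `𝓑(x₀,R) = B(x₀,R) × B(x₀,R) ⊂ ℝ^{2n}`. -/
def bB (n : ℕ) (x₀ : En n) (R : ℝ) : Set (En n × En n) := ball x₀ R ×ˢ ball x₀ R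

/-- The exponent `η = (np + εp²)/(n + sp + εp)`. -/
def etaEx (n : ℕ) (p s ε : ℝ) : ℝ := ((n : ℝ) * p + ε * p ^ 2) / ((n : ℝ) + s * p + ε * p)

/-- The exponent `γ = η/(p−1) = p'(n+εp)/(n+sp+εp)`. -/
def gammaEx (n : ℕ) (p s ε : ℝ) : ℝ :=
  pC p * (((n : ℝ) + ε * p) / ((n : ℝ) + s * p + ε * p))

/-- The exponent `θ = (s − ε(p−1))/(n + εp)`. -/
def thetaEx (n : ℕ) (p s ε : ℝ) : ℝ := (s - ε * (p - 1)) / ((n : ℝ) + ε * p)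

/-- `U(x,y) = |u(x)−u(y)|/|x−y|^{s+ε}`. -/
def Ufun (n : ℕ) (s ε : ℝ) (u : En n → ℝ) (z : En n × En n) : ℝ :=
  |u z.1 - u z.2| / ‖z.1 - z.2‖ ^ (s + ε)

/-- `A(x,y) = a(x,y)|x−y|^{(s−t)q+ε(q−p)}`. -/
def Afun (n : ℕ) (p q s t ε : ℝ) (a : En n × En n → ℝ) (z : En n × En n) : ℝ :=
  a z * ‖z.1 - z.2‖ ^ ((s - t) * q + ε * (q - p))

/-- `G(x,y,U) = U^p + A(x,y) U^q`. -/
def Gfun (n : ℕ) (p q s t ε : ℝ) (a : En n × En n → ℝ) (u : En n → ℝ)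
    (z : En n × En n) : ℝ :=
  Ufun n s ε u z ^ p + Afun n p q s t ε a z * Ufun n s ε u z ^ q

/-- `H(x,y,U) = G(x,y,U)^{(p−1)/p}`. -/
def Hfun (n : ℕ) (p q s t ε : ℝ) (a : En n × En n → ℝ) (u : En n → ℝ)
    (z : En n × En n) : ℝ :=
  Gfun n p q s t ε a u z ^ ((p - 1) / p)

/-- Volume of the unit ball. -/
def om (n : ℕ) : ℝ := volume.real (ball (0 : En n) 1)

lemma om_pos (n : ℕ) : 0 < om n := by
  unfold om
  rw [measureReal_def]
  exact ENNReal.toReal_pos (measure_ball_pos _ _ one_pos).ne' measure_ball_lt_top.ne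

lemma vol_ball (n : ℕ) (x : En n) {r : ℝ} (hr : 0 < r) :
    volume (ball x r) = ENNReal.ofReal (om n * r ^ (n : ℝ)) := by
  rw [Measure.addHaar_ball_of_pos _ _ hr, om, measureReal_def, ENNReal.ofReal_mul ENNReal.toReal_nonneg,
    ENNReal.ofReal_toReal measure_ball_lt_top.ne, mul_comm]
  simp

lemma lint_radial (n : ℕ) (hn : 2 ≤ n) (F : ℝ → ℝ) (h0 : ∀ r, 0 < r → 0 ≤ F r)
    (hI : IntegrableOn (fun y : ℝ => y ^ (n - 1) * F y) (Ioi 0)) :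
    ∫⁻ x : En n, ENNReal.ofReal (F ‖x‖) =
      ENNReal.ofReal (n * om n * ∫ y in Ioi (0:ℝ), y ^ (n - 1) * F y) := by
  have : Nonempty (Fin n) := ⟨⟨0, by omega⟩⟩
  have hd : Module.finrank ℝ (En n) = n := by simp
  have hIntg : Integrable (fun x : En n => F ‖x‖) := by
    rw [integrable_fun_norm_addHaar volume (f := F), hd]
    simpa using hI
  have hz : ∀ᵐ x : En n, 0 ≤ F ‖x‖ := by
    have h : ∀ᵐ x : En n, x ≠ 0 := by
      rw [ae_iff]
      simp
    filter_upwards [h] with x hx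
    exact h0 _ (norm_pos_iff.mpr hx)
  rw [← ofReal_integral_eq_lintegral_ofReal hIntg hz, integral_fun_norm_addHaar volume F, hd]
  simp [om, mul_assoc]

lemma lint_ball_rpow (n : ℕ) (hn : 2 ≤ n) {r b : ℝ} (hr : 0 < r) (hb : 0 < b) :
    ∫⁻ h : En n, (Iio r).indicator (fun ρ : ℝ => ENNReal.ofReal (ρ ^ (b - n))) ‖h‖ =
      ENNReal.ofReal (n * om n * (r ^ b / b)) := by
  have e1 : ∀ h : En n, (Iio r).indicator (fun ρ : ℝ => ENNReal.ofReal (ρ ^ (b - n))) ‖h‖ =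
      ENNReal.ofReal ((Iio r).indicator (fun ρ : ℝ => ρ ^ (b - n)) ‖h‖) := by
    intro h; by_cases hh : ‖h‖ < r <;> simp [indicator, hh]
  simp_rw [e1]
  have key : ∀ y ∈ Ioi (0:ℝ), y ^ (n - 1) * (Iio r).indicator (fun ρ : ℝ => ρ ^ (b - n)) y
      = (Ioo 0 r).indicator (fun ρ : ℝ => ρ ^ (b - 1)) y := by
    intro y hy
    have hy : 0 < y := hy
    by_cases hh : y < r
    · simp only [indicator, mem_Iio, hh, mem_Ioo, hy, and_self, if_true]
      rw [← Real.rpow_natCast, ← Real.rpow_add hy]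
      congr 1
      push_cast [Nat.cast_sub (by omega : 1 ≤ n)]; ring
    · simp [indicator, hh]
  have hio : IntervalIntegrable (fun ρ : ℝ => ρ ^ (b - 1)) volume 0 r :=
    intervalIntegral.intervalIntegrable_rpow' (by linarith)
  rw [lint_radial n hn]
  · rw [setIntegral_congr_fun measurableSet_Ioi key, setIntegral_indicator measurableSet_Ioo,
      inter_eq_self_of_subset_right (fun x hx => hx.1), ← integral_Ioc_eq_integral_Ioo,
      ← intervalIntegral.integral_of_le hr.le, integral_rpow (Or.inl (by linarith))]
    simp [Real.zero_rpow hb.ne']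
  · intro ρ hρ
    by_cases hx : ρ < r <;> simp [indicator, hx]; positivity
  · rw [integrableOn_congr_fun key measurableSet_Ioi]
    rw [intervalIntegrable_iff_integrableOn_Ioo_of_le hr.le] at hio
    exact (hio.integrable_indicator measurableSet_Ioo).integrableOn

lemma lint_compl_rpow (n : ℕ) (hn : 2 ≤ n) {r b : ℝ} (hr : 0 < r) (hb : 0 < b) :
    ∫⁻ h : En n, (Ici r).indicator (fun ρ : ℝ => ENNReal.ofReal (ρ ^ (-b - n))) ‖h‖ =
      ENNReal.ofReal (n * om n * (r ^ (-b) / b)) := by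
  have e1 : ∀ h : En n, (Ici r).indicator (fun ρ : ℝ => ENNReal.ofReal (ρ ^ (-b - n))) ‖h‖ =
      ENNReal.ofReal ((Ici r).indicator (fun ρ : ℝ => ρ ^ (-b - n)) ‖h‖) := by
    intro h; by_cases hh : r ≤ ‖h‖ <;> simp [indicator, hh]
  simp_rw [e1]
  have key : ∀ y ∈ Ioi (0:ℝ), y ^ (n - 1) * (Ici r).indicator (fun ρ : ℝ => ρ ^ (-b - n)) y
      = (Ici r).indicator (fun ρ : ℝ => ρ ^ (-b - 1)) y := by
    intro y hy
    have hy : 0 < y := hy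
    by_cases hh : r ≤ y
    · simp only [indicator, mem_Ici, hh, if_true]
      rw [← Real.rpow_natCast, ← Real.rpow_add hy]
      congr 1
      push_cast [Nat.cast_sub (by omega : 1 ≤ n)]; ring
    · simp [indicator, hh]
  have hio := integrableOn_Ioi_rpow_of_lt (a := -b - 1) (by linarith) hr
  rw [lint_radial n hn]
  · rw [setIntegral_congr_fun measurableSet_Ioi key, setIntegral_indicator measurableSet_Ici,
      inter_eq_self_of_subset_right (Ici_subset_Ioi.mpr hr), integral_Ici_eq_integral_Ioi,
      integral_Ioi_rpow_of_lt (by linarith) hr]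
    congr 2
    rw [sub_add_cancel, div_neg, neg_div, neg_neg]
  · intro ρ hρ
    by_cases hx : r ≤ ρ <;> simp [indicator, hx]; positivity
  · rw [integrableOn_congr_fun key measurableSet_Ioi]
    rw [← integrableOn_Ici_iff_integrableOn_Ioi] at hio
    exact (hio.integrable_indicator measurableSet_Ici).integrableOn

lemma lint_shift (n : ℕ) (x : En n) (g : ℝ → ℝ≥0∞) :
    ∫⁻ y : En n, g ‖x - y‖ = ∫⁻ h : En n, g ‖h‖ :=
  lintegral_sub_left_eq_self (fun h => g ‖h‖) x

lemma min_kernel (n : ℕ) (hn : 2 ≤ n) {s : ℝ} (hs0 : 0 < s) (hs1 : s < 1) :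
    ∃ C : ℝ, 0 < C ∧ ∀ μ : ℝ, 0 < μ →
      ∫⁻ h : En n, ENNReal.ofReal (min 1 (μ * ‖h‖) * ‖h‖ ^ (-s - n)) ≤ ENNReal.ofReal (C * μ ^ s) := by
  have hom := om_pos n
  have hn0 : (0:ℝ) < n := by positivity
  refine ⟨n * om n * (1 / (1 - s)) + n * om n * (1 / s), by
    have : 0 < 1 - s := by linarith
    positivity, fun μ hμ => ?_⟩
  have h1s : 0 < 1 - s := by linarith
  have hr : 0 < 1 / μ := by positivity
  calc ∫⁻ h : En n, ENNReal.ofReal (min 1 (μ * ‖h‖) * ‖h‖ ^ (-s - n))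
      ≤ ∫⁻ h : En n, (ENNReal.ofReal μ *
          (Iio (1/μ)).indicator (fun ρ : ℝ => ENNReal.ofReal (ρ ^ ((1 - s) - n))) ‖h‖
        + (Ici (1/μ)).indicator (fun ρ : ℝ => ENNReal.ofReal (ρ ^ (-s - n))) ‖h‖) := by
        apply lintegral_mono
        intro h
        dsimp only
        by_cases hh : ‖h‖ < 1 / μ
        · have h' : ¬ (1 / μ ≤ ‖h‖) := not_le.mpr hh
          simp only [indicator, mem_Iio, mem_Ici, hh, h', if_true, if_false, add_zero]
          rw [← ENNReal.ofReal_mul hμ.le]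
          apply ENNReal.ofReal_le_ofReal
          rcases eq_or_lt_of_le (norm_nonneg h) with h0 | h0
          · rw [← h0]; simp; positivity
          · have : ‖h‖ ^ ((1 - s) - n : ℝ) = ‖h‖ * ‖h‖ ^ (-s - n : ℝ) := by
              rw [← Real.rpow_one_add' h0.le]
              · ring_nf
              · have : (2:ℝ) ≤ n := by exact_mod_cast hn
                intro h; linarith
            rw [this, ← mul_assoc]
            exact mul_le_mul_of_nonneg_right (min_le_right _ _) (by positivity)
        · have h' : (1 / μ ≤ ‖h‖) := not_lt.mp hh
          simp only [indicator, mem_Iio, mem_Ici, hh, h', if_true, if_false, mul_zero, zero_add]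
          apply ENNReal.ofReal_le_ofReal
          have := mul_le_mul_of_nonneg_right (min_le_left 1 (μ * ‖h‖))
            (by positivity : 0 ≤ ‖h‖ ^ (-s - n : ℝ))
          simpa using this
    _ = ENNReal.ofReal ((n * om n * (1 / (1 - s)) + n * om n * (1 / s)) * μ ^ s) := by
        rw [lintegral_add_left, lintegral_const_mul, lint_ball_rpow n hn hr h1s,
          lint_compl_rpow n hn hr hs0, ← ENNReal.ofReal_mul hμ.le, ← ENNReal.ofReal_add]
        · congr 1
          have e1 : (1/μ) ^ (1 - s) = μ ^ s / μ := by
            rw [one_div, Real.inv_rpow hμ.le, Real.rpow_sub hμ, Real.rpow_one, inv_div]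
          have e2 : (1/μ) ^ (-s) = μ ^ s := by
            rw [one_div, Real.inv_rpow hμ.le, Real.rpow_neg hμ.le, inv_inv]
          rw [e1, e2]
          field_simp
        · positivity
        · positivity
        · exact ((by fun_prop : Measurable fun ρ : ℝ => ENNReal.ofReal (ρ ^ ((1 - s) - n))).indicator
            measurableSet_Iio).comp measurable_norm
        · exact (((by fun_prop : Measurable fun ρ : ℝ => ENNReal.ofReal (ρ ^ ((1 - s) - n))).indicator
            measurableSet_Iio).comp measurable_norm).const_mul _

lemma exp_kernel (n : ℕ) (hn : 2 ≤ n) :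
    ∃ C : ℝ, 0 < C ∧ ∀ μ : ℝ, 0 < μ →
      ∫⁻ h : En n, ENNReal.ofReal (Real.exp (-(μ * ‖h‖))) ≤ ENNReal.ofReal (C * μ ^ (-(n:ℝ))) := by
  have hom := om_pos n
  have hn0 : (0:ℝ) < n := by positivity
  set A : ℝ := ((n+1).factorial : ℝ) with hA
  have hA0 : 0 < A := by positivity
  refine ⟨n * om n * (1 / n) + A * (n * om n), by positivity, fun μ hμ => ?_⟩
  have hr : 0 < 1 / μ := by positivity
  calc ∫⁻ h : En n, ENNReal.ofReal (Real.exp (-(μ * ‖h‖)))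
      ≤ ∫⁻ h : En n, ((Iio (1/μ)).indicator (fun ρ : ℝ => ENNReal.ofReal (ρ ^ ((n:ℝ) - n))) ‖h‖
        + ENNReal.ofReal (A * μ ^ (-(n:ℝ) - 1)) *
          (Ici (1/μ)).indicator (fun ρ : ℝ => ENNReal.ofReal (ρ ^ (-1 - (n:ℝ)))) ‖h‖) := by
        apply lintegral_mono
        intro h
        dsimp only
        by_cases hh : ‖h‖ < 1 / μ
        · have h' : ¬ (1 / μ ≤ ‖h‖) := not_le.mpr hh
          simp only [indicator, mem_Iio, mem_Ici, hh, h', if_true, if_false, mul_zero, add_zero]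
          apply ENNReal.ofReal_le_ofReal
          simp; positivity
        · have h' : (1 / μ ≤ ‖h‖) := not_lt.mp hh
          have h0 : 0 < ‖h‖ := lt_of_lt_of_le hr h'
          simp only [indicator, mem_Iio, mem_Ici, hh, h', if_true, if_false, zero_add]
          rw [← ENNReal.ofReal_mul (by positivity)]
          apply ENNReal.ofReal_le_ofReal
          have h1 := Real.pow_div_factorial_le_exp (μ * ‖h‖) (by positivity) (n+1)
          have e1 : μ ^ (-(n:ℝ) - 1) = (μ ^ (n+1))⁻¹ := by
            rw [← Real.rpow_natCast, ← Real.rpow_neg hμ.le]; push_cast; ring_nf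
          have e2 : ‖h‖ ^ (-1 - (n:ℝ)) = (‖h‖ ^ (n+1))⁻¹ := by
            rw [← Real.rpow_natCast, ← Real.rpow_neg h0.le]; push_cast; ring_nf
          rw [e1, e2, Real.exp_neg]
          rw [mul_pow] at h1
          have : A * (μ ^ (n+1))⁻¹ * (‖h‖ ^ (n+1))⁻¹ = (μ ^ (n+1) * ‖h‖ ^ (n+1) / A)⁻¹ := by
            field_simp
          rw [this]
          exact inv_anti₀ (by positivity) h1
    _ = ENNReal.ofReal ((n * om n * (1 / n) + A * (n * om n)) * μ ^ (-(n:ℝ))) := by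
        rw [lintegral_add_left, lintegral_const_mul, lint_ball_rpow n hn hr hn0,
          lint_compl_rpow n hn hr one_pos, ← ENNReal.ofReal_mul (by positivity), ← ENNReal.ofReal_add]
        · congr 1
          have e1 : (1/μ) ^ (n:ℝ) = μ ^ (-(n:ℝ)) := by
            rw [one_div, Real.inv_rpow hμ.le, Real.rpow_neg hμ.le]
          have e2 : (1/μ) ^ (-1:ℝ) = μ := by
            rw [one_div, Real.inv_rpow hμ.le, Real.rpow_neg hμ.le, inv_inv, Real.rpow_one]
          have e3 : μ ^ (-(n:ℝ) - 1) = μ ^ (-(n:ℝ)) / μ := by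
            rw [Real.rpow_sub hμ, Real.rpow_one]
          rw [e1, e2, e3]
          field_simp
        · positivity
        · positivity
        · exact ((by fun_prop : Measurable fun ρ : ℝ => ENNReal.ofReal (ρ ^ (-1 - (n:ℝ)))).indicator
            measurableSet_Ici).comp measurable_norm
        · exact ((by fun_prop : Measurable fun ρ : ℝ => ENNReal.ofReal (ρ ^ ((n:ℝ) - n))).indicator
            measurableSet_Iio).comp measurable_norm

lemma sum_min {ρ : ℝ} (hρ : 1 < ρ) : ∃ c : ℝ, 0 < c ∧ ∀ D : ℝ, 0 < D → ∀ K : ℕ,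
    ∑ k ∈ Finset.range K, min (ρ ^ k * D) (1 / (ρ ^ k * D)) ≤ c := by
  have hρ1 : 0 < ρ - 1 := by linarith
  set c1 := ρ / (ρ - 1) with hc1
  set a := 1 / (ρ - 1) with ha
  have hc1p : 0 < c1 := by positivity
  have hap : 0 < a := by positivity
  have key : ∀ K : ℕ, ∀ D : ℝ, 0 < D →
      (1 ≤ D → ∑ k ∈ Finset.range K, min (ρ ^ k * D) (1 / (ρ ^ k * D)) ≤ c1 / D) ∧
      (D < 1 → ∑ k ∈ Finset.range K, min (ρ ^ k * D) (1 / (ρ ^ k * D)) ≤ (c1 + 1 + a) - a * D) := by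
    intro K
    induction K with
    | zero => 
      intro D hD
      simp only [Finset.range_zero, Finset.sum_empty]
      refine ⟨fun _ => by positivity, fun h => ?_⟩
      nlinarith
    | succ K ih =>
      intro D hD
      have hρD : 0 < ρ * D := by positivity
      obtain ⟨i1, i2⟩ := ih (ρ * D) hρD
      rw [Finset.sum_range_succ']
      have e : ∀ k, ρ ^ (k+1) * D = ρ ^ k * (ρ * D) := fun k => by ring
      simp only [e, pow_zero, one_mul]
      constructor
      · intro h1
        have h2 : 1 ≤ ρ * D := by nlinarith
        have h3 : c1 / (ρ * D) + 1 / D = c1 / D := by rw [hc1]; field_simp; ring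
        linarith [i1 h2, min_le_right D (1/D)]
      · intro h1
        have hm := min_le_left D (1/D)
        by_cases h2 : ρ * D < 1
        · have h3 : D + (c1 + 1 + a - a * (ρ * D)) = c1 + 1 + a - a * D := by
            rw [ha]; field_simp; ring
          linarith [i2 h2]
        · push Not at h2
          have h3 : c1 / (ρ * D) ≤ c1 := div_le_self hc1p.le h2
          have h4 : a * D ≤ a := by nlinarith
          linarith [i1 h2]
  refine ⟨c1 + 1 + a, by positivity, fun D hD K => ?_⟩
  rcases le_or_gt 1 D with h | h
  · have := (key K D hD).1 h
    have h3 : c1 / D ≤ c1 := div_le_self hc1p.le h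
    linarith
  · have := (key K D hD).2 h
    have : 0 < a * D := by positivity
    linarith

/-- Gagliardo kernel. -/
def gk (n : ℕ) (m e : ℝ) (w : En n → ℝ) (x y : En n) : ℝ≥0∞ :=
  ENNReal.ofReal (|w x - w y| ^ m / ‖x - y‖ ^ ((n:ℝ) + e))

lemma gk_meas (n : ℕ) (m e : ℝ) {w : En n → ℝ} (hw : Measurable w) :
    Measurable (fun z : En n × En n => gk n m e w z.1 z.2) := by
  unfold gk
  fun_prop

lemma gk_meas_right (n : ℕ) (m e : ℝ) {w : En n → ℝ} (hw : Measurable w) (x : En n) :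
    Measurable (fun y => gk n m e w x y) := by
  unfold gk
  fun_prop

lemma young_split {T t m : ℝ} (hT : 0 < T) (ht : 0 ≤ t) (hm : 1 ≤ m) : t ≤ T + T ^ (1 - m) * t ^ m := by
  rcases le_total t T with h | h
  · have : 0 ≤ T ^ (1 - m) * t ^ m := by positivity
    linarith
  · have ht' : 0 < t := lt_of_lt_of_le hT h
    have h1 : t ^ (1 - m) ≤ T ^ (1 - m) := Real.rpow_le_rpow_of_nonpos hT h (by linarith)
    have h2 : t ^ (1 - m) * t ^ m = t := by
      rw [← Real.rpow_add ht']; simp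
    have := mul_le_mul_of_nonneg_right h1 (by positivity : 0 ≤ t ^ m)
    linarith

lemma gk_dom (n : ℕ) {m e : ℝ} (hm : 0 < m) (he : 0 ≤ (n:ℝ) + e) (w : En n → ℝ) (x y : En n) {r : ℝ}
    (hr : ‖x - y‖ ≤ r) :
    ENNReal.ofReal (|w x - w y| ^ m) ≤ ENNReal.ofReal (r ^ ((n:ℝ) + e)) * gk n m e w x y := by
  have hr0 : 0 ≤ r := le_trans (norm_nonneg _) hr
  unfold gk
  rw [← ENNReal.ofReal_mul (by positivity)]
  apply ENNReal.ofReal_le_ofReal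
  rcases eq_or_lt_of_le (norm_nonneg (x - y)) with h | h
  · have : x = y := by rw [← sub_eq_zero, ← norm_eq_zero]; exact h.symm
    subst this
    simp [Real.zero_rpow hm.ne']
  · have h1 : ‖x - y‖ ^ ((n:ℝ) + e) ≤ r ^ ((n:ℝ) + e) := Real.rpow_le_rpow h.le hr he
    have h2 : 0 < ‖x - y‖ ^ ((n:ℝ) + e) := by positivity
    rw [mul_div_assoc', le_div_iff₀ h2, mul_comm]
    exact mul_le_mul_of_nonneg_right h1 (by positivity)

/-- Averaging step on the sub-ball `E` of radius `r/2`. -/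
lemma avg_step (n : ℕ) {m κ : ℝ} (hm : 1 ≤ m) (hκ : 0 < κ) {w : En n → ℝ} (hw : Measurable w)
    {x z : En n} {S : Set (En n)} {r T G : ℝ} (hr : 0 < r) (hT : 0 < T) (hG : 0 ≤ G)
    (hE1 : ball z (r / 2) ⊆ S) (hE2 : ball z (r / 2) ⊆ ball x r)
    (hg : ∫⁻ y in S, gk n m (κ * m) w x y ≤ ENNReal.ofReal G) :
    ∫⁻ y in ball z (r / 2), ENNReal.ofReal |w x - w y| ≤
      ENNReal.ofReal (T * (om n * (r / 2) ^ (n:ℝ)) + T ^ (1 - m) * (r ^ ((n:ℝ) + κ * m) * G)) := by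
  have hom := om_pos n
  calc ∫⁻ y in ball z (r / 2), ENNReal.ofReal |w x - w y|
      ≤ ∫⁻ y in ball z (r / 2), (ENNReal.ofReal T + ENNReal.ofReal (T ^ (1 - m)) *
          (ENNReal.ofReal (r ^ ((n:ℝ) + κ * m)) * gk n m (κ * m) w x y)) := by
        apply setLIntegral_mono' measurableSet_ball
        intro y hy
        have hxy : ‖x - y‖ ≤ r := by
          have := hE2 hy
          rw [mem_ball, dist_eq_norm] at this
          rw [norm_sub_rev]; exact this.le
        have h1 := young_split hT (abs_nonneg (w x - w y)) hm
        refine (ENNReal.ofReal_le_ofReal h1).trans ?_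
        rw [ENNReal.ofReal_add hT.le (by positivity), ENNReal.ofReal_mul (by positivity)]
        gcongr
        exact gk_dom n (by linarith) (by positivity) w x y hxy
    _ ≤ ENNReal.ofReal T * volume (ball z (r/2)) + ENNReal.ofReal (T ^ (1 - m)) *
          (ENNReal.ofReal (r ^ ((n:ℝ) + κ * m)) * ENNReal.ofReal G) := by
        rw [lintegral_add_left (by fun_prop), setLIntegral_const, lintegral_const_mul,
          lintegral_const_mul]
        · gcongr
          exact (lintegral_mono_set hE1).trans hg
        · exact gk_meas_right n _ _ hw x
        · exact (gk_meas_right n _ _ hw x).const_mul _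
    _ = _ := by
        rw [vol_ball n z (by positivity), ← ENNReal.ofReal_mul hT.le, ← ENNReal.ofReal_mul (by positivity),
          ← ENNReal.ofReal_mul (by positivity), ← ENNReal.ofReal_add (by positivity) (by positivity)]

lemma subball (n : ℕ) {x₀ x : En n} {ρ r : ℝ} (hρ : 0 < ρ) (hr : 0 < r) (hrρ : r ≤ 2 * ρ)
    (hx : x ∈ ball x₀ ρ) :
    ball (x + (r / (2 * ρ)) • (x₀ - x)) (r / 2) ⊆ ball x₀ ρ ∧
    ball (x + (r / (2 * ρ)) • (x₀ - x)) (r / 2) ⊆ ball x r := by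
  have hx' : ‖x₀ - x‖ < ρ := by rw [mem_ball, dist_eq_norm, norm_sub_rev] at hx; exact hx
  set θ := r / (2 * ρ) with hθ
  have hθ0 : 0 ≤ θ := by positivity
  have hθ1 : θ ≤ 1 := by rw [hθ, div_le_one (by positivity)]; exact hrρ
  have hθρ : θ * ρ = r / 2 := by rw [hθ]; field_simp
  constructor
  · intro y hy
    rw [mem_ball, dist_eq_norm] at hy ⊢
    have e : y - x₀ = (y - (x + θ • (x₀ - x))) + (-(1 - θ)) • (x₀ - x) := by
      module
    rw [e]
    refine (norm_add_le _ _).trans_lt ?_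
    rw [norm_smul, Real.norm_eq_abs, abs_neg, abs_of_nonneg (by linarith)]
    have : (1 - θ) * ‖x₀ - x‖ ≤ (1 - θ) * ρ := mul_le_mul_of_nonneg_left hx'.le (by linarith)
    nlinarith
  · intro y hy
    rw [mem_ball, dist_eq_norm] at hy ⊢
    have e : y - x = (y - (x + θ • (x₀ - x))) + θ • (x₀ - x) := by
      module
    rw [e]
    refine (norm_add_le _ _).trans_lt ?_
    rw [norm_smul, Real.norm_eq_abs, abs_of_nonneg hθ0]
    have : θ * ‖x₀ - x‖ ≤ θ * ρ := mul_le_mul_of_nonneg_left hx'.le hθ0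
    linarith

/-- Constant of the pointwise Sobolev estimate. -/
def cA (n : ℕ) : ℝ := 1 + 2 ^ (n:ℝ) / om n

lemma cA_ge (n : ℕ) : 1 ≤ cA n := by
  have := om_pos n
  unfold cA
  have : 0 ≤ 2 ^ (n:ℝ) / om n := by positivity
  linarith

lemma osc_le_avg (n : ℕ) {w : En n → ℝ} (hw : Measurable w) {Λ : ℝ} (hΛ : ∀ x, |w x| ≤ Λ)
    (x₀ : En n) {ρ : ℝ} (hρ : 0 < ρ) (x : En n) :
    ENNReal.ofReal |w x - ⨍ y in ball x₀ ρ, w y| * volume (ball x₀ ρ) ≤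
      ∫⁻ y in ball x₀ ρ, ENNReal.ofReal |w x - w y| := by
  have hfin : volume (ball x₀ ρ) ≠ ⊤ := measure_ball_lt_top.ne
  have hpos : 0 < volume.real (ball x₀ ρ) := by
    rw [measureReal_def]; exact ENNReal.toReal_pos (measure_ball_pos _ _ hρ).ne' hfin
  have hi : IntegrableOn w (ball x₀ ρ) :=
    Measure.integrableOn_of_bounded hfin hw.aestronglyMeasurable (M := Λ)
      (Filter.Eventually.of_forall fun x => by simpa using hΛ x)
  have hi2 : IntegrableOn (fun y => w x - w y) (ball x₀ ρ) :=
    (integrableOn_const hfin).sub hi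
  have e : (w x - ⨍ y in ball x₀ ρ, w y) * volume.real (ball x₀ ρ) =
      ∫ y in ball x₀ ρ, (w x - w y) := by
    rw [integral_sub (f := fun _ => w x) (integrableOn_const hfin).integrable hi, setIntegral_const, setAverage_eq]
    simp only [smul_eq_mul]
    field_simp
  have h1 : |w x - ⨍ y in ball x₀ ρ, w y| * volume.real (ball x₀ ρ) ≤
      ∫ y in ball x₀ ρ, |w x - w y| := by
    rw [← abs_of_pos hpos, ← abs_mul, e]
    exact abs_integral_le_integral_abs
  rw [← ofReal_integral_eq_lintegral_ofReal hi2.abs (Filter.Eventually.of_forall fun y => abs_nonneg _)]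
  refine le_trans ?_ (ENNReal.ofReal_le_ofReal h1)
  rw [ENNReal.ofReal_mul (abs_nonneg _), measureReal_def, ENNReal.ofReal_toReal hfin]

lemma poinc_pt (n : ℕ) (hn : 2 ≤ n) {m P κ : ℝ} (hm : 1 ≤ m) (hmP : m ≤ P) (hκ : 0 < κ)
    {w : En n → ℝ} (hw : Measurable w) {Λ : ℝ} (hΛ : ∀ x, |w x| ≤ Λ)
    (x₀ : En n) {ρ : ℝ} (hρ : 0 < ρ) {x : En n} (hx : x ∈ ball x₀ ρ) {N g : ℝ} (hN : 0 < N) (hg : 0 < g)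
    (hN' : ∫⁻ y in ball x₀ ρ, ENNReal.ofReal (|w y - ⨍ y in ball x₀ ρ, w y| ^ P) ≤ ENNReal.ofReal (N ^ P))
    (hg' : ∫⁻ y in ball x₀ ρ, gk n m (κ * m) w x y ≤ ENNReal.ofReal (g ^ m)) {r : ℝ} (hr : 0 < r) :
    |w x - ⨍ y in ball x₀ ρ, w y| ≤ cA n * (r ^ κ * g + r ^ (-(n / P)) * N) := by
  set c := ⨍ y in ball x₀ ρ, w y with hc
  have hom := om_pos n
  have hn0 : (0:ℝ) < n := by positivity
  have hP : 1 ≤ P := hm.trans hmP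
  have hcA : 0 < cA n := lt_of_lt_of_le one_pos (cA_ge n)
  -- algebra
  have alg : ∀ R : ℝ, 0 < R → (R ^ κ * g) * (om n * (R / 2) ^ (n:ℝ)) +
      (R ^ κ * g) ^ (1 - m) * (R ^ ((n:ℝ) + κ * m) * g ^ m)
        = (cA n * (R ^ κ * g)) * (om n * (R / 2) ^ (n:ℝ)) := by
    intro R hR
    have e1 : R ^ ((n:ℝ) + κ * m) * g ^ m = (R ^ κ * g) ^ m * R ^ (n:ℝ) := by
      rw [Real.rpow_add hR, Real.mul_rpow (by positivity) hg.le, ← Real.rpow_mul hR.le]; ring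
    have e2 : (R ^ κ * g) ^ (1 - m) * (R ^ κ * g) ^ m = R ^ κ * g := by
      rw [← Real.rpow_add (by positivity)]; simp
    rw [e1, ← mul_assoc ((R ^ κ * g) ^ (1 - m)), e2, Real.div_rpow hR.le (by norm_num)]
    unfold cA
    have : (0:ℝ) < 2 ^ (n:ℝ) := by positivity
    field_simp
  rcases le_or_gt r (2 * ρ) with hrρ | hrρ
  · obtain ⟨s1, s2⟩ := subball n hρ hr hrρ hx
    set z := x + (r / (2 * ρ)) • (x₀ - x) with hz
    set T1 := r ^ κ * g with hT1
    set T2 := r ^ (-(n / P)) * N with hT2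
    have hT1p : 0 < T1 := by positivity
    have hT2p : 0 < T2 := by positivity
    have a1 := avg_step n hm hκ hw hr hT1p (by positivity : 0 ≤ g ^ m) s1 s2 hg'
    set v := om n * (r / 2) ^ (n:ℝ) with hv
    have hvp : 0 < v := by positivity
    have a2 : ∫⁻ y in ball z (r/2), ENNReal.ofReal |w y - c| ≤
        ENNReal.ofReal (T2 * v + T2 ^ (1 - P) * N ^ P) := by
      calc ∫⁻ y in ball z (r/2), ENNReal.ofReal |w y - c|
          ≤ ∫⁻ y in ball z (r/2), (ENNReal.ofReal T2 + ENNReal.ofReal (T2 ^ (1 - P)) *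
            ENNReal.ofReal (|w y - c| ^ P)) := by
            apply lintegral_mono
            intro y
            dsimp only
            rw [← ENNReal.ofReal_mul (by positivity), ← ENNReal.ofReal_add hT2p.le (by positivity)]
            exact ENNReal.ofReal_le_ofReal (young_split hT2p (abs_nonneg _) hP)
        _ ≤ ENNReal.ofReal T2 * volume (ball z (r/2)) +
            ENNReal.ofReal (T2 ^ (1 - P)) * ENNReal.ofReal (N ^ P) := by
            rw [lintegral_add_left (by fun_prop), setLIntegral_const, lintegral_const_mul _ (by fun_prop)]
            gcongr
            exact (lintegral_mono_set s1).trans hN'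
        _ = _ := by
            rw [vol_ball n z (by positivity), ← ENNReal.ofReal_mul hT2p.le,
              ← ENNReal.ofReal_mul (by positivity), ← ENNReal.ofReal_add (by positivity) (by positivity)]
    have a3 : ENNReal.ofReal (|w x - c| * v) ≤ ENNReal.ofReal ((T1 * v + T1 ^ (1 - m) *
        (r ^ ((n:ℝ) + κ * m) * g ^ m)) + (T2 * v + T2 ^ (1 - P) * N ^ P)) := by
      calc ENNReal.ofReal (|w x - c| * v) = ∫⁻ y in ball z (r/2), ENNReal.ofReal |w x - c| := by
            rw [setLIntegral_const, vol_ball n z (by positivity), ENNReal.ofReal_mul (abs_nonneg _)]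
        _ ≤ ∫⁻ y in ball z (r/2), (ENNReal.ofReal |w x - w y| + ENNReal.ofReal |w y - c|) := by
            apply lintegral_mono
            intro y
            dsimp only
            rw [← ENNReal.ofReal_add (abs_nonneg _) (abs_nonneg _)]
            apply ENNReal.ofReal_le_ofReal
            exact abs_sub_le _ _ _
        _ ≤ _ := by
            rw [lintegral_add_left (by fun_prop), ENNReal.ofReal_add (by positivity) (by positivity)]
            exact add_le_add a1 a2
    rw [ENNReal.ofReal_le_ofReal_iff (by positivity)] at a3
    have e3 : T2 * v + T2 ^ (1 - P) * N ^ P = cA n * T2 * v := by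
      have e1 : N ^ P = T2 ^ P * r ^ (n:ℝ) := by
        rw [hT2, Real.mul_rpow (by positivity) hN.le, ← Real.rpow_mul hr.le, mul_right_comm,
          ← Real.rpow_add hr]
        have : -(n / P) * P + (n:ℝ) = 0 := by field_simp; ring
        rw [this]; simp
      have e2 : T2 ^ (1 - P) * T2 ^ P = T2 := by
        rw [← Real.rpow_add hT2p]; simp
      rw [e1, ← mul_assoc (T2 ^ (1 - P)), e2, hv, Real.div_rpow hr.le (by norm_num)]
      unfold cA
      have : (0:ℝ) < 2 ^ (n:ℝ) := by positivity
      field_simp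
    have e4 := alg r hr
    rw [← hT1, ← hv] at e4
    rw [e3, e4] at a3
    have : |w x - c| * v ≤ (cA n * (T1 + T2)) * v := by linarith
    exact le_of_mul_le_mul_right this hvp
  · have hr0 : 0 < 2 * ρ := by positivity
    obtain ⟨s1, s2⟩ := subball n hρ hr0 le_rfl hx
    have hz : x + ((2 * ρ) / (2 * ρ)) • (x₀ - x) = x₀ := by
      rw [div_self hr0.ne']; module
    rw [hz] at s1 s2
    have hT1p : 0 < (2 * ρ) ^ κ * g := by positivity
    have a1 := avg_step n hm hκ hw hr0 hT1p (by positivity : 0 ≤ g ^ m) s1 s2 hg'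
    rw [alg _ hr0] at a1
    have h2 : 2 * ρ / 2 = ρ := by ring
    rw [h2] at a1
    have a2 := (osc_le_avg n hw hΛ x₀ hρ x).trans a1
    rw [← hc, vol_ball n x₀ hρ, ← ENNReal.ofReal_mul (abs_nonneg _),
      ENNReal.ofReal_le_ofReal_iff (by positivity)] at a2
    have a3 := le_of_mul_le_mul_right a2 (by positivity)
    refine a3.trans ?_
    apply mul_le_mul_of_nonneg_left _ hcA.le
    have h3 : (2 * ρ) ^ κ ≤ r ^ κ := Real.rpow_le_rpow hr0.le hrρ.le hκ.le
    have h4 : 0 ≤ r ^ (-(n / P)) * N := by positivity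
    nlinarith

lemma poinc_pt2 (n : ℕ) (hn : 2 ≤ n) {m P κ : ℝ} (hm : 1 ≤ m) (hmP : m ≤ P) (hκ : 0 < κ)
    (hrel : 1 / P = 1 / m - κ / n)
    {w : En n → ℝ} (hw : Measurable w) {Λ : ℝ} (hΛ : ∀ x, |w x| ≤ Λ)
    (x₀ : En n) {ρ : ℝ} (hρ : 0 < ρ) {x : En n} (hx : x ∈ ball x₀ ρ) {N : ℝ} (hN : 0 < N)
    (hN' : ∫⁻ y in ball x₀ ρ, ENNReal.ofReal (|w y - ⨍ y in ball x₀ ρ, w y| ^ P) ≤ ENNReal.ofReal (N ^ P)) :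
    ENNReal.ofReal (|w x - ⨍ y in ball x₀ ρ, w y| ^ P) ≤
      ENNReal.ofReal ((2 * cA n) ^ P * N ^ (P - m)) * ∫⁻ y in ball x₀ ρ, gk n m (κ * m) w x y := by
  set c := ⨍ y in ball x₀ ρ, w y with hc
  have hn0 : (0:ℝ) < n := by positivity
  have hP : 1 ≤ P := hm.trans hmP
  have hP0 : 0 < P := by linarith
  have hm0 : 0 < m := by linarith
  have hcA : 0 < cA n := lt_of_lt_of_le one_pos (cA_ge n)
  by_cases hG : ∫⁻ y in ball x₀ ρ, gk n m (κ * m) w x y = ⊤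
  · rw [hG, ENNReal.mul_top]
    · exact le_top
    · simp only [ne_eq, ENNReal.ofReal_eq_zero, not_le]; positivity
  set G := (∫⁻ y in ball x₀ ρ, gk n m (κ * m) w x y).toReal with hGdef
  have hG0 : 0 ≤ G := ENNReal.toReal_nonneg
  rw [← ENNReal.ofReal_toReal hG, ← hGdef, ← ENNReal.ofReal_mul (by positivity)]
  apply ENNReal.ofReal_le_ofReal
  have key : ∀ δ : ℝ, 0 < δ → |w x - c| ^ P ≤ (2 * cA n) ^ P * N ^ (P - m) * (G + δ) := by
    intro δ hδ
    set g := (G + δ) ^ (1 / m) with hgdef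
    have hg : 0 < g := by positivity
    have hgm : g ^ m = G + δ := by
      rw [hgdef, ← Real.rpow_mul (by positivity), one_div_mul_cancel hm0.ne', Real.rpow_one]
    have hg' : ∫⁻ y in ball x₀ ρ, gk n m (κ * m) w x y ≤ ENNReal.ofReal (g ^ m) := by
      rw [hgm, ← ENNReal.ofReal_toReal hG]
      exact ENNReal.ofReal_le_ofReal (by rw [← hGdef]; linarith)
    set r := (N / g) ^ (m / n) with hrdef
    have hr : 0 < r := by positivity
    have h1 := poinc_pt n hn hm hmP hκ hw hΛ x₀ hρ hx hN hg hN' hg' hr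
    have e1 : r ^ κ * g = N ^ (1 - m / P) * g ^ (m / P) := by
      have : m / n * κ = 1 - m / P := by
        have : m * (1 / P) = m * (1 / m - κ / n) := by rw [hrel]
        field_simp at this ⊢
        linarith
      rw [hrdef, ← Real.rpow_mul (by positivity), this, Real.div_rpow hN.le hg.le,
        Real.rpow_sub hg, Real.rpow_one]
      field_simp
    have e2 : r ^ (-(n / P)) * N = N ^ (1 - m / P) * g ^ (m / P) := by
      have : m / n * (-(n / P)) = - (m / P) := by field_simp
      rw [hrdef, ← Real.rpow_mul (by positivity), this, Real.rpow_neg (by positivity),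
        Real.div_rpow hN.le hg.le, Real.rpow_sub hN, Real.rpow_one]
      field_simp
    rw [← hc, e1, e2] at h1
    have h2 : |w x - c| ≤ (2 * cA n) * (N ^ (1 - m / P) * g ^ (m / P)) := by linarith
    have h3 := Real.rpow_le_rpow (abs_nonneg _) h2 hP0.le
    refine h3.trans (le_of_eq ?_)
    rw [Real.mul_rpow (x := 2 * cA n) (by positivity) (by positivity),
      Real.mul_rpow (x := N ^ (1 - m / P)) (by positivity) (by positivity), ← Real.rpow_mul hN.le, ← Real.rpow_mul hg.le, ← hgm]
    have e3 : (1 - m / P) * P = P - m := by field_simp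
    have e4 : m / P * P = m := by field_simp
    rw [e3, e4]; ring
  have hlim : Filter.Tendsto (fun δ : ℝ => (2 * cA n) ^ P * N ^ (P - m) * (G + δ)) (nhdsWithin 0 (Ioi 0))
      (nhds ((2 * cA n) ^ P * N ^ (P - m) * (G + 0))) := by
    apply Filter.Tendsto.mono_left _ nhdsWithin_le_nhds
    exact (Continuous.tendsto (by fun_prop) 0)
  rw [add_zero] at hlim
  refine ge_of_tendsto hlim ?_
  filter_upwards [self_mem_nhdsWithin] with δ hδ using key δ hδ

/-- Sobolev-Poincare inequality on balls. -/
lemma sob_poinc (n : ℕ) (hn : 2 ≤ n) {m P κ : ℝ} (hm : 1 ≤ m) (hmP : m ≤ P) (hκ : 0 < κ)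
    (hrel : 1 / P = 1 / m - κ / n)
    {w : En n → ℝ} (hw : Measurable w) {Λ : ℝ} (hΛ : ∀ x, |w x| ≤ Λ)
    (x₀ : En n) {ρ : ℝ} (hρ : 0 < ρ) {Q : ℝ} (hQ0 : 0 ≤ Q)
    (hQ : ∫⁻ x in ball x₀ ρ, ∫⁻ y in ball x₀ ρ, gk n m (κ * m) w x y ≤ ENNReal.ofReal Q) :
    ∫⁻ y in ball x₀ ρ, ENNReal.ofReal (|w y - ⨍ y in ball x₀ ρ, w y| ^ P) ≤
      ENNReal.ofReal (((2 * cA n) ^ P * Q) ^ (P / m)) := by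
  set c := ⨍ y in ball x₀ ρ, w y with hc
  have hP : 1 ≤ P := hm.trans hmP
  have hP0 : 0 < P := by linarith
  have hm0 : 0 < m := by linarith
  have hcA : 0 < cA n := lt_of_lt_of_le one_pos (cA_ge n)
  set I := ∫⁻ y in ball x₀ ρ, ENNReal.ofReal (|w y - c| ^ P) with hI
  have hIfin : I ≠ ⊤ := by
    have : I ≤ ∫⁻ y in ball x₀ ρ, ENNReal.ofReal ((Λ + |c|) ^ P) := by
      apply lintegral_mono
      intro y
      apply ENNReal.ofReal_le_ofReal
      apply Real.rpow_le_rpow (abs_nonneg _) _ hP0.le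
      exact (abs_sub _ _).trans (add_le_add (hΛ y) le_rfl)
    refine ne_top_of_le_ne_top ?_ this
    rw [setLIntegral_const]
    exact ENNReal.mul_ne_top ENNReal.ofReal_ne_top measure_ball_lt_top.ne
  by_cases hI0 : I = 0
  · rw [hI0]; exact zero_le
  set N := I.toReal ^ (1 / P) with hN
  have hIr : 0 < I.toReal := ENNReal.toReal_pos hI0 hIfin
  have hNp : 0 < N := by positivity
  have hNP : N ^ P = I.toReal := by
    rw [hN, ← Real.rpow_mul hIr.le, one_div_mul_cancel hP0.ne', Real.rpow_one]
  have hIN : I = ENNReal.ofReal (N ^ P) := by rw [hNP, ENNReal.ofReal_toReal hIfin]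
  have h1 : I ≤ ENNReal.ofReal ((2 * cA n) ^ P * N ^ (P - m)) * ENNReal.ofReal Q := by
    calc I ≤ ∫⁻ x in ball x₀ ρ, ENNReal.ofReal ((2 * cA n) ^ P * N ^ (P - m)) *
          ∫⁻ y in ball x₀ ρ, gk n m (κ * m) w x y := by
          apply setLIntegral_mono' measurableSet_ball
          intro x hx
          exact poinc_pt2 n hn hm hmP hκ hrel hw hΛ x₀ hρ hx hNp hIN.le
      _ ≤ _ := by
          rw [lintegral_const_mul]
          · gcongr
          · exact (gk_meas n m (κ * m) hw).lintegral_prod_right'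
  rw [hIN, ← ENNReal.ofReal_mul (by positivity), ENNReal.ofReal_le_ofReal_iff (by positivity)] at h1
  rw [hIN]
  apply ENNReal.ofReal_le_ofReal
  have h2 : N ^ m ≤ (2 * cA n) ^ P * Q := by
    have e : N ^ P = N ^ (P - m) * N ^ m := by rw [← Real.rpow_add hNp]; ring_nf
    rw [e] at h1
    have : 0 < N ^ (P - m) := by positivity
    have h1' : N ^ (P - m) * N ^ m ≤ N ^ (P - m) * ((2 * cA n) ^ P * Q) := by linarith
    exact le_of_mul_le_mul_left h1' this
  have h3 := Real.rpow_le_rpow (by positivity) h2 (by positivity : 0 ≤ P / m)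
  refine le_trans (le_of_eq ?_) h3
  rw [← Real.rpow_mul hNp.le]
  congr 1; field_simp

lemma le_zero_of_forall_pos {a : ℝ} (h : ∀ T : ℝ, 0 < T → a ≤ T) : a ≤ 0 :=
  le_of_forall_pos_le_add (by simpa using h)

lemma abs_mean_le {Y : Type*} [MeasurableSpace Y] {m : Measure Y} {h q : Y → ℝ} {η : ℝ} (hη : 1 ≤ η)
    (hq : Integrable q m) (hq0 : ∀ y, 0 ≤ q y) (hq1 : ∫ y, q y ∂m = 1)
    (hi1 : Integrable (fun y => |h y| * q y) m) (hi2 : Integrable (fun y => |h y| ^ η * q y) m) :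
    ∫ y, |h y| * q y ∂m ≤ 2 * (∫ y, |h y| ^ η * q y ∂m) ^ (1 / η) := by
  set A := ∫ y, |h y| ^ η * q y ∂m with hA
  have hA0 : 0 ≤ A := integral_nonneg fun y => mul_nonneg (by positivity) (hq0 y)
  have key : ∀ T : ℝ, 0 < T → ∫ y, |h y| * q y ∂m ≤ T + T ^ (1 - η) * A := by
    intro T hT
    calc ∫ y, |h y| * q y ∂m ≤ ∫ y, (T * q y + T ^ (1 - η) * (|h y| ^ η * q y)) ∂m := by
          apply integral_mono hi1 ((hq.const_mul T).add (hi2.const_mul _))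
          intro y
          have := mul_le_mul_of_nonneg_right (young_split hT (abs_nonneg (h y)) hη) (hq0 y)
          simp only [Pi.add_apply]
          linarith
      _ = T + T ^ (1 - η) * A := by
          rw [integral_add (hq.const_mul T) (hi2.const_mul _), integral_const_mul, integral_const_mul,
            hq1, mul_one]
  rcases eq_or_lt_of_le hA0 with h0 | h0
  · have : ∫ y, |h y| * q y ∂m ≤ 0 := le_zero_of_forall_pos fun T hT => by
      have := key T hT
      rw [← h0] at this; simpa using this
    exact this.trans (by positivity)
  · have := key (A ^ (1/η)) (by positivity)
    have e : (A ^ (1/η)) ^ (1 - η) * A = A ^ (1/η) := by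
      rw [← Real.rpow_mul hA0]
      nth_rewrite 2 [← Real.rpow_one A]
      rw [← Real.rpow_add h0]
      congr 1; field_simp; ring
    linarith

lemma mean_diff {Y : Type*} [MeasurableSpace Y] {m : Measure Y} {h q q' : Y → ℝ} {τ : ℝ}
    (hτ : 0 ≤ τ) (hτ1 : τ ≤ 1)
    (h1 : ∀ y, q' y ≤ Real.exp τ * q y) (h2 : ∀ y, q y ≤ Real.exp τ * q' y) (hq0 : ∀ y, 0 ≤ q y)
    (hi : Integrable (fun y => h y * q y) m) (hi' : Integrable (fun y => h y * q' y) m)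
    (hi1 : Integrable (fun y => |h y| * q y) m) :
    |∫ y, h y * q y ∂m - ∫ y, h y * q' y ∂m| ≤ 2 * τ * ∫ y, |h y| * q y ∂m := by
  rw [← integral_sub hi hi', ← integral_const_mul]
  refine abs_integral_le_integral_abs.trans (integral_mono (hi.sub hi').abs (hi1.const_mul _) ?_)
  intro y
  dsimp only
  rw [← mul_sub, abs_mul, mul_left_comm]
  apply mul_le_mul_of_nonneg_left _ (abs_nonneg _)
  have e1 : Real.exp τ - 1 ≤ 2 * τ := by
    have := Real.abs_exp_sub_one_le (x := τ) (by rwa [abs_of_nonneg hτ])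
    rw [abs_of_nonneg hτ] at this
    exact (le_abs_self _).trans this
  have e2 : 1 ≤ Real.exp τ := Real.one_le_exp hτ
  have e3 := mul_le_mul_of_nonneg_right e1 (hq0 y)
  rw [abs_le]
  refine ⟨by linarith [h1 y], ?_⟩
  -- q - q' ≤ (1 - e^{-τ}) q ≤ (e^τ - 1) q
  have h3 : Real.exp τ * (q y - q' y) ≤ Real.exp τ * ((Real.exp τ - 1) * q y) := by
    have : 0 ≤ q y * (Real.exp τ - 1) ^ 2 := mul_nonneg (hq0 y) (sq_nonneg _)
    nlinarith [h2 y]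
  have h4 := le_of_mul_le_mul_left h3 (Real.exp_pos τ)
  linarith

lemma cut_facts {l η A : ℝ} (hl : 0 < l) (hη : 1 ≤ η) (hA : 0 ≤ A) :
    A ^ (1/η) * (l ^ η / (l ^ η + A)) ≤ l ∧
    A ^ (1/η) * (l ^ η / (l ^ η + A)) ≤ A ^ (1/η) ∧
    A ^ (1/η) * (1 - l ^ η / (l ^ η + A)) ≤ l ^ (1 - η) * A := by
  have hη0 : 0 < η := by linarith
  set a := A ^ (1/η) with ha
  have ha0 : 0 ≤ a := by positivity
  have haA : A = a ^ η := by
    rw [ha, ← Real.rpow_mul hA, one_div_mul_cancel hη0.ne', Real.rpow_one]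
  have hlη : 0 < l ^ η := by positivity
  have hpos : 0 < l ^ η + A := by positivity
  have split : ∀ x : ℝ, 0 ≤ x → x ^ η = x ^ (η - 1) * x := by
    intro x hx
    rcases eq_or_lt_of_le hx with h | h
    · rw [← h]; simp [Real.zero_rpow hη0.ne']
    · rw [← Real.rpow_add_one h.ne']; ring_nf
  have e1 : a * l ^ (η - 1) ≤ l ^ η + A := by
    rcases le_total a l with h | h
    · have := mul_le_mul_of_nonneg_right h (by positivity : 0 ≤ l ^ (η - 1))
      rw [split l hl.le]; nlinarith
    · have : l ^ (η - 1) ≤ a ^ (η - 1) := Real.rpow_le_rpow hl.le h (by linarith)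
      have := mul_le_mul_of_nonneg_left this ha0
      rw [haA, split a ha0]; nlinarith
  refine ⟨?_, ?_, ?_⟩
  · rw [mul_div_assoc', div_le_iff₀ hpos, split l hl.le]
    rw [split l hl.le] at e1
    nlinarith
  · apply mul_le_of_le_one_right ha0
    rw [div_le_one hpos]; linarith
  · have e2 : 1 - l ^ η / (l ^ η + A) = A / (l ^ η + A) := by field_simp; ring
    have e3 : l ^ (1 - η) * l ^ (η - 1) = 1 := by
      rw [← Real.rpow_add hl]; simp
    rw [e2, mul_div_assoc', div_le_iff₀ hpos]
    have h4 : 0 ≤ l ^ (1 - η) * A := by positivity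
    have := mul_le_mul_of_nonneg_left e1 h4
    calc a * A = l ^ (1 - η) * A * (a * l ^ (η - 1)) := by
          rw [show l ^ (1 - η) * A * (a * l ^ (η - 1)) = (l ^ (1 - η) * l ^ (η - 1)) * (a * A) by ring, e3]
          ring
      _ ≤ _ := this

lemma cut_real {l η A A' D D' τ : ℝ} (hl : 0 < l) (hη : 1 ≤ η) (hA : 0 ≤ A) (hA' : 0 ≤ A')
    (hτ : 0 ≤ τ)
    (hD : |D| ≤ 2 * A ^ (1/η)) (hD' : |D'| ≤ 2 * A' ^ (1/η))
    (hDD : τ ≤ 1 → |D - D'| ≤ 4 * τ * A ^ (1/η))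
    (h1 : A' ≤ Real.exp τ * A) (h2 : A ≤ Real.exp τ * A') :
    |D * (l ^ η / (l ^ η + A)) - D' * (l ^ η / (l ^ η + A'))| ≤
      16 * min 1 τ * (A ^ (1/η) * (l ^ η / (l ^ η + A)) + A' ^ (1/η) * (l ^ η / (l ^ η + A'))) := by
  have hη0 : 0 < η := by linarith
  have hlη : 0 < l ^ η := by positivity
  have hpos : 0 < l ^ η + A := by positivity
  have hpos' : 0 < l ^ η + A' := by positivity
  set χ := l ^ η / (l ^ η + A) with hχ
  set χ' := l ^ η / (l ^ η + A') with hχ'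
  have hχ0 : 0 ≤ χ := by positivity
  have hχ'0 : 0 ≤ χ' := by positivity
  set a := A ^ (1/η) with ha
  set a' := A' ^ (1/η) with ha'
  have ha0 : 0 ≤ a := by positivity
  have ha'0 : 0 ≤ a' := by positivity
  rcases le_total τ 1 with ht | ht
  · rw [min_eq_right ht]
    have e1 : Real.exp τ - 1 ≤ 2 * τ := by
      have := Real.abs_exp_sub_one_le (x := τ) (by rwa [abs_of_nonneg hτ])
      rw [abs_of_nonneg hτ] at this
      exact (le_abs_self _).trans this
    have e2 : 1 ≤ Real.exp τ := Real.one_le_exp hτ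
    have e3 : Real.exp τ ≤ 3 := by linarith
    have h5 : |A - A'| ≤ 2 * τ * A' := by
      rw [abs_le]
      constructor
      · have : Real.exp τ * (A' - A) ≤ Real.exp τ * ((Real.exp τ - 1) * A') := by
          have : 0 ≤ A' * (Real.exp τ - 1) ^ 2 := mul_nonneg hA' (sq_nonneg _)
          nlinarith
        have := le_of_mul_le_mul_left this (Real.exp_pos τ)
        nlinarith
      · nlinarith
    have h6 : |χ - χ'| ≤ 2 * τ * χ := by
      have : χ - χ' = χ * ((A' - A) / (l ^ η + A')) := by
        rw [hχ, hχ']; field_simp; ring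
      rw [this, abs_mul, abs_of_nonneg hχ0, mul_comm]
      apply mul_le_mul_of_nonneg_right _ hχ0
      rw [abs_div, abs_of_pos hpos', div_le_iff₀ hpos', abs_sub_comm]
      nlinarith
    have h7 : a' ≤ 3 * a := by
      have : A' ≤ 3 * A := h1.trans (mul_le_mul_of_nonneg_right e3 hA)
      have := Real.rpow_le_rpow hA' this (by positivity : 0 ≤ 1/η)
      rw [Real.mul_rpow (by norm_num) hA] at this
      have h3 : (3:ℝ) ^ (1/η) ≤ 3 := by
        calc (3:ℝ) ^ (1/η) ≤ 3 ^ (1:ℝ) := Real.rpow_le_rpow_of_exponent_le (by norm_num)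
              (by rw [div_le_one hη0]; exact hη)
          _ = 3 := Real.rpow_one _
      nlinarith
    calc |D * χ - D' * χ'| = |(D - D') * χ + D' * (χ - χ')| := by ring_nf
      _ ≤ |D - D'| * χ + |D'| * |χ - χ'| := by
          refine (abs_add_le _ _).trans (le_of_eq ?_)
          rw [abs_mul, abs_mul, abs_of_nonneg hχ0]
      _ ≤ (4 * τ * a) * χ + (2 * (3 * a)) * (2 * τ * χ) := by
          have q1 := mul_le_mul_of_nonneg_right (hDD ht) hχ0
          have q2 : |D'| * |χ - χ'| ≤ (2 * (3 * a)) * (2 * τ * χ) :=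
            mul_le_mul (hD'.trans (by linarith)) h6 (abs_nonneg _) (by positivity)
          linarith
      _ = 16 * τ * (a * χ) := by ring
      _ ≤ _ := by
          apply mul_le_mul_of_nonneg_left _ (by positivity)
          have : 0 ≤ a' * χ' := by positivity
          linarith
  · rw [min_eq_left ht]
    have q1 : |D * χ| ≤ 2 * a * χ := by
      rw [abs_mul, abs_of_nonneg hχ0]; exact mul_le_mul_of_nonneg_right hD hχ0
    have q2 : |D' * χ'| ≤ 2 * a' * χ' := by
      rw [abs_mul, abs_of_nonneg hχ'0]; exact mul_le_mul_of_nonneg_right hD' hχ'0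
    have := abs_sub (D * χ) (D' * χ')
    have : 0 ≤ a * χ := by positivity
    have : 0 ≤ a' * χ' := by positivity
    linarith

/-- unit ball -/
abbrev BB (n : ℕ) : Set (En n) := ball (0 : En n) 1

/-- exponential kernel -/
def kE (n : ℕ) (k : ℕ) (x y : En n) : ℝ := Real.exp (-(((2:ℝ) ^ k - 1) * ‖x - y‖))
/-- normalization -/
def kZ (n : ℕ) (k : ℕ) (x : En n) : ℝ := ∫ y in BB n, kE n k x y
/-- normalized kernel -/
def kP (n : ℕ) (k : ℕ) (x y : En n) : ℝ := kE n k x y / kZ n k x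

lemma two_pow_ge (k : ℕ) : (1:ℝ) ≤ 2 ^ k := one_le_pow₀ (by norm_num)

lemma kE_pos (n k : ℕ) (x y : En n) : 0 < kE n k x y := Real.exp_pos _

lemma kE_le_one (n k : ℕ) (x y : En n) : kE n k x y ≤ 1 := by
  unfold kE
  rw [Real.exp_le_one_iff, neg_nonpos]
  exact mul_nonneg (by linarith [two_pow_ge k]) (norm_nonneg _)

lemma kE_meas (n k : ℕ) : Measurable (fun z : En n × En n => kE n k z.1 z.2) := by
  unfold kE
  fun_prop

lemma kE_meas_right (n k : ℕ) (x : En n) : Measurable (fun y : En n => kE n k x y) := by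
  unfold kE
  fun_prop

lemma BB_fin (n : ℕ) : volume (BB n) ≠ ⊤ := measure_ball_lt_top.ne

lemma kE_int (n k : ℕ) (x : En n) : Integrable (fun y => kE n k x y) (volume.restrict (BB n)) :=
  Measure.integrableOn_of_bounded (BB_fin n) (kE_meas_right n k x).aestronglyMeasurable (M := 1)
      (Filter.Eventually.of_forall fun y => by
        rw [Real.norm_eq_abs, abs_of_pos (kE_pos n k x y)]; exact kE_le_one n k x y)

lemma kE_harnack (n k : ℕ) (x x' y : En n) :
    kE n k x' y ≤ Real.exp ((2:ℝ) ^ k * ‖x - x'‖) * kE n k x y := by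
  unfold kE
  rw [← Real.exp_add, Real.exp_le_exp]
  have h1 : ‖x - y‖ ≤ ‖x - x'‖ + ‖x' - y‖ := norm_sub_le_norm_sub_add_norm_sub _ _ _
  have h2 := two_pow_ge k
  have h3 := mul_le_mul_of_nonneg_left h1 (by linarith : (0:ℝ) ≤ 2 ^ k - 1)
  nlinarith [norm_nonneg (x - x')]

lemma kZ_pos (n k : ℕ) (x : En n) : 0 < kZ n k x := by
  unfold kZ
  rw [integral_pos_iff_support_of_nonneg (fun y => (kE_pos n k x y).le) (kE_int n k x)]
  have : Function.support (fun y => kE n k x y) = univ := by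
    ext y; simp [(kE_pos n k x y).ne']
  rw [this, Measure.restrict_apply_univ]
  exact measure_ball_pos _ _ one_pos

lemma kZ_harnack (n k : ℕ) (x x' : En n) :
    kZ n k x ≤ Real.exp ((2:ℝ) ^ k * ‖x - x'‖) * kZ n k x' := by
  unfold kZ
  rw [← integral_const_mul]
  apply integral_mono (kE_int n k x) ((kE_int n k x').const_mul _)
  intro y
  have := kE_harnack n k x' x y
  rwa [norm_sub_rev] at this

lemma kP_nonneg (n k : ℕ) (x y : En n) : 0 ≤ kP n k x y :=
  div_nonneg (kE_pos n k x y).le (kZ_pos n k x).le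

lemma kP_harnack (n k : ℕ) (x x' y : En n) :
    kP n k x' y ≤ Real.exp (2 * ((2:ℝ) ^ k * ‖x - x'‖)) * kP n k x y := by
  unfold kP
  set E := Real.exp ((2:ℝ) ^ k * ‖x - x'‖) with hE
  have hE0 : 0 < E := Real.exp_pos _
  have e : Real.exp (2 * ((2:ℝ) ^ k * ‖x - x'‖)) = E * E := by
    rw [hE, ← Real.exp_add]; ring_nf
  have h1 := kE_harnack n k x x' y
  have h2 := kZ_harnack n k x x'
  rw [← hE] at h1 h2
  have z1 := kZ_pos n k x
  have z2 := kZ_pos n k x'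
  rw [e, mul_div_assoc', div_le_div_iff₀ z2 z1]
  calc kE n k x' y * kZ n k x ≤ (E * kE n k x y) * (E * kZ n k x') :=
        mul_le_mul h1 h2 z1.le (mul_nonneg hE0.le (kE_pos n k x y).le)
    _ = _ := by ring

lemma kP_int (n k : ℕ) (x : En n) : Integrable (fun y => kP n k x y) (volume.restrict (BB n)) :=
  (kE_int n k x).div_const _

lemma kP_one (n k : ℕ) (x : En n) : ∫ y in BB n, kP n k x y = 1 := by
  unfold kP
  rw [integral_div]
  exact div_self (kZ_pos n k x).ne'

lemma kZ_meas (n k : ℕ) : Measurable (kZ n k) := by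
  unfold kZ
  have : StronglyMeasurable (fun z : En n × En n => kE n k z.1 z.2) := (kE_meas n k).stronglyMeasurable
  exact this.integral_prod_right'.measurable

lemma kP_meas (n k : ℕ) : Measurable (fun z : En n × En n => kP n k z.1 z.2) := by
  unfold kP
  exact (kE_meas n k).div ((kZ_meas n k).comp measurable_fst)

lemma kP_upper (n : ℕ) : ∃ C : ℝ, 0 < C ∧ ∀ (k : ℕ) (x y : En n), x ∈ BB n → y ∈ BB n →
    kP n k x y ≤ C * ((2:ℝ) ^ k) ^ (n:ℝ) * Real.exp (-((2:ℝ) ^ k * ‖x - y‖)) := by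
  have hom := om_pos n
  refine ⟨Real.exp 2 * (Real.exp 1 * 2 ^ (n:ℝ) / om n), by positivity, fun k x y hx hy => ?_⟩
  set L := (2:ℝ) ^ k with hL
  have hL1 : 1 ≤ L := two_pow_ge k
  have hL0 : 0 < L := by linarith
  have hZ : Real.exp (-1) * (om n * (1 / L / 2) ^ (n:ℝ)) ≤ kZ n k x := by
    obtain ⟨s1, s2⟩ := subball n one_pos (by positivity : 0 < 1 / L)
      (by rw [div_le_iff₀ hL0]; linarith) hx
    set z := x + ((1 / L) / (2 * 1)) • (0 - x) with hz
    calc Real.exp (-1) * (om n * (1 / L / 2) ^ (n:ℝ)) = ∫ y in ball z (1 / L / 2), Real.exp (-1) := by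
          rw [setIntegral_const, measureReal_def, vol_ball n z (by positivity),
            ENNReal.toReal_ofReal (by positivity), smul_eq_mul, mul_comm]
      _ ≤ ∫ y in ball z (1 / L / 2), kE n k x y := by
          apply setIntegral_mono_on (integrableOn_const measure_ball_lt_top.ne)
            (IntegrableOn.mono_set (kE_int n k x) s1) measurableSet_ball
          intro y hy
          unfold kE
          rw [Real.exp_le_exp, neg_le_neg_iff]
          have h1 := s2 hy
          rw [mem_ball, dist_eq_norm, norm_sub_rev] at h1
          rw [← hL]
          calc (L - 1) * ‖x - y‖ ≤ L * ‖x - y‖ := by nlinarith [norm_nonneg (x - y)]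
            _ ≤ L * (1 / L) := mul_le_mul_of_nonneg_left h1.le hL0.le
            _ = 1 := by field_simp
      _ ≤ kZ n k x := by
          unfold kZ
          apply setIntegral_mono_set (kE_int n k x)
            (Filter.Eventually.of_forall fun y => (kE_pos n k x y).le)
          exact s1.eventuallyLE
  have hE : kE n k x y ≤ Real.exp 2 * Real.exp (-(L * ‖x - y‖)) := by
    unfold kE
    rw [← Real.exp_add, Real.exp_le_exp, ← hL]
    have : ‖x - y‖ ≤ 2 := by
      rw [mem_ball_zero_iff] at hx hy
      linarith [norm_sub_le x y]
    nlinarith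
  have hz0 := kZ_pos n k x
  unfold kP
  rw [div_le_iff₀ hz0]
  have e1 : (1 / L / 2) ^ (n:ℝ) = (L ^ (n:ℝ))⁻¹ * (2 ^ (n:ℝ))⁻¹ := by
    rw [Real.div_rpow (by positivity) (by norm_num), Real.div_rpow (by norm_num) hL0.le, Real.one_rpow]
    field_simp
  rw [e1] at hZ
  have hLn : 0 < L ^ (n:ℝ) := by positivity
  have h2n : (0:ℝ) < 2 ^ (n:ℝ) := by positivity
  have h3 : 0 ≤ Real.exp 2 * (Real.exp 1 * 2 ^ (n:ℝ) / om n) * L ^ (n:ℝ) * Real.exp (-(L * ‖x - y‖)) := by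
    positivity
  refine hE.trans (le_trans (le_of_eq ?_) (mul_le_mul_of_nonneg_left hZ h3))
  have e2 : Real.exp 1 * Real.exp (-1) = 1 := by rw [← Real.exp_add]; simp
  field_simp
  exact e2.symm

/-- product measure on the unit ball -/
def mB (n : ℕ) : Measure (En n × En n) := (volume.restrict (BB n)).prod (volume.restrict (BB n))

instance (n : ℕ) : IsFiniteMeasure (volume.restrict (BB n)) := ⟨by
  rw [Measure.restrict_apply_univ]; exact measure_ball_lt_top⟩

instance (n : ℕ) : IsFiniteMeasure (mB n) := by unfold mB; infer_instance

/-- the coupled kernel -/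
def kq (n k : ℕ) (x : En n) (z : En n × En n) : ℝ := kP n (k+1) x z.1 * kP n k x z.2
/-- Littlewood-Paley piece -/
def dD (n k : ℕ) (w : En n → ℝ) (x : En n) : ℝ := ∫ z, (w z.1 - w z.2) * kq n k x z ∂mB n
/-- local oscillation -/
def aA (n k : ℕ) (η : ℝ) (w : En n → ℝ) (x : En n) : ℝ := ∫ z, |w z.1 - w z.2| ^ η * kq n k x z ∂mB n
/-- smooth average -/
def wk (n k : ℕ) (w : En n → ℝ) (x : En n) : ℝ := ∫ y in BB n, w y * kP n k x y

lemma kq_nonneg (n k : ℕ) (x : En n) (z : En n × En n) : 0 ≤ kq n k x z :=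
  mul_nonneg (kP_nonneg _ _ _ _) (kP_nonneg _ _ _ _)

lemma kq_int (n k : ℕ) (x : En n) : Integrable (kq n k x) (mB n) :=
  (kP_int n (k+1) x).mul_prod (kP_int n k x)

lemma kq_one (n k : ℕ) (x : En n) : ∫ z, kq n k x z ∂mB n = 1 := by
  unfold kq mB
  rw [integral_prod_mul (kP n (k+1) x) (kP n k x), kP_one, kP_one, one_mul]

lemma kP_meas_comp {X : Type*} [MeasurableSpace X] (n j : ℕ) {f g : X → En n} (hf : Measurable f)
    (hg : Measurable g) : Measurable (fun v => kP n j (f v) (g v)) := by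
  have h := Measurable.comp (kP_meas n j) (Measurable.prodMk hf hg)
  simp only [Function.comp_def] at h
  exact h

lemma kq_meas (n k : ℕ) : Measurable (fun v : En n × (En n × En n) => kq n k v.1 v.2) := by
  unfold kq
  exact Measurable.mul (kP_meas_comp n (k+1) measurable_fst measurable_snd.fst)
    (kP_meas_comp n k measurable_fst measurable_snd.snd)

lemma kq_meas_right (n k : ℕ) (x : En n) : Measurable (kq n k x) := by
  have h1 : Measurable (fun v : En n × En n => kq n k x v) := by
    unfold kq
    exact Measurable.mul (kP_meas_comp n (k+1) measurable_const measurable_fst)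
      (kP_meas_comp n k measurable_const measurable_snd)
  exact h1

lemma kq_harnack (n k : ℕ) (x x' : En n) (z : En n × En n) :
    kq n k x' z ≤ Real.exp (6 * ((2:ℝ) ^ k * ‖x - x'‖)) * kq n k x z := by
  unfold kq
  have h1 := kP_harnack n (k+1) x x' z.1
  have h2 := kP_harnack n k x x' z.2
  have e : Real.exp (6 * ((2:ℝ) ^ k * ‖x - x'‖)) =
      Real.exp (2 * ((2:ℝ) ^ (k+1) * ‖x - x'‖)) * Real.exp (2 * ((2:ℝ) ^ k * ‖x - x'‖)) := by
    rw [← Real.exp_add]; congr 1; ring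
  rw [e]
  calc kP n (k+1) x' z.1 * kP n k x' z.2 ≤ _ :=
        mul_le_mul h1 h2 (kP_nonneg _ _ _ _) (mul_nonneg (Real.exp_pos _).le (kP_nonneg _ _ _ _))
    _ = _ := by ring

section
variable {n : ℕ} {w : En n → ℝ} {Λ : ℝ}

lemma int1 (hw : Measurable w) (hΛ : ∀ x, |w x| ≤ Λ) (k : ℕ) (x : En n) :
    Integrable (fun z => (w z.1 - w z.2) * kq n k x z) (mB n) := by
  refine (kq_int n k x).bdd_mul (c := 2 * Λ) (Measurable.aestronglyMeasurable (by fun_prop)) ?_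
  refine Filter.Eventually.of_forall fun z => ?_
  rw [Real.norm_eq_abs]
  linarith [abs_sub (w z.1) (w z.2), hΛ z.1, hΛ z.2]

lemma int2 (hw : Measurable w) (hΛ : ∀ x, |w x| ≤ Λ) (k : ℕ) (x : En n) {η : ℝ} (hη : 1 ≤ η) :
    Integrable (fun z => |w z.1 - w z.2| ^ η * kq n k x z) (mB n) := by
  refine (kq_int n k x).bdd_mul (c := (2 * Λ) ^ η) (Measurable.aestronglyMeasurable (by fun_prop)) ?_
  refine Filter.Eventually.of_forall fun z => ?_
  rw [Real.norm_eq_abs, abs_of_nonneg (by positivity)]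
  refine Real.rpow_le_rpow (abs_nonneg _) ?_ (by linarith)
  linarith [abs_sub (w z.1) (w z.2), hΛ z.1, hΛ z.2]

lemma int3 (hw : Measurable w) (hΛ : ∀ x, |w x| ≤ Λ) (k : ℕ) (x : En n) :
    Integrable (fun z => |w z.1 - w z.2| * kq n k x z) (mB n) := by
  have := int2 hw hΛ k x (le_refl (1:ℝ))
  simpa using this

lemma aA_nonneg (k : ℕ) (η : ℝ) (x : En n) : 0 ≤ aA n k η w x :=
  integral_nonneg fun z => mul_nonneg (by positivity) (kq_nonneg _ _ _ _)

lemma dD_le (hw : Measurable w) (hΛ : ∀ x, |w x| ≤ Λ) (k : ℕ) (x : En n) {η : ℝ} (hη : 1 ≤ η) :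
    |dD n k w x| ≤ 2 * aA n k η w x ^ (1/η) := by
  refine le_trans ?_ (abs_mean_le hη (kq_int n k x) (kq_nonneg n k x) (kq_one n k x) (int3 hw hΛ k x)
    (int2 hw hΛ k x hη))
  unfold dD
  refine abs_integral_le_integral_abs.trans (le_of_eq ?_)
  congr 1; ext z
  rw [abs_mul, abs_of_nonneg (kq_nonneg n k x z)]

lemma dD_diff (hw : Measurable w) (hΛ : ∀ x, |w x| ≤ Λ) (k : ℕ) (x x' : En n) {η : ℝ} (hη : 1 ≤ η)
    (hτ : 6 * ((2:ℝ) ^ k * ‖x - x'‖) ≤ 1) :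
    |dD n k w x - dD n k w x'| ≤ 4 * (6 * ((2:ℝ) ^ k * ‖x - x'‖)) * aA n k η w x ^ (1/η) := by
  have h1 := mean_diff (m := mB n) (h := fun z : En n × En n => w z.1 - w z.2) (q := kq n k x) (q' := kq n k x')
    (τ := 6 * ((2:ℝ) ^ k * ‖x - x'‖)) (by positivity) hτ (kq_harnack n k x x')
    (fun z => by have := kq_harnack n k x' x z; rwa [norm_sub_rev] at this) (kq_nonneg n k x)
    (int1 hw hΛ k x) (int1 hw hΛ k x') (int3 hw hΛ k x)
  have h2 := abs_mean_le hη (kq_int n k x) (kq_nonneg n k x) (kq_one n k x) (int3 hw hΛ k x)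
    (int2 hw hΛ k x hη)
  refine h1.trans ?_
  have h3 : 0 ≤ 2 * (6 * ((2:ℝ) ^ k * ‖x - x'‖)) := by positivity
  refine (mul_le_mul_of_nonneg_left h2 h3).trans (le_of_eq ?_)
  unfold aA
  ring

lemma aA_harnack (hw : Measurable w) (hΛ : ∀ x, |w x| ≤ Λ) (k : ℕ) (x x' : En n) {η : ℝ} (hη : 1 ≤ η) :
    aA n k η w x' ≤ Real.exp (6 * ((2:ℝ) ^ k * ‖x - x'‖)) * aA n k η w x := by
  unfold aA
  rw [← integral_const_mul]
  apply integral_mono (int2 hw hΛ k x' hη) ((int2 hw hΛ k x hη).const_mul _)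
  intro z
  dsimp only
  rw [mul_left_comm]
  exact mul_le_mul_of_nonneg_left (kq_harnack n k x x' z) (by positivity)

lemma aA_meas (hw : Measurable w) (k : ℕ) (η : ℝ) : Measurable (aA n k η w) := by
  unfold aA
  have : StronglyMeasurable (fun v : En n × (En n × En n) => |w v.2.1 - w v.2.2| ^ η * kq n k v.1 v.2) := by
    apply Measurable.stronglyMeasurable
    exact Measurable.mul (by fun_prop) (kq_meas n k)
  exact this.integral_prod_right'.measurable

lemma dD_meas (hw : Measurable w) (k : ℕ) : Measurable (dD n k w) := by
  unfold dD
  have : StronglyMeasurable (fun v : En n × (En n × En n) => (w v.2.1 - w v.2.2) * kq n k v.1 v.2) := by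
    apply Measurable.stronglyMeasurable
    exact Measurable.mul (by fun_prop) (kq_meas n k)
  exact this.integral_prod_right'.measurable

lemma wP_int (hw : Measurable w) (hΛ : ∀ x, |w x| ≤ Λ) (k : ℕ) (x : En n) :
    Integrable (fun y => w y * kP n k x y) (volume.restrict (BB n)) :=
  (kP_int n k x).bdd_mul (c := Λ) hw.aestronglyMeasurable
    (Filter.Eventually.of_forall fun z => by rw [Real.norm_eq_abs]; exact hΛ z)

lemma dD_eq (hw : Measurable w) (hΛ : ∀ x, |w x| ≤ Λ) (k : ℕ) (x : En n) :
    dD n k w x = wk n (k+1) w x - wk n k w x := by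
  unfold dD wk mB kq
  have i1 := (wP_int hw hΛ (k+1) x).mul_prod (kP_int n k x)
  have i2 := (kP_int n (k+1) x).mul_prod (wP_int hw hΛ k x)
  calc ∫ z, (w z.1 - w z.2) * (kP n (k+1) x z.1 * kP n k x z.2)
        ∂((volume.restrict (BB n)).prod (volume.restrict (BB n)))
      = ∫ z, (w z.1 * kP n (k+1) x z.1 * kP n k x z.2 - kP n (k+1) x z.1 * (w z.2 * kP n k x z.2))
        ∂((volume.restrict (BB n)).prod (volume.restrict (BB n))) := by
        congr 1; ext z; ring
    _ = _ := by
        rw [integral_sub i1 i2, integral_prod_mul (fun y => w y * kP n (k+1) x y) (kP n k x),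
          integral_prod_mul (kP n (k+1) x) (fun y => w y * kP n k x y), kP_one, kP_one]
        ring

lemma wk_zero (hmean : ∫ y in BB n, w y = 0) (x : En n) : wk n 0 w x = 0 := by
  unfold wk kP kE
  simp only [pow_zero, sub_self, zero_mul, neg_zero, Real.exp_zero]
  rw [integral_mul_const, hmean, zero_mul]

lemma sum_dD (hw : Measurable w) (hΛ : ∀ x, |w x| ≤ Λ) (hmean : ∫ y in BB n, w y = 0) (N : ℕ) (x : En n) :
    ∑ k ∈ Finset.range N, dD n k w x = wk n N w x := by
  simp_rw [dD_eq hw hΛ]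
  rw [Finset.sum_range_sub (fun k => wk n k w x), wk_zero hmean, sub_zero]

end

lemma exp_min (n : ℕ) (hn : 2 ≤ n) (p : ℝ) : ∃ C : ℝ, 0 < C ∧ ∀ e t : ℝ, 0 ≤ e → e ≤ p → 0 < t →
    t ^ ((n:ℝ) + e) * Real.exp (-(t / 2)) ≤ C * min t (1 / t) := by
  obtain ⟨J, hJ⟩ := exists_nat_ge ((n:ℝ) + p + 1)
  have hn2 : (2:ℝ) ≤ n := by exact_mod_cast hn
  set A : ℝ := (J.factorial : ℝ) * 2 ^ J with hA
  have hA1 : 1 ≤ A := by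
    have h1 : (1:ℝ) ≤ J.factorial := by exact_mod_cast Nat.one_le_iff_ne_zero.mpr (Nat.factorial_ne_zero J)
    have h2 := two_pow_ge J
    nlinarith
  refine ⟨A, by linarith, fun e t he hep ht => ?_⟩
  rcases le_total t 1 with h | h
  · have h1 : min t (1/t) = t := min_eq_left (by rw [le_div_iff₀ ht]; nlinarith)
    rw [h1]
    have h2 : t ^ ((n:ℝ) + e) ≤ t := by
      calc t ^ ((n:ℝ) + e) ≤ t ^ (1:ℝ) := Real.rpow_le_rpow_of_exponent_ge ht h (by linarith)
        _ = t := Real.rpow_one t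
    have h3 : Real.exp (-(t/2)) ≤ 1 := by rw [Real.exp_le_one_iff]; linarith
    have h4 : 0 ≤ t ^ ((n:ℝ) + e) := by positivity
    nlinarith [Real.exp_pos (-(t/2))]
  · have h1 : min t (1/t) = 1/t := min_eq_right (by rw [div_le_iff₀ ht]; nlinarith)
    rw [h1]
    have h2 : t ^ ((n:ℝ) + e) * t ≤ t ^ J := by
      rw [← Real.rpow_add_one ht.ne', ← Real.rpow_natCast]
      exact Real.rpow_le_rpow_of_exponent_le h (by linarith)
    have h3 := Real.pow_div_factorial_le_exp (t/2) (by positivity) J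
    rw [Real.exp_neg]
    have h4 : t ^ J ≤ A * Real.exp (t/2) := by
      rw [div_pow, div_div, div_le_iff₀ (by positivity)] at h3
      rw [hA]; nlinarith
    rw [mul_one_div, ← div_eq_mul_inv, div_le_div_iff₀ (Real.exp_pos _) ht]
    linarith

lemma sum_exp (n : ℕ) (hn : 2 ≤ n) (p : ℝ) : ∃ C : ℝ, 0 < C ∧ ∀ e D : ℝ, 0 ≤ e → e ≤ p → 0 < D →
    ∀ N : ℕ, ∑ k ∈ Finset.range N, ((2:ℝ) ^ k) ^ ((n:ℝ) + e) * Real.exp (-((2:ℝ) ^ k * D / 2))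
      ≤ C * D ^ (-((n:ℝ) + e)) := by
  obtain ⟨C, hC, h⟩ := exp_min n hn p
  obtain ⟨c, hc, h'⟩ := sum_min (ρ := 2) (by norm_num)
  refine ⟨C * c, by positivity, fun e D he hep hD N => ?_⟩
  have hDn : 0 < D ^ ((n:ℝ) + e) := by positivity
  calc ∑ k ∈ Finset.range N, ((2:ℝ) ^ k) ^ ((n:ℝ) + e) * Real.exp (-((2:ℝ) ^ k * D / 2))
      ≤ ∑ k ∈ Finset.range N, C * D ^ (-((n:ℝ) + e)) * min ((2:ℝ) ^ k * D) (1 / ((2:ℝ) ^ k * D)) := by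
        apply Finset.sum_le_sum
        intro k _
        have := h e ((2:ℝ) ^ k * D) he hep (by positivity)
        rw [Real.mul_rpow (by positivity) hD.le] at this
        rw [Real.rpow_neg hD.le, mul_assoc, mul_left_comm, ← div_eq_inv_mul, le_div_iff₀ hDn]
        linarith
    _ = C * D ^ (-((n:ℝ) + e)) * ∑ k ∈ Finset.range N, min ((2:ℝ) ^ k * D) (1 / ((2:ℝ) ^ k * D)) := by
        rw [Finset.mul_sum]
    _ ≤ C * D ^ (-((n:ℝ) + e)) * c := by
        apply mul_le_mul_of_nonneg_left (h' D hD N) (by positivity)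
    _ = _ := by ring

lemma mB_eq (n : ℕ) : mB n = (volume : Measure (En n × En n)).restrict (BB n ×ˢ BB n) := by
  unfold mB
  rw [Measure.prod_restrict]; rfl

lemma mB_ae (n : ℕ) : ∀ᵐ z ∂mB n, z.1 ∈ BB n ∧ z.2 ∈ BB n := by
  rw [mB_eq]
  filter_upwards [ae_restrict_mem (measurableSet_ball.prod measurableSet_ball)] with z hz
  exact hz

lemma kq_x (n : ℕ) (hn : 2 ≤ n) : ∃ C : ℝ, 0 < C ∧ ∀ (k : ℕ) (z : En n × En n), z.1 ∈ BB n → z.2 ∈ BB n →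
    ∫⁻ x in BB n, ENNReal.ofReal (kq n k x z) ≤
      ENNReal.ofReal (C * ((2:ℝ) ^ k) ^ (n:ℝ) * Real.exp (-((2:ℝ) ^ k * ‖z.1 - z.2‖ / 2))) := by
  obtain ⟨C, hC, h⟩ := kP_upper n
  obtain ⟨c, hc, h'⟩ := exp_kernel n hn
  refine ⟨C ^ 2 * 2 ^ (n:ℝ) * (c * 2 ^ (n:ℝ)), by positivity, fun k z hz1 hz2 => ?_⟩
  set L := (2:ℝ) ^ k with hL
  have hL0 : 0 < L := by positivity
  set D := ‖z.1 - z.2‖ with hD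
  set B := C ^ 2 * 2 ^ (n:ℝ) * L ^ (n:ℝ) * L ^ (n:ℝ) * Real.exp (-(L * D / 2)) with hB
  have hB0 : 0 ≤ B := by positivity
  have hpt : ∀ x ∈ BB n, kq n k x z ≤ B * Real.exp (-(L/2 * ‖x - z.2‖)) := by
    intro x hx
    have h1 := h (k+1) x z.1 hx hz1
    have h2 := h k x z.2 hx hz2
    have h3 : D ≤ ‖x - z.1‖ + ‖x - z.2‖ := by
      rw [hD, norm_sub_rev x z.1]; exact norm_sub_le_norm_sub_add_norm_sub _ _ _
    calc kq n k x z ≤ (C * ((2:ℝ) ^ (k+1)) ^ (n:ℝ) * Real.exp (-((2:ℝ) ^ (k+1) * ‖x - z.1‖))) *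
          (C * L ^ (n:ℝ) * Real.exp (-(L * ‖x - z.2‖))) :=
          mul_le_mul h1 h2 (kP_nonneg _ _ _ _) (by positivity)
      _ = C ^ 2 * 2 ^ (n:ℝ) * L ^ (n:ℝ) * L ^ (n:ℝ) * Real.exp (-(2 * L * ‖x - z.1‖) + -(L * ‖x - z.2‖)) := by
          rw [Real.exp_add, pow_succ, ← hL, mul_comm L 2, Real.mul_rpow (by norm_num) hL0.le]; ring
      _ ≤ C ^ 2 * 2 ^ (n:ℝ) * L ^ (n:ℝ) * L ^ (n:ℝ) * Real.exp (-(L * D / 2) + -(L / 2 * ‖x - z.2‖)) := by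
          apply mul_le_mul_of_nonneg_left _ (by positivity)
          apply Real.exp_le_exp.mpr
          have := mul_le_mul_of_nonneg_left h3 hL0.le
          have := mul_nonneg hL0.le (norm_nonneg (x - z.1))
          have := mul_nonneg hL0.le (norm_nonneg (x - z.2))
          linarith
      _ = _ := by rw [Real.exp_add, hB]; ring
  calc ∫⁻ x in BB n, ENNReal.ofReal (kq n k x z)
      ≤ ∫⁻ x in BB n, ENNReal.ofReal B * ENNReal.ofReal (Real.exp (-(L/2 * ‖x - z.2‖))) := by
        apply setLIntegral_mono' measurableSet_ball
        intro x hx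
        rw [← ENNReal.ofReal_mul hB0]
        exact ENNReal.ofReal_le_ofReal (hpt x hx)
    _ ≤ ∫⁻ x, ENNReal.ofReal B * ENNReal.ofReal (Real.exp (-(L/2 * ‖x - z.2‖))) := setLIntegral_le_lintegral _ _
    _ = ENNReal.ofReal B * ∫⁻ x, ENNReal.ofReal (Real.exp (-(L/2 * ‖x - z.2‖))) := by
        rw [lintegral_const_mul _ (by fun_prop)]
    _ = ENNReal.ofReal B * ∫⁻ x : En n, ENNReal.ofReal (Real.exp (-(L/2 * ‖x‖))) := by
        congr 1
        have := lint_shift n z.2 (fun r => ENNReal.ofReal (Real.exp (-(L/2 * r))))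
        simp_rw [norm_sub_rev z.2] at this
        exact this
    _ ≤ ENNReal.ofReal B * ENNReal.ofReal (c * (L/2) ^ (-(n:ℝ))) := by
        gcongr; exact h' _ (by positivity)
    _ = _ := by
        rw [← ENNReal.ofReal_mul hB0]
        congr 1
        rw [Real.div_rpow hL0.le (by norm_num), Real.rpow_neg hL0.le, Real.rpow_neg (by norm_num : (0:ℝ) ≤ 2), hB]
        have : L ^ (n:ℝ) ≠ 0 := by positivity
        field_simp

lemma keyK (n : ℕ) (hn : 2 ≤ n) (p : ℝ) : ∃ C : ℝ, 0 < C ∧ ∀ (η e Λ : ℝ) (w : En n → ℝ), 1 ≤ η → 0 ≤ e → e ≤ p →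
    Measurable w → (∀ x, |w x| ≤ Λ) → ∀ N : ℕ,
    ∑ k ∈ Finset.range N, ENNReal.ofReal (((2:ℝ) ^ k) ^ e) * ∫⁻ x in BB n, ENNReal.ofReal (aA n k η w x)
      ≤ ENNReal.ofReal C * ∫⁻ x in BB n, ∫⁻ y in BB n, gk n η e w x y := by
  obtain ⟨C1, hC1, h1⟩ := kq_x n hn
  obtain ⟨C2, hC2, h2⟩ := sum_exp n hn p
  refine ⟨C1 * C2, by positivity, fun η e Λ w hη he hep hw hΛ N => ?_⟩
  have hmk : ∀ k, Measurable (fun v : En n × (En n × En n) => ENNReal.ofReal (|w v.2.1 - w v.2.2| ^ η * kq n k v.1 v.2)) :=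
    fun k => (Measurable.mul (by fun_prop) (kq_meas n k)).ennreal_ofReal
  have hmain : ∀ k, ENNReal.ofReal (((2:ℝ) ^ k) ^ e) * ∫⁻ x in BB n, ENNReal.ofReal (aA n k η w x) ≤
      ∫⁻ z, ENNReal.ofReal (C1 * |w z.1 - w z.2| ^ η * (((2:ℝ) ^ k) ^ ((n:ℝ)+e) *
        Real.exp (-((2:ℝ) ^ k * ‖z.1 - z.2‖ / 2)))) ∂mB n := by
    intro k
    have e1 : ∀ x, ENNReal.ofReal (aA n k η w x) = ∫⁻ z, ENNReal.ofReal (|w z.1 - w z.2| ^ η * kq n k x z) ∂mB n := by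
      intro x
      exact ofReal_integral_eq_lintegral_ofReal (int2 hw hΛ k x hη)
        (Filter.Eventually.of_forall fun z => mul_nonneg (by positivity) (kq_nonneg _ _ _ _))
    simp_rw [e1]
    rw [lintegral_lintegral_swap (hmk k).aemeasurable, ← lintegral_const_mul _ ((hmk k).lintegral_prod_left')]
    apply lintegral_mono_ae
    filter_upwards [mB_ae n] with z hz
    have e2 : ∫⁻ x in BB n, ENNReal.ofReal (|w z.1 - w z.2| ^ η * kq n k x z) =
        ENNReal.ofReal (|w z.1 - w z.2| ^ η) * ∫⁻ x in BB n, ENNReal.ofReal (kq n k x z) := by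
      rw [← lintegral_const_mul' _ _ ENNReal.ofReal_ne_top]
      simp_rw [ENNReal.ofReal_mul (show 0 ≤ |w z.1 - w z.2| ^ η by positivity)]
    rw [e2]
    calc _ ≤ ENNReal.ofReal (((2:ℝ) ^ k) ^ e) * (ENNReal.ofReal (|w z.1 - w z.2| ^ η) *
          ENNReal.ofReal (C1 * ((2:ℝ) ^ k) ^ (n:ℝ) * Real.exp (-((2:ℝ) ^ k * ‖z.1 - z.2‖ / 2)))) := by
          gcongr; exact h1 k z hz.1 hz.2
      _ = _ := by
          rw [← ENNReal.ofReal_mul (by positivity), ← ENNReal.ofReal_mul (by positivity)]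
          congr 1
          rw [Real.rpow_add (by positivity)]; ring
  calc _ ≤ ∑ k ∈ Finset.range N, ∫⁻ z, ENNReal.ofReal (C1 * |w z.1 - w z.2| ^ η * (((2:ℝ) ^ k) ^ ((n:ℝ)+e) *
        Real.exp (-((2:ℝ) ^ k * ‖z.1 - z.2‖ / 2)))) ∂mB n := Finset.sum_le_sum fun k _ => hmain k
    _ = ∫⁻ z, ∑ k ∈ Finset.range N, ENNReal.ofReal (C1 * |w z.1 - w z.2| ^ η * (((2:ℝ) ^ k) ^ ((n:ℝ)+e) *
        Real.exp (-((2:ℝ) ^ k * ‖z.1 - z.2‖ / 2)))) ∂mB n := by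
        rw [lintegral_finsetSum]
        intro k _
        fun_prop
    _ ≤ ∫⁻ z, ENNReal.ofReal (C1 * C2) * gk n η e w z.1 z.2 ∂mB n := by
        apply lintegral_mono
        intro z
        dsimp only
        rw [← ENNReal.ofReal_sum_of_nonneg (fun k _ => by positivity), ← Finset.mul_sum]
        unfold gk
        rw [← ENNReal.ofReal_mul (by positivity)]
        apply ENNReal.ofReal_le_ofReal
        rcases eq_or_lt_of_le (norm_nonneg (z.1 - z.2)) with h0 | h0
        · have : z.1 = z.2 := by rw [← sub_eq_zero, ← norm_eq_zero, ← h0]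
          rw [this, sub_self, abs_zero, Real.zero_rpow (by linarith)]; simp
        · have := h2 e _ he hep h0 N
          calc _ ≤ C1 * |w z.1 - w z.2| ^ η * (C2 * ‖z.1 - z.2‖ ^ (-((n:ℝ) + e))) :=
                mul_le_mul_of_nonneg_left this (by positivity)
            _ = _ := by rw [Real.rpow_neg h0.le]; ring
    _ = ENNReal.ofReal (C1 * C2) * ∫⁻ x in BB n, ∫⁻ y in BB n, gk n η e w x y := by
        have hg : Measurable (fun z : En n × En n => gk n η e w z.1 z.2) := gk_meas n η e hw
        rw [lintegral_const_mul _ hg]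
        unfold mB
        rw [lintegral_prod _ hg.aemeasurable]

lemma add_rpow_two {a b p : ℝ} (ha : 0 ≤ a) (hb : 0 ≤ b) (hp : 0 ≤ p) : (a + b) ^ p ≤ 2 ^ p * (a ^ p + b ^ p) := by
  have h1 : a + b ≤ 2 * max a b := by linarith [le_max_left a b, le_max_right a b]
  have h2 : 0 ≤ max a b := le_trans ha (le_max_left _ _)
  calc (a+b)^p ≤ (2 * max a b) ^ p := Real.rpow_le_rpow (by positivity) h1 hp
    _ = 2 ^ p * (max a b) ^ p := Real.mul_rpow (by norm_num) h2
    _ ≤ _ := by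
      apply mul_le_mul_of_nonneg_left _ (by positivity)
      rcases max_cases a b with ⟨h, _⟩ | ⟨h, _⟩ <;> rw [h] <;> linarith [Real.rpow_nonneg ha p, Real.rpow_nonneg hb p]

lemma sum_min_s {s : ℝ} (hs0 : 0 < s) (hs1 : s < 1) : ∃ c : ℝ, 0 < c ∧ ∀ d : ℝ, 0 < d → ∀ N : ℕ,
    ∑ k ∈ Finset.range N, min 1 ((2:ℝ) ^ k * d) * ((2:ℝ) ^ k) ^ (-s) ≤ c * d ^ s := by
  set κ := min s (1 - s) with hκ
  have hκ0 : 0 < κ := lt_min hs0 (by linarith)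
  have hκs : κ ≤ s := min_le_left _ _
  have hκs' : κ ≤ 1 - s := min_le_right _ _
  obtain ⟨c, hc, h⟩ := sum_min (ρ := (2:ℝ) ^ κ) (Real.one_lt_rpow (by norm_num) hκ0)
  refine ⟨c, hc, fun d hd N => ?_⟩
  rw [← div_le_iff₀ (by positivity), Finset.sum_div]
  refine le_trans (Finset.sum_le_sum fun k _ => ?_) (h (d ^ κ) (by positivity) N)
  set T := (2:ℝ) ^ k * d with hT
  have hT0 : 0 < T := by positivity
  have e1 : ((2:ℝ) ^ κ) ^ k * d ^ κ = T ^ κ := by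
    rw [hT, Real.mul_rpow (by positivity) hd.le, ← Real.rpow_natCast, ← Real.rpow_natCast, ← Real.rpow_mul (by norm_num),
      ← Real.rpow_mul (by norm_num), mul_comm κ]
  have e2 : min 1 T * ((2:ℝ) ^ k) ^ (-s) / d ^ s = min 1 T * T ^ (-s) := by
    rw [hT, Real.mul_rpow (x := (2:ℝ)^k) (by positivity) hd.le, Real.rpow_neg hd.le]; ring
  rw [e1, e2, one_div, ← Real.rpow_neg hT0.le]
  rcases le_total T 1 with h1 | h1
  · rw [min_eq_right h1]
    have e3 : T * T ^ (-s) = T ^ (1 - s) := by rw [sub_eq_add_neg, Real.rpow_add hT0, Real.rpow_one]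
    rw [e3]
    refine le_min (Real.rpow_le_rpow_of_exponent_ge hT0 h1 hκs') (Real.rpow_le_rpow_of_exponent_ge hT0 h1 (by linarith))
  · rw [min_eq_left h1, one_mul]
    exact le_min (Real.rpow_le_rpow_of_exponent_le h1 (by linarith)) (Real.rpow_le_rpow_of_exponent_le h1 (by linarith))

lemma schur_sum {s : ℝ} (hs0 : 0 < s) (hs1 : s < 1) {p : ℝ} (hp : 1 ≤ p) : ∃ c : ℝ, 0 < c ∧ ∀ d : ℝ, 0 < d → ∀ N : ℕ,
    ∀ b : ℕ → ℝ, (∀ k, 0 ≤ b k) →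
    (∑ k ∈ Finset.range N, min 1 ((2:ℝ) ^ k * d) * b k) ^ p ≤
      c * d ^ (s * (p - 1)) * ∑ k ∈ Finset.range N, min 1 ((2:ℝ) ^ k * d) * (((2:ℝ) ^ k) ^ (s * (p-1)) * b k ^ p) := by
  obtain ⟨c, hc, h⟩ := sum_min_s hs0 hs1
  refine ⟨c ^ (p - 1), by positivity, fun d hd N b hb => ?_⟩
  have hp0 : 0 < p := by linarith
  set m := fun k : ℕ => min 1 ((2:ℝ) ^ k * d) with hm
  have hm0 : ∀ k, 0 ≤ m k := fun k => le_min zero_le_one (by positivity)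
  have h1 := Real.inner_le_weight_mul_Lp_of_nonneg (Finset.range N) hp (fun k => m k * ((2:ℝ) ^ k) ^ (-s))
    (fun k => ((2:ℝ) ^ k) ^ s * b k) (fun k => mul_nonneg (hm0 k) (by positivity)) (fun k => mul_nonneg (by positivity) (hb k))
  have e1 : ∀ k, m k * ((2:ℝ) ^ k) ^ (-s) * (((2:ℝ) ^ k) ^ s * b k) = m k * b k := by
    intro k
    rw [Real.rpow_neg (by positivity)]
    have : ((2:ℝ) ^ k) ^ s ≠ 0 := by positivity
    field_simp
  have e2 : ∀ k, m k * ((2:ℝ) ^ k) ^ (-s) * (((2:ℝ) ^ k) ^ s * b k) ^ p =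
      m k * (((2:ℝ) ^ k) ^ (s * (p-1)) * b k ^ p) := by
    intro k
    rw [Real.mul_rpow (by positivity) (hb k), ← Real.rpow_mul (by positivity),
      show s * (p - 1) = -s + s * p by ring, Real.rpow_add (by positivity)]; ring
  simp_rw [e1, e2] at h1
  set S := ∑ k ∈ Finset.range N, m k * ((2:ℝ) ^ k) ^ (-s) with hS
  set Z := ∑ k ∈ Finset.range N, m k * (((2:ℝ) ^ k) ^ (s * (p-1)) * b k ^ p) with hZ
  have hS0 : 0 ≤ S := Finset.sum_nonneg fun k _ => mul_nonneg (hm0 k) (by positivity)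
  have hZ0 : 0 ≤ Z := Finset.sum_nonneg fun k _ => mul_nonneg (hm0 k) (mul_nonneg (by positivity) (Real.rpow_nonneg (hb k) _))
  have h2 : S ≤ c * d ^ s := h d hd N
  calc (∑ k ∈ Finset.range N, m k * b k) ^ p ≤ (S ^ (1 - p⁻¹) * Z ^ p⁻¹) ^ p :=
        Real.rpow_le_rpow (Finset.sum_nonneg fun k _ => mul_nonneg (hm0 k) (hb k)) h1 hp0.le
    _ = S ^ (p - 1) * Z := by
        rw [Real.mul_rpow (by positivity) (by positivity), ← Real.rpow_mul hS0, ← Real.rpow_mul hZ0,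
          inv_mul_cancel₀ hp0.ne', Real.rpow_one, sub_mul, inv_mul_cancel₀ hp0.ne', one_mul]
    _ ≤ (c * d ^ s) ^ (p - 1) * Z := by
        apply mul_le_mul_of_nonneg_right _ hZ0
        exact Real.rpow_le_rpow hS0 h2 (by linarith)
    _ = _ := by rw [Real.mul_rpow hc.le (by positivity), ← Real.rpow_mul hd.le]

/-- thresholds -/
def lk (lam β : ℝ) (k : ℕ) : ℝ := lam * ((2:ℝ) ^ k) ^ (-β)
/-- cutoff factor -/
def ch (n k : ℕ) (lam β η : ℝ) (w : En n → ℝ) (x : En n) : ℝ := lk lam β k ^ η / (lk lam β k ^ η + aA n k η w x)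
/-- cut size -/
def bk (n k : ℕ) (lam β η : ℝ) (w : En n → ℝ) (x : En n) : ℝ := aA n k η w x ^ (1/η) * ch n k lam β η w x
/-- good part -/
def gv (n N : ℕ) (lam β η : ℝ) (w : En n → ℝ) (x : En n) : ℝ :=
  ∑ k ∈ Finset.range N, dD n k w x * ch n k lam β η w x

lemma lk_pos {lam β : ℝ} (h : 0 < lam) (k : ℕ) : 0 < lk lam β k := by unfold lk; positivity

lemma ch_nonneg {n k : ℕ} {lam β η : ℝ} (h : 0 < lam) (w : En n → ℝ) (x : En n) : 0 ≤ ch n k lam β η w x := by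
  unfold ch
  have := lk_pos (β := β) h k
  have := aA_nonneg (w := w) k η x
  positivity

lemma ch_le_one {n k : ℕ} {lam β η : ℝ} (h : 0 < lam) (w : En n → ℝ) (x : En n) : ch n k lam β η w x ≤ 1 := by
  unfold ch
  have := lk_pos (β := β) h k
  have := aA_nonneg (w := w) k η x
  rw [div_le_one (by positivity)]; linarith

lemma bk_nonneg {n k : ℕ} {lam β η : ℝ} (h : 0 < lam) (w : En n → ℝ) (x : En n) : 0 ≤ bk n k lam β η w x :=
  mul_nonneg (Real.rpow_nonneg (aA_nonneg k η x) _) (ch_nonneg h w x)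

lemma bk_pow {n k : ℕ} {lam β η p : ℝ} (h : 0 < lam) (hη : 1 ≤ η) (hηp : η ≤ p) (w : En n → ℝ) (x : En n) :
    bk n k lam β η w x ^ p ≤ lk lam β k ^ (p - η) * aA n k η w x := by
  have hA := aA_nonneg (w := w) k η x
  obtain ⟨h1, h2, -⟩ := cut_facts (lk_pos (β := β) h k) hη hA
  have hb := bk_nonneg (k := k) (β := β) (η := η) h w x
  change bk n k lam β η w x ≤ _ at h1
  change bk n k lam β η w x ≤ _ at h2
  have e : p = (p - η) + η := by ring
  calc bk n k lam β η w x ^ p = bk n k lam β η w x ^ (p - η) * bk n k lam β η w x ^ η := by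
        rw [← Real.rpow_add_of_nonneg hb (by linarith) (by linarith)]; congr 1
    _ ≤ lk lam β k ^ (p - η) * (aA n k η w x ^ (1/η)) ^ η := by
        apply mul_le_mul (Real.rpow_le_rpow hb h1 (by linarith)) (Real.rpow_le_rpow hb h2 (by linarith))
          (Real.rpow_nonneg hb _) (Real.rpow_nonneg (lk_pos h k).le _)
    _ = _ := by
        rw [← Real.rpow_mul hA, one_div_mul_cancel (by linarith), Real.rpow_one]

lemma gv_meas {n : ℕ} {w : En n → ℝ} (hw : Measurable w) (N : ℕ) (lam β η : ℝ) : Measurable (gv n N lam β η w) := by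
  unfold gv ch
  have h1 := fun k => dD_meas hw k
  have h2 := fun k => aA_meas hw k η
  fun_prop

lemma gv_bdd {n : ℕ} {w : En n → ℝ} {Λ : ℝ} (hw : Measurable w) (hΛ : ∀ x, |w x| ≤ Λ) (N : ℕ) {lam : ℝ} (β η : ℝ)
    (hl : 0 < lam) (x : En n) : |gv n N lam β η w x| ≤ N * (2 * Λ) := by
  unfold gv
  refine (Finset.abs_sum_le_sum_abs _ _).trans ?_
  have : ∀ k ∈ Finset.range N, |dD n k w x * ch n k lam β η w x| ≤ 2 * Λ := by
    intro k _
    rw [abs_mul, abs_of_nonneg (ch_nonneg hl w x)]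
    have h1 : |dD n k w x| ≤ 2 * Λ := by
      unfold dD
      refine abs_integral_le_integral_abs.trans ?_
      calc ∫ z, |(w z.1 - w z.2) * kq n k x z| ∂mB n ≤ ∫ z, (2 * Λ) * kq n k x z ∂mB n := by
            apply integral_mono (int1 hw hΛ k x).abs ((kq_int n k x).const_mul _)
            intro z
            dsimp only
            rw [abs_mul, abs_of_nonneg (kq_nonneg n k x z)]
            apply mul_le_mul_of_nonneg_right _ (kq_nonneg _ _ _ _)
            linarith [abs_sub (w z.1) (w z.2), hΛ z.1, hΛ z.2]
        _ = _ := by rw [integral_const_mul, kq_one, mul_one]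
    calc _ ≤ |dD n k w x| * 1 := mul_le_mul_of_nonneg_left (ch_le_one hl w x) (abs_nonneg _)
      _ ≤ _ := by rw [mul_one]; exact h1
  refine (Finset.sum_le_card_nsmul _ _ _ this).trans ?_
  simp

lemma gv_diff {n : ℕ} {w : En n → ℝ} {Λ : ℝ} (hw : Measurable w) (hΛ : ∀ x, |w x| ≤ Λ) (N : ℕ) {lam β η : ℝ}
    (hη : 1 ≤ η) (hl : 0 < lam) (x x' : En n) : |gv n N lam β η w x - gv n N lam β η w x'| ≤
      96 * ∑ k ∈ Finset.range N, min 1 ((2:ℝ) ^ k * ‖x - x'‖) * (bk n k lam β η w x + bk n k lam β η w x') := by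
  unfold gv
  rw [← Finset.sum_sub_distrib, Finset.mul_sum]
  refine (Finset.abs_sum_le_sum_abs _ _).trans (Finset.sum_le_sum fun k _ => ?_)
  have h := cut_real (l := lk lam β k) (η := η) (A := aA n k η w x) (A' := aA n k η w x') (D := dD n k w x)
    (D' := dD n k w x') (τ := 6 * ((2:ℝ) ^ k * ‖x - x'‖)) (lk_pos hl k) hη (aA_nonneg k η x) (aA_nonneg k η x')
    (by positivity) (dD_le hw hΛ k x hη) (dD_le hw hΛ k x' hη) (fun hτ => dD_diff hw hΛ k x x' hη hτ)
    (aA_harnack hw hΛ k x x' hη) (by rw [norm_sub_rev]; exact aA_harnack hw hΛ k x' x hη)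
  refine h.trans ?_
  change 16 * _ * (bk n k lam β η w x + bk n k lam β η w x') ≤ _
  have hb : 0 ≤ bk n k lam β η w x + bk n k lam β η w x' := add_nonneg (bk_nonneg hl w x) (bk_nonneg hl w x')
  rw [← mul_assoc (96:ℝ)]
  apply mul_le_mul_of_nonneg_right _ hb
  have hT : 0 ≤ (2:ℝ) ^ k * ‖x - x'‖ := by positivity
  rcases min_cases 1 ((2:ℝ) ^ k * ‖x - x'‖) with ⟨h1, h2⟩ | ⟨h1, h2⟩ <;> rw [h1]
  · linarith [min_le_left 1 (6 * ((2:ℝ) ^ k * ‖x - x'‖))]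
  · linarith [min_le_right 1 (6 * ((2:ℝ) ^ k * ‖x - x'‖))]

lemma lint_dbl_symm {n : ℕ} (S : Set (En n)) {F : En n → En n → ℝ≥0∞} 
    (hF : Measurable (fun z : En n × En n => F z.1 z.2)) :
    ∫⁻ x in S, ∫⁻ y in S, F y x = ∫⁻ x in S, ∫⁻ y in S, F x y := by
  have h : Measurable (fun z : En n × En n => F z.2 z.1) := hF.comp measurable_swap
  exact lintegral_lintegral_swap (f := fun x y => F y x) h.aemeasurable

lemma kern_x (n : ℕ) (hn : 2 ≤ n) {s : ℝ} (hs0 : 0 < s) (hs1 : s < 1) : ∃ C : ℝ, 0 < C ∧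
    ∀ (A : En n → ℝ), Measurable A → (∀ x, 0 ≤ A x) → ∀ k : ℕ,
    ∫⁻ x in BB n, ∫⁻ y in BB n, ENNReal.ofReal (A x * (min 1 ((2:ℝ) ^ k * ‖x - y‖) * ‖x - y‖ ^ (-s - n))) ≤
      ENNReal.ofReal (C * ((2:ℝ) ^ k) ^ s) * ∫⁻ x in BB n, ENNReal.ofReal (A x) := by
  obtain ⟨C, hC, h⟩ := min_kernel n hn hs0 hs1
  refine ⟨C, hC, fun A hA hA0 k => ?_⟩
  rw [← lintegral_const_mul _ hA.ennreal_ofReal]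
  apply lintegral_mono
  intro x
  dsimp only
  simp_rw [ENNReal.ofReal_mul (hA0 x)]
  rw [lintegral_const_mul' _ _ ENNReal.ofReal_ne_top, mul_comm]
  gcongr
  refine (setLIntegral_le_lintegral _ _).trans ?_
  refine le_trans (le_of_eq ?_) (h _ (by positivity))
  exact lint_shift n x (fun r => ENNReal.ofReal (min 1 ((2:ℝ) ^ k * r) * r ^ (-s - n)))

lemma lk_pow {lam β : ℝ} (h : 0 < lam) (k : ℕ) (r : ℝ) : lk lam β k ^ r = lam ^ r * ((2:ℝ) ^ k) ^ (-β * r) := by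
  unfold lk
  rw [Real.mul_rpow h.le (by positivity), ← Real.rpow_mul (by positivity)]

lemma dbl_sum {n : ℕ} (N : ℕ) (a : ℕ → ℝ≥0∞) {F : ℕ → En n → En n → ℝ≥0∞}
    (hFm : ∀ k, Measurable (fun z : En n × En n => F k z.1 z.2)) :
    ∫⁻ x in BB n, ∫⁻ y in BB n, ∑ k ∈ Finset.range N, a k * (F k x y + F k y x) =
      ∑ k ∈ Finset.range N, a k * (2 * ∫⁻ x in BB n, ∫⁻ y in BB n, F k x y) := by
  have m1 : ∀ k x, Measurable (fun y => F k x y) := fun k x => (hFm k).of_uncurry_left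
  have m2 : ∀ k x, Measurable (fun y => F k y x) := fun k x => (hFm k).of_uncurry_right
  have m4 : ∀ k, Measurable (fun z : En n × En n => F k z.2 z.1) := fun k => (hFm k).comp measurable_swap
  have m3 : ∀ k, Measurable (fun x => ∫⁻ y in BB n, F k x y) := fun k => (hFm k).lintegral_prod_right'
  have m5 : ∀ k, Measurable (fun x => ∫⁻ y in BB n, F k y x) := fun k => (m4 k).lintegral_prod_right'
  have i1 : ∀ x, ∫⁻ y in BB n, ∑ k ∈ Finset.range N, a k * (F k x y + F k y x) =
      ∑ k ∈ Finset.range N, a k * ((∫⁻ y in BB n, F k x y) + ∫⁻ y in BB n, F k y x) := by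
    intro x
    rw [lintegral_finsetSum _ (fun k _ => Measurable.const_mul (f := fun y => F k x y + F k y x) ((m1 k x).add (m2 k x)) _)]
    apply Finset.sum_congr rfl
    intro k _
    rw [lintegral_const_mul (f := fun y => F k x y + F k y x) _ ((m1 k x).add (m2 k x)), lintegral_add_left (m1 k x)]
  simp_rw [i1]
  rw [lintegral_finsetSum _ (fun k _ => Measurable.const_mul (f := fun x => (∫⁻ y in BB n, F k x y) + ∫⁻ y in BB n, F k y x) ((m3 k).add (m5 k)) _)]
  apply Finset.sum_congr rfl
  intro k _
  rw [lintegral_const_mul (f := fun x => (∫⁻ y in BB n, F k x y) + ∫⁻ y in BB n, F k y x) _ ((m3 k).add (m5 k)), lintegral_add_left (m3 k), lint_dbl_symm (BB n) (hFm k), two_mul]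

lemma gv_energy (n : ℕ) (hn : 2 ≤ n) {p s : ℝ} (hp : 2 ≤ p) (hs0 : 0 < s) (hs1 : s < 1) : ∃ C : ℝ, 0 < C ∧
    ∀ (η β e lam Λ : ℝ) (w : En n → ℝ), 1 ≤ η → η ≤ p → e = s * p - β * (p - η) → 0 ≤ e → e ≤ p → 0 < lam →
    Measurable w → (∀ x, |w x| ≤ Λ) → ∀ N : ℕ,
    ∫⁻ x in BB n, ∫⁻ y in BB n, gk n p (s * p) (gv n N lam β η w) x y ≤
      ENNReal.ofReal (C * lam ^ (p - η)) * ∫⁻ x in BB n, ∫⁻ y in BB n, gk n η e w x y := by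
  obtain ⟨C1, hC1, h1⟩ := schur_sum hs0 hs1 (p := p) (by linarith)
  obtain ⟨C2, hC2, h2⟩ := kern_x n hn hs0 hs1
  obtain ⟨C3, hC3, h3⟩ := keyK n hn p
  refine ⟨96 ^ p * C1 * 2 ^ p * (2 * C2) * C3, by positivity, fun η β e lam Λ w hη hηp hee he hep hl hw hΛ N => ?_⟩
  set C4 := 96 ^ p * C1 * 2 ^ p with hC4
  have hC40 : 0 < C4 := by positivity
  have hp0 : 0 < p := by linarith
  set F : ℕ → En n → En n → ℝ≥0∞ := fun k x y =>
    ENNReal.ofReal (aA n k η w x * (min 1 ((2:ℝ) ^ k * ‖x - y‖) * ‖x - y‖ ^ (-s - n))) with hF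
  have hFm : ∀ k, Measurable (fun z : En n × En n => F k z.1 z.2) := by
    intro k
    have := aA_meas hw k η
    simp only [hF]
    fun_prop
  set a : ℕ → ℝ := fun k => C4 * (((2:ℝ) ^ k) ^ (s * (p-1)) * lk lam β k ^ (p - η)) with ha
  have ha0 : ∀ k, 0 ≤ a k := fun k => by
    have := lk_pos (β := β) hl k
    simp only [ha]; positivity
  have hpt : ∀ x y : En n, gk n p (s * p) (gv n N lam β η w) x y ≤
      ∑ k ∈ Finset.range N, ENNReal.ofReal (a k) * (F k x y + F k y x) := by
    intro x y
    rcases eq_or_lt_of_le (norm_nonneg (x - y)) with h0 | h0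
    · have : x = y := by rw [← sub_eq_zero, ← norm_eq_zero, ← h0]
      unfold gk
      rw [this, sub_self, abs_zero, Real.zero_rpow (by linarith)]; simp
    set d := ‖x - y‖ with hd
    have hb0 : ∀ k, 0 ≤ bk n k lam β η w x + bk n k lam β η w y :=
      fun k => add_nonneg (bk_nonneg hl w x) (bk_nonneg hl w y)
    have g1 := gv_diff hw hΛ N (β := β) hη hl x y
    have g2 := h1 d h0 N (fun k => bk n k lam β η w x + bk n k lam β η w y) hb0
    have hm0 : ∀ k : ℕ, 0 ≤ min 1 ((2:ℝ) ^ k * d) := fun k => le_min zero_le_one (by positivity)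
    have g3 : ∀ k, (bk n k lam β η w x + bk n k lam β η w y) ^ p ≤
        2 ^ p * (lk lam β k ^ (p - η) * (aA n k η w x + aA n k η w y)) := by
      intro k
      refine (add_rpow_two (bk_nonneg hl w x) (bk_nonneg hl w y) hp0.le).trans ?_
      apply mul_le_mul_of_nonneg_left _ (by positivity)
      rw [mul_add]
      exact add_le_add (bk_pow hl hη hηp w x) (bk_pow hl hη hηp w y)
    have e1 : ∀ k, ENNReal.ofReal (a k) * (F k x y + F k y x) = ENNReal.ofReal (a k *
        (aA n k η w x * (min 1 ((2:ℝ) ^ k * d) * d ^ (-s - n)) + aA n k η w y * (min 1 ((2:ℝ) ^ k * d) * d ^ (-s - n)))) := by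
      intro k
      simp only [hF]
      rw [norm_sub_rev y x, ← hd]
      have := hm0 k
      have := aA_nonneg (w := w) k η x
      have := aA_nonneg (w := w) k η y
      rw [← ENNReal.ofReal_add (by positivity) (by positivity), ← ENNReal.ofReal_mul (ha0 k)]
    simp_rw [e1]
    rw [← ENNReal.ofReal_sum_of_nonneg (fun k _ => by
      have := hm0 k
      have := aA_nonneg (w := w) k η x
      have := aA_nonneg (w := w) k η y
      have := ha0 k
      positivity)]
    unfold gk
    apply ENNReal.ofReal_le_ofReal
    rw [← hd]
    rw [div_le_iff₀ (by positivity)]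
    calc |gv n N lam β η w x - gv n N lam β η w y| ^ p ≤ _ := Real.rpow_le_rpow (abs_nonneg _) g1 hp0.le
      _ = 96 ^ p * (∑ k ∈ Finset.range N, min 1 ((2:ℝ) ^ k * d) * (bk n k lam β η w x + bk n k lam β η w y)) ^ p := by
          rw [Real.mul_rpow (by norm_num) (Finset.sum_nonneg fun k _ => mul_nonneg (hm0 k) (hb0 k))]
      _ ≤ 96 ^ p * (C1 * d ^ (s * (p - 1)) * ∑ k ∈ Finset.range N, min 1 ((2:ℝ) ^ k * d) *
            (((2:ℝ) ^ k) ^ (s * (p-1)) * (2 ^ p * (lk lam β k ^ (p - η) * (aA n k η w x + aA n k η w y))))) := by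
          apply mul_le_mul_of_nonneg_left _ (by positivity)
          refine g2.trans ?_
          apply mul_le_mul_of_nonneg_left _ (by positivity)
          apply Finset.sum_le_sum
          intro k _
          apply mul_le_mul_of_nonneg_left _ (hm0 k)
          apply mul_le_mul_of_nonneg_left (g3 k) (by positivity)
      _ = _ := by
          have e2 : d ^ (s * (p - 1)) = d ^ (-s - n) * d ^ ((n:ℝ) + s * p) := by
            rw [← Real.rpow_add h0]; congr 1; ring
          rw [e2, Finset.mul_sum, Finset.mul_sum, Finset.sum_mul]
          apply Finset.sum_congr rfl
          intro k _
          simp only [ha, hC4]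
          ring
  calc ∫⁻ x in BB n, ∫⁻ y in BB n, gk n p (s * p) (gv n N lam β η w) x y
      ≤ ∫⁻ x in BB n, ∫⁻ y in BB n, ∑ k ∈ Finset.range N, ENNReal.ofReal (a k) * (F k x y + F k y x) :=
        lintegral_mono fun x => lintegral_mono fun y => hpt x y
    _ = ∑ k ∈ Finset.range N, ENNReal.ofReal (a k) * (2 * ∫⁻ x in BB n, ∫⁻ y in BB n, F k x y) :=
        dbl_sum N (fun k => ENNReal.ofReal (a k)) hFm
    _ ≤ ∑ k ∈ Finset.range N, ENNReal.ofReal (C4 * (2 * C2) * lam ^ (p - η)) * (ENNReal.ofReal (((2:ℝ) ^ k) ^ e) *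
          ∫⁻ x in BB n, ENNReal.ofReal (aA n k η w x)) := by
        apply Finset.sum_le_sum
        intro k _
        have := h2 (aA n k η w) (aA_meas hw k η) (fun x => aA_nonneg k η x) k
        calc _ ≤ ENNReal.ofReal (a k) * (2 * (ENNReal.ofReal (C2 * ((2:ℝ) ^ k) ^ s) * ∫⁻ x in BB n, ENNReal.ofReal (aA n k η w x))) := by
              gcongr
          _ = ENNReal.ofReal (a k * (2 * (C2 * ((2:ℝ) ^ k) ^ s))) * ∫⁻ x in BB n, ENNReal.ofReal (aA n k η w x) := by
              rw [ENNReal.ofReal_mul (ha0 k), ENNReal.ofReal_mul (by norm_num : (0:ℝ) ≤ 2)]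
              simp only [ENNReal.ofReal_ofNat]
              ring
          _ = _ := by
              rw [← mul_assoc (ENNReal.ofReal (C4 * (2 * C2) * lam ^ (p - η))), ← ENNReal.ofReal_mul (by positivity)]
              congr 2
              simp only [ha]
              rw [lk_pow hl, show e = s * (p-1) + -β * (p - η) + s by rw [hee]; ring, Real.rpow_add (by positivity),
                Real.rpow_add (by positivity)]
              ring
    _ ≤ _ := by
        rw [← Finset.mul_sum]
        calc _ ≤ ENNReal.ofReal (C4 * (2 * C2) * lam ^ (p - η)) *
              (ENNReal.ofReal C3 * ∫⁻ x in BB n, ∫⁻ y in BB n, gk n η e w x y) := by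
              gcongr; exact h3 η e Λ w hη he hep hw hΛ N
          _ = _ := by
              rw [← mul_assoc, ← ENNReal.ofReal_mul (by positivity)]
              congr 2; ring

lemma wk_pt {n : ℕ} {w : En n → ℝ} {Λ : ℝ} (hw : Measurable w) (hΛ : ∀ x, |w x| ≤ Λ) (N : ℕ) (x : En n) {T η : ℝ}
    (hT : 0 < T) (hη : 1 ≤ η) :
    ENNReal.ofReal |w x - wk n N w x| ≤ ENNReal.ofReal T +
      ENNReal.ofReal (T ^ (1 - η)) * ∫⁻ y in BB n, ENNReal.ofReal (|w x - w y| ^ η * kP n N x y) := by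
  have hb : ∀ y, |w x - w y| ≤ 2 * Λ := fun y => by linarith [abs_sub (w x) (w y), hΛ x, hΛ y]
  have i1 : Integrable (fun y => |w x - w y| ^ η * kP n N x y) (volume.restrict (BB n)) := by
    refine (kP_int n N x).bdd_mul (c := (2 * Λ) ^ η) (Measurable.aestronglyMeasurable (by fun_prop)) ?_
    refine Filter.Eventually.of_forall fun y => ?_
    rw [Real.norm_eq_abs, abs_of_nonneg (by positivity)]
    exact Real.rpow_le_rpow (abs_nonneg _) (hb y) (by linarith)
  have i2 : Integrable (fun y => (w x - w y) * kP n N x y) (volume.restrict (BB n)) := by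
    refine (kP_int n N x).bdd_mul (c := 2 * Λ) (Measurable.aestronglyMeasurable (by fun_prop)) ?_
    exact Filter.Eventually.of_forall hb
  have e1 : w x - wk n N w x = ∫ y in BB n, (w x - w y) * kP n N x y := by
    unfold wk
    simp_rw [sub_mul]
    rw [integral_sub ((kP_int n N x).const_mul _) (wP_int hw hΛ N x), integral_const_mul, kP_one, mul_one]
  have h1 : |w x - wk n N w x| ≤ T + T ^ (1 - η) * ∫ y in BB n, |w x - w y| ^ η * kP n N x y := by
    rw [e1]
    refine abs_integral_le_integral_abs.trans ?_
    calc ∫ y in BB n, |(w x - w y) * kP n N x y| ≤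
          ∫ y in BB n, (T * kP n N x y + T ^ (1 - η) * (|w x - w y| ^ η * kP n N x y)) := by
          apply integral_mono i2.abs (((kP_int n N x).const_mul T).add (i1.const_mul _))
          intro y
          simp only [Pi.add_apply]
          rw [abs_mul, abs_of_nonneg (kP_nonneg n N x y), ← mul_assoc, ← add_mul]
          exact mul_le_mul_of_nonneg_right (young_split hT (abs_nonneg _) hη) (kP_nonneg _ _ _ _)
      _ = _ := by
          rw [integral_add ((kP_int n N x).const_mul T) (i1.const_mul _), integral_const_mul, integral_const_mul,
            kP_one, mul_one]
  refine (ENNReal.ofReal_le_ofReal h1).trans ?_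
  refine ENNReal.ofReal_add_le.trans ?_
  gcongr
  rw [ENNReal.ofReal_mul (by positivity)]
  gcongr
  rw [ofReal_integral_eq_lintegral_ofReal i1
    (Filter.Eventually.of_forall fun y => mul_nonneg (by positivity) (kP_nonneg _ _ _ _))]

lemma wk_rem (n : ℕ) (hn : 2 ≤ n) (p : ℝ) : ∃ C : ℝ, 0 < C ∧ ∀ (η e Λ T : ℝ) (w : En n → ℝ), 1 ≤ η → 0 ≤ e → e ≤ p →
    0 < T → Measurable w → (∀ x, |w x| ≤ Λ) → ∀ N : ℕ,
    ∫⁻ x in BB n, ENNReal.ofReal |w x - wk n N w x| ≤ ENNReal.ofReal (T * om n) +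
      ENNReal.ofReal (C * (T ^ (1 - η) * ((2:ℝ) ^ N) ^ (-e))) * ∫⁻ x in BB n, ∫⁻ y in BB n, gk n η e w x y := by
  obtain ⟨C1, hC1, h1⟩ := kP_upper n
  obtain ⟨C2, hC2, h2⟩ := exp_min n hn p
  refine ⟨C1 * C2, by positivity, fun η e Λ T w hη he hep hT hw hΛ N => ?_⟩
  have hpt : ∀ x ∈ BB n, ∀ y ∈ BB n, ENNReal.ofReal (|w x - w y| ^ η * kP n N x y) ≤
      ENNReal.ofReal (C1 * C2 * ((2:ℝ) ^ N) ^ (-e)) * gk n η e w x y := by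
    intro x hx y hy
    unfold gk
    rw [← ENNReal.ofReal_mul (by positivity)]
    apply ENNReal.ofReal_le_ofReal
    rcases eq_or_lt_of_le (norm_nonneg (x - y)) with h0 | h0
    · have : x = y := by rw [← sub_eq_zero, ← norm_eq_zero, ← h0]
      rw [this, sub_self, abs_zero, Real.zero_rpow (by linarith)]; simp
    set L := (2:ℝ) ^ N with hL
    have hL0 : 0 < L := by positivity
    set d := ‖x - y‖ with hd
    have g1 := h1 N x y hx hy
    rw [← hL, ← hd] at g1
    have g2 := h2 e (L * d) he hep (by positivity)
    have g3 : min (L * d) (1 / (L * d)) ≤ 1 := by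
      rcases le_total (L * d) 1 with h | h
      · exact (min_le_left _ _).trans h
      · exact (min_le_right _ _).trans (by rw [div_le_one (by positivity)]; exact h)
    have g4 : Real.exp (-(L * d)) ≤ Real.exp (-(L * d / 2)) := by
      apply Real.exp_le_exp.mpr
      have : 0 < L * d := by positivity
      linarith
    have g5 : (L * d) ^ ((n:ℝ) + e) * Real.exp (-(L * d)) ≤ C2 := by
      calc _ ≤ (L * d) ^ ((n:ℝ) + e) * Real.exp (-(L * d / 2)) := mul_le_mul_of_nonneg_left g4 (by positivity)
        _ ≤ C2 * min (L * d) (1 / (L * d)) := g2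
        _ ≤ C2 * 1 := mul_le_mul_of_nonneg_left g3 hC2.le
        _ = C2 := mul_one _
    have hdn : 0 < d ^ ((n:ℝ) + e) := by positivity
    rw [mul_div_assoc', le_div_iff₀ hdn]
    rw [Real.mul_rpow hL0.le h0.le, Real.rpow_add hL0] at g5
    have hLe : 0 < L ^ e := by positivity
    calc |w x - w y| ^ η * kP n N x y * d ^ ((n:ℝ) + e) ≤
          |w x - w y| ^ η * (C1 * L ^ (n:ℝ) * Real.exp (-(L * d))) * d ^ ((n:ℝ) + e) := by gcongr
      _ = |w x - w y| ^ η * C1 * L ^ (-e) * (L ^ (n:ℝ) * L ^ e * d ^ ((n:ℝ) + e) * Real.exp (-(L * d))) := by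
          rw [Real.rpow_neg hL0.le]; field_simp
      _ ≤ |w x - w y| ^ η * C1 * L ^ (-e) * C2 := mul_le_mul_of_nonneg_left g5 (by positivity)
      _ = _ := by ring
  have hin : ∀ x ∈ BB n, ENNReal.ofReal |w x - wk n N w x| ≤ ENNReal.ofReal T +
      ENNReal.ofReal (C1 * C2 * (T ^ (1 - η) * ((2:ℝ) ^ N) ^ (-e))) * ∫⁻ y in BB n, gk n η e w x y := by
    intro x hx
    refine (wk_pt hw hΛ N x hT hη).trans ?_
    refine add_le_add le_rfl ?_
    calc _ ≤ ENNReal.ofReal (T ^ (1 - η)) * ∫⁻ y in BB n, ENNReal.ofReal (C1 * C2 * ((2:ℝ) ^ N) ^ (-e)) * gk n η e w x y := by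
          exact mul_le_mul' le_rfl (setLIntegral_mono' measurableSet_ball (hpt x hx))
      _ = _ := by
          rw [lintegral_const_mul' _ _ ENNReal.ofReal_ne_top, ← mul_assoc, ← ENNReal.ofReal_mul (by positivity)]
          congr 2; ring
  refine (setLIntegral_mono' measurableSet_ball hin).trans ?_
  rw [lintegral_add_left measurable_const, lintegral_const_mul' _ _ ENNReal.ofReal_ne_top, setLIntegral_const,
    vol_ball n 0 one_pos, Real.one_rpow, mul_one, ← ENNReal.ofReal_mul hT.le]

lemma bad_part (n : ℕ) (hn : 2 ≤ n) (p : ℝ) : ∃ C : ℝ, 0 < C ∧ ∀ (η β e lam Λ : ℝ) (w : En n → ℝ), 1 ≤ η →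
    β * (η - 1) ≤ e → 0 ≤ e → e ≤ p →
    0 < lam → Measurable w → (∀ x, |w x| ≤ Λ) → ∀ N : ℕ,
    ∫⁻ x in BB n, ENNReal.ofReal |∑ k ∈ Finset.range N, dD n k w x - gv n N lam β η w x| ≤
      ENNReal.ofReal (C * lam ^ (1 - η)) * ∫⁻ x in BB n, ∫⁻ y in BB n, gk n η e w x y := by
  obtain ⟨C, hC, h⟩ := keyK n hn p
  refine ⟨2 * C, by positivity, fun η β e lam Λ w hη hβ he hep hl hw hΛ N => ?_⟩
  have hA := fun k => aA_meas hw k η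
  have hpt : ∀ x, ENNReal.ofReal |∑ k ∈ Finset.range N, dD n k w x - gv n N lam β η w x| ≤
      ∑ k ∈ Finset.range N, ENNReal.ofReal (2 * lam ^ (1 - η)) * (ENNReal.ofReal (((2:ℝ) ^ k) ^ e) * ENNReal.ofReal (aA n k η w x)) := by
    intro x
    have e1 : ∀ k, ENNReal.ofReal (2 * lam ^ (1 - η)) * (ENNReal.ofReal (((2:ℝ) ^ k) ^ e) * ENNReal.ofReal (aA n k η w x)) =
        ENNReal.ofReal (2 * lam ^ (1 - η) * (((2:ℝ) ^ k) ^ e * aA n k η w x)) := by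
      intro k
      rw [ENNReal.ofReal_mul (p := 2 * lam ^ (1 - η)) (by positivity), ENNReal.ofReal_mul (p := ((2:ℝ) ^ k) ^ e) (by positivity)]
    simp_rw [e1]
    rw [← ENNReal.ofReal_sum_of_nonneg (fun k _ => by have := aA_nonneg (w := w) k η x; positivity)]
    apply ENNReal.ofReal_le_ofReal
    unfold gv
    rw [← Finset.sum_sub_distrib]
    refine (Finset.abs_sum_le_sum_abs _ _).trans (Finset.sum_le_sum fun k _ => ?_)
    have hA0 := aA_nonneg (w := w) k η x
    obtain ⟨-, -, h3⟩ := cut_facts (lk_pos (β := β) hl k) hη hA0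
    have h4 := dD_le hw hΛ k x hη
    have hc : 0 ≤ 1 - ch n k lam β η w x := by linarith [ch_le_one (k := k) (β := β) (η := η) hl w x]
    calc |dD n k w x - dD n k w x * ch n k lam β η w x| = |dD n k w x| * (1 - ch n k lam β η w x) := by
          rw [← mul_one_sub, abs_mul, abs_of_nonneg hc]
      _ ≤ 2 * aA n k η w x ^ (1/η) * (1 - ch n k lam β η w x) := mul_le_mul_of_nonneg_right h4 hc
      _ = 2 * (aA n k η w x ^ (1/η) * (1 - ch n k lam β η w x)) := by ring
      _ ≤ 2 * (lk lam β k ^ (1 - η) * aA n k η w x) := mul_le_mul_of_nonneg_left h3 (by norm_num)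
      _ = 2 * lam ^ (1 - η) * (((2:ℝ) ^ k) ^ (β * (η - 1)) * aA n k η w x) := by
          rw [lk_pow hl, show -β * (1 - η) = β * (η - 1) by ring]; ring
      _ ≤ _ := by
          apply mul_le_mul_of_nonneg_left _ (by positivity)
          apply mul_le_mul_of_nonneg_right _ hA0
          exact Real.rpow_le_rpow_of_exponent_le (two_pow_ge k) hβ
  refine (lintegral_mono hpt).trans ?_
  rw [lintegral_finsetSum _ (fun k _ => by fun_prop)]
  have e2 : ∀ k, ∫⁻ x in BB n, ENNReal.ofReal (2 * lam ^ (1 - η)) * (ENNReal.ofReal (((2:ℝ) ^ k) ^ e) * ENNReal.ofReal (aA n k η w x)) =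
      ENNReal.ofReal (2 * lam ^ (1 - η)) * (ENNReal.ofReal (((2:ℝ) ^ k) ^ e) * ∫⁻ x in BB n, ENNReal.ofReal (aA n k η w x)) := by
    intro k
    rw [lintegral_const_mul' _ _ ENNReal.ofReal_ne_top, lintegral_const_mul' _ _ ENNReal.ofReal_ne_top]
  simp_rw [e2]
  rw [← Finset.mul_sum]
  calc _ ≤ ENNReal.ofReal (2 * lam ^ (1 - η)) * (ENNReal.ofReal C * ∫⁻ x in BB n, ∫⁻ y in BB n, gk n η e w x y) := by
        gcongr; exact h η e Λ w hη he hep hw hΛ N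
    _ = _ := by
        rw [← mul_assoc, ← ENNReal.ofReal_mul (by positivity)]; congr 2; ring

theorem good_part (n : ℕ) (hn : 2 ≤ n) {p s : ℝ} (hp : 2 ≤ p) (hs0 : 0 < s) (hs1 : s < 1) : ∃ C : ℝ, 0 < C ∧
    ∀ (η β e lam Λ Q : ℝ) (w : En n → ℝ), 1 ≤ η → η ≤ p → 0 < β → e = s * p - β * (p - η) → β * (η - 1) ≤ e →
    0 ≤ e → e ≤ p → 0 < lam → Measurable w → (∀ x, |w x| ≤ Λ) → ∫ y in BB n, w y = 0 → 0 < Q →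
    ∫⁻ x in BB n, ∫⁻ y in BB n, gk n η e w x y ≤ ENNReal.ofReal Q →
    ∃ v : En n → ℝ, Measurable v ∧ (∃ Λ', ∀ x, |v x| ≤ Λ') ∧
      ∫⁻ x in BB n, ∫⁻ y in BB n, gk n p (s * p) v x y ≤ ENNReal.ofReal (C * (lam ^ (p - η) * Q)) ∧
      ∫⁻ x in BB n, ENNReal.ofReal |w x - v x| ≤ ENNReal.ofReal (C * (lam ^ (1 - η) * Q)) := by
  obtain ⟨C1, hC1, h1⟩ := gv_energy n hn hp hs0 hs1
  obtain ⟨C2, hC2, h2⟩ := wk_rem n hn p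
  obtain ⟨C3, hC3, h3⟩ := bad_part n hn p
  have hom := om_pos n
  refine ⟨C1 + (1 + C2 + C3), by positivity, fun η β e lam Λ Q w hη hηp hβ hee hβe he hep hl hw hΛ hmean hQ hQ' => ?_⟩
  obtain ⟨N, hN⟩ : ∃ N : ℕ, lk lam β N * om n ≤ lam ^ (1 - η) * Q := by
    have ht : Filter.Tendsto (fun N : ℕ => lk lam β N * om n) Filter.atTop (nhds 0) := by
      have e1 : (fun N : ℕ => lk lam β N * om n) = fun N : ℕ => lam * om n * ((2:ℝ) ^ (-β)) ^ N := by
        ext N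
        unfold lk
        rw [← Real.rpow_natCast, ← Real.rpow_natCast, ← Real.rpow_mul (by norm_num), ← Real.rpow_mul (by norm_num),
          mul_comm (N:ℝ)]
        ring
      rw [e1, show (0:ℝ) = lam * om n * 0 by ring]
      apply Filter.Tendsto.const_mul
      exact tendsto_pow_atTop_nhds_zero_of_lt_one (by positivity) (Real.rpow_lt_one_of_one_lt_of_neg (by norm_num) (by linarith))
    have := (ht.eventually (gt_mem_nhds (show 0 < lam ^ (1 - η) * Q by positivity))).exists
    obtain ⟨N, hN⟩ := this
    exact ⟨N, hN.le⟩
  refine ⟨gv n N lam β η w, gv_meas hw N lam β η, ⟨_, gv_bdd hw hΛ N β η hl⟩, ?_, ?_⟩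
  · refine (h1 η β e lam Λ w hη hηp hee he hep hl hw hΛ N).trans ?_
    calc _ ≤ ENNReal.ofReal (C1 * lam ^ (p - η)) * ENNReal.ofReal Q := by gcongr
      _ = ENNReal.ofReal (C1 * (lam ^ (p - η) * Q)) := by
          rw [← ENNReal.ofReal_mul (by positivity)]; congr 1; ring
      _ ≤ _ := by
          apply ENNReal.ofReal_le_ofReal
          have : 0 < lam ^ (p - η) * Q := by positivity
          nlinarith
  · have hpt : ∀ x, ENNReal.ofReal |w x - gv n N lam β η w x| ≤ ENNReal.ofReal |w x - wk n N w x| +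
        ENNReal.ofReal |∑ k ∈ Finset.range N, dD n k w x - gv n N lam β η w x| := by
      intro x
      rw [sum_dD hw hΛ hmean N x, ← ENNReal.ofReal_add (abs_nonneg _) (abs_nonneg _)]
      exact ENNReal.ofReal_le_ofReal (abs_sub_le _ _ _)
    have hm1 : Measurable (fun x => ENNReal.ofReal |∑ k ∈ Finset.range N, dD n k w x - gv n N lam β η w x|) := by
      have h1 := fun k => dD_meas hw k
      have h2 := gv_meas hw N lam β η
      fun_prop
    refine (lintegral_mono hpt).trans ?_
    rw [lintegral_add_right _ hm1]
    have g1 := h2 η e Λ (lk lam β N) w hη he hep (lk_pos hl N) hw hΛ N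
    have g2 := h3 η β e lam Λ w hη hβe he hep hl hw hΛ N
    have hlp := lk_pos (β := β) hl N
    have g3 : lk lam β N ^ (1 - η) * ((2:ℝ) ^ N) ^ (-e) ≤ lam ^ (1 - η) := by
      rw [lk_pow hl, mul_assoc, ← Real.rpow_add (by positivity)]
      have : ((2:ℝ) ^ N) ^ (-β * (1 - η) + -e) ≤ 1 := Real.rpow_le_one_of_one_le_of_nonpos (two_pow_ge N) (by nlinarith)
      have h5 : 0 < lam ^ (1 - η) := by positivity
      nlinarith
    calc _ ≤ (ENNReal.ofReal (lam ^ (1 - η) * Q) + ENNReal.ofReal (C2 * lam ^ (1 - η)) * ENNReal.ofReal Q) +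
          ENNReal.ofReal (C3 * lam ^ (1 - η)) * ENNReal.ofReal Q := by
          refine add_le_add (g1.trans (add_le_add (ENNReal.ofReal_le_ofReal hN) (mul_le_mul' (ENNReal.ofReal_le_ofReal ?_) hQ')))
            (g2.trans (by gcongr))
          exact mul_le_mul_of_nonneg_left g3 hC2.le
      _ = ENNReal.ofReal (lam ^ (1 - η) * Q + C2 * lam ^ (1 - η) * Q + C3 * lam ^ (1 - η) * Q) := by
          rw [← ENNReal.ofReal_mul (by positivity), ← ENNReal.ofReal_mul (by positivity), ← ENNReal.ofReal_add (by positivity) (by positivity),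
            ← ENNReal.ofReal_add (by positivity) (by positivity)]
      _ ≤ _ := by
          apply ENNReal.ofReal_le_ofReal
          have : 0 < lam ^ (1 - η) * Q := by positivity
          nlinarith

theorem shift_cont {E X : Type*} [TopologicalSpace E]
    [NormedAddCommGroup X] [NormedSpace ℝ X] [FiniteDimensional ℝ X]
    [MeasurableSpace X] [BorelSpace X] (μ : Measure X) [μ.IsAddHaarMeasure]
    {ι : E → X} (hι : Continuous ι) {P P' : ℝ≥0∞} [Fact (1 ≤ P)] [Fact (1 ≤ P')]
    [hPP : P'.HolderTriple P 1]
    (hP : P ≠ ⊤) {V D : X → ℝ} (hV : MemLp V P' μ) (hD : MemLp D P μ) :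
    Continuous (fun h => ∫ z, V z * D (z - ι h) ∂μ) := by
  have hmp : ∀ h : E, MeasurePreserving (fun z => z - ι h) μ μ :=
    fun h => measurePreserving_sub_right μ (ι h)
  let g : E → C(X, X) := fun h => ⟨fun z => z - ι h, by fun_prop⟩
  have hg : Continuous g := by
    refine ContinuousMap.continuous_of_continuous_uncurry _ ?_
    change Continuous (fun a : E × X => a.2 - ι a.1)
    fun_prop
  have hc := Continuous.compMeasurePreservingLp (f := fun _ : E => hD.toLp D) (μ := μ) (g := g)
    continuous_const hg hmp hP
  have h2 := (((ContinuousLinearMap.mul ℝ ℝ).lpPairing μ P' P) (hV.toLp V)).continuous.comp hc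
  refine h2.congr fun h => ?_
  simp only [Function.comp_apply]
  rw [ContinuousLinearMap.lpPairing_eq_integral]
  refine integral_congr_ae ?_
  have e1 := hV.coeFn_toLp
  have e2 : (Lp.compMeasurePreserving (g h) (hmp h) (hD.toLp D)) =ᵐ[μ] fun z => D (z - ι h) := by
    rw [Lp.toLp_compMeasurePreserving]
    exact (hD.comp_measurePreserving (hmp h)).coeFn_toLp
  filter_upwards [e1, e2] with z h1 h2
  rw [h1, h2]; rfl

theorem shift_fubini {E X : Type*} [NormedAddCommGroup E] [NormedSpace ℝ E] [FiniteDimensional ℝ E]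
    [MeasurableSpace E] [BorelSpace E] (m : Measure E) [m.IsAddHaarMeasure]
    [NormedAddCommGroup X] [NormedSpace ℝ X] [FiniteDimensional ℝ X]
    [MeasurableSpace X] [BorelSpace X] (μ : Measure X) [μ.IsAddHaarMeasure]
    {ι : E → X} (hι : Continuous ι) {P P' : ℝ≥0∞} [Fact (1 ≤ P)] [Fact (1 ≤ P')]
    [hPP : P'.HolderTriple P 1]
    (hP : P ≠ ⊤) {V D : X → ℝ} (hVm : Measurable V) (hDm : Measurable D)
    (hV : MemLp V P' μ) (hD : MemLp D P μ)
    {ρ : E → ℝ} (hρ : Continuous ρ) (hρc : HasCompactSupport ρ) :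
    ∫ h, ρ h * ∫ z, V z * D (z - ι h) ∂μ ∂m = ∫ z, V z * ∫ h, ρ h * D (z - ι h) ∂m ∂μ := by
  have hmp : ∀ h : E, MeasurePreserving (fun z => z - ι h) μ μ :=
    fun h => measurePreserving_sub_right μ (ι h)
  have hi : ∀ h, Integrable (fun z => V z * D (z - ι h)) μ := fun h =>
    MemLp.integrable_mul hV (hD.comp_measurePreserving (hmp h))
  have hcn := shift_cont μ hι (P := P) (P' := P') hP hV.norm hD.norm
  have hm : Measurable (Function.uncurry fun (h : E) (z : X) => ρ h * (V z * D (z - ι h))) := by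
    have h1 : Measurable fun w : E × X => w.2 - ι w.1 :=
      measurable_snd.sub (hι.measurable.comp measurable_fst)
    exact (hρ.measurable.comp measurable_fst).mul
      ((hVm.comp measurable_snd).mul (hDm.comp h1))
  have hIntg : Integrable (Function.uncurry fun (h : E) (z : X) => ρ h * (V z * D (z - ι h)))
      (m.prod μ) := by
    rw [integrable_prod_iff hm.aestronglyMeasurable]
    refine ⟨Filter.Eventually.of_forall fun h => ((hi h).const_mul (ρ h)), ?_⟩
    have hcc : Continuous fun h => |ρ h| * ∫ z, ‖V z‖ * ‖D (z - ι h)‖ ∂μ := hρ.abs.mul hcn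
    have hsup : HasCompactSupport fun h => |ρ h| * ∫ z, ‖V z‖ * ‖D (z - ι h)‖ ∂μ := by
      refine HasCompactSupport.mul_right ?_
      exact hρc.comp_left (g := fun x : ℝ => |x|) abs_zero
    refine (hcc.integrable_of_hasCompactSupport hsup).congr ?_
    refine Filter.Eventually.of_forall fun h => ?_
    simp only [Function.uncurry, norm_mul]
    rw [integral_const_mul]; rfl
  have := integral_integral_swap hIntg
  simp only [integral_const_mul] at this
  rw [this]
  refine integral_congr_ae (Filter.Eventually.of_forall fun z => ?_)
  simp only
  rw [← integral_const_mul]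
  congr 1; ext h; ring

/-- The unified weak form integrand. -/
def Fi (n : ℕ) (p s : ℝ) (K : En n × En n → ℝ) (u φ : En n → ℝ) (z : En n × En n) : ℝ :=
  K z * (|u z.1 - u z.2| ^ (p - 2) * (u z.1 - u z.2)) * (φ z.1 - φ z.2)
    / ‖z.1 - z.2‖ ^ ((n : ℝ) + s * p)

/-- Kernel bound. -/
def kap (p s b K0 d : ℝ) : ℝ := K0 * max 1 (d ^ (s * p - b))

structure Adm (n : ℕ) (p s b K0 : ℝ) (K : En n × En n → ℝ) (u f : En n → ℝ) : Prop where
  Km : Measurable K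
  K01 : 1 ≤ K0
  K1 : ∀ z, 1 ≤ K z
  K2 : ∀ z, K z ≤ kap p s b K0 ‖z.1 - z.2‖
  um : Measurable u
  ub : ∃ Λ, ∀ x, |u x| ≤ Λ
  fm : Measurable f
  en : ∫⁻ z : En n × En n, ENNReal.ofReal
    (K z * |u z.1 - u z.2| ^ p / ‖z.1 - z.2‖ ^ ((n : ℝ) + s * p)) < ⊤
  fl : ∫⁻ x in BB n, ENNReal.ofReal (|f x| ^ pStar n p s) < ⊤
  weak : ∀ φ : En n → ℝ, ContDiff ℝ (⊤ : ℕ∞) φ → HasCompactSupport φ →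
    ∫ z, Fi n p s K u φ z = ∫ x, f x * φ x

theorem memLp_of_lint {X : Type*} [MeasurableSpace X] {μ : Measure X} {g : X → ℝ}
    (hg : Measurable g) {r : ℝ} (hr : 0 < r) (h : ∫⁻ x, ENNReal.ofReal (|g x| ^ r) ∂μ < ⊤) :
    MemLp g (ENNReal.ofReal r) μ := by
  refine ⟨hg.aestronglyMeasurable, ?_⟩
  rw [eLpNorm_lt_top_iff_lintegral_rpow_enorm_lt_top (by simpa using hr) (by simp),
    ENNReal.toReal_ofReal hr.le]
  convert h using 3 with x
  rw [← ENNReal.ofReal_rpow_of_nonneg (abs_nonneg _) hr.le, ← Real.enorm_eq_ofReal_abs]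

theorem kap_ge (p s b K0 d : ℝ) (h : 1 ≤ K0) : 1 ≤ kap p s b K0 d := by
  unfold kap
  have : (1:ℝ) ≤ max 1 (d ^ (s * p - b)) := le_max_left _ _
  nlinarith

theorem kap_tail {n : ℕ} {p s b K0 d : ℝ} (hK : 1 ≤ K0) (hb : 0 < b) (hbs : b ≤ s * p) (hd : 1/2 ≤ d) :
    kap p s b K0 d / d ^ ((n:ℝ) + s * p) ≤ K0 * 2 ^ (s * p) * d ^ (-b - n) := by
  have hd0 : 0 < d := by linarith
  unfold kap
  have e1 : d ^ ((n:ℝ) + s * p) = d ^ (s * p - b) / d ^ (-b - n) := by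
    rw [← Real.rpow_sub hd0]; congr 1; ring
  have hA := Real.rpow_pos_of_pos hd0 (s*p-b)
  have hB := Real.rpow_pos_of_pos hd0 (-b-n)
  have h1 : 1 ≤ d ^ (s*p-b) * 2 ^ (s*p) := by
    calc (1:ℝ) = (1/2:ℝ)^(s*p-b) * 2^(s*p-b) := by
          rw [← Real.mul_rpow (by norm_num) (by norm_num)]; norm_num
      _ ≤ d ^ (s*p-b) * 2 ^ (s*p) := by
          gcongr
          · norm_num
          · linarith
  have h2 : (1:ℝ) ≤ 2^(s*p) := Real.one_le_rpow (by norm_num) (by linarith)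
  have h3 : max 1 (d ^ (s * p - b)) ≤ d ^ (s*p-b) * 2 ^ (s*p) := max_le h1 (by nlinarith)
  rw [e1]
  calc K0 * max 1 (d ^ (s * p - b)) / (d ^ (s * p - b) / d ^ (-b - n))
      ≤ K0 * (d ^ (s*p-b) * 2 ^ (s*p)) / (d ^ (s * p - b) / d ^ (-b - n)) := by gcongr
    _ = _ := by field_simp

theorem alg1 {k a kp d N p c : ℝ} (hp : 0 < p) (hd : 0 < d) (hk : 0 < kp) :
    (k * a * kp ^ (-(1/p)) / d ^ (N * (1 - 1/p))) * (kp ^ (1/p) * c / d ^ (N/p))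
      = k * a * c / d ^ N := by
  have e : d ^ N = d ^ (N * (1 - 1/p)) * d ^ (N/p) := by
    rw [← Real.rpow_add hd]; congr 1; field_simp; ring
  have e2 : kp ^ (-(1/p)) * kp ^ (1/p) = 1 := by rw [← Real.rpow_add hk]; simp
  have h1 := Real.rpow_pos_of_pos hd (N * (1 - 1/p))
  have h2 := Real.rpow_pos_of_pos hd (N/p)
  rw [e]
  field_simp
  linear_combination (k * a * c) * e2

theorem alg2 {k τ kp d N p : ℝ} (hp : 2 ≤ p) (hd : 0 ≤ d) (hk1 : 1 ≤ k) (hk : k ≤ kp)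
    (hτ : 0 ≤ τ) :
    (k * τ ^ (p-1) * kp ^ (-(1/p)) / d ^ (N * (1 - 1/p))) ^ (p/(p-1)) ≤ k * τ ^ p / d ^ N := by
  have hp1 : 0 < p - 1 := by linarith
  have hk0 : 0 < k := by linarith
  have hkp : 0 < kp := by linarith
  rw [Real.div_rpow (by positivity) (by positivity), Real.mul_rpow (by positivity) (by positivity),
    Real.mul_rpow (by positivity) (by positivity), ← Real.rpow_mul hτ, ← Real.rpow_mul hkp.le,
    ← Real.rpow_mul hd]
  have e1 : (p-1)*(p/(p-1)) = p := by field_simp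
  have e2 : N * (1-1/p) * (p/(p-1)) = N := by field_simp
  have e3 : -(1/p)*(p/(p-1)) = -(1/(p-1)) := by field_simp
  have e4 : k ^ (p/(p-1)) = k * k ^ (1/(p-1)) := by
    nth_rewrite 2 [← Real.rpow_one k]
    rw [← Real.rpow_add hk0]; congr 1; field_simp; ring
  rw [e1, e2, e3, e4, Real.rpow_neg hkp.le]
  have h5 : k ^ (1/(p-1)) ≤ kp ^ (1/(p-1)) := Real.rpow_le_rpow hk0.le hk (by positivity)
  have h6 := Real.rpow_pos_of_pos hkp (1/(p-1))
  refine div_le_div_of_nonneg_right ?_ (by positivity)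
  rw [← div_eq_mul_inv, div_le_iff₀ h6]
  have : 0 ≤ k * τ^p := by positivity
  nlinarith

theorem alg3 {kp d N p c : ℝ} (hp : 0 < p) (hd : 0 ≤ d) (hk : 0 ≤ kp) :
    |kp ^ (1/p) * c / d ^ (N/p)| ^ p = kp * |c| ^ p / d ^ N := by
  rw [abs_div, abs_mul, abs_of_nonneg (Real.rpow_nonneg hk _), abs_of_nonneg (Real.rpow_nonneg hd _),
    Real.div_rpow (by positivity) (by positivity), Real.mul_rpow (by positivity) (by positivity),
    ← Real.rpow_mul hk, ← Real.rpow_mul hd]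
  have e1 : 1/p*p = 1 := by field_simp
  have e2 : N/p*p = N := by field_simp
  rw [e1, e2, Real.rpow_one]

theorem abs_Phi {p τ : ℝ} (hp : 2 ≤ p) : |(|τ| ^ (p-2) * τ)| = |τ| ^ (p-1) := by
  rw [abs_mul, abs_of_nonneg (Real.rpow_nonneg (abs_nonneg _) _)]
  rcases eq_or_ne τ 0 with h | h
  · subst h; simp [show p - 1 ≠ 0 by intro h; linarith]
  · have : 0 < |τ| := abs_pos.2 h
    nth_rewrite 2 [← Real.rpow_one |τ|]
    rw [← Real.rpow_add this]; congr 1; ring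

/-- `D ∈ L^p`. -/
theorem D_fin (n : ℕ) (hn : 2 ≤ n) {p s b K0 : ℝ} (hp : 2 ≤ p) (hK : 1 ≤ K0) (hb : 0 < b)
    (hbs : b ≤ s * p) {φ : En n → ℝ} (hφ : Measurable φ) {Λ : ℝ} (hΛ : ∀ x, |φ x| ≤ Λ)
    (h0 : ∀ x, x ∉ ball (0:En n) (1/2) → φ x = 0)
    (hfin : ∫⁻ x in BB n, ∫⁻ y in BB n, gk n p (s*p) φ x y < ⊤) :
    ∫⁻ z : En n × En n, ENNReal.ofReal (kap p s b K0 ‖z.1 - z.2‖ * |φ z.1 - φ z.2| ^ p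
      / ‖z.1 - z.2‖ ^ ((n : ℝ) + s * p)) < ⊤ := by
  have hΛ0 : 0 ≤ Λ := (abs_nonneg _).trans (hΛ 0)
  set c1 := K0 * 2 ^ (s*p) with hc1
  set T : En n → En n → ℝ≥0∞ := fun x y =>
    (Ici (1/2:ℝ)).indicator (fun ρ => ENNReal.ofReal (ρ^(-b-n))) ‖x - y‖ with hT
  have hind : Measurable ((Ici (1/2:ℝ)).indicator (fun ρ => ENNReal.ofReal (ρ^(-b-n)))) := by
    refine Measurable.indicator ?_ measurableSet_Ici
    fun_prop
  have hTm : Measurable (fun z : En n × En n => T z.1 z.2) :=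
    hind.comp (measurable_fst.sub measurable_snd).norm
  set g : En n × En n → ℝ≥0∞ := fun z => (BB n ×ˢ BB n).indicator
    (fun z => gk n p (s*p) φ z.1 z.2) z with hg
  set χ : En n → ℝ≥0∞ := (ball (0:En n) (1/2)).indicator (fun _ => ENNReal.ofReal (c1 * Λ^p)) with hχ
  have hχm : Measurable χ := measurable_const.indicator measurableSet_ball
  have hBBm : MeasurableSet (BB n) := measurableSet_ball
  have hgm : Measurable g := (gk_meas n p (s*p) hφ).indicator (hBBm.prod hBBm)
  have hpt : ∀ z : En n × En n, ENNReal.ofReal (kap p s b K0 ‖z.1 - z.2‖ * |φ z.1 - φ z.2| ^ p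
      / ‖z.1 - z.2‖ ^ ((n : ℝ) + s * p)) ≤ ENNReal.ofReal (K0 * 2 ^ (s*p)) * g z
        + (χ z.1 * T z.1 z.2 + χ z.2 * T z.1 z.2) := by
    rintro ⟨x, y⟩
    simp only [hg]
    by_cases hxy : (x, y) ∈ BB n ×ˢ BB n
    · rw [indicator_of_mem hxy]
      refine le_trans ?_ le_self_add
      unfold gk
      rw [← ENNReal.ofReal_mul (by positivity)]
      refine ENNReal.ofReal_le_ofReal ?_
      have hd : ‖x - y‖ ≤ 2 := by
        have h1 : ‖x‖ < 1 := by simpa using hxy.1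
        have h2 : ‖y‖ < 1 := by simpa using hxy.2
        exact (norm_sub_le _ _).trans (by linarith)
      have h2 : (1:ℝ) ≤ 2^(s*p) := Real.one_le_rpow (by norm_num) (by linarith)
      have hk : kap p s b K0 ‖x-y‖ ≤ K0 * 2 ^ (s*p) := by
        unfold kap
        refine mul_le_mul_of_nonneg_left (max_le h2 ?_) (by linarith)
        refine (Real.rpow_le_rpow (norm_nonneg _) hd (by linarith)).trans ?_
        exact Real.rpow_le_rpow_of_exponent_le (by norm_num) (by linarith)
      rw [mul_div_assoc]
      exact mul_le_mul_of_nonneg_right hk (by positivity)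
    · rw [indicator_of_notMem hxy, mul_zero, zero_add]
      have key : ∀ a b' : En n, a ∈ ball (0:En n) (1/2) → b' ∉ BB n → ‖a-b'‖ = ‖x-y‖ →
          |φ x - φ y| ≤ Λ →
          ENNReal.ofReal (kap p s b K0 ‖x - y‖ * |φ x - φ y| ^ p
            / ‖x - y‖ ^ ((n : ℝ) + s * p)) ≤ χ a * T x y := by
        intro a b' ha hb' hab hle
        have hd : 1/2 ≤ ‖x-y‖ := by
          rw [← hab]
          have h1 : ‖a‖ < 1/2 := by simpa using ha
          have h2 : 1 ≤ ‖b'‖ := by simpa using hb'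
          have := norm_sub_norm_le b' a
          rw [norm_sub_rev] at this
          linarith
        rw [hχ, indicator_of_mem ha]
        simp only [hT]
        rw [indicator_of_mem (show ‖x-y‖ ∈ Ici (1/2:ℝ) from hd),
          ← ENNReal.ofReal_mul (by positivity)]
        refine ENNReal.ofReal_le_ofReal ?_
        have h1 := kap_tail (n := n) hK hb hbs hd
        have h2 : |φ x - φ y| ^ p ≤ Λ ^ p := Real.rpow_le_rpow (abs_nonneg _) hle (by linarith)
        have h3 : 0 ≤ kap p s b K0 ‖x-y‖ := by linarith [kap_ge p s b K0 ‖x-y‖ hK]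
        calc _ = (kap p s b K0 ‖x - y‖ / ‖x - y‖ ^ ((n : ℝ) + s * p)) * |φ x - φ y| ^ p := by ring
          _ ≤ (c1 * ‖x-y‖ ^ (-b-n)) * Λ ^ p := by
              apply mul_le_mul h1 h2 (by positivity) (by positivity)
          _ = _ := by ring
      by_cases hx : x ∈ BB n
      · have hy : y ∉ BB n := fun hy => hxy ⟨hx, hy⟩
        have hφy : φ y = 0 := h0 y fun h => hy (ball_subset_ball (by norm_num) h)
        by_cases hx2 : x ∈ ball (0:En n) (1/2)
        · exact (key x y hx2 hy rfl (by rw [hφy, sub_zero]; exact hΛ x)).trans le_self_add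
        · rw [h0 x hx2, hφy]; simp [show p ≠ 0 by intro h; linarith]
      · have hφx : φ x = 0 := h0 x fun h => hx (ball_subset_ball (by norm_num) h)
        by_cases hy2 : y ∈ ball (0:En n) (1/2)
        · exact (key y x hy2 hx (norm_sub_rev _ _)
            (by rw [hφx, zero_sub, abs_neg]; exact hΛ y)).trans le_add_self
        · rw [h0 y hy2, hφx]; simp [show p ≠ 0 by intro h; linarith]
  have hI1 : ∫⁻ z, g z < ⊤ := by
    simp only [hg]
    rw [lintegral_indicator (hBBm.prod hBBm), Measure.volume_eq_prod,
      setLIntegral_prod _ (by rw [← Measure.volume_eq_prod]; exact (gk_meas n p (s*p) hφ).aemeasurable)]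
    exact hfin
  have hχI : ∫⁻ x, χ x < ⊤ := by
    rw [hχ, lintegral_indicator measurableSet_ball, setLIntegral_const]
    exact ENNReal.mul_lt_top ENNReal.ofReal_lt_top measure_ball_lt_top
  have hTI : ∀ x, ∫⁻ y, T x y = ENNReal.ofReal (n * om n * ((1/2)^(-b)/b)) := by
    intro x
    simp only [hT]
    rw [lint_shift n x, lint_compl_rpow n hn (by norm_num) hb]
  have hTI2 : ∀ y, ∫⁻ x, T x y = ENNReal.ofReal (n * om n * ((1/2)^(-b)/b)) := by
    intro y
    rw [← hTI y]
    refine lintegral_congr fun x => ?_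
    simp only [hT]; rw [norm_sub_rev]
  have hm2 : Measurable (fun z : En n × En n => χ z.1 * T z.1 z.2) :=
    (hχm.comp measurable_fst).mul hTm
  have hm3 : Measurable (fun z : En n × En n => χ z.2 * T z.1 z.2) :=
    (hχm.comp measurable_snd).mul hTm
  have hI2 : ∫⁻ z : En n × En n, χ z.1 * T z.1 z.2 < ⊤ := by
    rw [Measure.volume_eq_prod, lintegral_prod _ hm2.aemeasurable]
    calc ∫⁻ x, ∫⁻ y, χ x * T x y = ∫⁻ x, χ x * ENNReal.ofReal (n * om n * ((1/2)^(-b)/b)) := by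
          refine lintegral_congr fun x => ?_
          rw [lintegral_const_mul _ (hTm.of_uncurry_left (x := x)), hTI]
      _ < ⊤ := by
          rw [lintegral_mul_const _ hχm]
          exact ENNReal.mul_lt_top hχI ENNReal.ofReal_lt_top
  have hI3 : ∫⁻ z : En n × En n, χ z.2 * T z.1 z.2 < ⊤ := by
    rw [Measure.volume_eq_prod, lintegral_prod_symm _ hm3.aemeasurable]
    calc ∫⁻ y, ∫⁻ x, χ y * T x y = ∫⁻ y, χ y * ENNReal.ofReal (n * om n * ((1/2)^(-b)/b)) := by
          refine lintegral_congr fun y => ?_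
          rw [lintegral_const_mul _ (hTm.of_uncurry_right (y := y)), hTI2]
      _ < ⊤ := by
          rw [lintegral_mul_const _ hχm]
          exact ENNReal.mul_lt_top hχI ENNReal.ofReal_lt_top
  refine (lintegral_mono hpt).trans_lt ?_
  rw [lintegral_add_left (hgm.const_mul _), lintegral_const_mul _ hgm,
    lintegral_add_left hm2]
  exact ENNReal.add_lt_top.2 ⟨ENNReal.mul_lt_top ENNReal.ofReal_lt_top hI1,
    ENNReal.add_lt_top.2 ⟨hI2, hI3⟩⟩

/-- The two factors. -/
def Vf (n : ℕ) (p s b K0 : ℝ) (K : En n × En n → ℝ) (u : En n → ℝ) (z : En n × En n) : ℝ :=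
  K z * (|u z.1 - u z.2| ^ (p - 2) * (u z.1 - u z.2)) * kap p s b K0 ‖z.1 - z.2‖ ^ (-(1/p))
    / ‖z.1 - z.2‖ ^ (((n : ℝ) + s * p) * (1 - 1/p))

def Df (n : ℕ) (p s b K0 : ℝ) (φ : En n → ℝ) (z : En n × En n) : ℝ :=
  kap p s b K0 ‖z.1 - z.2‖ ^ (1/p) * (φ z.1 - φ z.2) / ‖z.1 - z.2‖ ^ (((n : ℝ) + s * p)/p)

theorem Vf_meas (n : ℕ) (p s b K0 : ℝ) {K : En n × En n → ℝ} {u : En n → ℝ} (hK : Measurable K)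
    (hu : Measurable u) : Measurable (Vf n p s b K0 K u) := by
  unfold Vf kap; fun_prop

theorem Df_meas (n : ℕ) (p s b K0 : ℝ) {u : En n → ℝ}
    (hu : Measurable u) : Measurable (Df n p s b K0 u) := by
  unfold Df kap; fun_prop

theorem Vf_mul_Df (n : ℕ) {p s b K0 : ℝ} (hp : 2 ≤ p) (hK0 : 1 ≤ K0) (K : En n × En n → ℝ)
    (u φ : En n → ℝ)
    (z : En n × En n) : Vf n p s b K0 K u z * Df n p s b K0 φ z = Fi n p s K u φ z := by
  unfold Vf Df Fi
  rcases eq_or_ne z.1 z.2 with h | h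
  · simp [h]
  · have hd : 0 < ‖z.1 - z.2‖ := norm_pos_iff.2 (sub_ne_zero.2 h)
    exact alg1 (by linarith) hd (by linarith [kap_ge p s b K0 ‖z.1 - z.2‖ hK0])

theorem Vf_memLp (n : ℕ) {p s b K0 : ℝ} (hp : 2 ≤ p) {K : En n × En n → ℝ} {u f : En n → ℝ}
    (hA : Adm n p s b K0 K u f) :
    MemLp (Vf n p s b K0 K u) (ENNReal.ofReal (p/(p-1))) volume := by
  refine memLp_of_lint (Vf_meas n p s b K0 hA.Km hA.um) (div_pos (by linarith) (by linarith)) ?_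
  refine lt_of_le_of_lt (lintegral_mono fun z => ENNReal.ofReal_le_ofReal ?_) hA.en
  unfold Vf
  have hk := kap_ge p s b K0 ‖z.1 - z.2‖ hA.K01
  rw [abs_div, abs_mul, abs_mul, abs_Phi hp, abs_of_nonneg (by linarith [hA.K1 z] : 0 ≤ K z),
    abs_of_nonneg (Real.rpow_nonneg (by linarith) _),
    abs_of_nonneg (Real.rpow_nonneg (norm_nonneg _) _)]
  exact alg2 hp (norm_nonneg _) (hA.K1 z) (hA.K2 z) (abs_nonneg _)

theorem Df_memLp (n : ℕ) (hn : 2 ≤ n) {p s b K0 : ℝ} (hp : 2 ≤ p) (hK : 1 ≤ K0) (hb : 0 < b)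
    (hbs : b ≤ s * p) {φ : En n → ℝ} (hφ : Measurable φ) {Λ : ℝ} (hΛ : ∀ x, |φ x| ≤ Λ)
    (h0 : ∀ x, x ∉ ball (0:En n) (1/2) → φ x = 0)
    (hfin : ∫⁻ x in BB n, ∫⁻ y in BB n, gk n p (s*p) φ x y < ⊤) :
    MemLp (Df n p s b K0 φ) (ENNReal.ofReal p) volume := by
  refine memLp_of_lint (Df_meas n p s b K0 hφ) (by linarith) ?_
  refine lt_of_le_of_lt (lintegral_mono fun z => ENNReal.ofReal_le_ofReal ?_)
    (D_fin n hn hp hK hb hbs hφ hΛ h0 hfin)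
  unfold Df
  rw [alg3 (by linarith) (norm_nonneg _) (by linarith [kap_ge p s b K0 ‖z.1 - z.2‖ hK])]

theorem conv_exists (n : ℕ) {φ ρ : En n → ℝ} (hφ : Measurable φ) {Λ : ℝ} (hΛ : ∀ x, |φ x| ≤ Λ)
    (hρ : Continuous ρ) (hρc : HasCompactSupport ρ) (x : En n) :
    Integrable (fun h => ρ h * φ (x - h)) := by
  refine (hρ.integrable_of_hasCompactSupport hρc).mul_bdd
    (hφ.comp (measurable_const.sub measurable_id)).aestronglyMeasurable (c := Λ) ?_
  exact Filter.Eventually.of_forall fun h => hΛ _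

theorem Df_conv (n : ℕ) (p s b K0 : ℝ) {φ ρ : En n → ℝ} (hφ : Measurable φ) {Λ : ℝ}
    (hΛ : ∀ x, |φ x| ≤ Λ)
    (hρ : Continuous ρ) (hρc : HasCompactSupport ρ) (z : En n × En n) :
    ∫ h, ρ h * Df n p s b K0 φ (z - (h, h)) =
      Df n p s b K0 (fun x => ∫ h, ρ h * φ (x - h)) z := by
  unfold Df
  rw [← integral_sub (conv_exists n hφ hΛ hρ hρc _) (conv_exists n hφ hΛ hρ hρc _),
    ← integral_const_mul, ← integral_div]
  refine integral_congr_ae (Filter.Eventually.of_forall fun h => ?_)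
  simp only [Prod.fst_sub, Prod.snd_sub, sub_sub_sub_cancel_right]
  ring

theorem pStar_pos {n : ℕ} (hn : 2 ≤ n) {p s : ℝ} (hp : 2 ≤ p) (hs : 0 < s) : 0 < pStar n p s := by
  unfold pStar pC
  have : (0:ℝ) < n := by exact_mod_cast (by omega : 0 < n)
  have hp1 : 0 < p - 1 := by linarith
  have : 0 < p/(p-1) := by positivity
  positivity

theorem pStar_conj {n : ℕ} (hn : 2 ≤ n) {p s : ℝ} (hp : 2 ≤ p) (hs : 0 < s) (hsp : s * p < n) :
    (pStar n p s).HolderConjugate (n * p / (n - s * p)) := by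
  have hn0 : (0:ℝ) < n := by exact_mod_cast (by omega : 0 < n)
  have hp1 : 0 < p - 1 := by linarith
  have hd : 0 < n - s * p := by linarith
  refine Real.holderConjugate_iff.2 ⟨?_, ?_⟩
  · unfold pStar pC
    rw [lt_div_iff₀ (by positivity)]
    have : n + s * (p/(p-1)) = ((n:ℝ)*(p-1) + s*p)/(p-1) := by field_simp
    rw [one_mul, this, div_lt_iff₀ hp1]
    have : (n:ℝ) * (p/(p-1)) * (p-1) = n*p := by field_simp
    rw [this]; nlinarith
  · unfold pStar pC
    have : n + s * (p/(p-1)) = ((n:ℝ)*(p-1) + s*p)/(p-1) := by field_simp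
    have h3 : 0 < (n:ℝ)*(p-1) + s*p := by positivity
    rw [this, inv_div, inv_div]
    field_simp
    ring

theorem density (n : ℕ) (hn : 2 ≤ n) {p s b K0 : ℝ} (hp : 2 ≤ p) (hs : 0 < s) (hsp : s * p < n)
    (hb : 0 < b) (hbs : b ≤ s * p) {K : En n × En n → ℝ} {u f : En n → ℝ}
    (hA : Adm n p s b K0 K u f) {φ : En n → ℝ} (hφ : Measurable φ) {Λ : ℝ} (hΛ : ∀ x, |φ x| ≤ Λ)
    (h0 : ∀ x, x ∉ ball (0:En n) (1/2) → φ x = 0)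
    (hfin : ∫⁻ x in BB n, ∫⁻ y in BB n, gk n p (s*p) φ x y < ⊤) :
    Integrable (Fi n p s K u φ) ∧ ∫ z, Fi n p s K u φ z = ∫ x, f x * φ x := by
  have hn0 : (0:ℝ) < n := by exact_mod_cast (by omega : 0 < n)
  have hΛ0 : 0 ≤ Λ := (abs_nonneg _).trans (hΛ 0)
  have hV := Vf_memLp n hp hA
  have hD := Df_memLp n hn hp hA.K01 hb hbs hφ hΛ h0 hfin
  have hc1 : (p/(p-1)).HolderConjugate p := by
    have : p.HolderConjugate (p/(p-1)) := Real.HolderConjugate.conjExponent (by linarith)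
    exact this.symm
  have hc2 := pStar_conj hn hp hs hsp
  have i1 := hc1.ennrealOfReal
  have i2 := hc2.ennrealOfReal
  have j1 : Fact (1 ≤ ENNReal.ofReal p) := ⟨by simpa using hc1.symm.lt.le⟩
  have j2 : Fact (1 ≤ ENNReal.ofReal (p/(p-1))) := ⟨by rw [ENNReal.one_le_ofReal]; exact hc1.lt.le⟩
  have j3 : Fact (1 ≤ ENNReal.ofReal (pStar n p s)) := ⟨by simpa using hc2.lt.le⟩
  have j4 : Fact (1 ≤ ENNReal.ofReal (n * p / (n - s * p))) :=
    ⟨by rw [ENNReal.one_le_ofReal]; exact hc2.symm.lt.le⟩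
  have hIntg : Integrable (Fi n p s K u φ) := by
    have := MemLp.integrable_mul hV hD
    refine this.congr (Filter.Eventually.of_forall fun z => ?_)
    exact Vf_mul_Df n hp hA.K01 K u φ z
  refine ⟨hIntg, ?_⟩
  -- truncated data
  set f1 : En n → ℝ := (BB n).indicator f with hf1
  have hBBm : MeasurableSet (BB n) := measurableSet_ball
  have hf1m : Measurable f1 := hA.fm.indicator hBBm
  have hf1L : MemLp f1 (ENNReal.ofReal (pStar n p s)) volume := by
    refine memLp_of_lint hf1m (pStar_pos hn hp hs) ?_
    refine lt_of_eq_of_lt ?_ hA.fl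
    rw [← lintegral_indicator hBBm]
    refine lintegral_congr fun x => ?_
    by_cases hx : x ∈ BB n
    · simp only [hf1, indicator_of_mem hx]
    · simp only [hf1, indicator_of_notMem hx]
      simp [(pStar_pos hn hp hs).ne']
  have hφL : ∀ r : ℝ, 0 < r → MemLp φ (ENNReal.ofReal r) volume := by
    intro r hr
    refine memLp_of_lint hφ hr ?_
    calc ∫⁻ x, ENNReal.ofReal (|φ x| ^ r)
        ≤ ∫⁻ x, (ball (0:En n) (1/2)).indicator (fun _ => ENNReal.ofReal (Λ ^ r)) x := by
          refine lintegral_mono fun x => ?_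
          by_cases hx : x ∈ ball (0:En n) (1/2)
          · rw [indicator_of_mem hx]
            exact ENNReal.ofReal_le_ofReal (Real.rpow_le_rpow (abs_nonneg _) (hΛ x) hr.le)
          · rw [indicator_of_notMem hx, h0 x hx]; simp [hr.ne']
      _ < ⊤ := by
          rw [lintegral_indicator measurableSet_ball, setLIntegral_const]
          exact ENNReal.mul_lt_top ENNReal.ofReal_lt_top measure_ball_lt_top
  have hφP := hφL (n * p / (n - s * p)) hc2.symm.pos
  have hιc : Continuous (fun h : En n => (h, h)) := by fun_prop
  have : (volume : Measure (En n × En n)).IsAddHaarMeasure := by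
    rw [Measure.volume_eq_prod]; infer_instance
  have hL1 := shift_cont (volume : Measure (En n × En n)) hιc ENNReal.ofReal_ne_top hV hD
  have hL2 := shift_cont (volume : Measure (En n)) (continuous_id (X := En n))
    ENNReal.ofReal_ne_top hf1L hφP
  set L : En n → ℝ := fun h => (∫ z, Vf n p s b K0 K u z * Df n p s b K0 φ (z - (h, h)))
    - ∫ x, f1 x * φ (x - h) with hL
  have hLc : Continuous L := hL1.sub hL2
  have hzero : ∀ ρ : En n → ℝ, ContDiff ℝ (⊤ : ℕ∞) ρ → HasCompactSupport ρ →
      tsupport ρ ⊆ ball (0:En n) (1/2) → ∫ h, ρ h • L h = 0 := by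
    intro ρ hρ hρc hρs
    have hρ' : Continuous ρ := hρ.continuous
    set g : En n → ℝ := fun x => ∫ h, ρ h * φ (x - h) with hg
    have hφloc : LocallyIntegrable φ := by
      have : MemLp φ 1 volume := by simpa using hφL 1 one_pos
      exact (memLp_one_iff_integrable.1 this).locallyIntegrable
    have hφc : HasCompactSupport φ :=
      HasCompactSupport.intro (isCompact_closedBall (0:En n) (1/2)) fun x hx =>
        h0 x fun h => hx (ball_subset_closedBall h)
    have hgs : ContDiff ℝ (⊤ : ℕ∞) g :=
      hρc.contDiff_convolution_left (ContinuousLinearMap.mul ℝ ℝ) hρ hφloc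
    have hgc : HasCompactSupport g :=
      HasCompactSupport.convolution (ContinuousLinearMap.mul ℝ ℝ) (μ := volume) hρc hφc
    have hw := hA.weak g hgs hgc
    have e1 := shift_fubini (volume : Measure (En n)) (volume : Measure (En n × En n)) hιc
      ENNReal.ofReal_ne_top (Vf_meas n p s b K0 hA.Km hA.um) (Df_meas n p s b K0 hφ) hV hD hρ' hρc
    have e2 := shift_fubini (volume : Measure (En n)) (volume : Measure (En n))
      (continuous_id (X := En n))
      ENNReal.ofReal_ne_top hf1m hφ hf1L hφP hρ' hρc
    have e3 : ∫ z, Vf n p s b K0 K u z * ∫ h, ρ h * Df n p s b K0 φ (z - (h, h))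
        = ∫ z, Fi n p s K u g z := by
      refine integral_congr_ae (Filter.Eventually.of_forall fun z => ?_)
      simp only
      rw [Df_conv n p s b K0 hφ hΛ hρ' hρc]
      exact Vf_mul_Df n hp hA.K01 K u g z
    have e4 : ∫ x, f1 x * ∫ h, ρ h * φ (x - id h) = ∫ x, f x * g x := by
      refine integral_congr_ae (Filter.Eventually.of_forall fun x => ?_)
      simp only [id]
      by_cases hx : x ∈ BB n
      · simp only [hf1, indicator_of_mem hx, hg]
      · have : g x = 0 := by
          simp only [hg]
          refine integral_eq_zero_of_ae (Filter.Eventually.of_forall fun h => ?_)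
          simp only [Pi.zero_apply]
          by_cases hh : h ∈ ball (0:En n) (1/2)
          · rw [h0 (x-h), mul_zero]
            intro hxh
            apply hx
            have h1 : ‖h‖ < 1/2 := by simpa using hh
            have h2 : ‖x-h‖ < 1/2 := by simpa using hxh
            have h3 := norm_add_le (x-h) h
            rw [sub_add_cancel] at h3
            simp; linarith
          · rw [image_eq_zero_of_notMem_tsupport (fun h' => hh (hρs h')), zero_mul]
        rw [this]
        have : ∫ h, ρ h * φ (x - h) = 0 := this
        rw [this]; simp
    have hLs : ∀ {G : En n → ℝ}, Continuous G → Integrable (fun h => ρ h * G h) := by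
      intro G hG
      exact (hρ'.mul hG).integrable_of_hasCompactSupport hρc.mul_right
    calc ∫ h, ρ h • L h = ∫ h, (ρ h * (∫ z, Vf n p s b K0 K u z * Df n p s b K0 φ (z - (h, h)))
          - ρ h * ∫ x, f1 x * φ (x - id h)) := by
          refine integral_congr_ae (Filter.Eventually.of_forall fun h => ?_)
          simp only [hL, smul_eq_mul, id]; ring
      _ = 0 := by
          rw [integral_sub (hLs hL1) (hLs hL2), e1, e2, e3, e4, hw, sub_self]
  have hae := isOpen_ball.ae_eq_zero_of_integral_contDiff_smul_eq_zero
    (hLc.locallyIntegrable.locallyIntegrableOn (ball (0:En n) (1/2))) hzero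
  have hL0 : L 0 = 0 := by
    by_contra hne
    have hopen : IsOpen (ball (0:En n) (1/2) ∩ {x | L x ≠ 0}) :=
      isOpen_ball.inter (isOpen_ne_fun hLc continuous_const)
    have hpos := hopen.measure_pos volume ⟨0, by simp, hne⟩
    have hz : volume (ball (0:En n) (1/2) ∩ {x | L x ≠ 0}) = 0 := by
      rw [← nonpos_iff_eq_zero]
      refine (measure_mono ?_).trans (ae_iff.1 hae).le
      rintro x ⟨hx, hx2⟩ h
      exact hx2 (h hx)
    exact hpos.ne' hz
  simp only [hL] at hL0
  have e5 : ∫ z, Fi n p s K u φ z =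
      ∫ z, Vf n p s b K0 K u z * Df n p s b K0 φ (z - ((0:En n), (0:En n))) := by
    refine integral_congr_ae (Filter.Eventually.of_forall fun z => ?_)
    have : z - ((0:En n), (0:En n)) = z := by ext <;> simp
    simp only [this]
    exact (Vf_mul_Df n hp hA.K01 K u φ z).symm
  have e6 : ∫ x, f x * φ x = ∫ x, f1 x * φ (x - 0) := by
    refine integral_congr_ae (Filter.Eventually.of_forall fun x => ?_)
    simp only [sub_zero]
    by_cases hx : x ∈ BB n
    · simp only [hf1, indicator_of_mem hx]
    · rw [h0 x fun h => hx (ball_subset_ball (by norm_num) h)]; simp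
  rw [e5, e6]; linarith

theorem hardy_rec {r θ : ℝ} (hr : 1 ≤ r) (h0 : 0 < θ) (h1 : θ < 1) (x y : ℕ → ℝ)
    (hx : ∀ k, 0 ≤ x k) (hy : ∀ k, 0 ≤ y k) (hx0 : x 0 = y 0)
    (hrec : ∀ k, x (k+1) = θ * x k + y (k+1)) (N : ℕ) :
    ∑ k ∈ Finset.range N, x k ^ r ≤ (1-θ) ^ (-r) * ∑ k ∈ Finset.range N, y k ^ r := by
  have hθ : 0 < 1 - θ := by linarith
  have step : ∀ k, x (k+1) ^ r ≤ θ * x k ^ r + (1-θ) ^ (1-r) * y (k+1) ^ r := by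
    intro k
    have hc := (convexOn_rpow hr).2 (x := x k) (y := y (k+1) / (1-θ)) (hx k)
      (div_nonneg (hy _) hθ.le) h0.le hθ.le (by ring)
    simp only [smul_eq_mul] at hc
    rw [mul_div_cancel₀ _ hθ.ne', ← hrec, Real.div_rpow (hy _) hθ.le] at hc
    refine hc.trans_eq ?_
    rw [Real.rpow_sub hθ, Real.rpow_one]; ring
  have hc1 : 1 ≤ (1-θ) ^ (1-r) := Real.one_le_rpow_of_pos_of_le_one_of_nonpos hθ (by linarith) (by linarith)
  cases N with
  | zero => simp
  | succ N =>
    have h2 : ∑ k ∈ Finset.range (N+1), x k ^ r ≤ θ * ∑ k ∈ Finset.range (N+1), x k ^ r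
        + (1-θ) ^ (1-r) * ∑ k ∈ Finset.range (N+1), y k ^ r := by
      calc ∑ k ∈ Finset.range (N+1), x k ^ r
          = ∑ k ∈ Finset.range N, x (k+1) ^ r + x 0 ^ r := Finset.sum_range_succ' _ _
        _ ≤ ∑ k ∈ Finset.range N, (θ * x k ^ r + (1-θ) ^ (1-r) * y (k+1) ^ r)
            + (1-θ) ^ (1-r) * y 0 ^ r := by
            refine add_le_add (Finset.sum_le_sum fun k _ => step k) ?_
            rw [hx0]
            have : 0 ≤ y 0 ^ r := Real.rpow_nonneg (hy 0) _
            nlinarith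
        _ = θ * ∑ k ∈ Finset.range N, x k ^ r + (1-θ) ^ (1-r) * ∑ k ∈ Finset.range (N+1), y k ^ r := by
            rw [Finset.sum_range_succ' (fun k => y k ^ r), Finset.sum_add_distrib, Finset.mul_sum,
              mul_add, Finset.mul_sum]; ring
        _ ≤ _ := by
            rw [Finset.sum_range_succ (fun k => x k ^ r), mul_add]
            have : 0 ≤ x N ^ r := Real.rpow_nonneg (hx N) _
            have := mul_nonneg h0.le this
            linarith
    have e : (1-θ) ^ (-r) = (1-θ) ^ (1-r) / (1-θ) := by
      rw [Real.rpow_sub hθ, Real.rpow_one, Real.rpow_neg hθ.le]; field_simp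
    rw [e, div_mul_eq_mul_div, le_div_iff₀ hθ]
    linarith

theorem hardy {r b : ℝ} (hr : 1 ≤ r) (hb : 0 < b) : ∃ C : ℝ, 0 < C ∧ ∀ m : ℕ → ℝ, (∀ k, 0 ≤ m k) →
    ∀ N, ∑ k ∈ Finset.range N, (2:ℝ) ^ (-(k:ℝ) * b) * (∑ j ∈ Finset.range (k+1), m j) ^ r ≤
      C * ∑ k ∈ Finset.range N, (2:ℝ) ^ (-(k:ℝ) * b) * m k ^ r := by
  have hr0 : 0 < r := by linarith
  set θ : ℝ := 2 ^ (-(b/r)) with hθ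
  have h0 : 0 < θ := by positivity
  have h1 : θ < 1 := Real.rpow_lt_one_of_one_lt_of_neg (by norm_num) (by have := div_pos hb hr0; linarith)
  refine ⟨(1-θ)^(-r), Real.rpow_pos_of_pos (by linarith) _, fun m hm N => ?_⟩
  have e : ∀ (k : ℕ) (a : ℝ), 0 ≤ a → (2:ℝ) ^ (-(k:ℝ) * b) * a ^ r = (θ ^ k * a) ^ r := by
    intro k a ha
    rw [Real.mul_rpow (by positivity) ha, hθ, ← Real.rpow_natCast, ← Real.rpow_mul (by positivity),
      ← Real.rpow_mul (by positivity)]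
    congr 2; field_simp
  have hS : ∀ k, 0 ≤ ∑ j ∈ Finset.range (k+1), m j := fun k => Finset.sum_nonneg fun j _ => hm j
  rw [Finset.sum_congr rfl fun k _ => e k _ (hS k), Finset.sum_congr rfl fun k _ => e k _ (hm k)]
  refine hardy_rec hr h0 h1 (fun k => θ^k * ∑ j ∈ Finset.range (k+1), m j) (fun k => θ^k * m k) ?_ ?_ ?_ ?_ N
  · exact fun k => mul_nonneg (by positivity) (hS k)
  · exact fun k => mul_nonneg (by positivity) (hm k)
  · simp
  · intro k
    rw [Finset.sum_range_succ _ (k+1)]; ring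

theorem pow_int {X : Type*} [MeasurableSpace X] {μ : Measure X} {g : X → ℝ} (hg : Measurable g) {T r P : ℝ}
    (hT : 0 < T) (hr : 0 ≤ r) (hrP : r ≤ P)
    (h : ∫⁻ x, ENNReal.ofReal (|g x| ^ P) ∂μ ≤ ENNReal.ofReal (T ^ P) * μ univ) :
    ∫⁻ x, ENNReal.ofReal (|g x| ^ r) ∂μ ≤ ENNReal.ofReal (2 * T ^ r) * μ univ := by
  have hpt : ∀ x, ENNReal.ofReal (|g x| ^ r) ≤ ENNReal.ofReal (T ^ r)
      + ENNReal.ofReal (T ^ (r-P)) * ENNReal.ofReal (|g x| ^ P) := by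
    intro x
    rw [← ENNReal.ofReal_mul (by positivity), ← ENNReal.ofReal_add (by positivity) (by positivity)]
    refine ENNReal.ofReal_le_ofReal ?_
    rcases le_total |g x| T with h | h
    · have := Real.rpow_le_rpow (abs_nonneg _) h hr
      have h2 : 0 ≤ T ^ (r-P) * |g x| ^ P := by positivity
      linarith
    · have hg0 : 0 < |g x| := hT.trans_le h
      have : |g x| ^ r ≤ T ^ (r-P) * |g x| ^ P := by
        have e : |g x| ^ r = |g x| ^ (r-P) * |g x| ^ P := by rw [← Real.rpow_add hg0]; ring_nf
        rw [e]
        refine mul_le_mul_of_nonneg_right ?_ (by positivity)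
        exact Real.rpow_le_rpow_of_nonpos hT h (by linarith)
      have h2 : 0 ≤ T ^ r := by positivity
      linarith
  calc ∫⁻ x, ENNReal.ofReal (|g x| ^ r) ∂μ ≤ ∫⁻ x, (ENNReal.ofReal (T ^ r)
      + ENNReal.ofReal (T ^ (r-P)) * ENNReal.ofReal (|g x| ^ P)) ∂μ := lintegral_mono hpt
    _ = ENNReal.ofReal (T ^ r) * μ univ +
        ENNReal.ofReal (T ^ (r-P)) * ∫⁻ x, ENNReal.ofReal (|g x| ^ P) ∂μ := by
        rw [lintegral_add_left measurable_const, lintegral_const,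
          lintegral_const_mul _ (by fun_prop)]
    _ ≤ ENNReal.ofReal (T ^ r) * μ univ + ENNReal.ofReal (T ^ (r-P)) *
        (ENNReal.ofReal (T ^ P) * μ univ) := by
        exact add_le_add le_rfl (mul_le_mul' le_rfl h)
    _ = ENNReal.ofReal (2 * T ^ r) * μ univ := by
        rw [← mul_assoc (ENNReal.ofReal (T ^ (r-P))), ← ENNReal.ofReal_mul (by positivity),
          ← Real.rpow_add hT, sub_add_cancel, ← add_mul, ← ENNReal.ofReal_add (by positivity) (by positivity),
          two_mul]

theorem mean_const (n : ℕ) {w : En n → ℝ} (hw : Measurable w) {Λ : ℝ} (hΛ : ∀ x, |w x| ≤ Λ)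
    (x₀ : En n) {ρ : ℝ} (hρ : 0 < ρ) (c : ℝ) :
    ENNReal.ofReal |(⨍ y in ball x₀ ρ, w y) - c| * volume (ball x₀ ρ) ≤
      ∫⁻ y in ball x₀ ρ, ENNReal.ofReal |w y - c| := by
  have hfin : volume (ball x₀ ρ) ≠ ⊤ := measure_ball_lt_top.ne
  have hpos : 0 < volume.real (ball x₀ ρ) := by
    rw [measureReal_def]; exact ENNReal.toReal_pos (measure_ball_pos _ _ hρ).ne' hfin
  have hwi : IntegrableOn w (ball x₀ ρ) :=
    Measure.integrableOn_of_bounded hfin hw.aestronglyMeasurable (M := Λ)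
      (Filter.Eventually.of_forall hΛ)
  have e : ((⨍ y in ball x₀ ρ, w y) - c) * volume.real (ball x₀ ρ) = ∫ y in ball x₀ ρ, (w y - c) := by
    rw [integral_sub hwi (integrableOn_const hfin), setAverage_eq, setIntegral_const]
    simp only [smul_eq_mul]
    field_simp
  have h := enorm_integral_le_lintegral_enorm (μ := volume.restrict (ball x₀ ρ)) (fun y => w y - c)
  rw [← e, Real.enorm_eq_ofReal_abs, abs_mul, abs_of_pos hpos, ENNReal.ofReal_mul (abs_nonneg _),
    measureReal_def, ENNReal.ofReal_toReal hfin] at h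
  simpa only [Real.enorm_eq_ofReal_abs] using h

/-- dyadic ball -/
abbrev Bd (n : ℕ) (j : ℕ) : Set (En n) := ball (0 : En n) (2 ^ j)

/-- dyadic mean -/
def cj (n : ℕ) (u : En n → ℝ) (j : ℕ) : ℝ := ⨍ y in Bd n j, u y

theorem vol_Bd (n j : ℕ) : volume (Bd n j) = ENNReal.ofReal (om n * ((2:ℝ) ^ j) ^ n) := by
  rw [vol_ball n _ (by positivity), Real.rpow_natCast]

theorem cj_step (n : ℕ) {p : ℝ} (hp : 2 ≤ p) {u : En n → ℝ} (hu : Measurable u) {Λ : ℝ}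
    (hΛ : ∀ x, |u x| ≤ Λ) {m : ℕ → ℝ} (hm : ∀ j, 0 < m j)
    (hosc : ∀ j, ∫⁻ y in Bd n j, ENNReal.ofReal (|u y - cj n u j| ^ p) ≤
      ENNReal.ofReal (m j ^ p) * volume (Bd n j)) (j : ℕ) :
    |cj n u j - cj n u (j+1)| ≤ 2 ^ (n+1) * m (j+1) := by
  have hom := om_pos n
  have h1 := mean_const n hu hΛ 0 (ρ := 2^j) (by positivity) (cj n u (j+1))
  have h2 : ∫⁻ y in Bd n j, ENNReal.ofReal |u y - cj n u (j+1)| ≤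
      ∫⁻ y in Bd n (j+1), ENNReal.ofReal |u y - cj n u (j+1)| :=
    lintegral_mono_set (ball_subset_ball (pow_le_pow_right₀ (by norm_num) (by omega)))
  have h3 := pow_int (μ := volume.restrict (Bd n (j+1))) (g := fun y => u y - cj n u (j+1))
    (by fun_prop) (hm (j+1)) (r := 1) (P := p) (by norm_num) (by linarith)
    (by rw [Measure.restrict_apply_univ]; exact hosc (j+1))
  simp only [Real.rpow_one, Measure.restrict_apply_univ] at h3
  have h4 := (h1.trans h2).trans h3
  change ENNReal.ofReal |cj n u j - cj n u (j+1)| * volume (Bd n j) ≤ _ at h4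
  have hmj := hm (j+1)
  rw [vol_Bd, vol_Bd, ← ENNReal.ofReal_mul (abs_nonneg _), ← ENNReal.ofReal_mul (by positivity),
    ENNReal.ofReal_le_ofReal_iff (by positivity)] at h4
  have hV : 0 < om n * ((2:ℝ)^j)^n := by positivity
  refine le_of_mul_le_mul_right (h4.trans_eq ?_) hV
  rw [pow_succ, mul_pow]; ring

theorem cj_sum (n : ℕ) {p : ℝ} (hp : 2 ≤ p) {u : En n → ℝ} (hu : Measurable u) {Λ : ℝ}
    (hΛ : ∀ x, |u x| ≤ Λ) {m : ℕ → ℝ} (hm : ∀ j, 0 < m j)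
    (hosc : ∀ j, ∫⁻ y in Bd n j, ENNReal.ofReal (|u y - cj n u j| ^ p) ≤
      ENNReal.ofReal (m j ^ p) * volume (Bd n j)) (k : ℕ) :
    |cj n u k - cj n u 0| ≤ 2 ^ (n+1) * ∑ j ∈ Finset.range (k+1), m j := by
  induction k with
  | zero => 
    have := (hm 0).le
    simp; positivity
  | succ k ih =>
    have h1 := cj_step n hp hu hΛ hm hosc k
    rw [Finset.sum_range_succ, mul_add]
    have h2 := abs_sub_le (cj n u (k+1)) (cj n u k) (cj n u 0)
    rw [abs_sub_comm] at h1
    linarith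

theorem w_int (n : ℕ) {p r : ℝ} (hp : 2 ≤ p) (hr : 0 ≤ r) (hrp : r ≤ p) {u : En n → ℝ} (hu : Measurable u) {Λ : ℝ}
    (hΛ : ∀ x, |u x| ≤ Λ) {m : ℕ → ℝ} (hm : ∀ j, 0 < m j)
    (hosc : ∀ j, ∫⁻ y in Bd n j, ENNReal.ofReal (|u y - cj n u j| ^ p) ≤
      ENNReal.ofReal (m j ^ p) * volume (Bd n j)) (k : ℕ) :
    ∫⁻ y in Bd n k, ENNReal.ofReal (|u y - cj n u 0| ^ r) ≤
      ENNReal.ofReal (2^r*(2 + (2^(n+1))^r) * (∑ j ∈ Finset.range (k+1), m j) ^ r) * volume (Bd n k) := by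
  have hc := cj_sum n hp hu hΛ hm hosc k
  set S := ∑ j ∈ Finset.range (k+1), m j with hS
  have hS0 : 0 ≤ S := Finset.sum_nonneg fun j _ => (hm j).le
  have hmS : m k ≤ S := Finset.single_le_sum (f := m) (fun j _ => (hm j).le) (Finset.self_mem_range_succ k)
  have hmk := hm k
  have h3 := pow_int (μ := volume.restrict (Bd n k)) (g := fun y => u y - cj n u k)
    (by fun_prop) (hm k) hr hrp
    (by rw [Measure.restrict_apply_univ]; exact hosc k)
  rw [Measure.restrict_apply_univ] at h3
  have hpt : ∀ y, ENNReal.ofReal (|u y - cj n u 0| ^ r) ≤ ENNReal.ofReal (2^r) *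
      ENNReal.ofReal (|u y - cj n u k| ^ r) + ENNReal.ofReal (2^r * (2^(n+1)*S)^r) := by
    intro y
    rw [← ENNReal.ofReal_mul (by positivity), ← ENNReal.ofReal_add (by positivity) (by positivity), ← mul_add]
    refine ENNReal.ofReal_le_ofReal ?_
    refine (Real.rpow_le_rpow (abs_nonneg _) (abs_sub_le _ (cj n u k) _) hr).trans ?_
    refine (add_rpow_two (abs_nonneg _) (abs_nonneg _) hr).trans ?_
    gcongr
  refine (lintegral_mono hpt).trans ?_
  rw [lintegral_add_right _ measurable_const, lintegral_const_mul _ (by fun_prop), setLIntegral_const]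
  refine (add_le_add (mul_le_mul' le_rfl h3) le_rfl).trans ?_
  rw [← mul_assoc, ← ENNReal.ofReal_mul (by positivity), ← add_mul,
    ← ENNReal.ofReal_add (by positivity) (by positivity)]
  refine mul_le_mul' (ENNReal.ofReal_le_ofReal ?_) le_rfl
  rw [Real.mul_rpow (x := 2^(n+1)) (by positivity) hS0]
  have : m k ^ r ≤ S ^ r := Real.rpow_le_rpow hmk.le hmS hr
  have h2 : (0:ℝ) < 2^r := by positivity
  calc (2:ℝ)^r * (2 * m k ^ r) + 2^r * ((2^(n+1))^r * S^r)
      ≤ (2:ℝ)^r * (2 * S ^ r) + 2^r * ((2^(n+1))^r * S^r) := by gcongr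
    _ = _ := by ring

theorem far_int (n : ℕ) {p r b : ℝ} (hp : 2 ≤ p) (hr : 1 ≤ r) (hrp : r ≤ p) (hb : 0 < b) :
    ∃ C : ℝ, 0 < C ∧ ∀ (u : En n → ℝ) (Λ L : ℝ) (m : ℕ → ℝ), Measurable u →
    (∀ x, |u x| ≤ Λ) → (∀ j, 0 < m j) →
    (∀ j, ∫⁻ y in Bd n j, ENNReal.ofReal (|u y - cj n u j| ^ p) ≤
      ENNReal.ofReal (m j ^ p) * volume (Bd n j)) →
    (∀ N, ∑ k ∈ Finset.range N, (2:ℝ) ^ (-(k:ℝ) * b) * m k ^ r ≤ L) →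
    ∫⁻ y in (BB n)ᶜ, ENNReal.ofReal (‖y‖ ^ (-b - n) * |u y - cj n u 0| ^ r) ≤ ENNReal.ofReal (C * L) := by
  obtain ⟨CH, hCH, hH⟩ := hardy hr hb
  have hom := om_pos n
  set C1 : ℝ := 2^r*(2 + (2^(n+1))^r) with hC1
  have hC10 : 0 < C1 := by positivity
  refine ⟨C1 * om n * 2^n * 2^b * CH, by positivity, ?_⟩
  intro u Λ L m hu hΛ hm hosc hL
  have hcov : (BB n)ᶜ ⊆ ⋃ k : ℕ, (Bd n (k+1) \ Bd n k) := by
    intro y hy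
    have hy1 : 1 ≤ ‖y‖ := by simpa using hy
    have hex : ∃ k : ℕ, ‖y‖ < 2 ^ k := pow_unbounded_of_one_lt _ (by norm_num)
    classical
    have h1 := Nat.find_spec hex
    have h0 : Nat.find hex ≠ 0 := by
      intro h; rw [h] at h1; simp at h1; linarith
    obtain ⟨k, hk⟩ := Nat.exists_eq_succ_of_ne_zero h0
    refine mem_iUnion.2 ⟨k, ?_, ?_⟩
    · rw [hk] at h1; simpa using h1
    · have := Nat.find_min hex (m := k) (by omega)
      simpa using this
  set a : ℕ → ℝ := fun k => (2:ℝ) ^ (-(k:ℝ) * b) * (∑ j ∈ Finset.range (k+1), m j) ^ r with ha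
  have ha0 : ∀ k, 0 ≤ a k := fun k =>
    mul_nonneg (by positivity) (Real.rpow_nonneg (Finset.sum_nonneg fun j _ => (hm j).le) _)
  have hk : ∀ k : ℕ, ∫⁻ y in Bd n (k+1) \ Bd n k, ENNReal.ofReal (‖y‖ ^ (-b - n) * |u y - cj n u 0| ^ r)
      ≤ ENNReal.ofReal (C1 * om n * 2^n * 2^b * a (k+1)) := by
    intro k
    have hmeas : MeasurableSet (Bd n (k+1) \ Bd n k) := measurableSet_ball.diff measurableSet_ball
    calc ∫⁻ y in Bd n (k+1) \ Bd n k, ENNReal.ofReal (‖y‖ ^ (-b - n) * |u y - cj n u 0| ^ r)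
        ≤ ∫⁻ y in Bd n (k+1) \ Bd n k, ENNReal.ofReal (((2:ℝ)^k) ^ (-b - n)) *
            ENNReal.ofReal (|u y - cj n u 0| ^ r) := by
          refine setLIntegral_mono' hmeas fun y hy => ?_
          rw [← ENNReal.ofReal_mul (by positivity)]
          refine ENNReal.ofReal_le_ofReal (mul_le_mul_of_nonneg_right ?_ (by positivity))
          have : (2:ℝ)^k ≤ ‖y‖ := by simpa using hy.2
          exact Real.rpow_le_rpow_of_nonpos (by positivity) this
            (by have : (0:ℝ) ≤ n := Nat.cast_nonneg n; linarith)
      _ ≤ ENNReal.ofReal (((2:ℝ)^k) ^ (-b - n)) *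
          ∫⁻ y in Bd n (k+1), ENNReal.ofReal (|u y - cj n u 0| ^ r) := by
          rw [lintegral_const_mul _ (by fun_prop)]
          exact mul_le_mul' le_rfl (lintegral_mono_set sdiff_subset)
      _ ≤ ENNReal.ofReal (((2:ℝ)^k) ^ (-b - n)) *
          (ENNReal.ofReal (C1 * (∑ j ∈ Finset.range (k+1+1), m j) ^ r) * volume (Bd n (k+1))) :=
          mul_le_mul' le_rfl (w_int n hp (by linarith) hrp hu hΛ hm hosc (k+1))
      _ = ENNReal.ofReal (C1 * om n * 2^n * 2^b * a (k+1)) := by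
          have hS0 : 0 ≤ ∑ j ∈ Finset.range (k+1+1), m j := Finset.sum_nonneg fun j _ => (hm j).le
          rw [vol_Bd, ← ENNReal.ofReal_mul (by positivity), ← ENNReal.ofReal_mul (by positivity)]
          congr 1
          simp only [ha]
          have e1 : ((2:ℝ)^k) ^ (-b - n) = 2 ^ (-(k:ℝ)*b) * (((2:ℝ)^k)^n)⁻¹ := by
            rw [sub_eq_add_neg, Real.rpow_add (by positivity), Real.rpow_neg (by positivity) (n:ℝ),
              Real.rpow_natCast, ← Real.rpow_natCast 2 k, ← Real.rpow_mul (by positivity)]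
            congr 2; ring
          have e2 : (2:ℝ) ^ (-((k+1:ℕ):ℝ)*b) = 2 ^ (-(k:ℝ)*b) * (2^b)⁻¹ := by
            rw [← Real.rpow_neg (by positivity), ← Real.rpow_add (by positivity)]
            congr 1; push_cast; ring
          rw [e1, e2, pow_succ 2 k, mul_pow]
          have : (0:ℝ) < 2^b := by positivity
          field_simp
  refine (lintegral_mono_set hcov).trans ((lintegral_iUnion_le _ _).trans ?_)
  refine (ENNReal.tsum_le_tsum hk).trans ?_
  refine ENNReal.tsum_le_of_sum_range_le fun N => ?_
  have hc0 : 0 ≤ C1 * om n * 2^n * 2^b := by positivity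
  rw [← ENNReal.ofReal_sum_of_nonneg fun k _ => mul_nonneg hc0 (ha0 _), ← Finset.mul_sum]
  refine ENNReal.ofReal_le_ofReal ?_
  have h1 : ∑ k ∈ Finset.range N, a (k+1) ≤ ∑ k ∈ Finset.range (N+1), a k := by
    rw [Finset.sum_range_succ']
    linarith [ha0 0]
  have h2 := hH m (fun k => (hm k).le) (N+1)
  have h3 := mul_le_mul_of_nonneg_left (hL (N+1)) hCH.le
  calc C1 * om n * 2^n * 2^b * ∑ k ∈ Finset.range N, a (k+1) ≤ C1 * om n * 2^n * 2^b * (CH * L) :=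
        mul_le_mul_of_nonneg_left (h1.trans (h2.trans h3)) hc0
    _ = _ := by ring

/-- normalized oscillation -/
def mj (n : ℕ) (p η : ℝ) (Q : ℕ → ℝ) (j : ℕ) : ℝ :=
  ((2 * cA n) ^ (2:ℝ) * om n ^ (-(1/p))) * (((2:ℝ) ^ j) ^ (-((n:ℝ)/p)) * Q j ^ (1/η))

theorem cA_pos (n : ℕ) : 0 < cA n := by linarith [cA_ge n]

theorem mj_osc (n : ℕ) (hn : 2 ≤ n) {p η κ : ℝ} (hp : 2 ≤ p) (hη1 : 1 ≤ η) (hη2 : p/2 ≤ η) (hηp : η ≤ p)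
    (hκ : 0 < κ) (hrel : 1/p = 1/η - κ/n) {u : En n → ℝ} (hu : Measurable u) {Λ : ℝ}
    (hΛ : ∀ x, |u x| ≤ Λ) {Q : ℕ → ℝ} (hQ : ∀ j, 0 < Q j)
    (hQ' : ∀ j, ∫⁻ x in Bd n j, ∫⁻ y in Bd n j, gk n η (κ*η) u x y ≤ ENNReal.ofReal (Q j)) (j : ℕ) :
    ∫⁻ y in Bd n j, ENNReal.ofReal (|u y - cj n u j| ^ p) ≤
      ENNReal.ofReal (mj n p η Q j ^ p) * volume (Bd n j) := by
  have hom := om_pos n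
  have hcA := cA_ge n
  have hQj := hQ j
  have hp0 : 0 < p := by linarith
  have hη0 : 0 < η := by linarith
  have h := sob_poinc n hn hη1 hηp hκ hrel hu hΛ 0 (ρ := 2^j) (by positivity) hQj.le (hQ' j)
  refine h.trans ?_
  have hcA0 := cA_pos n
  rw [vol_Bd]
  unfold mj
  rw [← ENNReal.ofReal_mul (by positivity)]
  refine ENNReal.ofReal_le_ofReal ?_
  have hD1 : 1 ≤ 2 * cA n := by linarith
  generalize 2 * cA n = D at hD1 ⊢
  have hD0 : 0 < D := by linarith
  rw [Real.mul_rpow (by positivity) (by positivity), Real.mul_rpow (by positivity) (by positivity),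
    Real.mul_rpow (by positivity) (by positivity), Real.mul_rpow (by positivity) (by positivity),
    ← Real.rpow_mul (by positivity), ← Real.rpow_mul (by positivity), ← Real.rpow_mul (by positivity),
    ← Real.rpow_mul (by positivity), ← Real.rpow_mul (by positivity)]
  have e1 : -(1/p) * p = -1 := by field_simp
  have e2 : -((n:ℝ)/p) * p = -n := by field_simp
  have e3 : 1/η*p = p/η := by ring
  rw [e1, e2, e3, Real.rpow_neg (by positivity) (n:ℝ), Real.rpow_natCast, Real.rpow_neg_one]
  have e4 : D ^ (p * (p/η)) ≤ D ^ (2 * p) := by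
    refine Real.rpow_le_rpow_of_exponent_le hD1 ?_
    have : p/η ≤ 2 := by rw [div_le_iff₀ hη0]; linarith
    nlinarith
  calc D ^ (p * (p/η)) * Q j ^ (p/η) ≤ D ^ (2 * p) * Q j ^ (p/η) := by gcongr
    _ = _ := by field_simp

theorem mj_pos (n : ℕ) (p η : ℝ) {Q : ℕ → ℝ} (hQ : ∀ j, 0 < Q j) (j : ℕ) : 0 < mj n p η Q j := by
  have hom := om_pos n
  have hcA := cA_pos n
  have := hQ j
  unfold mj; positivity

theorem kap_far {n : ℕ} {p s b K0 : ℝ} (hK : 1 ≤ K0) (hb : 0 < b) (hbs : b ≤ s * p) {x y : En n}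
    (hx : x ∈ ball (0:En n) (1/2)) (hy : y ∈ (BB n)ᶜ) :
    kap p s b K0 ‖x-y‖ / ‖x-y‖ ^ ((n:ℝ) + s * p) ≤ K0 * 2 ^ (s * p) * 2 ^ (b + n) * ‖y‖ ^ (-b - n) := by
  have h1 : ‖x‖ < 1/2 := by simpa using hx
  have h2 : 1 ≤ ‖y‖ := by simpa using hy
  have h3 := norm_sub_norm_le y x
  rw [norm_sub_rev] at h3
  have hd : ‖y‖/2 ≤ ‖x-y‖ := by linarith
  refine (kap_tail hK hb hbs (by linarith)).trans ?_
  have h4 : ‖x-y‖ ^ (-b-n) ≤ (‖y‖/2) ^ (-b-n) :=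
    Real.rpow_le_rpow_of_nonpos (by linarith) hd (by have : (0:ℝ) ≤ n := Nat.cast_nonneg n; linarith)
  have h5 : (‖y‖/2) ^ (-b-n) = 2 ^ (b+n) * ‖y‖ ^ (-b-n) := by
    rw [Real.div_rpow (norm_nonneg _) (by norm_num), show -b - (n:ℝ) = -(b+n) by ring,
      Real.rpow_neg (by norm_num : (0:ℝ) ≤ 2)]
    field_simp
  rw [h5] at h4
  calc K0 * 2 ^ (s * p) * ‖x-y‖ ^ (-b-n) ≤ K0 * 2 ^ (s * p) * (2 ^ (b+n) * ‖y‖ ^ (-b-n)) := by gcongr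
    _ = _ := by ring

theorem tail_main (n : ℕ) (hn : 2 ≤ n) {p s b K0 : ℝ} (hp : 2 ≤ p) (hK : 1 ≤ K0) (hb : 0 < b)
    (hbs : b ≤ s * p) : ∃ C : ℝ, 0 < C ∧ ∀ (η κ Λ lam : ℝ) (u : En n → ℝ) (Q : ℕ → ℝ), 1 ≤ η → p/2 ≤ η → η ≤ p →
    0 < κ → 1/p = 1/η - κ/n → Measurable u → (∀ x, |u x| ≤ Λ) → 0 < lam → (∀ j, 0 < Q j) →
    (∀ j, ∫⁻ x in Bd n j, ∫⁻ y in Bd n j, gk n η (κ*η) u x y ≤ ENNReal.ofReal (Q j)) →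
    (∀ N, ∑ k ∈ Finset.range N, (2:ℝ) ^ (-(k:ℝ) * b) * (((2:ℝ) ^ k) ^ (-((n:ℝ)/p)) * Q k ^ (1/η)) ^ (p-1)
      ≤ lam ^ (p-1)) →
    (∫⁻ y in BB n, ENNReal.ofReal (|u y - cj n u 0| ^ p) ≤ ENNReal.ofReal (C * (Q 0 ^ (1/η)) ^ p)) ∧
    (∀ x ∈ ball (0:En n) (1/2), ∫⁻ y in (BB n)ᶜ, ENNReal.ofReal (kap p s b K0 ‖x-y‖ * |u x - u y| ^ (p-1)
      / ‖x-y‖ ^ ((n:ℝ) + s * p)) ≤ ENNReal.ofReal (C * (|u x - cj n u 0| ^ (p-1) + lam ^ (p-1)))) := by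
  have hr : 1 ≤ p - 1 := by linarith
  have hom := om_pos n
  have hcA := cA_pos n
  have hn0 : (0:ℝ) < n := by exact_mod_cast (by omega : 0 < n)
  obtain ⟨C1, hC1, h1⟩ := far_int n hp hr (by linarith : p - 1 ≤ p) hb
  set cm : ℝ := (2 * cA n) ^ (2:ℝ) * om n ^ (-(1/p)) with hcm
  have hcm0 : 0 < cm := by positivity
  set c2 : ℝ := K0 * 2 ^ (s * p) * 2 ^ (b + n) with hc2
  have hc20 : 0 < c2 := by positivity
  set c3 : ℝ := n * om n * (1 ^ (-b) / b) with hc3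
  have hc30 : 0 < c3 := by positivity
  refine ⟨cm ^ p * om n + c2 * 2^(p-1) * (c3 + C1 * cm ^ (p-1)), by positivity, ?_⟩
  intro η κ Λ lam u Q hη1 hη2 hηp hκ hrel hu hΛ hlam hQ hQ' hsum
  have hosc := mj_osc n hn hp hη1 hη2 hηp hκ hrel hu hΛ hQ hQ'
  have hmp := mj_pos n p η hQ
  constructor
  · have h := hosc 0
    rw [vol_Bd] at h
    simp only [Bd, pow_zero, one_pow, mul_one] at h
    refine h.trans ?_
    have hQ0 := hQ 0
    unfold mj
    rw [← hcm, pow_zero, Real.one_rpow, one_mul, ← ENNReal.ofReal_mul (by positivity)]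
    refine ENNReal.ofReal_le_ofReal ?_
    rw [Real.mul_rpow (by positivity) (by positivity)]
    have h0 : 0 ≤ c2 * 2^(p-1) * (c3 + C1 * cm ^ (p-1)) * (Q 0 ^ (1/η)) ^ p := by positivity
    nlinarith
  · intro x hx
    have hL : ∀ N, ∑ k ∈ Finset.range N, (2:ℝ) ^ (-(k:ℝ) * b) * mj n p η Q k ^ (p-1) ≤ cm ^ (p-1) * lam ^ (p-1) := by
      intro N
      refine le_trans (le_of_eq ?_) (mul_le_mul_of_nonneg_left (hsum N) (by positivity : 0 ≤ cm ^ (p-1)))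
      rw [Finset.mul_sum]
      refine Finset.sum_congr rfl fun k _ => ?_
      have := hQ k
      unfold mj
      rw [← hcm, Real.mul_rpow (x := cm) (by positivity) (by positivity)]; ring
    have hfar := h1 u Λ _ _ hu hΛ hmp hosc hL
    have hBm : MeasurableSet (BB n)ᶜ := measurableSet_ball.compl
    have hbase : ∫⁻ y in (BB n)ᶜ, ENNReal.ofReal (‖y‖ ^ (-b - n)) = ENNReal.ofReal c3 := by
      rw [hc3, ← lint_compl_rpow n hn one_pos hb, ← lintegral_indicator hBm]
      refine lintegral_congr fun y => ?_
      by_cases hy : 1 ≤ ‖y‖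
      · rw [indicator_of_mem (by simpa using hy), indicator_of_mem (by simpa using hy)]
      · rw [indicator_of_notMem (by simpa using hy), indicator_of_notMem (by simpa using hy)]
    set W := |u x - cj n u 0| ^ (p-1) with hW
    have hW0 : 0 ≤ W := by positivity
    calc ∫⁻ y in (BB n)ᶜ, ENNReal.ofReal (kap p s b K0 ‖x-y‖ * |u x - u y| ^ (p-1)
          / ‖x-y‖ ^ ((n:ℝ) + s * p))
        ≤ ∫⁻ y in (BB n)ᶜ, (ENNReal.ofReal (c2 * 2^(p-1) * W) * ENNReal.ofReal (‖y‖ ^ (-b - n))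
          + ENNReal.ofReal (c2 * 2^(p-1)) * ENNReal.ofReal (‖y‖ ^ (-b - n) * |u y - cj n u 0| ^ (p-1))) := by
          refine setLIntegral_mono' hBm fun y hy => ?_
          rw [← ENNReal.ofReal_mul (by positivity), ← ENNReal.ofReal_mul (by positivity),
            ← ENNReal.ofReal_add (by positivity) (by positivity)]
          refine ENNReal.ofReal_le_ofReal ?_
          have k1 := kap_far hK hb hbs hx hy
          have k2 : |u x - u y| ^ (p-1) ≤ 2^(p-1) * (W + |u y - cj n u 0| ^ (p-1)) := by
            have h := abs_sub_le (u x) (cj n u 0) (u y)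
            rw [abs_sub_comm (cj n u 0)] at h
            exact (Real.rpow_le_rpow (abs_nonneg _) h (by linarith)).trans
              (add_rpow_two (abs_nonneg _) (abs_nonneg _) (by linarith))
          calc _ = (kap p s b K0 ‖x-y‖ / ‖x-y‖ ^ ((n:ℝ) + s * p)) * |u x - u y| ^ (p-1) := by ring
            _ ≤ (c2 * ‖y‖ ^ (-b - n)) * (2^(p-1) * (W + |u y - cj n u 0| ^ (p-1))) :=
              mul_le_mul k1 k2 (by positivity) (by positivity)
            _ = _ := by ring
      _ = ENNReal.ofReal (c2 * 2^(p-1) * W) * ENNReal.ofReal c3 + ENNReal.ofReal (c2 * 2^(p-1)) *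
          ∫⁻ y in (BB n)ᶜ, ENNReal.ofReal (‖y‖ ^ (-b - n) * |u y - cj n u 0| ^ (p-1)) := by
          rw [lintegral_add_left (by fun_prop), lintegral_const_mul _ (by fun_prop), hbase,
            lintegral_const_mul _ (by fun_prop)]
      _ ≤ ENNReal.ofReal (c2 * 2^(p-1) * W) * ENNReal.ofReal c3 + ENNReal.ofReal (c2 * 2^(p-1)) *
          ENNReal.ofReal (C1 * (cm ^ (p-1) * lam ^ (p-1))) := add_le_add le_rfl (mul_le_mul' le_rfl hfar)
      _ ≤ _ := by
          rw [← ENNReal.ofReal_mul (by positivity), ← ENNReal.ofReal_mul (by positivity),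
            ← ENNReal.ofReal_add (by positivity) (by positivity)]
          refine ENNReal.ofReal_le_ofReal ?_
          have hl : 0 ≤ lam ^ (p-1) := by positivity
          have t1 : 0 ≤ cm ^ p * om n * (W + lam ^ (p-1)) := by positivity
          have t2 : 0 ≤ c2 * 2^(p-1) * c3 * lam^(p-1) := by positivity
          have t3 : 0 ≤ c2 * 2^(p-1) * (C1 * cm^(p-1)) * W := by positivity
          nlinarith

theorem sob_abs (n : ℕ) (hn : 2 ≤ n) {p s : ℝ} (hp : 2 ≤ p) (hs0 : 0 < s) (hsp : s * p < n) :
    ∃ C : ℝ, 0 < C ∧ ∀ (h : En n → ℝ) (Λ Q A : ℝ), Measurable h → (∀ x, |h x| ≤ Λ) → 0 ≤ Q → 0 ≤ A →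
      ∫⁻ x in BB n, ∫⁻ y in BB n, gk n p (s * p) h x y ≤ ENNReal.ofReal Q →
      ∫⁻ x in BB n, ENNReal.ofReal |h x| ≤ ENNReal.ofReal A →
      ∫⁻ x in BB n, ENNReal.ofReal (|h x| ^ (n * p / (n - s * p))) ≤
        ENNReal.ofReal ((C * (Q ^ (1 / p) + A)) ^ (n * p / (n - s * p))) := by
  have hn0 : (0:ℝ) < n := by positivity
  have hd : 0 < (n:ℝ) - s * p := by linarith
  have hp0 : 0 < p := by linarith
  set P : ℝ := n * p / (n - s * p) with hP
  have hpP : p ≤ P := by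
    rw [hP, le_div_iff₀ hd]
    have : 0 < s * p := by positivity
    nlinarith
  have hP1 : 1 ≤ P := by linarith
  have hP0 : 0 < P := by linarith
  have hrel : 1 / P = 1 / p - s / n := by
    rw [hP]; field_simp
  have hom := om_pos n
  have hcA := cA_pos n
  set D : ℝ := ((2 * cA n) ^ P) ^ (1 / p) with hD
  have hDp : 0 < D := by positivity
  set o : ℝ := om n with ho
  refine ⟨4 * (D + o ^ (1 / P) / o), by positivity, fun h Λ Q A hm hΛ hQ hA hQe hAe => ?_⟩
  have h1 := sob_poinc n hn (m := p) (by linarith) hpP hs0 hrel hm hΛ 0 one_pos hQ hQe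
  have h2 := mean_const n hm hΛ 0 one_pos 0
  set c : ℝ := ⨍ y in ball (0 : En n) 1, h y with hc
  rw [vol_ball n 0 one_pos] at h2
  simp only [sub_zero, Real.one_rpow, mul_one] at h2
  have h3 : |c| * o ≤ A := by
    have := h2.trans hAe
    rw [← ENNReal.ofReal_mul (abs_nonneg _)] at this
    exact (ENNReal.ofReal_le_ofReal_iff hA).1 this
  have h4 : |c| ≤ A / o := by rw [le_div_iff₀ hom]; exact h3
  have hpt : ∀ x, ENNReal.ofReal (|h x| ^ P) ≤ ENNReal.ofReal (2 ^ P) * ENNReal.ofReal (|h x - c| ^ P)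
      + ENNReal.ofReal (2 ^ P * (A / o) ^ P) := by
    intro x
    rw [← ENNReal.ofReal_mul (by positivity), ← ENNReal.ofReal_add (by positivity) (by positivity)]
    refine ENNReal.ofReal_le_ofReal ?_
    calc |h x| ^ P ≤ (|h x - c| + A / o) ^ P := by
          refine Real.rpow_le_rpow (abs_nonneg _) ?_ hP0.le
          have := abs_add_le (h x - c) c
          simp only [sub_add_cancel] at this
          linarith
      _ ≤ 2 ^ P * (|h x - c| ^ P + (A / o) ^ P) := add_rpow_two (abs_nonneg _) (by positivity) (by linarith)
      _ = _ := by ring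
  have e1 : ((2 * cA n) ^ P * Q) ^ (P / p) = (D * Q ^ (1 / p)) ^ P := by
    rw [Real.mul_rpow (by positivity) hQ, Real.mul_rpow hDp.le (by positivity), hD,
      ← Real.rpow_mul (by positivity), ← Real.rpow_mul (by positivity), ← Real.rpow_mul (by positivity),
      ← Real.rpow_mul hQ]
    congr 2 <;> ring
  rw [e1] at h1
  calc ∫⁻ x in BB n, ENNReal.ofReal (|h x| ^ P)
      ≤ ∫⁻ x in BB n, (ENNReal.ofReal (2 ^ P) * ENNReal.ofReal (|h x - c| ^ P)
      + ENNReal.ofReal (2 ^ P * (A / o) ^ P)) := lintegral_mono hpt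
    _ = ENNReal.ofReal (2 ^ P) * (∫⁻ x in BB n, ENNReal.ofReal (|h x - c| ^ P)) +
        ENNReal.ofReal (2 ^ P * (A / o) ^ P) * ENNReal.ofReal o := by
        rw [lintegral_add_right _ measurable_const, lintegral_const_mul' _ _ ENNReal.ofReal_ne_top,
          lintegral_const, Measure.restrict_apply_univ, vol_ball n 0 one_pos]
        simp only [Real.one_rpow, mul_one, ho]
    _ ≤ ENNReal.ofReal (2 ^ P) * ENNReal.ofReal ((D * Q ^ (1 / p)) ^ P) +
        ENNReal.ofReal (2 ^ P * (A / o) ^ P) * ENNReal.ofReal o :=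
        add_le_add (mul_le_mul' le_rfl h1) le_rfl
    _ = ENNReal.ofReal (2 ^ P * (D * Q ^ (1 / p)) ^ P + 2 ^ P * (A / o) ^ P * o) := by
        rw [← ENNReal.ofReal_mul (by positivity), ← ENNReal.ofReal_mul (by positivity),
          ← ENNReal.ofReal_add (by positivity) (by positivity)]
    _ ≤ _ := by
        refine ENNReal.ofReal_le_ofReal ?_
        have e2 : o = (o ^ (1 / P)) ^ P := by
          rw [← Real.rpow_mul hom.le]; field_simp; simp
        set g : ℝ := o ^ (1 / P) with hg
        have hgp : 0 < g := by positivity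
        set Z := Q ^ (1 / p) with hZ
        have hZ0 : 0 ≤ Z := by positivity
        have e3 : 2 ^ P * (A / o) ^ P * o = (2 * (g / o * A)) ^ P := by
          conv_lhs => rw [show 2 ^ P * (A / o) ^ P * o = 2 ^ P * (A / o) ^ P * (g ^ P) by rw [← e2]]
          rw [← Real.mul_rpow (by positivity) (by positivity), ← Real.mul_rpow (by positivity) (by positivity)]
          congr 1; field_simp
        rw [e3, ← Real.mul_rpow (by positivity) (by positivity)]
        have hY : 0 ≤ (D + g / o) * (Z + A) := by positivity
        have hk1 : D * Z ≤ (D + g / o) * (Z + A) := by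
          have : 0 ≤ g / o := by positivity
          nlinarith [mul_nonneg hDp.le hA, mul_nonneg this hZ0, mul_nonneg this hA]
        have hk2 : g / o * A ≤ (D + g / o) * (Z + A) := by
          have : 0 ≤ g / o := by positivity
          nlinarith [mul_nonneg hDp.le hA, mul_nonneg this hZ0, mul_nonneg hDp.le hZ0]
        set Y := (D + g / o) * (Z + A) with hYd
        have h22 : (2:ℝ) ≤ 2 ^ P := by
          calc (2:ℝ) = 2 ^ (1:ℝ) := by simp
            _ ≤ 2 ^ P := Real.rpow_le_rpow_of_exponent_le (by norm_num) hP1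
        calc (2 * (D * Z)) ^ P + (2 * (g / o * A)) ^ P ≤ (2 * Y) ^ P + (2 * Y) ^ P := by
              refine add_le_add (Real.rpow_le_rpow (by positivity) (by linarith) hP0.le)
                (Real.rpow_le_rpow (by positivity) (by linarith) hP0.le)
          _ = 2 * (2 * Y) ^ P := by ring
          _ ≤ 2 ^ P * (2 * Y) ^ P := mul_le_mul_of_nonneg_right h22 (by positivity)
          _ = (2 * (2 * Y)) ^ P := by rw [← Real.mul_rpow (by positivity) (by positivity)]
          _ = _ := by congr 1; rw [hYd]; ring

/-- Young type inequality. -/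
theorem young_half {a y p : ℝ} (ha : 0 ≤ a) (hy : 0 ≤ y) (hp : 1 ≤ p) :
    a ^ (p - 1) * y ≤ 1 / 2 * a ^ p + 2 ^ p * y ^ p := by
  have hap : 0 ≤ a ^ (p - 1) := Real.rpow_nonneg ha _
  have hyp : 0 ≤ y ^ p := Real.rpow_nonneg hy _
  have ha' : a ^ p = a ^ (p - 1) * a := by
    rcases ha.eq_or_lt with rfl | h
    · rw [Real.zero_rpow (by linarith)]; simp
    · rw [← Real.rpow_add_one h.ne']; congr 1; ring
  have hy' : y ^ p = y ^ (p - 1) * y := by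
    rcases hy.eq_or_lt with rfl | h
    · rw [Real.zero_rpow (by linarith)]; simp
    · rw [← Real.rpow_add_one h.ne']; congr 1; ring
  have h2 : (0:ℝ) < 2 ^ p := by positivity
  by_cases h : y ≤ a / 2
  · nlinarith [mul_le_mul_of_nonneg_left h hap, mul_nonneg h2.le hyp]
  · push Not at h
    have h3 : a ^ (p - 1) ≤ (2 * y) ^ (p - 1) := Real.rpow_le_rpow ha (by linarith) (by linarith)
    rw [Real.mul_rpow (by norm_num) hy] at h3
    have h4 : (2:ℝ) ^ (p - 1) ≤ 2 ^ p := Real.rpow_le_rpow_of_exponent_le (by norm_num) (by linarith)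
    have h5 : 0 ≤ y ^ (p - 1) := Real.rpow_nonneg hy _
    calc a ^ (p - 1) * y ≤ 2 ^ (p - 1) * y ^ (p - 1) * y := mul_le_mul_of_nonneg_right h3 hy
      _ = 2 ^ (p - 1) * y ^ p := by rw [hy']; ring
      _ ≤ 2 ^ p * y ^ p := mul_le_mul_of_nonneg_right h4 hyp
      _ ≤ _ := by have := Real.rpow_nonneg ha p; linarith

theorem pow_diff {A B p : ℝ} (hB : 0 ≤ B) (hAB : B ≤ A) (hp : 1 ≤ p) :
    |A ^ p - B ^ p| ≤ p * A ^ (p - 1) * |A - B| := by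
  have hA : 0 ≤ A := hB.trans hAB
  have h0 : B ^ p ≤ A ^ p := Real.rpow_le_rpow hB hAB (by linarith)
  rw [abs_of_nonneg (by linarith), abs_of_nonneg (by linarith)]
  have hconv := convexOn_rpow (p := p) hp
  rcases hAB.eq_or_lt with rfl | hlt
  · simp
  have hA' : 0 < A := lt_of_le_of_lt hB hlt
  have := hconv.slope_le_deriv (x := B) (y := A) hB hA hlt
    (Real.differentiableAt_rpow_const_of_ne p hA'.ne')
  rw [slope_def_field, Real.deriv_rpow_const, div_le_iff₀ (by linarith)] at this
  exact this

theorem dphi_split {A B gx gy p L : ℝ} (hA : 0 ≤ A) (hB : 0 ≤ B) (hA1 : A ≤ 1) (hB1 : B ≤ 1) (hp : 1 ≤ p)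
    (hL : |A - B| ≤ L) :
    ∃ m r : ℝ, 0 ≤ m ∧ m ≤ 1 ∧ A ≤ m ∧ A ^ p * gx - B ^ p * gy = m ^ p * (gx - gy) + r ∧
      |r| ≤ m ^ (p - 1) * (p * L * (|gx| + |gy|)) := by
  have hL0 : 0 ≤ L := (abs_nonneg _).trans hL
  have hp0 : 0 ≤ p := by linarith
  rcases le_total B A with h | h
  · refine ⟨A, (A ^ p - B ^ p) * gy, hA, hA1, le_rfl, by ring, ?_⟩
    rw [abs_mul]
    have hq := pow_diff hB h hp
    have hA2 : 0 ≤ A ^ (p - 1) := Real.rpow_nonneg hA _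
    calc |A ^ p - B ^ p| * |gy| ≤ (p * A ^ (p - 1) * L) * (|gx| + |gy|) := by
          refine mul_le_mul (hq.trans (mul_le_mul_of_nonneg_left hL (by positivity))) (by
            have := abs_nonneg gx; linarith) (abs_nonneg _) (by positivity)
      _ = _ := by ring
  · refine ⟨B, (A ^ p - B ^ p) * gx, hB, hB1, h, by ring, ?_⟩
    rw [abs_mul]
    have hq := pow_diff hA h hp
    rw [abs_sub_comm, abs_sub_comm B A] at hq
    have hA2 : 0 ≤ B ^ (p - 1) := Real.rpow_nonneg hB _
    calc |A ^ p - B ^ p| * |gx| ≤ (p * B ^ (p - 1) * L) * (|gx| + |gy|) := by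
          refine mul_le_mul (hq.trans (mul_le_mul_of_nonneg_left hL (by positivity))) (by
            have := abs_nonneg gy; linarith) (abs_nonneg _) (by positivity)
      _ = _ := by ring

/-- Pointwise energy inequality on the diagonal ball. -/
theorem pt_energy {A B wx wy vx vy p L : ℝ} (hA : 0 ≤ A) (hB : 0 ≤ B) (hA1 : A ≤ 1) (hB1 : B ≤ 1)
    (hp : 2 ≤ p) (hL : |A - B| ≤ L) :
    1 / 2 * (A ^ p * |wx - wy| ^ p) ≤
      (|wx - wy| ^ (p - 2) * (wx - wy)) * (A ^ p * (wx - vx) - B ^ p * (wy - vy))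
      + 2 ^ p * (|vx - vy| + p * L * (|wx - vx| + |wy - vy|)) ^ p := by
  obtain ⟨m, r, hm0, hm1, hAm, he, hr⟩ := dphi_split (gx := wx - vx) (gy := wy - vy) hA hB hA1 hB1 (by linarith : (1:ℝ) ≤ p) hL
  have hL0 : 0 ≤ L := (abs_nonneg _).trans hL
  have hp0 : 0 ≤ p := by linarith
  rw [he]
  have hy0 : 0 ≤ p * L * (|wx - vx| + |wy - vy|) := by positivity
  set y1 := p * L * (|wx - vx| + |wy - vy|) with hy1
  set τ := wx - wy with hτ
  have e1 : wx - vx - (wy - vy) = τ - (vx - vy) := by rw [hτ]; ring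
  rw [e1]
  set d := vx - vy with hd
  have hphi := abs_Phi (τ := τ) hp
  set Φ := |τ| ^ (p - 2) * τ with hΦ
  have hΦτ : Φ * τ = |τ| ^ p := by
    rw [hΦ, mul_assoc, ← sq, ← sq_abs, ← Real.rpow_natCast]
    by_cases h0 : |τ| = 0
    · rw [h0, Real.zero_rpow (by norm_num : ((2:ℕ):ℝ) ≠ 0), Real.zero_rpow (by linarith : p ≠ 0)]; simp
    · rw [← Real.rpow_add (lt_of_le_of_ne (abs_nonneg _) (Ne.symm h0))]; congr 1; push_cast; ring
  have hmm : m ^ p ≤ m ^ (p - 1) := by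
    rcases hm0.eq_or_lt with h | h
    · rw [← h, Real.zero_rpow (by linarith), Real.zero_rpow (by linarith)]
    · exact Real.rpow_le_rpow_of_exponent_ge h hm1 (by linarith)
  have hmp : 0 ≤ m ^ p := Real.rpow_nonneg hm0 _
  have hmq : 0 ≤ m ^ (p - 1) := Real.rpow_nonneg hm0 _
  have hτq : 0 ≤ |τ| ^ (p - 1) := Real.rpow_nonneg (abs_nonneg _) _
  have hτp : 0 ≤ |τ| ^ p := Real.rpow_nonneg (abs_nonneg _) _
  have hbad : |Φ * (m ^ p * d - r)| ≤ (m * |τ|) ^ (p - 1) * (|d| + y1) := by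
    rw [abs_mul, hphi, Real.mul_rpow hm0 (abs_nonneg _)]
    have : |m ^ p * d - r| ≤ m ^ (p - 1) * (|d| + y1) := by
      calc |m ^ p * d - r| ≤ |m ^ p * d| + |r| := abs_sub _ _
        _ ≤ m ^ (p - 1) * |d| + m ^ (p - 1) * y1 := by
            refine add_le_add ?_ hr
            rw [abs_mul, abs_of_nonneg hmp]
            exact mul_le_mul_of_nonneg_right hmm (abs_nonneg _)
        _ = _ := by ring
    calc |τ| ^ (p - 1) * |m ^ p * d - r| ≤ |τ| ^ (p - 1) * (m ^ (p - 1) * (|d| + y1)) :=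
          mul_le_mul_of_nonneg_left this hτq
      _ = _ := by ring
  have hY := young_half (a := m * |τ|) (y := |d| + y1) (p := p) (by positivity) (by positivity) (by linarith)
  rw [Real.mul_rpow hm0 (abs_nonneg _) (z := p)] at hY
  have hAp : A ^ p * |τ| ^ p ≤ m ^ p * |τ| ^ p :=
    mul_le_mul_of_nonneg_right (Real.rpow_le_rpow hA hAm hp0) hτp
  have e2 : Φ * (m ^ p * (τ - d) + r) = m ^ p * |τ| ^ p - Φ * (m ^ p * d - r) := by
    rw [← hΦτ]; ring
  rw [e2]
  have := (abs_le.1 hbad).2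
  linarith

theorem pt_dphi {A B wx wy vx vy p L : ℝ} (hA : 0 ≤ A) (hB : 0 ≤ B) (hA1 : A ≤ 1) (hB1 : B ≤ 1)
    (hp : 2 ≤ p) (hL : |A - B| ≤ L) :
    |A ^ p * (wx - vx) - B ^ p * (wy - vy)| ≤ |wx - wy| + (|vx - vy| + p * L * (|wx - vx| + |wy - vy|)) := by
  obtain ⟨m, r, hm0, hm1, hAm, he, hr⟩ := dphi_split (gx := wx - vx) (gy := wy - vy) hA hB hA1 hB1 (by linarith : (1:ℝ) ≤ p) hL
  have hL0 : 0 ≤ L := (abs_nonneg _).trans hL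
  have hp0 : 0 ≤ p := by linarith
  rw [he]
  have hmp1 : m ^ p ≤ 1 := Real.rpow_le_one hm0 hm1 hp0
  have hmq1 : m ^ (p - 1) ≤ 1 := Real.rpow_le_one hm0 hm1 (by linarith)
  have hmp : 0 ≤ m ^ p := Real.rpow_nonneg hm0 _
  have hy0 : 0 ≤ p * L * (|wx - vx| + |wy - vy|) := by positivity
  calc |m ^ p * (wx - vx - (wy - vy)) + r| ≤ |m ^ p * (wx - vx - (wy - vy))| + |r| := abs_add_le _ _
    _ ≤ |wx - vx - (wy - vy)| + p * L * (|wx - vx| + |wy - vy|) := by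
        refine add_le_add ?_ (hr.trans (mul_le_of_le_one_left hy0 hmq1))
        rw [abs_mul, abs_of_nonneg hmp]
        exact mul_le_of_le_one_left (abs_nonneg _) hmp1
    _ ≤ (|wx - wy| + |vx - vy|) + p * L * (|wx - vx| + |wy - vy|) := by
        refine add_le_add ?_ le_rfl
        rw [show wx - vx - (wy - vy) = (wx - wy) - (vx - vy) by ring]
        exact abs_sub _ _
    _ = _ := by ring

theorem pt_psi {A B wx wy vx vy p L : ℝ} (hA : 0 ≤ A) (hA1 : A ≤ 1)
    (hp : 2 ≤ p) (hL : |A - B| ≤ L) :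
    |A * (wx - vx) - B * (wy - vy)| ≤ A * |wx - wy| + (|vx - vy| + p * L * (|wx - vx| + |wy - vy|)) := by
  have hL0 : 0 ≤ L := (abs_nonneg _).trans hL
  have e : A * (wx - vx) - B * (wy - vy) = A * (wx - wy) + (- (A * (vx - vy)) + (A - B) * (wy - vy)) := by ring
  rw [e]
  refine (abs_add_le _ _).trans (add_le_add ?_ ((abs_add_le _ _).trans (add_le_add ?_ ?_)))
  · rw [abs_mul, abs_of_nonneg hA]
  · rw [abs_neg, abs_mul, abs_of_nonneg hA]
    exact mul_le_of_le_one_left (abs_nonneg _) hA1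
  · rw [abs_mul]
    have h1 := abs_nonneg (wx - vx)
    have h2 := abs_nonneg (wy - vy)
    calc |A - B| * |wy - vy| ≤ L * (|wx - vx| + |wy - vy|) := by
          refine mul_le_mul hL (by linarith) h2 hL0
      _ ≤ p * (L * (|wx - vx| + |wy - vy|)) := by
          have : 0 ≤ L * (|wx - vx| + |wy - vy|) := by positivity
          nlinarith
      _ = _ := by ring

abbrev B2 (n : ℕ) : Set (En n × En n) := BB n ×ˢ BB n

theorem b2_lint (n : ℕ) {F : En n × En n → ℝ≥0∞} (hF : Measurable F) :
    ∫⁻ z in B2 n, F z = ∫⁻ x in BB n, ∫⁻ y in BB n, F (x, y) := by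
  rw [Measure.volume_eq_prod]
  exact setLIntegral_prod F hF.aemeasurable

theorem b2_swap (n : ℕ) {F : En n × En n → ℝ≥0∞} (hF : Measurable F) :
    ∫⁻ z in B2 n, F z.swap = ∫⁻ z in B2 n, F z := by
  rw [b2_lint n hF, b2_lint n (F := fun z => F z.swap) (hF.comp measurable_swap)]
  exact lint_dbl_symm (BB n) (F := fun x y => F (x, y)) hF

theorem ker_int (n : ℕ) (hn : 2 ≤ n) {b : ℝ} (hb : 0 < b) {φ : En n → ℝ≥0∞} (hφ : Measurable φ) :
    ∫⁻ z in B2 n, φ z.1 * ENNReal.ofReal (‖z.1 - z.2‖ ^ (b - n)) ≤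
      ENNReal.ofReal (n * om n * (2 ^ b / b)) * ∫⁻ x in BB n, φ x := by
  have hm : Measurable (fun z : En n × En n => φ z.1 * ENNReal.ofReal (‖z.1 - z.2‖ ^ (b - n))) := by
    fun_prop
  rw [b2_lint n hm]
  rw [← lintegral_const_mul' _ _ ENNReal.ofReal_ne_top]
  refine setLIntegral_mono' measurableSet_ball (fun x hx => ?_)
  simp only
  have h1 : ∫⁻ y in BB n, φ x * ENNReal.ofReal (‖x - y‖ ^ (b - n)) =
      φ x * ∫⁻ y in BB n, ENNReal.ofReal (‖x - y‖ ^ (b - n)) :=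
    lintegral_const_mul _ (by fun_prop)
  rw [h1, mul_comm (ENNReal.ofReal _)]
  refine mul_le_mul' le_rfl ?_
  rw [← lint_ball_rpow n hn (by norm_num : (0:ℝ) < 2) hb, ← lint_shift n x]
  rw [← lintegral_indicator measurableSet_ball]
  refine lintegral_mono (fun y => ?_)
  by_cases hy : y ∈ BB n
  · rw [indicator_of_mem hy, indicator_of_mem]
    simp only [mem_Iio]
    rw [BB, mem_ball_zero_iff] at hx hy
    linarith [norm_sub_le x y]
  · rw [indicator_of_notMem hy]; exact zero_le

def Rk (n : ℕ) (p s : ℝ) (v g : En n → ℝ) (z : En n × En n) : ℝ :=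
  (|v z.1 - v z.2| + p * (4 * ‖z.1 - z.2‖) * (|g z.1| + |g z.2|)) ^ p / ‖z.1 - z.2‖ ^ ((n:ℝ) + s * p)

theorem Rk_meas (n : ℕ) (p s : ℝ) {v g : En n → ℝ} (hv : Measurable v) (hg : Measurable g) :
    Measurable (Rk n p s v g) := by
  unfold Rk; fun_prop

theorem pow_ker {n : ℕ} {p s d X : ℝ} (hn : 2 ≤ n) (hp : 2 ≤ p) (hs0 : 0 < s) (hd : 0 ≤ d) (hX : 0 ≤ X) :
    d ^ p * X / d ^ ((n:ℝ) + s * p) ≤ X * d ^ ((p - s * p) - n) := by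
  rcases hd.eq_or_lt with rfl | h
  · rw [Real.zero_rpow (by positivity : (n:ℝ) + s * p ≠ 0)]; simp
    positivity
  · refine le_of_eq ?_
    rw [show (p - s * p) - n = p - ((n:ℝ) + s * p) by ring, Real.rpow_sub h]; ring

theorem R_int (n : ℕ) (hn : 2 ≤ n) {p s : ℝ} (hp : 2 ≤ p) (hs0 : 0 < s) (hs1 : s < 1) :
    ∃ C : ℝ, 0 < C ∧ ∀ (v g : En n → ℝ) (E G : ℝ), Measurable v → Measurable g → 0 ≤ E → 0 ≤ G →
      ∫⁻ x in BB n, ∫⁻ y in BB n, gk n p (s * p) v x y ≤ ENNReal.ofReal E →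
      ∫⁻ x in BB n, ENNReal.ofReal (|g x| ^ p) ≤ ENNReal.ofReal G →
      ∫⁻ z in B2 n, ENNReal.ofReal (Rk n p s v g z) ≤ ENNReal.ofReal (C * (E + G)) := by
  have hp0 : 0 < p := by linarith
  have hb : 0 < p - s * p := by nlinarith
  have hom := om_pos n
  have hn0 : (0:ℝ) < n := by positivity
  set c1 : ℝ := 2 ^ p with hc1
  have hc1p : 0 < c1 := by positivity
  set c2 : ℝ := 2 ^ p * ((4 * p) ^ p * 2 ^ p) with hc2
  have hc2p : 0 < c2 := by positivity
  set c3 : ℝ := n * om n * (2 ^ (p - s * p) / (p - s * p)) with hc3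
  have hc3p : 0 < c3 := by positivity
  refine ⟨c1 + 2 * (c2 * c3), by positivity, fun v g E G hv hg hE hG hE' hG' => ?_⟩
  set φ : En n → ℝ≥0∞ := fun x => ENNReal.ofReal (|g x| ^ p) with hφ
  have hφm : Measurable φ := by rw [hφ]; fun_prop
  set k : En n × En n → ℝ≥0∞ := fun z => ENNReal.ofReal (‖z.1 - z.2‖ ^ ((p - s * p) - n)) with hk
  have hkm : Measurable k := by rw [hk]; fun_prop
  have hpt : ∀ z, ENNReal.ofReal (Rk n p s v g z) ≤ ENNReal.ofReal c1 * gk n p (s * p) v z.1 z.2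
      + ENNReal.ofReal c2 * (φ z.1 * k z + φ z.2 * k z) := by
    intro z
    rw [hφ, hk]
    simp only [gk]
    rw [← ENNReal.ofReal_mul hc1p.le, ← ENNReal.ofReal_mul (by positivity), ← ENNReal.ofReal_mul (by positivity),
      ← ENNReal.ofReal_add (by positivity) (by positivity), ← ENNReal.ofReal_mul hc2p.le,
      ← ENNReal.ofReal_add (by positivity) (by positivity)]
    refine ENNReal.ofReal_le_ofReal ?_
    unfold Rk
    have hd := norm_nonneg (z.1 - z.2)
    set d := ‖z.1 - z.2‖ with hd'
    set α := |v z.1 - v z.2| with hα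
    have hα0 : 0 ≤ α := abs_nonneg _
    have hg1 := abs_nonneg (g z.1)
    have hg2 := abs_nonneg (g z.2)
    set g1 := |g z.1|
    set g2 := |g z.2|
    have i1 : (α + p * (4 * d) * (g1 + g2)) ^ p ≤ c1 * α ^ p + c2 * (d ^ p * (g1 ^ p + g2 ^ p)) := by
      calc (α + p * (4 * d) * (g1 + g2)) ^ p ≤ 2 ^ p * (α ^ p + (p * (4 * d) * (g1 + g2)) ^ p) :=
            add_rpow_two hα0 (by positivity) hp0.le
        _ = 2 ^ p * α ^ p + 2 ^ p * ((4 * p) ^ p * (d ^ p * (g1 + g2) ^ p)) := by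
            rw [show p * (4 * d) * (g1 + g2) = 4 * p * (d * (g1 + g2)) by ring,
              Real.mul_rpow (x := 4 * p) (y := d * (g1 + g2)) (by positivity) (by positivity),
              Real.mul_rpow (x := d) (y := g1 + g2) hd (by positivity)]
            ring
        _ ≤ 2 ^ p * α ^ p + 2 ^ p * ((4 * p) ^ p * (d ^ p * (2 ^ p * (g1 ^ p + g2 ^ p)))) := by
            have := add_rpow_two hg1 hg2 hp0.le
            gcongr
        _ = _ := by rw [hc1, hc2]; ring
    have i2 := pow_ker (n := n) (p := p) (s := s) (d := d) (X := g1 ^ p + g2 ^ p) hn hp hs0 hd (by positivity)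
    calc (α + p * (4 * d) * (g1 + g2)) ^ p / d ^ ((n:ℝ) + s * p)
        ≤ (c1 * α ^ p + c2 * (d ^ p * (g1 ^ p + g2 ^ p))) / d ^ ((n:ℝ) + s * p) := by gcongr
      _ = c1 * (α ^ p / d ^ ((n:ℝ) + s * p)) + c2 * (d ^ p * (g1 ^ p + g2 ^ p) / d ^ ((n:ℝ) + s * p)) := by ring
      _ ≤ c1 * (α ^ p / d ^ ((n:ℝ) + s * p)) + c2 * ((g1 ^ p + g2 ^ p) * d ^ ((p - s * p) - n)) := by gcongr
      _ = _ := by ring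
  have hgkm := gk_meas n p (s * p) hv
  have m1 : Measurable (fun z : En n × En n => φ z.1 * k z) := by fun_prop
  have m2 : Measurable (fun z : En n × En n => φ z.2 * k z) := by fun_prop
  have i1 : ∫⁻ z in B2 n, φ z.1 * k z ≤ ENNReal.ofReal (c3 * G) := by
    refine (ker_int n hn hb hφm).trans ?_
    rw [ENNReal.ofReal_mul hc3p.le]
    exact mul_le_mul' le_rfl hG'
  have i2 : ∫⁻ z in B2 n, φ z.2 * k z ≤ ENNReal.ofReal (c3 * G) := by
    refine le_trans (le_of_eq ?_) i1
    rw [← b2_swap n m1]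
    refine lintegral_congr (fun z => ?_)
    simp only [Prod.fst_swap, hk, Prod.snd_swap, norm_sub_rev]
  have i3 : ∫⁻ z in B2 n, gk n p (s * p) v z.1 z.2 ≤ ENNReal.ofReal E := by
    rw [b2_lint n hgkm]; exact hE'
  calc ∫⁻ z in B2 n, ENNReal.ofReal (Rk n p s v g z)
      ≤ ∫⁻ z in B2 n, (ENNReal.ofReal c1 * gk n p (s * p) v z.1 z.2
      + ENNReal.ofReal c2 * (φ z.1 * k z + φ z.2 * k z)) := lintegral_mono hpt
    _ = ENNReal.ofReal c1 * (∫⁻ z in B2 n, gk n p (s * p) v z.1 z.2)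
      + ENNReal.ofReal c2 * ((∫⁻ z in B2 n, φ z.1 * k z) + ∫⁻ z in B2 n, φ z.2 * k z) := by
        rw [lintegral_add_left (hgkm.const_mul _), lintegral_const_mul' _ _ ENNReal.ofReal_ne_top,
          lintegral_const_mul' _ _ ENNReal.ofReal_ne_top, lintegral_add_left m1]
    _ ≤ ENNReal.ofReal c1 * ENNReal.ofReal E + ENNReal.ofReal c2 * (ENNReal.ofReal (c3 * G) + ENNReal.ofReal (c3 * G)) :=
        add_le_add (mul_le_mul' le_rfl i3) (mul_le_mul' le_rfl (add_le_add i1 i2))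
    _ = ENNReal.ofReal (c1 * E + c2 * (c3 * G + c3 * G)) := by
        rw [← ENNReal.ofReal_mul hc1p.le, ← ENNReal.ofReal_add (by positivity) (by positivity),
          ← ENNReal.ofReal_mul hc2p.le, ← ENNReal.ofReal_add (by positivity) (by positivity)]
    _ ≤ _ := by
        refine ENNReal.ofReal_le_ofReal ?_
        have h1 : 0 ≤ c2 * c3 * E := by positivity
        have h2 : 0 ≤ c1 * G := by positivity
        nlinarith

/-- The cut-off. -/
def psi (n : ℕ) (x : En n) : ℝ := max 0 (min 1 (2 - 4 * ‖x‖))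

theorem psi_nonneg (n : ℕ) (x : En n) : 0 ≤ psi n x := le_max_left _ _
theorem psi_le (n : ℕ) (x : En n) : psi n x ≤ 1 := max_le (by norm_num) (min_le_left _ _)
theorem psi_one (n : ℕ) {x : En n} (hx : x ∈ ball (0 : En n) (1/4)) : psi n x = 1 := by
  rw [mem_ball_zero_iff] at hx
  unfold psi
  rw [min_eq_left (by linarith), max_eq_right (by norm_num)]
theorem psi_zero (n : ℕ) {x : En n} (hx : x ∉ ball (0 : En n) (1/2)) : psi n x = 0 := by
  rw [mem_ball_zero_iff, not_lt] at hx
  unfold psi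
  rw [max_eq_left]
  exact (min_le_right _ _).trans (by linarith)
theorem psi_meas (n : ℕ) : Measurable (psi n) := by unfold psi; fun_prop
theorem psi_lip (n : ℕ) (x y : En n) : |psi n x - psi n y| ≤ 4 * ‖x - y‖ := by
  unfold psi
  refine (abs_max_sub_max_le_max _ _ _ _).trans ?_
  simp only [sub_self, abs_zero]
  refine max_le (by positivity) ((abs_min_sub_min_le_max _ _ _ _).trans ?_)
  simp only [sub_self, abs_zero]
  refine max_le (by positivity) ?_
  rw [show 2 - 4 * ‖x‖ - (2 - 4 * ‖y‖) = 4 * (‖y‖ - ‖x‖) by ring, abs_mul, abs_of_pos (by norm_num : (0:ℝ) < 4)]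
  rw [norm_sub_rev]
  exact mul_le_mul_of_nonneg_left (abs_norm_sub_norm_le y x) (by norm_num)

theorem int_ineq {X : Type*} [MeasurableSpace X] {μ : Measure X} {F G1 G2 : X → ℝ} (hF : Integrable F μ)
    (hG2 : Measurable G2) (h2 : ∀ z, 0 ≤ G2 z) (h1 : ∀ z, 0 ≤ G1 z)
    (h : ∀ z, G1 z ≤ F z + G2 z) :
    ∫⁻ z, ENNReal.ofReal (G1 z) ∂μ ≤ ENNReal.ofReal (∫ z, F z ∂μ) + ∫⁻ z, ENNReal.ofReal (G2 z) ∂μ := by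
  by_cases ht : ∫⁻ z, ENNReal.ofReal (G2 z) ∂μ = ⊤
  · rw [ht]; simp
  have hi : Integrable G2 μ := by
    refine ⟨hG2.aestronglyMeasurable, ?_⟩
    rw [hasFiniteIntegral_iff_ofReal (Filter.Eventually.of_forall h2)]
    exact lt_top_iff_ne_top.2 ht
  have hnn : 0 ≤ fun z => F z + G2 z := fun z => (h1 z).trans (h z)
  calc ∫⁻ z, ENNReal.ofReal (G1 z) ∂μ ≤ ∫⁻ z, ENNReal.ofReal (F z + G2 z) ∂μ :=
        lintegral_mono (fun z => ENNReal.ofReal_le_ofReal (h z))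
    _ = ENNReal.ofReal (∫ z, (F z + G2 z) ∂μ) :=
        (ofReal_integral_eq_lintegral_ofReal (hF.add hi) (Filter.Eventually.of_forall hnn)).symm
    _ = ENNReal.ofReal (∫ z, F z ∂μ + ∫ z, G2 z ∂μ) := by rw [integral_add hF hi]
    _ ≤ ENNReal.ofReal (∫ z, F z ∂μ) + ENNReal.ofReal (∫ z, G2 z ∂μ) := ENNReal.ofReal_add_le
    _ = _ := by rw [ofReal_integral_eq_lintegral_ofReal hi (Filter.Eventually.of_forall h2)]

def tq0 (n : ℕ) (p s b K0 : ℝ) (u : En n → ℝ) (z : En n × En n) : ℝ :=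
  kap p s b K0 ‖z.1 - z.2‖ * |u z.1 - u z.2| ^ (p - 1) / ‖z.1 - z.2‖ ^ ((n:ℝ) + s * p)

theorem tq0_meas (n : ℕ) (p s b K0 : ℝ) {u : En n → ℝ} (hu : Measurable u) : Measurable (tq0 n p s b K0 u) := by
  unfold tq0 kap; fun_prop

theorem tq0_nonneg (n : ℕ) (p s b K0 : ℝ) (h : 1 ≤ K0) (u : En n → ℝ) (z) : 0 ≤ tq0 n p s b K0 u z := by
  unfold tq0
  have := kap_ge p s b K0 ‖z.1 - z.2‖ h
  positivity

theorem tq0_swap (n : ℕ) (p s b K0 : ℝ) (u : En n → ℝ) (z : En n × En n) :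
    tq0 n p s b K0 u z.swap = tq0 n p s b K0 u z := by
  unfold tq0
  simp only [Prod.fst_swap, Prod.snd_swap]
  rw [norm_sub_rev, abs_sub_comm]

def Jf (n : ℕ) (p s b K0 : ℝ) (u φ : En n → ℝ) : En n × En n → ℝ :=
  (BB n ×ˢ (BB n)ᶜ).indicator (fun z => |φ z.1| * tq0 n p s b K0 u z)

theorem Jf_meas (n : ℕ) (p s b K0 : ℝ) {u φ : En n → ℝ} (hu : Measurable u) (hφ : Measurable φ) :
    Measurable (Jf n p s b K0 u φ) := by
  unfold Jf
  refine Measurable.indicator ?_ (measurableSet_ball.prod measurableSet_ball.compl)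
  have := tq0_meas n p s b K0 hu
  fun_prop

theorem Jf_nonneg (n : ℕ) (p s b K0 : ℝ) (h : 1 ≤ K0) (u φ : En n → ℝ) (z) : 0 ≤ Jf n p s b K0 u φ z := by
  unfold Jf
  refine indicator_nonneg (fun z _ => ?_) z
  exact mul_nonneg (abs_nonneg _) (tq0_nonneg n p s b K0 h u z)

theorem Jf_int (n : ℕ) (p s b K0 : ℝ) {u φ T : En n → ℝ} (hu : Measurable u) (hφ : Measurable φ)
    (h0 : ∀ x, x ∉ ball (0 : En n) (1/2) → φ x = 0)
    (hT : ∀ x ∈ ball (0 : En n) (1/2), ∫⁻ y in (BB n)ᶜ, ENNReal.ofReal (tq0 n p s b K0 u (x, y)) ≤ ENNReal.ofReal (T x)) :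
    ∫⁻ z, ENNReal.ofReal (Jf n p s b K0 u φ z) ≤ ∫⁻ x in BB n, ENNReal.ofReal (|φ x| * T x) := by
  have hk := tq0_meas n p s b K0 hu
  have hm : Measurable (fun z : En n × En n => ENNReal.ofReal (|φ z.1| * tq0 n p s b K0 u z)) := by fun_prop
  have e1 : ∀ z, ENNReal.ofReal (Jf n p s b K0 u φ z) =
      (BB n ×ˢ (BB n)ᶜ).indicator (fun z => ENNReal.ofReal (|φ z.1| * tq0 n p s b K0 u z)) z := by
    intro z
    unfold Jf
    by_cases hz : z ∈ BB n ×ˢ (BB n)ᶜ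
    · rw [indicator_of_mem hz, indicator_of_mem hz]
    · rw [indicator_of_notMem hz, indicator_of_notMem hz, ENNReal.ofReal_zero]
  simp_rw [e1]
  rw [lintegral_indicator (measurableSet_ball.prod measurableSet_ball.compl), Measure.volume_eq_prod,
    setLIntegral_prod _ hm.aemeasurable]
  refine lintegral_mono (fun x => ?_)
  simp only
  by_cases hx : x ∈ ball (0 : En n) (1/2)
  · have e2 : ∀ y, ENNReal.ofReal (|φ x| * tq0 n p s b K0 u (x, y)) =
        ENNReal.ofReal |φ x| * ENNReal.ofReal (tq0 n p s b K0 u (x, y)) := fun y => ENNReal.ofReal_mul (abs_nonneg _)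
    simp_rw [e2]
    rw [lintegral_const_mul' _ _ ENNReal.ofReal_ne_top, ENNReal.ofReal_mul (abs_nonneg _)]
    exact mul_le_mul' le_rfl (hT x hx)
  · rw [h0 x hx]; simp

theorem lint_swap (n : ℕ) {F : En n × En n → ℝ≥0∞} (_hF : Measurable F) :
    ∫⁻ z : En n × En n, F z.swap = ∫⁻ z, F z := by
  rw [Measure.volume_eq_prod]
  exact lintegral_prod_swap F

/-- localized energy density -/
def El (n : ℕ) (p s : ℝ) (u : En n → ℝ) (z : En n × En n) : ℝ :=
  psi n z.1 ^ p * |u z.1 - u z.2| ^ p / ‖z.1 - z.2‖ ^ ((n:ℝ) + s * p)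

theorem El_nonneg (n : ℕ) (p s : ℝ) (u : En n → ℝ) (z) : 0 ≤ El n p s u z := by
  unfold El
  have := psi_nonneg n z.1
  positivity

theorem El_meas (n : ℕ) (p s : ℝ) {u : En n → ℝ} (hu : Measurable u) : Measurable (El n p s u) := by
  have := psi_meas n
  unfold El
  fun_prop

theorem kap_B2 {p s b K0 : ℝ} (hK : 1 ≤ K0) (hs : 0 ≤ s) (hp : 0 ≤ p) (hb : 0 < b) (hbs : b ≤ s * p) {d : ℝ} (hd0 : 0 ≤ d)
    (hd : d ≤ 2) : kap p s b K0 d ≤ K0 * 2 ^ (s * p) := by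
  unfold kap
  refine mul_le_mul_of_nonneg_left (max_le (Real.one_le_rpow (by norm_num) (by positivity)) ?_) (by linarith)
  exact (Real.rpow_le_rpow hd0 hd (by linarith)).trans
    (Real.rpow_le_rpow_of_exponent_le (by norm_num) (by linarith))

theorem energy_raw (n : ℕ) (hn : 2 ≤ n) {p s b K0 : ℝ} (hp : 2 ≤ p) (hs0 : 0 < s) (hsp : s * p < n)
    (hb : 0 < b) (hbs : b ≤ s * p) {K : En n × En n → ℝ} {u f v T : En n → ℝ} (hA : Adm n p s b K0 K u f)
    (hv : Measurable v) {Λ' : ℝ} (hv' : ∀ x, |v x| ≤ Λ') (c0 : ℝ)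
    (hT : ∀ x ∈ ball (0 : En n) (1/2), ∫⁻ y in (BB n)ᶜ, ENNReal.ofReal (tq0 n p s b K0 u (x, y)) ≤ ENNReal.ofReal (T x))
    (hR : ∫⁻ z in B2 n, ENNReal.ofReal (Rk n p s v (fun x => u x - c0 - v x) z) < ⊤) :
    ∫⁻ z in B2 n, ENNReal.ofReal (El n p s u z) < ⊤ ∧
    ENNReal.ofReal (1/2) * (∫⁻ z in B2 n, ENNReal.ofReal (El n p s u z)) ≤
      ENNReal.ofReal (∫ x, f x * (psi n x ^ p * (u x - c0 - v x)))
      + (ENNReal.ofReal (K0 * 2 ^ (s * p) * 2 ^ p) * (∫⁻ z in B2 n, ENNReal.ofReal (Rk n p s v (fun x => u x - c0 - v x) z))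
        + 2 * ∫⁻ x in BB n, ENNReal.ofReal (|psi n x ^ p * (u x - c0 - v x)| * T x)) := by
  obtain ⟨Λ, hΛ⟩ := hA.ub
  have hp0 : 0 < p := by linarith
  have hu := hA.um
  have hψ := psi_meas n
  set g : En n → ℝ := fun x => u x - c0 - v x with hg
  have hgm : Measurable g := by rw [hg]; fun_prop
  set φ : En n → ℝ := fun x => psi n x ^ p * g x with hφ
  have hφm : Measurable φ := by rw [hφ]; fun_prop
  have hφb : ∀ x, |φ x| ≤ Λ + |c0| + Λ' := by
    intro x
    rw [hφ]; simp only
    rw [abs_mul, abs_of_nonneg (Real.rpow_nonneg (psi_nonneg n x) _)]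
    refine (mul_le_of_le_one_left (abs_nonneg _) (Real.rpow_le_one (psi_nonneg n x) (psi_le n x) hp0.le)).trans ?_
    rw [hg]; simp only
    have h1 := hΛ x
    have h2 := hv' x
    have h3 := abs_sub (u x - c0) (v x)
    have h4 := abs_sub (u x) c0
    linarith
  have hφ0 : ∀ x, x ∉ ball (0 : En n) (1/2) → φ x = 0 := by
    intro x hx
    rw [hφ]; simp only
    rw [psi_zero n hx, Real.zero_rpow hp0.ne', zero_mul]
  have hRm := Rk_meas n p s hv hgm
  have hEm : Measurable (fun z : En n × En n => |u z.1 - u z.2| ^ p / ‖z.1 - z.2‖ ^ ((n:ℝ) + s * p)) := by fun_prop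
  have hen : ∫⁻ z in B2 n, ENNReal.ofReal (|u z.1 - u z.2| ^ p / ‖z.1 - z.2‖ ^ ((n:ℝ) + s * p)) < ⊤ := by
    refine lt_of_le_of_lt ?_ hA.en
    refine (setLIntegral_le_lintegral _ _).trans (lintegral_mono (fun z => ENNReal.ofReal_le_ofReal ?_))
    have := hA.K1 z
    gcongr
    exact le_mul_of_one_le_left (by positivity) this
  have hElfin : ∫⁻ z in B2 n, ENNReal.ofReal (El n p s u z) < ⊤ := by
    refine lt_of_le_of_lt (lintegral_mono (fun z => ENNReal.ofReal_le_ofReal ?_)) hen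
    unfold El
    gcongr
    exact mul_le_of_le_one_left (by positivity) (Real.rpow_le_one (psi_nonneg n _) (psi_le n _) hp0.le)
  have hRdef : ∀ z, Rk n p s v g z = (|v z.1 - v z.2| + p * (4 * ‖z.1 - z.2‖) * (|g z.1| + |g z.2|)) ^ p
      / ‖z.1 - z.2‖ ^ ((n:ℝ) + s * p) := fun z => rfl
  have hRnn : ∀ z, 0 ≤ Rk n p s v g z := by
    intro z; rw [hRdef]; positivity
  have hfin : ∫⁻ x in BB n, ∫⁻ y in BB n, gk n p (s * p) φ x y < ⊤ := by
    rw [← b2_lint n (gk_meas n p (s * p) hφm)]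
    have hpt : ∀ z, gk n p (s * p) φ z.1 z.2 ≤ ENNReal.ofReal (2 ^ p) *
        (ENNReal.ofReal (|u z.1 - u z.2| ^ p / ‖z.1 - z.2‖ ^ ((n:ℝ) + s * p)) + ENNReal.ofReal (Rk n p s v g z)) := by
      intro z
      rw [gk, ← ENNReal.ofReal_add (by positivity) (hRnn z), ← ENNReal.ofReal_mul (by positivity)]
      refine ENNReal.ofReal_le_ofReal ?_
      have h1 := pt_dphi (A := psi n z.1) (B := psi n z.2) (wx := u z.1 - c0) (wy := u z.2 - c0) (vx := v z.1) (vy := v z.2)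
        (psi_nonneg n _) (psi_nonneg n _) (psi_le n _) (psi_le n _) hp (psi_lip n _ _)
      rw [sub_sub_sub_cancel_right] at h1
      rw [hRdef, ← add_div, ← mul_div_assoc]
      gcongr
      refine le_trans (Real.rpow_le_rpow (abs_nonneg _) h1 hp0.le) ?_
      exact add_rpow_two (abs_nonneg _) (by positivity) hp0.le
    refine lt_of_le_of_lt (lintegral_mono hpt) ?_
    rw [lintegral_const_mul' _ _ ENNReal.ofReal_ne_top, lintegral_add_left hEm.ennreal_ofReal]
    exact ENNReal.mul_lt_top ENNReal.ofReal_lt_top (ENNReal.add_lt_top.2 ⟨hen, hR⟩)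
  obtain ⟨hFi, hFe⟩ := density n hn hp hs0 hsp hb hbs hA hφm hφb hφ0 hfin
  refine ⟨hElfin, ?_⟩
  have hK0 := hA.K01
  set c : ℝ := K0 * 2 ^ (s * p) * 2 ^ p with hc
  have hc0 : 0 < c := by positivity
  have hJm := Jf_meas n p s b K0 hu hφm
  have hJ0 := Jf_nonneg n p s b K0 hK0 u φ
  have hpt : ∀ z, (B2 n).indicator (fun z => 1/2 * El n p s u z) z ≤ Fi n p s K u φ z +
      ((B2 n).indicator (fun z => c * Rk n p s v g z) z + (Jf n p s b K0 u φ z + Jf n p s b K0 u φ z.swap)) := by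
    intro z
    have hJ1 := hJ0 z
    have hJ2 := hJ0 z.swap
    have hK1 := hA.K1 z
    have hK2 := hA.K2 z
    have hFabs : |Fi n p s K u φ z| ≤ |φ z.1 - φ z.2| * tq0 n p s b K0 u z := by
      unfold Fi tq0
      rw [abs_div, abs_mul, abs_mul, abs_Phi hp, abs_of_nonneg (by linarith : 0 ≤ K z),
        abs_of_nonneg (by positivity : 0 ≤ ‖z.1 - z.2‖ ^ ((n:ℝ) + s * p)), ← mul_div_assoc,
        mul_comm |φ z.1 - φ z.2|]
      gcongr
    by_cases h1 : z.1 ∈ BB n <;> by_cases h2 : z.2 ∈ BB n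
    · have hz : z ∈ B2 n := ⟨h1, h2⟩
      rw [indicator_of_mem hz, indicator_of_mem hz]
      suffices hs : 1/2 * El n p s u z ≤ Fi n p s K u φ z + c * Rk n p s v g z by linarith
      have hd : ‖z.1 - z.2‖ ≤ 2 := by
        rw [BB, mem_ball_zero_iff] at h1 h2
        linarith [norm_sub_le z.1 z.2]
      have hK3 := hK2.trans (kap_B2 hK0 hs0.le hp0.le hb hbs (norm_nonneg _) hd)
      have hq := pt_energy (A := psi n z.1) (B := psi n z.2) (wx := u z.1 - c0) (wy := u z.2 - c0) (vx := v z.1) (vy := v z.2)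
        (psi_nonneg n _) (psi_nonneg n _) (psi_le n _) (psi_le n _) hp (psi_lip n _ _)
      rw [sub_sub_sub_cancel_right] at hq
      rw [hRdef]
      unfold El Fi
      rw [← mul_div_assoc, ← mul_div_assoc, ← add_div]
      refine div_le_div_of_nonneg_right ?_ (by positivity)
      set E0 := 1/2 * (psi n z.1 ^ p * |u z.1 - u z.2| ^ p) with hE0
      have hE00 : 0 ≤ E0 := by
        have := psi_nonneg n z.1
        positivity
      set R0 := (|v z.1 - v z.2| + p * (4 * ‖z.1 - z.2‖) * (|g z.1| + |g z.2|)) ^ p with hR0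
      have hR00 : 0 ≤ R0 := by positivity
      change E0 ≤ (|u z.1 - u z.2| ^ (p - 2) * (u z.1 - u z.2)) * (φ z.1 - φ z.2) + 2 ^ p * R0 at hq
      set D0 := (|u z.1 - u z.2| ^ (p - 2) * (u z.1 - u z.2)) with hD0
      calc E0 ≤ K z * E0 := le_mul_of_one_le_left hE00 hK1
        _ ≤ K z * (D0 * (φ z.1 - φ z.2) + 2 ^ p * R0) := mul_le_mul_of_nonneg_left hq (by linarith)
        _ = K z * D0 * (φ z.1 - φ z.2) + K z * (2 ^ p * R0) := by ring
        _ ≤ K z * D0 * (φ z.1 - φ z.2) + (K0 * 2 ^ (s * p)) * (2 ^ p * R0) := by gcongr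
        _ = _ := by rw [hc]; ring
    · have hz : z ∉ B2 n := fun h => h2 h.2
      have h22 : φ z.2 = 0 := hφ0 _ (fun h => h2 (ball_subset_ball (by norm_num) h))
      rw [indicator_of_notMem hz, indicator_of_notMem hz]
      have e1 : Jf n p s b K0 u φ z = |φ z.1| * tq0 n p s b K0 u z := by
        unfold Jf
        rw [indicator_of_mem]; exact ⟨h1, h2⟩
      rw [h22, sub_zero, ← e1] at hFabs
      have := (abs_le.1 hFabs).1
      linarith
    · have hz : z ∉ B2 n := fun h => h1 h.1
      have h22 : φ z.1 = 0 := hφ0 _ (fun h => h1 (ball_subset_ball (by norm_num) h))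
      rw [indicator_of_notMem hz, indicator_of_notMem hz]
      have e1 : Jf n p s b K0 u φ z.swap = |φ z.2| * tq0 n p s b K0 u z := by
        unfold Jf
        rw [indicator_of_mem, tq0_swap]; rfl
        exact ⟨h2, h1⟩
      rw [h22, zero_sub, abs_neg, ← e1] at hFabs
      have := (abs_le.1 hFabs).1
      linarith
    · have hz : z ∉ B2 n := fun h => h1 h.1
      have h21 : φ z.1 = 0 := hφ0 _ (fun h => h1 (ball_subset_ball (by norm_num) h))
      have h22 : φ z.2 = 0 := hφ0 _ (fun h => h2 (ball_subset_ball (by norm_num) h))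
      rw [indicator_of_notMem hz, indicator_of_notMem hz]
      rw [h21, h22, sub_zero, abs_zero, zero_mul] at hFabs
      have := (abs_le.1 hFabs).1
      linarith
  have hB2 : MeasurableSet (B2 n) := measurableSet_ball.prod measurableSet_ball
  have hI1 : ∀ z, 0 ≤ (B2 n).indicator (fun z => c * Rk n p s v g z) z :=
    fun z => indicator_nonneg (fun z _ => mul_nonneg hc0.le (hRnn z)) z
  have hI1m : Measurable ((B2 n).indicator (fun z => c * Rk n p s v g z)) := (hRm.const_mul c).indicator hB2
  have hJsm : Measurable (fun z : En n × En n => Jf n p s b K0 u φ z.swap) := hJm.comp measurable_swap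
  have hmain := int_ineq hFi (G1 := (B2 n).indicator (fun z => 1/2 * El n p s u z))
    (G2 := fun z => (B2 n).indicator (fun z => c * Rk n p s v g z) z + (Jf n p s b K0 u φ z + Jf n p s b K0 u φ z.swap))
    (by fun_prop) (fun z => add_nonneg (hI1 z) (add_nonneg (hJ0 z) (hJ0 z.swap)))
    (fun z => indicator_nonneg (fun z _ => mul_nonneg (by norm_num) (El_nonneg n p s u z)) z) hpt
  have hind : ∀ (k : ℝ), 0 ≤ k → ∀ (h : En n × En n → ℝ), 
      ∫⁻ z, ENNReal.ofReal ((B2 n).indicator (fun z => k * h z) z) = ENNReal.ofReal k * ∫⁻ z in B2 n, ENNReal.ofReal (h z) := by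
    intro k hk h
    rw [← lintegral_const_mul' _ _ ENNReal.ofReal_ne_top, ← lintegral_indicator hB2]
    refine lintegral_congr (fun z => ?_)
    by_cases hz : z ∈ B2 n
    · rw [indicator_of_mem hz, indicator_of_mem hz, ENNReal.ofReal_mul hk]
    · rw [indicator_of_notMem hz, indicator_of_notMem hz, ENNReal.ofReal_zero]
  have e2 : ∫⁻ z, ENNReal.ofReal ((B2 n).indicator (fun z => c * Rk n p s v g z) z + (Jf n p s b K0 u φ z + Jf n p s b K0 u φ z.swap))
      = ENNReal.ofReal c * (∫⁻ z in B2 n, ENNReal.ofReal (Rk n p s v g z)) +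
        2 * ∫⁻ z, ENNReal.ofReal (Jf n p s b K0 u φ z) := by
    have : ∀ z, ENNReal.ofReal ((B2 n).indicator (fun z => c * Rk n p s v g z) z + (Jf n p s b K0 u φ z + Jf n p s b K0 u φ z.swap))
        = ENNReal.ofReal ((B2 n).indicator (fun z => c * Rk n p s v g z) z) + (ENNReal.ofReal (Jf n p s b K0 u φ z) + ENNReal.ofReal (Jf n p s b K0 u φ z.swap)) := by
      intro z
      rw [ENNReal.ofReal_add (hI1 z) (add_nonneg (hJ0 z) (hJ0 z.swap)), ENNReal.ofReal_add (hJ0 z) (hJ0 z.swap)]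
    simp_rw [this]
    rw [lintegral_add_left hI1m.ennreal_ofReal, lintegral_add_left hJm.ennreal_ofReal, hind c hc0.le,
      lint_swap n (F := fun z => ENNReal.ofReal (Jf n p s b K0 u φ z)) hJm.ennreal_ofReal, two_mul]
  rw [hind _ (by norm_num), e2, hFe] at hmain
  refine hmain.trans (add_le_add le_rfl (add_le_add le_rfl (mul_le_mul' le_rfl ?_)))
  exact Jf_int n p s b K0 hu hφm hφ0 hT

theorem lr_of_lp (n : ℕ) {r P : ℝ} (hr : 0 ≤ r) (hrP : r ≤ P) (hP : 0 < P) : ∃ C : ℝ, 0 < C ∧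
    ∀ (h : En n → ℝ) (Z : ℝ), Measurable h → 0 < Z →
    ∫⁻ x in BB n, ENNReal.ofReal (|h x| ^ P) ≤ ENNReal.ofReal (Z ^ P) →
    ∫⁻ x in BB n, ENNReal.ofReal (|h x| ^ r) ≤ ENNReal.ofReal (C * Z ^ r) := by
  have hom := om_pos n
  refine ⟨2 * (om n ^ (-(1 / P))) ^ r * om n, by positivity, fun h Z hm hZ hh => ?_⟩
  have hv : (volume.restrict (BB n)) univ = ENNReal.ofReal (om n) := by
    rw [Measure.restrict_apply_univ, vol_ball n 0 one_pos]; simp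
  have h2 := pow_int (μ := volume.restrict (BB n)) hm (T := om n ^ (-(1 / P)) * Z) (r := r) (P := P)
    (by positivity) hr hrP (by
      rw [hv, ← ENNReal.ofReal_mul (by positivity)]
      refine hh.trans (le_of_eq ?_)
      congr 1
      rw [Real.mul_rpow (by positivity) hZ.le, ← Real.rpow_mul hom.le,
        show -(1 / P) * P = -1 by field_simp, Real.rpow_neg_one]
      field_simp)
  rw [hv, ← ENNReal.ofReal_mul (by positivity)] at h2
  refine h2.trans (le_of_eq ?_)
  congr 1
  rw [Real.mul_rpow (by positivity) hZ.le]; ring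

theorem q_young {a z p : ℝ} (ha : 0 ≤ a) (hz : 0 ≤ z) (hp : 2 ≤ p) :
    a * z ≤ 1 / 4 * z ^ p + (4 * a) ^ pC p := by
  have hp1 : 0 < p - 1 := by linarith
  have e : pC p = 1 + 1 / (p - 1) := by unfold pC; field_simp; ring
  have hz' : z ^ p = z ^ (p - 1) * z := by
    rcases hz.eq_or_lt with rfl | h
    · rw [Real.zero_rpow (by linarith)]; simp
    · rw [← Real.rpow_add_one h.ne']; congr 1; ring
  have h4 : 0 ≤ (4 * a) ^ pC p := by positivity
  by_cases h : 4 * a ≤ z ^ (p - 1)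
  · rw [hz']
    nlinarith [mul_le_mul_of_nonneg_right h hz]
  · push Not at h
    have hz1 : z ≤ (4 * a) ^ (1 / (p - 1)) := by
      calc z = (z ^ (p - 1)) ^ (1 / (p - 1)) := by
            rw [← Real.rpow_mul hz]; field_simp; simp
        _ ≤ _ := Real.rpow_le_rpow (by positivity) h.le (by positivity)
    have hzp : 0 ≤ z ^ p := by positivity
    have h5 : (4 * a) ^ pC p = 4 * a * (4 * a) ^ (1 / (p - 1)) := by
      rw [e]
      rcases ha.eq_or_lt with rfl | h
      · rw [mul_zero, Real.zero_rpow (by positivity)]; simp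
      · rw [Real.rpow_add (by positivity), Real.rpow_one]
    rw [h5]
    have h6 := mul_le_mul_of_nonneg_left hz1 (by positivity : 0 ≤ 4 * a)
    nlinarith [mul_nonneg ha hz]

theorem absorb {E Y F p C6 C7 : ℝ} (hE : 0 ≤ E) (hY : 0 ≤ Y) (hF : 0 ≤ F) (hp : 2 ≤ p) (h6 : 0 ≤ C6)
    (h : 1/2 * E ≤ F * (C6 * (E + Y) ^ (1 / p)) + C7 * Y) :
    E ≤ (1 + 4 * C7) * Y + 4 * (4 * C6) ^ pC p * F ^ pC p := by
  have hq := q_young (a := F * C6) (z := (E + Y) ^ (1 / p)) (by positivity) (by positivity) hp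
  have e : ((E + Y) ^ (1 / p)) ^ p = E + Y := by
    rw [← Real.rpow_mul (by positivity), show 1 / p * p = 1 by field_simp, Real.rpow_one]
  rw [e, show 4 * (F * C6) = 4 * C6 * F by ring, Real.mul_rpow (by positivity) hF] at hq
  nlinarith

/-- Duality bound for the data term. -/
theorem data_bd (n : ℕ) (hn : 2 ≤ n) {p s : ℝ} (hp : 2 ≤ p) (hs0 : 0 < s) (hsp : s * p < n)
    {f φ h : En n → ℝ} (hf : Measurable f) (hh : Measurable h) {F Z : ℝ} (hF : 0 ≤ F) (hZ : 0 ≤ Z)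
    (h0 : ∀ x, x ∉ BB n → φ x = 0) (hφh : ∀ x, |φ x| ≤ |h x|)
    (hf1 : ∫⁻ x in BB n, ENNReal.ofReal (|f x| ^ pStar n p s) ≤ ENNReal.ofReal (F ^ pStar n p s))
    (hh1 : ∫⁻ x in BB n, ENNReal.ofReal (|h x| ^ (n * p / (n - s * p))) ≤ ENNReal.ofReal (Z ^ (n * p / (n - s * p)))) :
    ENNReal.ofReal (∫ x, f x * φ x) ≤ ENNReal.ofReal (F * Z) := by
  have hc := pStar_conj hn hp hs0 hsp
  set P := (n * p / (n - s * p)) with hP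
  set r := pStar n p s with hr
  have hr0 : 0 < r := hc.pos
  have hP0 : 0 < P := hc.symm.pos
  have e1 : ENNReal.ofReal (∫ x, f x * φ x) ≤ ∫⁻ x, ENNReal.ofReal |f x * φ x| := by
    calc ENNReal.ofReal (∫ x, f x * φ x) ≤ ENNReal.ofReal ‖∫ x, f x * φ x‖ :=
          ENNReal.ofReal_le_ofReal (Real.le_norm_self _)
      _ = ‖∫ x, f x * φ x‖ₑ := ofReal_norm _
      _ ≤ ∫⁻ x, ‖f x * φ x‖ₑ := enorm_integral_le_lintegral_enorm _
      _ = _ := by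
          refine lintegral_congr (fun x => ?_)
          rw [Real.enorm_eq_ofReal_abs]
  have e2 : ∫⁻ x, ENNReal.ofReal |f x * φ x| ≤ ∫⁻ x in BB n, ENNReal.ofReal |f x| * ENNReal.ofReal |h x| := by
    rw [← lintegral_indicator measurableSet_ball]
    refine lintegral_mono (fun x => ?_)
    by_cases hx : x ∈ BB n
    · rw [indicator_of_mem hx, ← ENNReal.ofReal_mul (abs_nonneg _), abs_mul]
      exact ENNReal.ofReal_le_ofReal (mul_le_mul_of_nonneg_left (hφh x) (abs_nonneg _))
    · rw [h0 x hx]; simp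
  refine (e1.trans e2).trans ?_
  have hH := ENNReal.lintegral_mul_le_Lp_mul_Lq (volume.restrict (BB n)) hc
    (f := fun x => ENNReal.ofReal |f x|) (g := fun x => ENNReal.ofReal |h x|) (by fun_prop) (by fun_prop)
  refine hH.trans ?_
  have k1 : ∀ x, ENNReal.ofReal |f x| ^ r = ENNReal.ofReal (|f x| ^ r) := fun x =>
    ENNReal.ofReal_rpow_of_nonneg (abs_nonneg _) hr0.le
  have k2 : ∀ x, ENNReal.ofReal |h x| ^ P = ENNReal.ofReal (|h x| ^ P) := fun x =>
    ENNReal.ofReal_rpow_of_nonneg (abs_nonneg _) hP0.le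
  simp only [k1, k2]
  rw [ENNReal.ofReal_mul hF]
  refine mul_le_mul' ?_ ?_
  · refine (ENNReal.rpow_le_rpow hf1 (by positivity)).trans (le_of_eq ?_)
    rw [ENNReal.ofReal_rpow_of_nonneg (by positivity) (by positivity), ← Real.rpow_mul hF,
      show r * (1 / r) = 1 by field_simp, Real.rpow_one]
  · refine (ENNReal.rpow_le_rpow hh1 (by positivity)).trans (le_of_eq ?_)
    rw [ENNReal.ofReal_rpow_of_nonneg (by positivity) (by positivity), ← Real.rpow_mul hZ,
      show P * (1 / P) = 1 by field_simp, Real.rpow_one]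

theorem lint_add_bd {X : Type*} [MeasurableSpace X] {μ : Measure X} {f g h : X → ℝ} {A B c : ℝ}
    (hg : Measurable g) (hg0 : ∀ x, 0 ≤ g x) (hh0 : ∀ x, 0 ≤ h x) (hc : 0 ≤ c) (hA : 0 ≤ A) (hB : 0 ≤ B)
    (hfg : ∀ x, f x ≤ c * (g x + h x)) (h1 : ∫⁻ x, ENNReal.ofReal (g x) ∂μ ≤ ENNReal.ofReal A)
    (h2 : ∫⁻ x, ENNReal.ofReal (h x) ∂μ ≤ ENNReal.ofReal B) :
    ∫⁻ x, ENNReal.ofReal (f x) ∂μ ≤ ENNReal.ofReal (c * (A + B)) := by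
  calc ∫⁻ x, ENNReal.ofReal (f x) ∂μ ≤ ∫⁻ x, ENNReal.ofReal c * (ENNReal.ofReal (g x) + ENNReal.ofReal (h x)) ∂μ := by
        refine lintegral_mono (fun x => ?_)
        rw [← ENNReal.ofReal_add (hg0 x) (hh0 x), ← ENNReal.ofReal_mul hc]
        exact ENNReal.ofReal_le_ofReal (hfg x)
    _ = ENNReal.ofReal c * ((∫⁻ x, ENNReal.ofReal (g x) ∂μ) + ∫⁻ x, ENNReal.ofReal (h x) ∂μ) := by
        rw [lintegral_const_mul' _ _ ENNReal.ofReal_ne_top, lintegral_add_left hg.ennreal_ofReal]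
    _ ≤ ENNReal.ofReal c * (ENNReal.ofReal A + ENNReal.ofReal B) := mul_le_mul' le_rfl (add_le_add h1 h2)
    _ = _ := by rw [← ENNReal.ofReal_add hA hB, ← ENNReal.ofReal_mul hc]

theorem mean_zero (n : ℕ) {u : En n → ℝ} (hu : Measurable u) {Λ : ℝ} (hΛ : ∀ x, |u x| ≤ Λ) :
    ∫ y in BB n, (u y - cj n u 0) = 0 := by
  have hfin : volume (BB n) ≠ ⊤ := measure_ball_lt_top.ne
  have hi : IntegrableOn u (BB n) :=
    Measure.integrableOn_of_bounded hfin hu.aestronglyMeasurable (M := Λ)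
      (Filter.Eventually.of_forall (fun x => by rw [Real.norm_eq_abs]; exact hΛ x))
  have hpos : 0 < volume.real (BB n) := by
    rw [measureReal_def]; exact ENNReal.toReal_pos (measure_ball_pos _ _ one_pos).ne' hfin
  rw [integral_sub hi (integrableOn_const hfin), setIntegral_const, cj]
  simp only [Bd, pow_zero]
  rw [setAverage_eq, smul_eq_mul, smul_eq_mul, BB, ← mul_assoc, mul_inv_cancel₀ hpos.ne', one_mul, sub_self]

theorem lamQ_le {lam Q η p : ℝ} (hl : 0 < lam) (hQ : 0 < Q) (hp : 2 ≤ p) (hQl : Q ≤ lam ^ η) :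
    lam ^ (1 - η) * Q ≤ (lam ^ (p - η) * Q) ^ (1 / p) := by
  have hp0 : 0 < p := by linarith
  have h1 : (lam ^ (1 - η) * Q) ^ p ≤ lam ^ (p - η) * Q := by
    rw [Real.mul_rpow (by positivity) hQ.le, ← Real.rpow_mul hl.le]
    have e1 : Q ^ p = Q ^ (p - 1) * Q := by rw [← Real.rpow_add_one hQ.ne']; congr 1; ring
    have e2 : Q ^ (p - 1) ≤ (lam ^ η) ^ (p - 1) := Real.rpow_le_rpow hQ.le hQl (by linarith)
    rw [← Real.rpow_mul hl.le] at e2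
    rw [e1]
    calc lam ^ ((1 - η) * p) * (Q ^ (p - 1) * Q) ≤ lam ^ ((1 - η) * p) * (lam ^ (η * (p - 1)) * Q) := by gcongr
      _ = lam ^ ((1 - η) * p) * lam ^ (η * (p - 1)) * Q := by ring
      _ = _ := by rw [← Real.rpow_add hl]; congr 2; ring
  calc lam ^ (1 - η) * Q = ((lam ^ (1 - η) * Q) ^ p) ^ (1 / p) := by
        rw [← Real.rpow_mul (by positivity), show p * (1 / p) = 1 by field_simp, Real.rpow_one]
    _ ≤ _ := Real.rpow_le_rpow (by positivity) h1 (by positivity)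

set_option maxHeartbeats 400000 in
theorem good_bounds (n : ℕ) (hn : 2 ≤ n) {p s C0 : ℝ} (hp : 2 ≤ p) (hs0 : 0 < s) (hs1 : s < 1) (hsp : s * p < n)
    (hC0 : 0 < C0) : ∃ C : ℝ, 0 < C ∧
    ∀ (η β e lam Λ Q : ℝ) (w : En n → ℝ), 1 ≤ η → η ≤ p → 0 < β → e = s * p - β * (p - η) → β * (η - 1) ≤ e →
    0 ≤ e → e ≤ p → 0 < lam → Measurable w → (∀ x, |w x| ≤ Λ) → ∫ y in BB n, w y = 0 → 0 < Q → Q ≤ lam ^ η →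
    ∫⁻ x in BB n, ∫⁻ y in BB n, gk n η e w x y ≤ ENNReal.ofReal Q →
    ∫⁻ x in BB n, ENNReal.ofReal (|w x| ^ p) ≤ ENNReal.ofReal (C0 * (lam ^ (p - η) * Q)) →
    ∃ v : En n → ℝ, Measurable v ∧ (∃ Λ', ∀ x, |v x| ≤ Λ') ∧
      ∫⁻ x in BB n, ENNReal.ofReal |w x - v x| ≤ ENNReal.ofReal (C * (lam ^ (1 - η) * Q)) ∧
      ∫⁻ x in BB n, ENNReal.ofReal (|w x - v x| ^ p) ≤ ENNReal.ofReal (C * (lam ^ (p - η) * Q)) ∧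
      ∫⁻ z in B2 n, ENNReal.ofReal (Rk n p s v (fun x => w x - v x) z) ≤ ENNReal.ofReal (C * (lam ^ (p - η) * Q)) := by
  have hp0 : 0 < p := by linarith
  have hn0 : (0:ℝ) < n := by positivity
  have hd : 0 < (n:ℝ) - s * p := by linarith
  obtain ⟨c1, hc1, h1⟩ := good_part n hn hp hs0 hs1
  obtain ⟨c2, hc2, h2⟩ := lr_of_lp n (r := 1) (P := p) (by norm_num) (by linarith) hp0
  obtain ⟨c3, hc3, h3⟩ := sob_abs n hn hp hs0 hsp
  have hpP : p ≤ n * p / (n - s * p) := by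
    rw [le_div_iff₀ hd]
    have : 0 < s * p := by positivity
    nlinarith
  obtain ⟨c4, hc4, h4⟩ := lr_of_lp n (r := p) (P := n * p / (n - s * p)) hp0.le hpP (by positivity)
  obtain ⟨c5, hc5, h5⟩ := R_int n hn hp hs0 hs1
  set k2 : ℝ := c2 * C0 ^ (1 / p) with hk2
  set k3 : ℝ := c3 * (c1 ^ (1 / p) + (k2 + c1)) with hk3
  set k4 : ℝ := c4 * k3 ^ p with hk4
  set k5 : ℝ := 2 ^ p * (C0 + k4) with hk5
  have hk2p : 0 < k2 := by positivity
  have hk3p : 0 < k3 := by positivity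
  have hk4p : 0 < k4 := by positivity
  have hk5p : 0 < k5 := by positivity
  refine ⟨c1 + k5 + c5 * (c1 + k5), by positivity, fun η β e lam Λ Q w hη hηp hβ hee hβe he hep hl hw hΛ hmean hQ hQl hQ' hwp => ?_⟩
  obtain ⟨v, hv, ⟨Λ', hΛ'⟩, hv1, hv2⟩ := h1 η β e lam Λ Q w hη hηp hβ hee hβe he hep hl hw hΛ hmean hQ hQ'
  have hYp : 0 < lam ^ (p - η) * Q := by positivity
  have hlq := lamQ_le (p := p) hl hQ hp hQl
  set Y := lam ^ (p - η) * Q with hY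
  set q1 := lam ^ (1 - η) * Q with hq1
  have hq1p : 0 < q1 := by positivity
  set y := Y ^ (1 / p) with hy
  have hyp : 0 < y := by positivity
  have hyY : y ^ p = Y := by
    rw [hy, ← Real.rpow_mul hYp.le, show 1 / p * p = 1 by field_simp, Real.rpow_one]
  have hw1 : ∫⁻ x in BB n, ENNReal.ofReal |w x| ≤ ENNReal.ofReal (k2 * y) := by
    have := h2 w (C0 ^ (1 / p) * y) hw (by positivity) (by
      rw [Real.mul_rpow (by positivity) hyp.le, hyY, ← Real.rpow_mul hC0.le,
        show 1 / p * p = 1 by field_simp, Real.rpow_one]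
      exact hwp)
    simp only [Real.rpow_one] at this
    rw [hk2, mul_assoc]; exact this
  have hvL1 : ∫⁻ x in BB n, ENNReal.ofReal |v x| ≤ ENNReal.ofReal (1 * (k2 * y + c1 * q1)) := by
    refine lint_add_bd (g := fun x => |w x|) (h := fun x => |w x - v x|) (by fun_prop) (fun _ => abs_nonneg _)
      (fun _ => abs_nonneg _) zero_le_one (by positivity) (by positivity) (fun x => ?_) hw1 hv2
    have := abs_sub (w x) (w x - v x)
    rw [sub_sub_cancel] at this
    linarith
  have hvL1' : ∫⁻ x in BB n, ENNReal.ofReal |v x| ≤ ENNReal.ofReal ((k2 + c1) * y) := by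
    refine hvL1.trans (ENNReal.ofReal_le_ofReal ?_)
    rw [one_mul, add_mul]
    exact add_le_add le_rfl (mul_le_mul_of_nonneg_left hlq hc1.le)
  have hvP := h3 v Λ' (c1 * Y) ((k2 + c1) * y) hv hΛ' (by positivity) (by positivity) hv1 hvL1'
  have e3 : c3 * ((c1 * Y) ^ (1 / p) + (k2 + c1) * y) = k3 * y := by
    rw [Real.mul_rpow hc1.le hYp.le, hk3]; ring
  rw [e3] at hvP
  have hvp := h4 v (k3 * y) hv (by positivity) hvP
  rw [Real.mul_rpow hk3p.le hyp.le, hyY, ← mul_assoc] at hvp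
  have hgp : ∫⁻ x in BB n, ENNReal.ofReal (|w x - v x| ^ p) ≤ ENNReal.ofReal (2 ^ p * (C0 * Y + k4 * Y)) := by
    refine lint_add_bd (g := fun x => |w x| ^ p) (h := fun x => |v x| ^ p) (by fun_prop) (fun _ => by positivity)
      (fun _ => by positivity) (by positivity) (by positivity) (by positivity) (fun x => ?_) hwp hvp
    refine (Real.rpow_le_rpow (abs_nonneg _) (abs_sub _ _) hp0.le).trans ?_
    exact add_rpow_two (abs_nonneg _) (abs_nonneg _) hp0.le
  have hgp' : ∫⁻ x in BB n, ENNReal.ofReal (|w x - v x| ^ p) ≤ ENNReal.ofReal (k5 * Y) := by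
    refine hgp.trans (le_of_eq ?_)
    rw [hk5]; congr 1; ring
  have hR := h5 v (fun x => w x - v x) (c1 * Y) (k5 * Y) hv (by fun_prop) (by positivity) (by positivity) hv1 hgp'
  refine ⟨v, hv, ⟨Λ', hΛ'⟩, hv2.trans (ENNReal.ofReal_le_ofReal ?_), hgp'.trans (ENNReal.ofReal_le_ofReal ?_),
    hR.trans (ENNReal.ofReal_le_ofReal ?_)⟩
  · refine mul_le_mul_of_nonneg_right ?_ hq1p.le
    have : 0 < c5 * (c1 + k5) := by positivity
    linarith
  · refine mul_le_mul_of_nonneg_right ?_ hYp.le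
    have : 0 < c5 * (c1 + k5) := by positivity
    linarith
  · rw [← add_mul, ← mul_assoc]
    refine mul_le_mul_of_nonneg_right ?_ hYp.le
    linarith

set_option maxHeartbeats 1000000 in
theorem energy_main (n : ℕ) (hn : 2 ≤ n) {p s b K0 : ℝ} (hp : 2 ≤ p) (hs0 : 0 < s) (hs1 : s < 1) (hsp : s * p < n)
    (hb : 0 < b) (hbs : b ≤ s * p) (hK0 : 1 ≤ K0) : ∃ C : ℝ, 0 < C ∧
    ∀ (η β κ lam F : ℝ) (Q : ℕ → ℝ) (K : En n × En n → ℝ) (u f : En n → ℝ), Adm n p s b K0 K u f →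
    1 ≤ η → p / 2 ≤ η → η ≤ p → 0 < κ → 1 / p = 1 / η - κ / n → 0 < β → κ * η = s * p - β * (p - η) →
    β * (η - 1) ≤ κ * η → κ * η ≤ p → 0 < lam → (∀ j, 0 < Q j) →
    (∀ j, ∫⁻ x in Bd n j, ∫⁻ y in Bd n j, gk n η (κ * η) u x y ≤ ENNReal.ofReal (Q j)) →
    (∀ N, ∑ k ∈ Finset.range N, (2:ℝ) ^ (-(k:ℝ) * b) * (((2:ℝ) ^ k) ^ (-((n:ℝ) / p)) * Q k ^ (1 / η)) ^ (p - 1)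
      ≤ lam ^ (p - 1)) →
    0 ≤ F → ∫⁻ x in BB n, ENNReal.ofReal (|f x| ^ pStar n p s) ≤ ENNReal.ofReal (F ^ pStar n p s) →
    ∫⁻ z in ball (0 : En n) (1/4) ×ˢ ball (0 : En n) (1/4),
      ENNReal.ofReal (|u z.1 - u z.2| ^ p / ‖z.1 - z.2‖ ^ ((n:ℝ) + s * p)) ≤
      ENNReal.ofReal (C * (lam ^ (p - η) * Q 0 + F ^ pC p)) := by
  have hp0 : 0 < p := by linarith
  have hn0 : (0:ℝ) < n := by positivity
  have hd : 0 < (n:ℝ) - s * p := by linarith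
  obtain ⟨c1, hc1, h1⟩ := tail_main (s := s) n hn hp hK0 hb hbs
  obtain ⟨c2, hc2, h2⟩ := good_bounds n hn hp hs0 hs1 hsp hc1
  obtain ⟨c3, hc3, h3⟩ := sob_abs n hn hp hs0 hsp
  set c4 : ℝ := K0 * 2 ^ (s * p) * 2 ^ p with hc4
  have hc4p : 0 < c4 := by positivity
  set C7 : ℝ := c4 * c2 + 2 * (c1 * ((c2 + c1) + c2)) with hC7
  set C6 : ℝ := c3 * ((2 ^ p * (1 + c2)) ^ (1 / p) + c2) with hC6
  have hC6p : 0 < C6 := by positivity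
  have hC7p : 0 < C7 := by positivity
  refine ⟨(1 + 4 * C7) + 4 * (4 * C6) ^ pC p, by positivity,
    fun η β κ lam F Q K u f hA hη hpη hηp hκ hrel hβ he hβe hep hl hQ hQe hsum hF hFe => ?_⟩
  have hη0 : 0 < η := by linarith
  obtain ⟨Λ, hΛ⟩ := hA.ub
  have hu := hA.um
  obtain ⟨ht1, ht2⟩ := h1 η κ Λ lam u Q hη hpη hηp hκ hrel hu hΛ hl hQ hQe hsum
  set c0 := cj n u 0 with hc0
  -- X ≤ lam
  have hX : Q 0 ^ (1 / η) ≤ lam := by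
    have := hsum 1
    simp only [Finset.range_one, Finset.sum_singleton, Nat.cast_zero, neg_zero, zero_mul, Real.rpow_zero,
      pow_zero, Real.one_rpow, one_mul] at this
    exact (Real.rpow_le_rpow_iff (by have := hQ 0; positivity) hl.le (by linarith)).1 this
  have hQ0 := hQ 0
  have hXp : 0 < Q 0 ^ (1 / η) := by positivity
  have eXη : (Q 0 ^ (1 / η)) ^ η = Q 0 := by
    rw [← Real.rpow_mul hQ0.le, show 1 / η * η = 1 by field_simp, Real.rpow_one]
  have hQl : Q 0 ≤ lam ^ η := by
    rw [← eXη]; exact Real.rpow_le_rpow hXp.le hX hη0.le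
  have hYp : 0 < lam ^ (p - η) * Q 0 := by positivity
  have hXY : (Q 0 ^ (1 / η)) ^ p ≤ lam ^ (p - η) * Q 0 := by
    calc (Q 0 ^ (1 / η)) ^ p = (Q 0 ^ (1 / η)) ^ (p - η) * (Q 0 ^ (1 / η)) ^ η := by
          rw [← Real.rpow_add hXp]; congr 1; ring
      _ ≤ lam ^ (p - η) * (Q 0 ^ (1 / η)) ^ η := by
          gcongr
      _ = _ := by rw [eXη]
  have hwp : ∫⁻ x in BB n, ENNReal.ofReal (|u x - c0| ^ p) ≤ ENNReal.ofReal (c1 * (lam ^ (p - η) * Q 0)) := by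
    refine ht1.trans (ENNReal.ofReal_le_ofReal ?_)
    gcongr
  have hgk0 : ∫⁻ x in BB n, ∫⁻ y in BB n, gk n η (κ * η) (fun x => u x - c0) x y ≤ ENNReal.ofReal (Q 0) := by
    have := hQe 0
    simp only [Bd, pow_zero] at this
    simp only [gk, sub_sub_sub_cancel_right] at this ⊢
    exact this
  have hlq := lamQ_le (p := p) hl hQ0 hp hQl
  obtain ⟨v, hv, ⟨Λ', hΛ'⟩, hg1, hgp, hR⟩ := h2 η β (κ * η) lam (Λ + |c0|) (Q 0) (fun x => u x - c0) hη hηp hβ he hβe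
    (by positivity) hep hl (by fun_prop) (fun x => by
      have h3 := abs_sub (u x) c0
      have h4 := hΛ x
      linarith) (mean_zero n hu hΛ) hQ0 hQl hgk0 hwp
  have elam : lam ^ (p - 1) * (lam ^ (1 - η) * Q 0) = lam ^ (p - η) * Q 0 := by
    rw [← mul_assoc, ← Real.rpow_add hl]; congr 2; ring
  set Y := lam ^ (p - η) * Q 0 with hY
  set q1 := lam ^ (1 - η) * Q 0 with hq1
  have hq1p : 0 < q1 := by positivity
  have hψ := psi_meas n
  have hgm : Measurable (fun x => u x - c0 - v x) := by fun_prop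
  obtain ⟨hEfin, hE⟩ := energy_raw n hn hp hs0 hsp hb hbs hA hv hΛ' c0
    (T := fun x => c1 * (|u x - c0| ^ (p - 1) + lam ^ (p - 1))) ht2 (lt_of_le_of_lt hR ENNReal.ofReal_lt_top)
  -- off-diagonal term
  have hT : ∫⁻ x in BB n, ENNReal.ofReal (|psi n x ^ p * (u x - c0 - v x)| * (c1 * (|u x - c0| ^ (p - 1) + lam ^ (p - 1))))
      ≤ ENNReal.ofReal (c1 * ((c2 * Y + c1 * Y) + c2 * Y)) := by
    have i1 : ∫⁻ x in BB n, ENNReal.ofReal (|u x - c0 - v x| ^ p + |u x - c0| ^ p) ≤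
        ENNReal.ofReal (1 * (c2 * Y + c1 * Y)) := by
      refine lint_add_bd (g := fun x => |u x - c0 - v x| ^ p) (h := fun x => |u x - c0| ^ p) (by fun_prop)
        (fun _ => by positivity) (fun _ => by positivity) zero_le_one (by positivity) (by positivity)
        (fun x => by rw [one_mul]) hgp hwp
    rw [one_mul] at i1
    have i2 : ∫⁻ x in BB n, ENNReal.ofReal (lam ^ (p - 1) * |u x - c0 - v x|) ≤ ENNReal.ofReal (c2 * Y) := by
      have : ∀ x, ENNReal.ofReal (lam ^ (p - 1) * |u x - c0 - v x|) =
          ENNReal.ofReal (lam ^ (p - 1)) * ENNReal.ofReal |u x - c0 - v x| :=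
        fun x => ENNReal.ofReal_mul (by positivity)
      simp_rw [this]
      rw [lintegral_const_mul' _ _ ENNReal.ofReal_ne_top]
      refine (mul_le_mul' le_rfl hg1).trans (le_of_eq ?_)
      rw [← ENNReal.ofReal_mul (by positivity), ← elam]; congr 1; ring
    refine lint_add_bd (g := fun x => |u x - c0 - v x| ^ p + |u x - c0| ^ p) (h := fun x => lam ^ (p - 1) * |u x - c0 - v x|)
      (by fun_prop) (fun _ => by positivity) (fun _ => by positivity) hc1.le (by positivity) (by positivity)
      (fun x => ?_) i1 i2
    have hφ : |psi n x ^ p * (u x - c0 - v x)| ≤ |u x - c0 - v x| := by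
      rw [abs_mul, abs_of_nonneg (Real.rpow_nonneg (psi_nonneg n x) _)]
      exact mul_le_of_le_one_left (abs_nonneg _) (Real.rpow_le_one (psi_nonneg n x) (psi_le n x) hp0.le)
    have hyo : |u x - c0 - v x| * |u x - c0| ^ (p - 1) ≤ |u x - c0 - v x| ^ p + |u x - c0| ^ p := by
      have ha := abs_nonneg (u x - c0 - v x)
      have hbb := abs_nonneg (u x - c0)
      generalize |u x - c0 - v x| = a at *
      generalize |u x - c0| = d at *
      have hpow : ∀ t : ℝ, 0 ≤ t → t ^ p = t * t ^ (p - 1) := by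
        intro t ht
        rcases ht.eq_or_lt with rfl | h
        · rw [Real.zero_rpow (by linarith)]; simp
        · rw [mul_comm, ← Real.rpow_add_one h.ne']; congr 1; ring
      have h1p : 0 ≤ a ^ p := by positivity
      have h2p : 0 ≤ d ^ p := by positivity
      rcases le_total a d with h | h
      · rw [hpow d hbb] at *
        have : a * d ^ (p - 1) ≤ d * d ^ (p - 1) := mul_le_mul_of_nonneg_right h (by positivity)
        linarith
      · rw [hpow a ha] at *
        have : a * d ^ (p - 1) ≤ a * a ^ (p - 1) :=
          mul_le_mul_of_nonneg_left (Real.rpow_le_rpow hbb h (by linarith)) ha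
        linarith
    calc |psi n x ^ p * (u x - c0 - v x)| * (c1 * (|u x - c0| ^ (p - 1) + lam ^ (p - 1)))
        ≤ |u x - c0 - v x| * (c1 * (|u x - c0| ^ (p - 1) + lam ^ (p - 1))) :=
          mul_le_mul_of_nonneg_right hφ (by positivity)
      _ = c1 * (|u x - c0 - v x| * |u x - c0| ^ (p - 1) + lam ^ (p - 1) * |u x - c0 - v x|) := by ring
      _ ≤ _ := by gcongr
  -- name the energy
  obtain ⟨E, hE0, hEeq⟩ : ∃ E : ℝ, 0 ≤ E ∧ ∫⁻ z in B2 n, ENNReal.ofReal (El n p s u z) = ENNReal.ofReal E :=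
    ⟨_, ENNReal.toReal_nonneg, (ENNReal.ofReal_toReal hEfin.ne).symm⟩
  rw [hEeq] at hE
  -- Sobolev for the localized function
  have hEm := El_meas n p s hu
  have hhm : Measurable (fun x => psi n x * (u x - c0 - v x)) := by fun_prop
  have hh1 : ∀ x, |psi n x * (u x - c0 - v x)| ≤ |u x - c0 - v x| := by
    intro x
    rw [abs_mul, abs_of_nonneg (psi_nonneg n x)]
    exact mul_le_of_le_one_left (abs_nonneg _) (psi_le n x)
  have hhg : ∫⁻ x in BB n, ∫⁻ y in BB n, gk n p (s * p) (fun x => psi n x * (u x - c0 - v x)) x y ≤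
      ENNReal.ofReal (2 ^ p * (E + c2 * Y)) := by
    rw [← b2_lint n (gk_meas n p (s * p) hhm)]
    unfold gk
    refine lint_add_bd (g := El n p s u) (h := Rk n p s v (fun x => u x - c0 - v x)) hEm (El_nonneg n p s u)
      (fun z => by unfold Rk; positivity) (by positivity) hE0 (by positivity) (fun z => ?_) hEeq.le hR
    have hq := pt_psi (A := psi n z.1) (B := psi n z.2) (wx := u z.1 - c0) (wy := u z.2 - c0) (vx := v z.1) (vy := v z.2)
        (psi_nonneg n _) (psi_le n _) hp (psi_lip n _ _)
    rw [sub_sub_sub_cancel_right] at hq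
    have hψ0 := psi_nonneg n z.1
    unfold El Rk
    rw [← add_div, ← mul_div_assoc]
    gcongr
    refine (Real.rpow_le_rpow (abs_nonneg _) hq hp0.le).trans ?_
    refine (add_rpow_two (by positivity) (by positivity) hp0.le).trans (le_of_eq ?_)
    rw [Real.mul_rpow hψ0 (abs_nonneg _)]
  have hhL1 : ∫⁻ x in BB n, ENNReal.ofReal |psi n x * (u x - c0 - v x)| ≤ ENNReal.ofReal (c2 * q1) :=
    (lintegral_mono (fun x => ENNReal.ofReal_le_ofReal (hh1 x))).trans hg1
  have hhP := h3 (fun x => psi n x * (u x - c0 - v x)) (Λ + |c0| + Λ') (2 ^ p * (E + c2 * Y)) (c2 * q1) hhm (fun x => by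
      refine (hh1 x).trans ?_
      have h1 := hΛ x
      have h2 := hΛ' x
      have h3 := abs_sub (u x - c0) (v x)
      have h4 := abs_sub (u x) c0
      linarith) (by positivity) (by positivity) hhg hhL1
  have hZ : c3 * ((2 ^ p * (E + c2 * Y)) ^ (1 / p) + c2 * q1) ≤ C6 * (E + Y) ^ (1 / p) := by
    have i1 : (2 ^ p * (E + c2 * Y)) ^ (1 / p) ≤ (2 ^ p * (1 + c2)) ^ (1 / p) * (E + Y) ^ (1 / p) := by
      rw [← Real.mul_rpow (by positivity) (by positivity)]
      refine Real.rpow_le_rpow (by positivity) ?_ (by positivity)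
      rw [mul_assoc]
      refine mul_le_mul_of_nonneg_left ?_ (by positivity)
      have := mul_nonneg hc2.le hE0
      linarith [add_mul 1 c2 (E + Y), mul_add c2 E Y]
    have i2 : q1 ≤ (E + Y) ^ (1 / p) :=
      hlq.trans (Real.rpow_le_rpow hYp.le (by linarith) (by positivity))
    rw [hC6, mul_assoc, add_mul]
    gcongr
  have hdat := data_bd n hn hp hs0 hsp (f := f) (φ := fun x => psi n x ^ p * (u x - c0 - v x)) hA.fm hhm hF
    (by positivity) (fun x hx => by
      have : x ∉ ball (0 : En n) (1/2) := fun h => hx (ball_subset_ball (by norm_num) h)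
      rw [psi_zero n this, Real.zero_rpow hp0.ne', zero_mul]) (fun x => by
      rw [abs_mul, abs_mul, abs_of_nonneg (psi_nonneg n x), abs_of_nonneg (Real.rpow_nonneg (psi_nonneg n x) _)]
      refine mul_le_mul_of_nonneg_right ?_ (abs_nonneg _)
      rcases (psi_nonneg n x).eq_or_lt with h | h
      · rw [← h, Real.zero_rpow hp0.ne']
      · calc psi n x ^ p ≤ psi n x ^ (1:ℝ) := Real.rpow_le_rpow_of_exponent_ge h (psi_le n x) (by linarith)
          _ = _ := Real.rpow_one _) hFe hhP
  have hfinal : 1/2 * E ≤ F * (C6 * (E + Y) ^ (1 / p)) + C7 * Y := by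
    have hz : ENNReal.ofReal (1/2 * E) ≤ ENNReal.ofReal (F * (C6 * (E + Y) ^ (1 / p)) + C7 * Y) := by
      rw [ENNReal.ofReal_mul (by norm_num)]
      refine hE.trans ?_
      have i1 := hdat.trans (ENNReal.ofReal_le_ofReal (mul_le_mul_of_nonneg_left hZ hF))
      have i2 := add_le_add (mul_le_mul' (le_refl (ENNReal.ofReal c4)) hR) (mul_le_mul' (le_refl (2:ℝ≥0∞)) hT)
      refine (add_le_add i1 i2).trans (le_of_eq ?_)
      rw [← ENNReal.ofReal_mul hc4p.le, show (2:ℝ≥0∞) = ENNReal.ofReal 2 by simp, ← ENNReal.ofReal_mul (by norm_num),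
        ← ENNReal.ofReal_add (by positivity) (by positivity), ← ENNReal.ofReal_add (by positivity) (by positivity)]
      congr 1
      rw [hC7]; ring
    exact (ENNReal.ofReal_le_ofReal_iff (by positivity)).1 hz
  have habs := absorb hE0 hYp.le hF hp hC6p.le hfinal
  calc ∫⁻ z in ball (0 : En n) (1/4) ×ˢ ball (0 : En n) (1/4),
      ENNReal.ofReal (|u z.1 - u z.2| ^ p / ‖z.1 - z.2‖ ^ ((n:ℝ) + s * p))
      ≤ ∫⁻ z in ball (0 : En n) (1/4) ×ˢ ball (0 : En n) (1/4), ENNReal.ofReal (El n p s u z) := by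
        refine setLIntegral_mono' (measurableSet_ball.prod measurableSet_ball) (fun z hz => le_of_eq ?_)
        unfold El
        rw [psi_one n hz.1, Real.one_rpow, one_mul]
    _ ≤ ∫⁻ z in B2 n, ENNReal.ofReal (El n p s u z) :=
        lintegral_mono_set (prod_mono (ball_subset_ball (by norm_num)) (ball_subset_ball (by norm_num)))
    _ = ENNReal.ofReal E := hEeq
    _ ≤ _ := by
        refine ENNReal.ofReal_le_ofReal (habs.trans ?_)
        have i1 : 0 ≤ F ^ pC p := by positivity
        have i2 : 0 < (4 * C6) ^ pC p := by positivity
        have i3 := mul_nonneg i2.le hYp.le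
        have i4 := mul_nonneg hC7p.le i1
        rw [mul_add, add_mul, add_mul]
        linarith

section aff
variable {E : Type*} [NormedAddCommGroup E] [NormedSpace ℝ E] [MeasurableSpace E] [BorelSpace E]
  (μ : Measure E) [μ.IsAddHaarMeasure]

theorem aff_emb (a : E) {R : ℝ} (hR : 0 < R) : MeasurableEmbedding (fun x : E => a + R • x) :=
  ((Homeomorph.smulOfNeZero R hR.ne').trans (Homeomorph.addLeft a)).measurableEmbedding

variable [FiniteDimensional ℝ E]

theorem map_aff (a : E) {R : ℝ} (hR : 0 < R) :
    Measure.map (fun x : E => a + R • x) μ = ENNReal.ofReal (R ^ (-(Module.finrank ℝ E : ℝ))) • μ := by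
  have h1 : Measure.map (fun x : E => a + R • x) μ = Measure.map (fun x => a + x) (Measure.map (fun x => R • x) μ) := by
    rw [Measure.map_map (by fun_prop) (by fun_prop)]; rfl
  rw [h1, Measure.map_addHaar_smul μ hR.ne', Measure.map_smul, map_add_left_eq_self]
  congr 2
  rw [Real.rpow_neg hR.le, Real.rpow_natCast, abs_of_pos (by positivity)]

theorem aff_lint (a : E) {R : ℝ} (hR : 0 < R) (g : E → ℝ≥0∞) :
    ∫⁻ x, g (a + R • x) ∂μ = ENNReal.ofReal (R ^ (-(Module.finrank ℝ E : ℝ))) * ∫⁻ x, g x ∂μ := by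
  rw [← (aff_emb a hR).lintegral_map g, map_aff μ a hR, lintegral_smul_measure, smul_eq_mul]

theorem aff_int (a : E) {R : ℝ} (hR : 0 < R) (g : E → ℝ) :
    ∫ x, g (a + R • x) ∂μ = R ^ (-(Module.finrank ℝ E : ℝ)) * ∫ x, g x ∂μ := by
  rw [← (aff_emb a hR).integral_map g, map_aff μ a hR, integral_smul_measure, smul_eq_mul,
    ENNReal.toReal_ofReal (by positivity)]

theorem aff_slint (a : E) {R : ℝ} (hR : 0 < R) {S S' : Set E} (hS : MeasurableSet S) (hS' : MeasurableSet S')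
    (hSS : ∀ x, a + R • x ∈ S ↔ x ∈ S') (g : E → ℝ≥0∞) :
    ∫⁻ x in S', g (a + R • x) ∂μ = ENNReal.ofReal (R ^ (-(Module.finrank ℝ E : ℝ))) * ∫⁻ x in S, g x ∂μ := by
  rw [← lintegral_indicator hS, ← aff_lint μ a hR, ← lintegral_indicator hS']
  refine lintegral_congr (fun x => ?_)
  by_cases hx : x ∈ S'
  · rw [indicator_of_mem hx, indicator_of_mem ((hSS x).2 hx)]
  · rw [indicator_of_notMem hx, indicator_of_notMem (fun h => hx ((hSS x).1 h))]

end aff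

theorem mem_aff_ball {n : ℕ} (x₀ x : En n) {R c : ℝ} (hR : 0 < R) :
    x₀ + R • x ∈ ball x₀ (c * R) ↔ x ∈ ball (0 : En n) c := by
  rw [mem_ball_iff_norm, mem_ball_zero_iff, add_sub_cancel_left, norm_smul, Real.norm_of_nonneg hR.le, mul_comm]
  exact mul_lt_mul_iff_left₀ hR

/-- affine map on the product -/
def T2 {n : ℕ} (x₀ : En n) (R : ℝ) (z : En n × En n) : En n × En n := (x₀ + R • z.1, x₀ + R • z.2)

theorem T2_eq {n : ℕ} (x₀ : En n) (R : ℝ) (z : En n × En n) : T2 x₀ R z = (x₀, x₀) + R • z := rfl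

theorem T2_norm {n : ℕ} (x₀ : En n) {R : ℝ} (hR : 0 < R) (z : En n × En n) :
    ‖(T2 x₀ R z).1 - (T2 x₀ R z).2‖ = R * ‖z.1 - z.2‖ := by
  simp only [T2, add_sub_add_left_eq_sub]
  rw [← smul_sub, norm_smul, Real.norm_of_nonneg hR.le]

theorem mem_T2 {n : ℕ} (x₀ : En n) {R c : ℝ} (hR : 0 < R) (z : En n × En n) :
    T2 x₀ R z ∈ bB n x₀ (c * R) ↔ z ∈ bB n 0 c := by
  simp only [bB, mem_prod, T2, mem_aff_ball _ _ hR]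

theorem bB_meas (n : ℕ) (x₀ : En n) (R : ℝ) : MeasurableSet (bB n x₀ R) := measurableSet_ball.prod measurableSet_ball

theorem fr_prod (n : ℕ) : ((Module.finrank ℝ (En n × En n) : ℕ) : ℝ) = 2 * n := by
  rw [Module.finrank_prod, finrank_euclideanSpace, Fintype.card_fin]; push_cast; ring

theorem vol_haar (n : ℕ) : (volume : Measure (En n × En n)).IsAddHaarMeasure := by
  rw [Measure.volume_eq_prod]; infer_instance

theorem T2_slint {n : ℕ} (x₀ : En n) {R c : ℝ} (hR : 0 < R) (g : En n × En n → ℝ≥0∞) :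
    ∫⁻ z in bB n 0 c, g (T2 x₀ R z) = ENNReal.ofReal (R ^ (-(2 * n : ℝ))) * ∫⁻ z in bB n x₀ (c * R), g z := by
  have hh := vol_haar n
  have := aff_slint (volume : Measure (En n × En n)) (x₀, x₀) hR (bB_meas n x₀ (c * R)) (bB_meas n 0 c)
    (fun z => mem_T2 x₀ hR z) g
  rw [fr_prod] at this
  exact this

theorem T2_lint {n : ℕ} (x₀ : En n) {R : ℝ} (hR : 0 < R) (g : En n × En n → ℝ≥0∞) :
    ∫⁻ z, g (T2 x₀ R z) = ENNReal.ofReal (R ^ (-(2 * n : ℝ))) * ∫⁻ z, g z := by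
  have hh := vol_haar n
  have := aff_lint (volume : Measure (En n × En n)) (x₀, x₀) hR g
  rw [fr_prod] at this
  exact this

theorem T2_int {n : ℕ} (x₀ : En n) {R : ℝ} (hR : 0 < R) (g : En n × En n → ℝ) :
    ∫ z, g (T2 x₀ R z) = R ^ (-(2 * n : ℝ)) * ∫ z, g z := by
  have hh := vol_haar n
  have := aff_int (volume : Measure (En n × En n)) (x₀, x₀) hR g
  rw [fr_prod] at this
  exact this

theorem T1_slint {n : ℕ} (x₀ : En n) {R : ℝ} (hR : 0 < R) (g : En n → ℝ≥0∞) :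
    ∫⁻ x in BB n, g (x₀ + R • x) = ENNReal.ofReal (R ^ (-(n : ℝ))) * ∫⁻ x in ball x₀ R, g x := by
  have := aff_slint (volume : Measure (En n)) x₀ hR (measurableSet_ball (x := x₀) (ε := 1 * R)) (measurableSet_ball (x := (0 : En n)) (ε := 1))
    (fun z => mem_aff_ball x₀ z hR) g
  rw [finrank_euclideanSpace, Fintype.card_fin, one_mul] at this
  exact this

theorem T1_int {n : ℕ} (x₀ : En n) {R : ℝ} (hR : 0 < R) (g : En n → ℝ) :
    ∫ x, g (x₀ + R • x) = R ^ (-(n : ℝ)) * ∫ x, g x := by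
  have := aff_int (volume : Measure (En n)) x₀ hR g
  rw [finrank_euclideanSpace, Fintype.card_fin] at this
  exact this

/-- density of nu -/
def dn (n : ℕ) (p ε : ℝ) (z : En n × En n) : ℝ := ‖z.1 - z.2‖ ^ (ε * p - n)

theorem dn_meas (n : ℕ) (p ε : ℝ) : Measurable (dn n p ε) := by unfold dn; fun_prop
theorem dn_nonneg (n : ℕ) (p ε : ℝ) (z) : 0 ≤ dn n p ε z := by unfold dn; positivity

theorem nu_slint (n : ℕ) (p ε : ℝ) {g : En n × En n → ℝ} (hg : Measurable g) {S : Set (En n × En n)}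
    (hS : MeasurableSet S) :
    ∫⁻ z in S, ENNReal.ofReal (g z) ∂nu n p ε = ∫⁻ z in S, ENNReal.ofReal (g z * dn n p ε z) := by
  have hd := dn_meas n p ε
  have := setLIntegral_withDensity_eq_setLIntegral_mul (volume : Measure (En n × En n))
    (f := fun z => ENNReal.ofReal (dn n p ε z)) (g := fun z => ENNReal.ofReal (g z)) hd.ennreal_ofReal hg.ennreal_ofReal hS
  refine (this.trans ?_)
  refine lintegral_congr (fun z => ?_)
  simp only [Pi.mul_apply]
  rw [mul_comm (g z), ENNReal.ofReal_mul (dn_nonneg n p ε z)]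

theorem nu_bB (n : ℕ) (p ε : ℝ) (x₀ : En n) (R : ℝ) :
    nu n p ε (bB n x₀ R) = ∫⁻ z in bB n x₀ R, ENNReal.ofReal (dn n p ε z) :=
  withDensity_apply _ (bB_meas n x₀ R)

theorem nu_scale (n : ℕ) (p ε : ℝ) (x₀ : En n) {R : ℝ} (hR : 0 < R) :
    nu n p ε (bB n x₀ R) = ENNReal.ofReal (R ^ ((n:ℝ) + ε * p)) * nu n p ε (bB n 0 1) := by
  have h := T2_slint (c := 1) x₀ hR (fun z => ENNReal.ofReal (dn n p ε z))
  have e : ∀ z : En n × En n, ENNReal.ofReal (dn n p ε (T2 x₀ R z)) =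
      ENNReal.ofReal (R ^ (ε * p - n)) * ENNReal.ofReal (dn n p ε z) := by
    intro z
    unfold dn
    rw [T2_norm x₀ hR, Real.mul_rpow hR.le (norm_nonneg _), ENNReal.ofReal_mul (by positivity)]
  simp_rw [e] at h
  rw [lintegral_const_mul' _ _ ENNReal.ofReal_ne_top, ← nu_bB, one_mul, ← nu_bB] at h
  have h2 : ENNReal.ofReal (R ^ (2 * n : ℝ)) * (ENNReal.ofReal (R ^ (ε * p - n)) * nu n p ε (bB n 0 1)) =
      ENNReal.ofReal (R ^ (2 * n : ℝ)) * (ENNReal.ofReal (R ^ (-(2 * n : ℝ))) * nu n p ε (bB n x₀ R)) := by rw [h]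
  rw [← mul_assoc, ← mul_assoc, ← ENNReal.ofReal_mul (by positivity), ← ENNReal.ofReal_mul (by positivity),
    ← Real.rpow_add hR, ← Real.rpow_add hR, add_neg_cancel, Real.rpow_zero, ENNReal.ofReal_one, one_mul] at h2
  rw [← h2]
  congr 3; ring

theorem diag_ae (n : ℕ) (hn : 2 ≤ n) : ∀ᵐ z : En n × En n, z.1 ≠ z.2 := by
  have hms : MeasurableSet {z : En n × En n | z.1 = z.2} := measurableSet_eq_fun measurable_fst measurable_snd
  rw [ae_iff]
  simp only [ne_eq, not_not]
  rw [Measure.volume_eq_prod, Measure.measure_prod_null hms]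
  have hne : Nontrivial (En n) := by
    have : Nonempty (Fin n) := ⟨⟨0, by omega⟩⟩
    infer_instance
  refine Filter.Eventually.of_forall (fun x => ?_)
  have : Prod.mk x ⁻¹' {z : En n × En n | z.1 = z.2} = {x} := by
    ext y; simp [eq_comm]
  show volume (Prod.mk x ⁻¹' {z : En n × En n | z.1 = z.2}) = 0
  rw [this]; simp

theorem nu_bounds (n : ℕ) (hn : 2 ≤ n) : ∃ c C : ℝ, 0 < c ∧ c ≤ 1 ∧ 1 ≤ C ∧ ∀ p ε : ℝ, 2 ≤ p → 0 < ε → ε * p < 1 →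
    ∃ N : ℝ, 0 < N ∧ nu n p ε (bB n 0 1) = ENNReal.ofReal N ∧ c ≤ N ∧ N ≤ C / ε := by
  have hom := om_pos n
  have hn0 : (0:ℝ) < n := by positivity
  have hn2 : (2:ℝ) ≤ n := by exact_mod_cast hn
  refine ⟨min 1 (2 ^ (-(n:ℝ)) * (om n * om n)), max 1 (n * om n * 2 * om n), by positivity, min_le_left _ _, le_max_left _ _,
    fun p ε hp hε hεp => ?_⟩
  have hp0 : 0 < p := by linarith
  have hvol : volume (BB n) = ENNReal.ofReal (om n) := by
    rw [vol_ball n 0 one_pos]; simp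
  have hvol2 : volume (bB n 0 1) = ENNReal.ofReal (om n * om n) := by
    unfold bB
    rw [Measure.volume_eq_prod, Measure.prod_prod, hvol, ← ENNReal.ofReal_mul hom.le]
  have hup : nu n p ε (bB n 0 1) ≤ ENNReal.ofReal (n * om n * (2 ^ (ε * p) / (ε * p)) * om n) := by
    rw [nu_bB]
    have := ker_int n hn (b := ε * p) (by positivity) (φ := fun _ => 1) measurable_const
    simp only [one_mul, lintegral_const, Measure.restrict_apply_univ, hvol] at this
    rw [← ENNReal.ofReal_mul (by positivity)] at this
    exact this
  have hlo : ENNReal.ofReal (2 ^ (-(n:ℝ)) * (om n * om n)) ≤ nu n p ε (bB n 0 1) := by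
    rw [nu_bB, ENNReal.ofReal_mul (by positivity), ← hvol2, ← setLIntegral_const]
    have hdiag := ae_restrict_of_ae (s := bB n 0 1) (diag_ae n hn)
    refine lintegral_mono_ae ?_
    filter_upwards [hdiag, ae_restrict_mem (bB_meas n 0 1)] with z hz hzB
    refine ENNReal.ofReal_le_ofReal ?_
    unfold dn
    have hd : 0 < ‖z.1 - z.2‖ := norm_pos_iff.2 (sub_ne_zero.2 hz)
    have hd2 : ‖z.1 - z.2‖ ≤ 2 := by
      have h1 := hzB.1
      have h2 := hzB.2
      rw [mem_ball_zero_iff] at h1 h2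
      linarith [norm_sub_le z.1 z.2]
    calc (2:ℝ) ^ (-(n:ℝ)) ≤ 2 ^ (ε * p - n) := Real.rpow_le_rpow_of_exponent_le (by norm_num) (by nlinarith)
      _ ≤ _ := Real.rpow_le_rpow_of_nonpos hd hd2 (by linarith)
  have hfin : nu n p ε (bB n 0 1) ≠ ⊤ := ne_top_of_le_ne_top ENNReal.ofReal_ne_top hup
  have he := (ENNReal.ofReal_toReal hfin).symm
  have h1 : 2 ^ (-(n:ℝ)) * (om n * om n) ≤ (nu n p ε (bB n 0 1)).toReal := by
    rw [he] at hlo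
    exact (ENNReal.ofReal_le_ofReal_iff ENNReal.toReal_nonneg).1 hlo
  have h2 : (nu n p ε (bB n 0 1)).toReal ≤ n * om n * (2 ^ (ε * p) / (ε * p)) * om n := by
    rw [he] at hup
    exact (ENNReal.ofReal_le_ofReal_iff (by positivity)).1 hup
  have hpos : 0 < 2 ^ (-(n:ℝ)) * (om n * om n) := by positivity
  refine ⟨_, lt_of_lt_of_le hpos h1, he, (min_le_right _ _).trans h1, h2.trans ?_⟩
  have h3 : (2:ℝ) ^ (ε * p) ≤ 2 := by
    calc (2:ℝ) ^ (ε * p) ≤ 2 ^ (1:ℝ) := Real.rpow_le_rpow_of_exponent_le (by norm_num) hεp.le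
      _ = 2 := Real.rpow_one _
  calc n * om n * (2 ^ (ε * p) / (ε * p)) * om n ≤ n * om n * (2 / ε) * om n := by
        gcongr
        nlinarith
    _ = (n * om n * 2 * om n) / ε := by ring
    _ ≤ _ := by
        gcongr
        exact le_max_right _ _

theorem exps (n : ℕ) (hn : 2 ≤ n) {p s ε : ℝ} (hp : 2 ≤ p) (hs0 : 0 < s) (hsp : s * p < n)
    (hε : 0 < ε) (hε2 : ε < s / p) :
    1 ≤ etaEx n p s ε ∧ p / 2 ≤ etaEx n p s ε ∧ etaEx n p s ε ≤ p ∧ 0 < s * n / (n + ε * p) ∧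
    1 / p = 1 / etaEx n p s ε - s * n / (n + ε * p) / n ∧
    s * n / (n + ε * p) * etaEx n p s ε = s * p - (s + ε) * (p - etaEx n p s ε) ∧
    (s + ε) * (etaEx n p s ε - 1) ≤ s * n / (n + ε * p) * etaEx n p s ε := by
  have hn0 : (0:ℝ) < n := by positivity
  have hp0 : 0 < p := by linarith
  have hD : 0 < n + s * p + ε * p := by positivity
  have hE : 0 < n + ε * p := by positivity
  have e0 : etaEx n p s ε = p * (n + ε * p) / (n + s * p + ε * p) := by unfold etaEx; congr 1; ring
  have e1 : etaEx n p s ε - p / 2 = p * (n - s * p + ε * p) / (2 * (n + s * p + ε * p)) := by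
    rw [e0]; field_simp; ring
  have h2 : p / 2 ≤ etaEx n p s ε := by
    have : 0 ≤ p * (n - s * p + ε * p) / (2 * (n + s * p + ε * p)) := by
      have : 0 ≤ n - s * p + ε * p := by nlinarith
      positivity
    linarith
  have e3 : p - etaEx n p s ε = p * (s * p) / (n + s * p + ε * p) := by
    rw [e0]; field_simp; ring
  have h3 : 0 ≤ p - etaEx n p s ε := by rw [e3]; positivity
  have e4 : s * n / (n + ε * p) * etaEx n p s ε = s * n * p / (n + s * p + ε * p) := by
    rw [e0]; field_simp
  refine ⟨by linarith, h2, by linarith, by positivity, ?_, ?_, ?_⟩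
  · rw [e0]; field_simp; ring
  · rw [e4, e3]; field_simp; ring
  · have e5 : (s + ε) * (etaEx n p s ε - 1) = (s + ε) * (p * n + ε * p ^ 2 - n - s * p - ε * p) / (n + s * p + ε * p) := by
      rw [e0]; field_simp; ring
    rw [e4, e5]
    refine div_le_div_of_nonneg_right ?_ hD.le
    have hεp : ε * p < s := (lt_div_iff₀ hp0).1 hε2
    have h6 : p * n + ε * p ^ 2 - n - s * p - ε * p ≤ (p - 1) * n := by nlinarith
    have h7 : (s + ε) * (p * n + ε * p ^ 2 - n - s * p - ε * p) ≤ (s + ε) * ((p - 1) * n) :=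
      mul_le_mul_of_nonneg_left h6 (by linarith)
    have h8 : (s + ε) * (p - 1) ≤ s * p := by nlinarith
    calc _ ≤ (s + ε) * ((p - 1) * n) := h7
      _ = ((s + ε) * (p - 1)) * n := by ring
      _ ≤ (s * p) * n := mul_le_mul_of_nonneg_right h8 hn0.le
      _ = _ := by ring

theorem gam_eq (n : ℕ) {p s ε : ℝ} : gammaEx n p s ε = etaEx n p s ε / (p - 1) := by
  unfold gammaEx etaEx pC
  rw [div_mul_div_comm, div_div]
  congr 1 <;> ring

theorem gam_diff (n : ℕ) (hn : 2 ≤ n) {p s ε : ℝ} (hp : 2 ≤ p) (hs0 : 0 < s)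
    (hε : 0 < ε) : 1 / gammaEx n p s ε - 1 / pC p = s * (p - 1) / (n + ε * p) := by
  have hn0 : (0:ℝ) < n := by positivity
  have hp0 : 0 < p := by linarith
  have hp1 : 0 < p - 1 := by linarith
  have hE : 0 < n + ε * p := by positivity
  have hD : 0 < n + s * p + ε * p := by positivity
  unfold gammaEx pC
  field_simp
  ring

theorem pst_diff (n : ℕ) (hn : 2 ≤ n) {p s : ℝ} (hp : 2 ≤ p) (hs0 : 0 < s) :
    1 / pStar n p s - 1 / pC p = s / n := by
  have hn0 : (0:ℝ) < n := by positivity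
  have hp0 : 0 < p := by linarith
  have hp1 : 0 < p - 1 := by linarith
  have : 0 < n * (p - 1) + s * p := by positivity
  unfold pStar pC
  field_simp
  ring

theorem G_nonneg {n : ℕ} {p q s t ε : ℝ} {a : En n × En n → ℝ} (ha : ∀ z, 0 ≤ a z) (u : En n → ℝ) (z) :
    0 ≤ Gfun n p q s t ε a u z := by
  have := ha z
  unfold Gfun Ufun Afun
  positivity

theorem G_dn {n : ℕ} (hn : 2 ≤ n) {p q s t ε : ℝ} (hp : 2 ≤ p) (hq : 0 < q) (hs0 : 0 < s) (ht0 : 0 < t) (hεp : ε * p < 1)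
    {a : En n × En n → ℝ} (u : En n → ℝ) (z) :
    Gfun n p q s t ε a u z * dn n p ε z = energyIntegrand n p q s t a u z := by
  have hn2 : (2:ℝ) ≤ n := by exact_mod_cast hn
  unfold Gfun Ufun Afun dn energyIntegrand
  rcases eq_or_lt_of_le (norm_nonneg (z.1 - z.2)) with h | h
  · rw [← h, Real.zero_rpow (x := ε * p - n) (by linarith), Real.zero_rpow (x := n + s * p) (by positivity),
      Real.zero_rpow (x := n + t * q) (by positivity)]
    simp
  · generalize ‖z.1 - z.2‖ = d at h
    have hw : 0 ≤ |u z.1 - u z.2| := abs_nonneg _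
    generalize |u z.1 - u z.2| = w at hw
    rw [Real.div_rpow hw (by positivity), Real.div_rpow hw (by positivity), ← Real.rpow_mul h.le, ← Real.rpow_mul h.le,
      add_mul]
    congr 1
    · rw [div_mul_eq_mul_div, mul_div_assoc, ← Real.rpow_sub h, div_eq_mul_inv, ← Real.rpow_neg h.le]
      congr 2; ring
    · rw [div_eq_mul_inv, div_eq_mul_inv, ← Real.rpow_neg h.le, ← Real.rpow_neg h.le]
      calc _ = a z * w ^ q * (d ^ ((s - t) * q + ε * (q - p)) * d ^ (-((s + ε) * q)) * d ^ (ε * p - n)) := by ring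
        _ = _ := by
          rw [← Real.rpow_add h, ← Real.rpow_add h]
          congr 2; ring

theorem U_dn {n : ℕ} (hn : 2 ≤ n) {p s ε η e : ℝ} (hεp : ε * p < 1) (he : e = (s + ε) * η - ε * p) (he0 : 0 ≤ e)
    (u : En n → ℝ) (z) :
    Ufun n s ε u z ^ η * dn n p ε z = |u z.1 - u z.2| ^ η / ‖z.1 - z.2‖ ^ ((n:ℝ) + e) := by
  have hn2 : (2:ℝ) ≤ n := by exact_mod_cast hn
  unfold Ufun dn
  rcases eq_or_lt_of_le (norm_nonneg (z.1 - z.2)) with h | h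
  · rw [← h, Real.zero_rpow (x := ε * p - n) (by linarith), Real.zero_rpow (x := (n:ℝ) + e) (by positivity)]
    simp
  · generalize ‖z.1 - z.2‖ = d at h
    have hw : 0 ≤ |u z.1 - u z.2| := abs_nonneg _
    generalize |u z.1 - u z.2| = w at hw
    rw [Real.div_rpow hw (by positivity), ← Real.rpow_mul h.le]
    rw [div_mul_eq_mul_div, mul_div_assoc, ← Real.rpow_sub h, div_eq_mul_inv, ← Real.rpow_neg h.le, he]
    congr 2; ring

theorem H_nonneg {n : ℕ} {p q s t ε : ℝ} {a : En n × En n → ℝ} (ha : ∀ z, 0 ≤ a z) (u : En n → ℝ) (z) :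
    0 ≤ Hfun n p q s t ε a u z := by
  have := G_nonneg (p := p) (q := q) (s := s) (t := t) (ε := ε) ha u z
  unfold Hfun
  positivity

theorem H_pC {n : ℕ} {p q s t ε : ℝ} (hp : 2 ≤ p) {a : En n × En n → ℝ} (ha : ∀ z, 0 ≤ a z) (u : En n → ℝ) (z) :
    Hfun n p q s t ε a u z ^ pC p = Gfun n p q s t ε a u z := by
  have hp0 : 0 < p := by linarith
  have hp1 : 0 < p - 1 := by linarith
  unfold Hfun pC
  rw [← Real.rpow_mul (G_nonneg ha u z), div_mul_div_comm, mul_comm, div_self (by positivity), Real.rpow_one]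

theorem H_gam {n : ℕ} {p q s t ε : ℝ} (hp : 2 ≤ p) {a : En n × En n → ℝ} (ha : ∀ z, 0 ≤ a z) (u : En n → ℝ)
    (hη : 0 ≤ etaEx n p s ε) (z) :
    Ufun n s ε u z ^ etaEx n p s ε ≤ Hfun n p q s t ε a u z ^ gammaEx n p s ε := by
  have hp0 : 0 < p := by linarith
  have hp1 : 0 < p - 1 := by linarith
  have hG := G_nonneg (p := p) (q := q) (s := s) (t := t) (ε := ε) ha u z
  unfold Hfun
  rw [← Real.rpow_mul hG, gam_eq, div_mul_div_comm]
  have e : (p - 1) * etaEx n p s ε / (p * (p - 1)) = etaEx n p s ε / p := by field_simp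
  rw [e]
  have hU : 0 ≤ Ufun n s ε u z := by unfold Ufun; positivity
  have h1 : Ufun n s ε u z ^ p ≤ Gfun n p q s t ε a u z := by
    have := ha z
    unfold Gfun
    have : 0 ≤ Afun n p q s t ε a z * Ufun n s ε u z ^ q := by unfold Afun; positivity
    linarith
  calc _ = (Ufun n s ε u z ^ p) ^ (etaEx n p s ε / p) := by
        rw [← Real.rpow_mul hU]; congr 1; field_simp
    _ ≤ _ := Real.rpow_le_rpow (by positivity) h1 (by positivity)

theorem H_meas {n : ℕ} {p q s t ε : ℝ} {a : En n × En n → ℝ} (ha : Measurable a) {u : En n → ℝ} (hu : Measurable u) :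
    Measurable (Hfun n p q s t ε a u) := by
  unfold Hfun Gfun Ufun Afun
  fun_prop

/-- rescaled solution -/
def ut {n : ℕ} (x₀ : En n) (R : ℝ) (u : En n → ℝ) (x : En n) : ℝ := u (x₀ + R • x)
/-- rescaled kernel -/
def Kt {n : ℕ} (p q s t : ℝ) (x₀ : En n) (R : ℝ) (a : En n × En n → ℝ) (u : En n → ℝ) (z : En n × En n) : ℝ :=
  1 + a (T2 x₀ R z) * |ut x₀ R u z.1 - ut x₀ R u z.2| ^ (q - p) * (R * ‖z.1 - z.2‖) ^ (s * p - t * q)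
/-- rescaled data -/
def ft {n : ℕ} (p s : ℝ) (x₀ : En n) (R : ℝ) (f : En n → ℝ) (x : En n) : ℝ := R ^ (s * p) * f (x₀ + R • x)

theorem sc_alg {n : ℕ} (hn : 2 ≤ n) {p q s t R d A w c v : ℝ} (hR : 0 < R) (hd : 0 ≤ d)
    (hsp : 0 < s * p) (htq : 0 < t * q) (hv : c * w = v) :
    (1 + A * c * (R * d) ^ (s * p - t * q)) * w / d ^ ((n:ℝ) + s * p) =
      R ^ ((n:ℝ) + s * p) * (w / (R * d) ^ ((n:ℝ) + s * p) + A * v / (R * d) ^ ((n:ℝ) + t * q)) := by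
  have hn0 : (0:ℝ) < n := by positivity
  rcases eq_or_lt_of_le hd with h | h
  · rw [← h, mul_zero, Real.zero_rpow (x := (n:ℝ) + s * p) (by positivity), Real.zero_rpow (x := (n:ℝ) + t * q) (by positivity)]
    simp
  · have e : (R * d) ^ (s * p - t * q) = (R * d) ^ ((n:ℝ) + s * p) / (R * d) ^ ((n:ℝ) + t * q) := by
      rw [← Real.rpow_sub (by positivity)]; congr 1; ring
    rw [e, ← hv]
    have e2 : (R * d) ^ ((n:ℝ) + s * p) = R ^ ((n:ℝ) + s * p) * d ^ ((n:ℝ) + s * p) := Real.mul_rpow hR.le hd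
    rw [e2]
    have h1 : 0 < R ^ ((n:ℝ) + s * p) := by positivity
    have h2 : 0 < d ^ ((n:ℝ) + s * p) := by positivity
    have h3 : 0 < (R * d) ^ ((n:ℝ) + t * q) := by positivity
    generalize R ^ ((n:ℝ) + s * p) = X at *
    generalize d ^ ((n:ℝ) + s * p) = Y at *
    generalize (R * d) ^ ((n:ℝ) + t * q) = Z at *
    field_simp

theorem sc_energy {n : ℕ} (hn : 2 ≤ n) {p q s t R : ℝ} (hp : 2 ≤ p) (hpq : p ≤ q) (hs0 : 0 < s) (ht0 : 0 < t) (hR : 0 < R)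
    (x₀ : En n) (a : En n × En n → ℝ) (u : En n → ℝ) (z : En n × En n) :
    Kt p q s t x₀ R a u z * |ut x₀ R u z.1 - ut x₀ R u z.2| ^ p / ‖z.1 - z.2‖ ^ ((n:ℝ) + s * p) =
      R ^ ((n:ℝ) + s * p) * energyIntegrand n p q s t a u (T2 x₀ R z) := by
  unfold Kt energyIntegrand
  rw [T2_norm x₀ hR]
  have hq : 0 < q := by linarith
  have hp0 : 0 < p := by linarith
  refine sc_alg hn hR (norm_nonneg _) (by positivity) (by positivity) ?_
  rw [← Real.rpow_add_of_nonneg (abs_nonneg _) (by linarith) (by linarith), sub_add_cancel]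
  rfl

theorem sc_form {n : ℕ} (hn : 2 ≤ n) {p q s t R : ℝ} (hp : 2 ≤ p) (hpq : p ≤ q) (hs0 : 0 < s) (ht0 : 0 < t) (hR : 0 < R)
    (x₀ : En n) (a : En n × En n → ℝ) (u φ : En n → ℝ) (z : En n × En n) :
    Fi n p s (Kt p q s t x₀ R a u) (ut x₀ R u) φ z =
      R ^ ((n:ℝ) + s * p) * formIntegrand n p q s t a u (fun x => φ (R⁻¹ • (x - x₀))) (T2 x₀ R z) := by
  unfold Fi Kt formIntegrand
  rw [T2_norm x₀ hR]
  have hq : 0 < q := by linarith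
  have hp0 : 0 < p := by linarith
  have e : ∀ x : En n, R⁻¹ • (x₀ + R • x - x₀) = x := by
    intro x; rw [add_sub_cancel_left, smul_smul, inv_mul_cancel₀ hR.ne', one_smul]
  simp only [T2, e]
  have := sc_alg (w := |ut x₀ R u z.1 - ut x₀ R u z.2| ^ (p - 2) * (ut x₀ R u z.1 - ut x₀ R u z.2) * (φ z.1 - φ z.2))
    (A := a (T2 x₀ R z)) (c := |ut x₀ R u z.1 - ut x₀ R u z.2| ^ (q - p)) (s := s) (p := p) (t := t) (q := q)
    (v := |ut x₀ R u z.1 - ut x₀ R u z.2| ^ (q - 2) * (ut x₀ R u z.1 - ut x₀ R u z.2) * (φ z.1 - φ z.2))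
    hn hR (norm_nonneg (z.1 - z.2)) (by positivity) (by positivity) (by
      rw [← mul_assoc, ← mul_assoc, ← Real.rpow_add_of_nonneg (abs_nonneg _) (by linarith) (by linarith)]
      congr 3; ring)
  rw [← mul_assoc] at this
  exact this

theorem ft_lint {n : ℕ} {p s R r : ℝ} (hR : 0 < R) (x₀ : En n) (f : En n → ℝ) :
    ∫⁻ x in BB n, ENNReal.ofReal (|ft p s x₀ R f x| ^ r) =
      ENNReal.ofReal (R ^ (s * p * r - n)) * ∫⁻ x in ball x₀ R, ENNReal.ofReal (|f x| ^ r) := by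
  have h : ∀ x, ENNReal.ofReal (|ft p s x₀ R f x| ^ r) =
      ENNReal.ofReal (R ^ (s * p * r)) * ENNReal.ofReal (|f (x₀ + R • x)| ^ r) := by
    intro x
    unfold ft
    rw [abs_mul, abs_of_nonneg (by positivity), Real.mul_rpow (by positivity) (abs_nonneg _), ← Real.rpow_mul hR.le,
      ENNReal.ofReal_mul (by positivity)]
  simp_rw [h]
  rw [lintegral_const_mul' _ _ ENNReal.ofReal_ne_top, T1_slint x₀ hR (fun x => ENNReal.ofReal (|f x| ^ r)), ← mul_assoc,
    ← ENNReal.ofReal_mul (by positivity), ← Real.rpow_add hR, sub_eq_add_neg]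

theorem f_fin {n : ℕ} {r δ : ℝ} (hr : 0 ≤ r) (hδ : 0 ≤ δ) {f : En n → ℝ} {x₀ : En n} {R : ℝ}
    (h : ∫⁻ x in ball x₀ R, ENNReal.ofReal (|f x| ^ (r + δ)) < ⊤) :
    ∫⁻ x in ball x₀ R, ENNReal.ofReal (|f x| ^ r) < ⊤ := by
  calc _ ≤ ∫⁻ x in ball x₀ R, (1 + ENNReal.ofReal (|f x| ^ (r + δ))) := by
        refine lintegral_mono (fun x => ?_)
        rcases le_total |f x| 1 with h1 | h1
        · refine le_trans ?_ le_self_add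
          rw [← ENNReal.ofReal_one]
          exact ENNReal.ofReal_le_ofReal (Real.rpow_le_one (abs_nonneg _) h1 hr)
        · refine le_trans ?_ le_add_self
          exact ENNReal.ofReal_le_ofReal (Real.rpow_le_rpow_of_exponent_le h1 (by linarith))
    _ < ⊤ := by
        rw [lintegral_add_left measurable_const, lintegral_const, Measure.restrict_apply_univ, one_mul]
        exact ENNReal.add_lt_top.2 ⟨measure_ball_lt_top, h⟩

theorem adm_sc {n : ℕ} (hn : 2 ≤ n) {p q s t M Λ R δ : ℝ} (hp : 2 ≤ p) (hpq : p ≤ q) (hs0 : 0 < s) (hs1 : s < 1) (ht0 : 0 < t)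
    (htq : t * q ≤ s * p) (hR : 0 < R) (hR1 : R ≤ 1) (x₀ : En n) {a : En n × En n → ℝ} {u f : En n → ℝ}
    (ham : Measurable a) (ha0 : ∀ z, 0 ≤ a z) (haM : ∀ z, a z ≤ M) (hu : Measurable u) (hub : ∀ x, |u x| ≤ Λ)
    (hf : Measurable f) (hδ : 0 < δ) (hfl : ∫⁻ x in ball x₀ R, ENNReal.ofReal (|f x| ^ (pStar n p s + δ)) < ⊤)
    (hw : IsBoundedWeakSolution n p q s t a u f) :
    Adm n p s (t * q) (1 + |M| * (2 * |Λ|) ^ (q - p)) (Kt p q s t x₀ R a u) (ut x₀ R u) (ft p s x₀ R f) := by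
  have hutm : Measurable (ut x₀ R u) := by unfold ut; fun_prop
  have hT : Measurable (T2 x₀ R) := by unfold T2; fun_prop
  have hL : ∀ x, |ut x₀ R u x| ≤ |Λ| := fun x => (hub _).trans (le_abs_self _)
  refine ⟨?_, ?_, ?_, ?_, hutm, ⟨_, hL⟩, ?_, ?_, ?_, ?_⟩
  · unfold Kt; fun_prop
  · have : 0 ≤ |M| * (2 * |Λ|) ^ (q - p) := by positivity
    linarith
  · intro z
    have : 0 ≤ a (T2 x₀ R z) * |ut x₀ R u z.1 - ut x₀ R u z.2| ^ (q - p) * (R * ‖z.1 - z.2‖) ^ (s * p - t * q) := by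
      have := ha0 (T2 x₀ R z); positivity
    unfold Kt; linarith
  · intro z
    unfold Kt kap
    rw [add_mul]
    have h1 : a (T2 x₀ R z) ≤ |M| := (haM _).trans (le_abs_self _)
    have h2 : |ut x₀ R u z.1 - ut x₀ R u z.2| ^ (q - p) ≤ (2 * |Λ|) ^ (q - p) := by
      refine Real.rpow_le_rpow (abs_nonneg _) ?_ (by linarith)
      have := abs_sub (ut x₀ R u z.1) (ut x₀ R u z.2)
      linarith [hL z.1, hL z.2]
    have h3 : (R * ‖z.1 - z.2‖) ^ (s * p - t * q) ≤ max 1 (‖z.1 - z.2‖ ^ (s * p - t * q)) := by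
      refine le_trans (Real.rpow_le_rpow (by positivity) ?_ (by linarith)) (le_max_right _ _)
      exact mul_le_of_le_one_left (norm_nonneg _) hR1
    refine add_le_add (by rw [one_mul]; exact le_max_left _ _) ?_
    have := ha0 (T2 x₀ R z)
    gcongr
  · unfold ft; fun_prop
  · simp_rw [sc_energy hn hp hpq hs0 ht0 hR]
    simp_rw [fun z => ENNReal.ofReal_mul (p := R ^ ((n:ℝ) + s * p)) (q := energyIntegrand n p q s t a u (T2 x₀ R z)) (by positivity)]
    rw [lintegral_const_mul' _ _ ENNReal.ofReal_ne_top, T2_lint x₀ hR (fun z => ENNReal.ofReal (energyIntegrand n p q s t a u z))]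
    exact ENNReal.mul_lt_top ENNReal.ofReal_lt_top (ENNReal.mul_lt_top ENNReal.ofReal_lt_top hw.1)
  · rw [ft_lint hR]
    exact ENNReal.mul_lt_top ENNReal.ofReal_lt_top (f_fin (pStar_pos hn hp hs0).le hδ.le hfl)
  · intro φ hφ hφc
    simp_rw [sc_form hn hp hpq hs0 ht0 hR]
    rw [integral_const_mul, T2_int x₀ hR (fun z => formIntegrand n p q s t a u (fun x => φ (R⁻¹ • (x - x₀))) z)]
    have hR' : R⁻¹ ≠ 0 := by positivity
    have hc : HasCompactSupport (fun x => φ (R⁻¹ • (x - x₀))) :=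
      hφc.comp_homeomorph ((Homeomorph.subRight x₀).trans (Homeomorph.smulOfNeZero R⁻¹ hR'))
    have h2 := hw.2 (fun x => φ (R⁻¹ • (x - x₀))) (hφ.comp (by fun_prop)) hc
    rw [h2]
    have h3 := T1_int x₀ hR (fun x => f x * φ (R⁻¹ • (x - x₀)))
    have e : ∀ x : En n, R⁻¹ • (x₀ + R • x - x₀) = x := by
      intro x; rw [add_sub_cancel_left, smul_smul, inv_mul_cancel₀ hR.ne', one_smul]
    simp only [e] at h3
    unfold ft
    simp_rw [mul_assoc]
    rw [integral_const_mul, h3, ← mul_assoc, ← mul_assoc, ← Real.rpow_add hR, ← Real.rpow_add hR]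
    congr 2; ring

theorem avg_eq {n : ℕ} {p ε N r : ℝ} (hN : 0 < N) (hNe : nu n p ε (bB n 0 1) = ENNReal.ofReal N) (hr : 0 < r) (x₀ : En n)
    {g : En n × En n → ℝ} (hg : Measurable g) (hg0 : ∀ z, 0 ≤ g z) :
    ⨍ z in bB n x₀ r, g z ∂nu n p ε =
      (r ^ ((n:ℝ) + ε * p) * N)⁻¹ * (∫⁻ z in bB n x₀ r, ENNReal.ofReal (g z * dn n p ε z)).toReal := by
  rw [setAverage_eq, smul_eq_mul, integral_eq_lintegral_of_nonneg_ae (Filter.Eventually.of_forall hg0) hg.aestronglyMeasurable,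
    nu_slint n p ε hg (bB_meas n x₀ r), Measure.real, nu_scale n p ε x₀ hr, hNe, ← ENNReal.ofReal_mul (by positivity),
    ENNReal.toReal_ofReal (by positivity)]

theorem avg_nonneg {n : ℕ} {p ε : ℝ} {S : Set (En n × En n)} {g : En n × En n → ℝ} (hg0 : ∀ z, 0 ≤ g z) :
    0 ≤ ⨍ z in S, g z ∂nu n p ε := by
  rw [setAverage_eq, smul_eq_mul]
  exact mul_nonneg (by positivity) (integral_nonneg hg0)

theorem avg_inv {n : ℕ} {p ε N r : ℝ} (hN : 0 < N) (hNe : nu n p ε (bB n 0 1) = ENNReal.ofReal N) (hr : 0 < r) (x₀ : En n)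
    {g : En n × En n → ℝ} (hg : Measurable g) (hg0 : ∀ z, 0 ≤ g z)
    (hfin : ∫⁻ z in bB n x₀ r, ENNReal.ofReal (g z * dn n p ε z) < ⊤) :
    ∫⁻ z in bB n x₀ r, ENNReal.ofReal (g z * dn n p ε z) =
      ENNReal.ofReal (r ^ ((n:ℝ) + ε * p) * N * ⨍ z in bB n x₀ r, g z ∂nu n p ε) := by
  rw [avg_eq hN hNe hr x₀ hg hg0, mul_inv_cancel_left₀ (by positivity), ENNReal.ofReal_toReal hfin.ne]

theorem gam_bd (n : ℕ) (hn : 2 ≤ n) {p s ε : ℝ} (hp : 2 ≤ p) (hs0 : 0 < s) (hε : 0 < ε) :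
    0 < gammaEx n p s ε ∧ gammaEx n p s ε ≤ pC p := by
  have hn0 : (0:ℝ) < n := by positivity
  have hp0 : 0 < p := by linarith
  have hp1 : 0 < p - 1 := by linarith
  have hC : 0 < pC p := by unfold pC; positivity
  unfold gammaEx
  refine ⟨by positivity, mul_le_of_le_one_right hC.le ?_⟩
  rw [div_le_one (by positivity)]
  have : 0 < s * p := by positivity
  linarith

/-- bound of the `H ^ γ` integral by the measure plus the energy -/
theorem Hg_bd {n : ℕ} (hn : 2 ≤ n) {p q s t ε : ℝ} (hp : 2 ≤ p) (hq : 0 < q) (hs0 : 0 < s) (ht0 : 0 < t) (hε : 0 < ε)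
    (hεp : ε * p < 1)
    {a : En n × En n → ℝ} (ha : ∀ z, 0 ≤ a z) (u : En n → ℝ) (x₀ : En n) (r : ℝ) :
    ∫⁻ z in bB n x₀ r, ENNReal.ofReal (Hfun n p q s t ε a u z ^ gammaEx n p s ε * dn n p ε z) ≤
      nu n p ε (bB n x₀ r) + ∫⁻ z, ENNReal.ofReal (energyIntegrand n p q s t a u z) := by
  obtain ⟨hg0, hg1⟩ := gam_bd n hn hp hs0 hε
  rw [nu_bB]
  refine le_trans ?_ (add_le_add le_rfl (setLIntegral_le_lintegral (bB n x₀ r) _))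
  rw [← lintegral_add_left (dn_meas n p ε).ennreal_ofReal]
  refine lintegral_mono (fun z => ?_)
  have hd := dn_nonneg n p ε z
  have hH := H_nonneg (p := p) (q := q) (s := s) (t := t) (ε := ε) ha u z
  have h1 : Hfun n p q s t ε a u z ^ gammaEx n p s ε ≤ 1 + Hfun n p q s t ε a u z ^ pC p := by
    rcases le_total (Hfun n p q s t ε a u z) 1 with h | h
    · have := Real.rpow_le_one hH h hg0.le
      have : 0 ≤ Hfun n p q s t ε a u z ^ pC p := by positivity
      linarith
    · have := Real.rpow_le_rpow_of_exponent_le h hg1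
      linarith
  rw [← G_dn hn hp hq hs0 ht0 hεp, ← H_pC hp ha,
    ← ENNReal.ofReal_add hd (by positivity)]
  refine ENNReal.ofReal_le_ofReal ?_
  calc _ ≤ (1 + Hfun n p q s t ε a u z ^ pC p) * dn n p ε z := mul_le_mul_of_nonneg_right h1 hd
    _ = _ := by ring

theorem gk_T2 {n : ℕ} {η e R : ℝ} (he : 0 ≤ e) (hn : 2 ≤ n) (hR : 0 < R) (x₀ : En n) (u : En n → ℝ) (z : En n × En n) :
    gk n η e (ut x₀ R u) z.1 z.2 = ENNReal.ofReal (R ^ ((n:ℝ) + e)) *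
      ENNReal.ofReal (|u (T2 x₀ R z).1 - u (T2 x₀ R z).2| ^ η / ‖(T2 x₀ R z).1 - (T2 x₀ R z).2‖ ^ ((n:ℝ) + e)) := by
  have hn0 : (0:ℝ) < n := by positivity
  rw [T2_norm x₀ hR, ← ENNReal.ofReal_mul (by positivity), Real.mul_rpow hR.le (norm_nonneg _)]
  unfold gk
  congr 1
  have : R ^ ((n:ℝ) + e) ≠ 0 := by positivity
  rw [← div_div, mul_div_assoc', mul_div_cancel₀ _ this]
  rfl

theorem Q_bd {n : ℕ} (hn : 2 ≤ n) {p q s t ε R N : ℝ} (hp : 2 ≤ p) (hs0 : 0 < s) (hε : 0 < ε)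
    (hεp : ε * p < 1) (hR : 0 < R) {η e : ℝ} (hη : η = etaEx n p s ε) (hη0 : 0 ≤ η) (he : e = (s + ε) * η - ε * p) (he0 : 0 ≤ e)
    (hN : 0 < N) (hNe : nu n p ε (bB n 0 1) = ENNReal.ofReal N) (x₀ : En n)
    {a : En n × En n → ℝ} (ham : Measurable a) (ha : ∀ z, 0 ≤ a z) {u : En n → ℝ} (hu : Measurable u) (k : ℕ)
    (hfin : ∫⁻ z in bB n x₀ (2 ^ k * R), ENNReal.ofReal (Hfun n p q s t ε a u z ^ gammaEx n p s ε * dn n p ε z) < ⊤) :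
    ∫⁻ x in Bd n k, ∫⁻ y in Bd n k, gk n η e (ut x₀ R u) x y ≤
      ENNReal.ofReal (R ^ ((s + ε) * η) * ((2:ℝ) ^ k) ^ ((n:ℝ) + ε * p) * N *
        ⨍ z in bB n x₀ (2 ^ k * R), Hfun n p q s t ε a u z ^ gammaEx n p s ε ∂nu n p ε) := by
  have hutm : Measurable (ut x₀ R u) := by unfold ut; fun_prop
  have hm : Measurable (fun z : En n × En n => gk n η e (ut x₀ R u) z.1 z.2) := gk_meas n η e hutm
  have hHm : Measurable (fun z => Hfun n p q s t ε a u z ^ gammaEx n p s ε) :=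
    (H_meas (p := p) (q := q) (s := s) (t := t) (ε := ε) ham hu).pow_const _
  have h0 : ∫⁻ x in Bd n k, ∫⁻ y in Bd n k, gk n η e (ut x₀ R u) x y =
      ∫⁻ z in bB n 0 (2 ^ k), gk n η e (ut x₀ R u) z.1 z.2 := by
    unfold bB
    rw [Measure.volume_eq_prod, setLIntegral_prod _ hm.aemeasurable]
  rw [h0]
  simp_rw [gk_T2 he0 hn hR]
  rw [lintegral_const_mul' _ _ ENNReal.ofReal_ne_top,
    T2_slint x₀ hR (fun z => ENNReal.ofReal (|u z.1 - u z.2| ^ η / ‖z.1 - z.2‖ ^ ((n:ℝ) + e)))]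
  have h1 : ∫⁻ z in bB n x₀ (2 ^ k * R), ENNReal.ofReal (|u z.1 - u z.2| ^ η / ‖z.1 - z.2‖ ^ ((n:ℝ) + e)) ≤
      ENNReal.ofReal ((2 ^ k * R) ^ ((n:ℝ) + ε * p) * N * ⨍ z in bB n x₀ (2 ^ k * R), Hfun n p q s t ε a u z ^ gammaEx n p s ε ∂nu n p ε) := by
    rw [← avg_inv hN hNe (by positivity) x₀ hHm (fun z => Real.rpow_nonneg (H_nonneg ha u z) _) hfin]
    refine lintegral_mono (fun z => ENNReal.ofReal_le_ofReal ?_)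
    rw [← U_dn hn hεp he he0]
    refine mul_le_mul_of_nonneg_right ?_ (dn_nonneg n p ε z)
    rw [hη]
    exact H_gam hp ha u (hη ▸ hη0) z
  refine (mul_le_mul' le_rfl (mul_le_mul' le_rfl h1)).trans ?_
  rw [← ENNReal.ofReal_mul (by positivity), ← ENNReal.ofReal_mul (by positivity)]
  refine ENNReal.ofReal_le_ofReal (le_of_eq ?_)
  rw [Real.mul_rpow (by positivity) hR.le]
  have e1 : R ^ ((s + ε) * η) = R ^ ((n:ℝ) + e) * R ^ (-(2 * n : ℝ)) * R ^ ((n:ℝ) + ε * p) := by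
    rw [← Real.rpow_add hR, ← Real.rpow_add hR, he]; congr 1; ring
  rw [e1]
  ring

theorem L_bd {n : ℕ} (hn : 2 ≤ n) {p q s t K0 R : ℝ} (hp : 2 ≤ p) (hpq : p ≤ q) (hs0 : 0 < s) (ht0 : 0 < t)
    (htq : t * q ≤ s * p) (hR : 0 < R) (hK0 : 1 ≤ K0) (x₀ : En n)
    {a : En n × En n → ℝ} {u f : En n → ℝ}
    (hA : Adm n p s (t * q) K0 (Kt p q s t x₀ R a u) (ut x₀ R u) f) {Y : ℝ}
    (hY : ∫⁻ z in ball (0:En n) (1/4) ×ˢ ball (0:En n) (1/4),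
      ENNReal.ofReal (|ut x₀ R u z.1 - ut x₀ R u z.2| ^ p / ‖z.1 - z.2‖ ^ ((n:ℝ) + s * p)) ≤ ENNReal.ofReal Y) :
    ∫⁻ z in bB n x₀ (R / 4), ENNReal.ofReal (energyIntegrand n p q s t a u z) ≤
      ENNReal.ofReal (R ^ ((n:ℝ) - s * p) * K0 * Y) := by
  have h := T2_slint (c := 1 / 4) x₀ hR (fun z => ENNReal.ofReal (energyIntegrand n p q s t a u z))
  have e4 : 1 / 4 * R = R / 4 := by ring
  rw [e4] at h
  have h1 : ∫⁻ z in bB n 0 (1 / 4), ENNReal.ofReal (energyIntegrand n p q s t a u (T2 x₀ R z)) ≤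
      ENNReal.ofReal (R ^ (-((n:ℝ) + s * p)) * K0) * ENNReal.ofReal Y := by
    refine le_trans ?_ (mul_le_mul' le_rfl hY)
    rw [← lintegral_const_mul' _ _ ENNReal.ofReal_ne_top]
    refine setLIntegral_mono' (bB_meas n 0 (1 / 4)) (fun z hz => ?_)
    rw [← ENNReal.ofReal_mul (by positivity)]
    refine ENNReal.ofReal_le_ofReal ?_
    have hs := sc_energy hn hp hpq hs0 ht0 hR x₀ a u z
    have hd1 : ‖z.1 - z.2‖ ≤ 1 := by
      have h1 := hz.1
      have h2 := hz.2
      rw [mem_ball_zero_iff] at h1 h2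
      linarith [norm_sub_le z.1 z.2]
    have hk : Kt p q s t x₀ R a u z ≤ K0 := by
      refine (hA.K2 z).trans ?_
      unfold kap
      rw [max_eq_left (Real.rpow_le_one (norm_nonneg _) hd1 (by linarith)), mul_one]
    have e5 : energyIntegrand n p q s t a u (T2 x₀ R z) = R ^ (-((n:ℝ) + s * p)) * (Kt p q s t x₀ R a u z *
        (|ut x₀ R u z.1 - ut x₀ R u z.2| ^ p / ‖z.1 - z.2‖ ^ ((n:ℝ) + s * p))) := by
      rw [mul_div_assoc] at hs
      rw [hs, ← mul_assoc, ← Real.rpow_add hR, neg_add_cancel, Real.rpow_zero, one_mul]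
    rw [e5, mul_assoc]
    refine mul_le_mul_of_nonneg_left (mul_le_mul_of_nonneg_right hk ?_) (by positivity)
    positivity
  rw [h] at h1
  have h2 := mul_le_mul' (le_refl (ENNReal.ofReal (R ^ (2 * n : ℝ)))) h1
  rw [← mul_assoc, ← ENNReal.ofReal_mul (by positivity), ← Real.rpow_add hR, add_neg_cancel, Real.rpow_zero, ENNReal.ofReal_one,
    one_mul, ← ENNReal.ofReal_mul (by positivity), ← ENNReal.ofReal_mul (by positivity)] at h2
  refine h2.trans (ENNReal.ofReal_le_ofReal (le_of_eq ?_))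
  have e6 : R ^ ((n:ℝ) - s * p) = R ^ (2 * n : ℝ) * R ^ (-((n:ℝ) + s * p)) := by
    rw [← Real.rpow_add hR]; congr 1; ring
  rw [e6]; ring

theorem F_bd {n : ℕ} (hn : 2 ≤ n) {p ε R N r : ℝ} (hp : 2 ≤ p) (hε : 0 < ε)
    (hεp : ε * p < 1) (hR : 0 < R)
    (hN : 0 < N) (hNe : nu n p ε (bB n 0 1) = ENNReal.ofReal N) (x₀ : En n) {f : En n → ℝ} (hf : Measurable f)
    (hfin : ∫⁻ x in ball x₀ R, ENNReal.ofReal (|f x| ^ r) < ⊤) :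
    (∫⁻ x in ball x₀ R, ENNReal.ofReal (|f x| ^ r)).toReal ≤
      2 ^ (n:ℝ) / om n * (R ^ (n:ℝ) * N * ⨍ z in bB n x₀ R, |f z.1| ^ r ∂nu n p ε) := by
  have hp0 : 0 < p := by linarith
  have hn2 : (2:ℝ) ≤ n := by exact_mod_cast hn
  have hom := om_pos n
  have hfm : Measurable (fun x => |f x| ^ r) := hf.abs.pow_const r
  have hgm : Measurable (fun z : En n × En n => |f z.1| ^ r) := hfm.comp measurable_fst
  -- finiteness
  have hfin2 : ∫⁻ z in bB n x₀ R, ENNReal.ofReal (|f z.1| ^ r * dn n p ε z) < ⊤ := by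
    have h := T2_slint (c := 1) x₀ hR (fun z => ENNReal.ofReal (|f z.1| ^ r * dn n p ε z))
    rw [one_mul] at h
    have h1 : ∫⁻ z in bB n 0 1, ENNReal.ofReal (|f (T2 x₀ R z).1| ^ r * dn n p ε (T2 x₀ R z)) < ⊤ := by
      have e : ∀ z : En n × En n, ENNReal.ofReal (|f (T2 x₀ R z).1| ^ r * dn n p ε (T2 x₀ R z)) =
          ENNReal.ofReal (R ^ (ε * p - n)) * (ENNReal.ofReal (|f (x₀ + R • z.1)| ^ r) * ENNReal.ofReal (‖z.1 - z.2‖ ^ (ε * p - n))) := by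
        intro z
        unfold dn
        rw [T2_norm x₀ hR, Real.mul_rpow hR.le (norm_nonneg _), ← ENNReal.ofReal_mul (by positivity),
          ← ENNReal.ofReal_mul (by positivity)]
        congr 1
        show |f (x₀ + R • z.1)| ^ r * _ = _
        ring
      simp_rw [e]
      rw [lintegral_const_mul' _ _ ENNReal.ofReal_ne_top]
      refine ENNReal.mul_lt_top ENNReal.ofReal_lt_top ?_
      refine lt_of_le_of_lt (ker_int n hn (b := ε * p) (by positivity) (φ := fun x => ENNReal.ofReal (|f (x₀ + R • x)| ^ r))
        (by fun_prop)) ?_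
      rw [T1_slint x₀ hR (fun x => ENNReal.ofReal (|f x| ^ r))]
      exact ENNReal.mul_lt_top ENNReal.ofReal_lt_top (ENNReal.mul_lt_top ENNReal.ofReal_lt_top hfin)
    rw [h] at h1
    refine ENNReal.lt_top_of_mul_ne_top_right h1.ne ?_
    rw [ENNReal.ofReal_ne_zero_iff]
    positivity
  have hI := avg_inv hN hNe hR x₀ hgm (fun z => by positivity) hfin2
  have hlow : ENNReal.ofReal ((2 * R) ^ (ε * p - n) * (om n * R ^ (n:ℝ))) * ∫⁻ x in ball x₀ R, ENNReal.ofReal (|f x| ^ r) ≤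
      ∫⁻ z in bB n x₀ R, ENNReal.ofReal (|f z.1| ^ r * dn n p ε z) := by
    have h1 : ∫⁻ z in bB n x₀ R, ENNReal.ofReal ((2 * R) ^ (ε * p - n)) * ENNReal.ofReal (|f z.1| ^ r) ≤
        ∫⁻ z in bB n x₀ R, ENNReal.ofReal (|f z.1| ^ r * dn n p ε z) := by
      refine lintegral_mono_ae ?_
      filter_upwards [ae_restrict_of_ae (s := bB n x₀ R) (diag_ae n hn), ae_restrict_mem (bB_meas n x₀ R)] with z hz hzB
      rw [← ENNReal.ofReal_mul (by positivity), mul_comm]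
      refine ENNReal.ofReal_le_ofReal (mul_le_mul_of_nonneg_left ?_ (by positivity))
      have hd : 0 < ‖z.1 - z.2‖ := norm_pos_iff.2 (sub_ne_zero.2 hz)
      have hd2 : ‖z.1 - z.2‖ ≤ 2 * R := by
        have h1 := hzB.1
        have h2 := hzB.2
        rw [mem_ball_iff_norm] at h1 h2
        have := norm_sub_le (z.1 - x₀) (z.2 - x₀)
        rw [sub_sub_sub_cancel_right] at this
        linarith
      exact Real.rpow_le_rpow_of_nonpos hd hd2 (by linarith)
    refine le_trans (le_of_eq ?_) h1
    rw [lintegral_const_mul' _ _ ENNReal.ofReal_ne_top]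
    unfold bB
    rw [Measure.volume_eq_prod, setLIntegral_prod _ hgm.ennreal_ofReal.aemeasurable]
    simp only [lintegral_const, Measure.restrict_apply_univ]
    rw [lintegral_mul_const _ hfm.ennreal_ofReal, vol_ball n x₀ hR, ENNReal.ofReal_mul (by positivity)]
    ring
  rw [hI] at hlow
  have hA0 : 0 ≤ ⨍ z in bB n x₀ R, |f z.1| ^ r ∂nu n p ε := avg_nonneg (fun z => by positivity)
  rw [← ENNReal.ofReal_toReal hfin.ne, ← ENNReal.ofReal_mul (by positivity), ENNReal.ofReal_le_ofReal_iff (by positivity)] at hlow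
  generalize (∫⁻ x in ball x₀ R, ENNReal.ofReal (|f x| ^ r)).toReal = f0 at *
  generalize ⨍ z in bB n x₀ R, |f z.1| ^ r ∂nu n p ε = A at *
  have e1 : (2 * R) ^ (ε * p - n) * (om n * R ^ (n:ℝ)) = 2 ^ (ε * p) * (2 ^ (n:ℝ))⁻¹ * om n * R ^ (ε * p) := by
    rw [Real.mul_rpow (by norm_num) hR.le, Real.rpow_sub (by norm_num), Real.rpow_sub hR]
    field_simp
  rw [e1, Real.rpow_add hR] at hlow
  have h2 : (1:ℝ) ≤ 2 ^ (ε * p) := Real.one_le_rpow (by norm_num) (by positivity)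
  rcases le_total f0 0 with hf0 | hf0
  · exact hf0.trans (by positivity)
  have h3 : R ^ (ε * p) * f0 ≤ R ^ (ε * p) * (2 ^ (n:ℝ) / om n * (R ^ (n:ℝ) * N * A)) := by
    calc R ^ (ε * p) * f0 = 1 * (R ^ (ε * p) * f0) := by ring
      _ ≤ 2 ^ (ε * p) * (R ^ (ε * p) * f0) := mul_le_mul_of_nonneg_right h2 (by positivity)
      _ = 2 ^ (n:ℝ) / om n * (2 ^ (ε * p) * (2 ^ (n:ℝ))⁻¹ * om n * R ^ (ε * p) * f0) := by field_simp
      _ ≤ 2 ^ (n:ℝ) / om n * (R ^ (n:ℝ) * R ^ (ε * p) * N * A) := mul_le_mul_of_nonneg_left hlow (by positivity)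
      _ = _ := by ring
  exact le_of_mul_le_mul_left h3 (by positivity)

theorem term_alg {n p q s t ε η γ R N A : ℝ} (k : ℕ) (hp : 2 ≤ p) (hη : 0 < η) (hγ : γ = η / (p - 1))
    (hηe : (n + ε * p) / η = (n + s * p + ε * p) / p) (hτ : 0 ≤ t * q / (p - 1) - s - ε)
    (hR : 0 < R) (hN : 0 < N) (hA : 0 ≤ A) :
    (2:ℝ) ^ (-(k:ℝ) * (t * q)) * (((2:ℝ) ^ k) ^ (-(n / p)) *
      (R ^ ((s + ε) * η) * ((2:ℝ) ^ k) ^ (n + ε * p) * N * A) ^ (1 / η)) ^ (p - 1) ≤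
    R ^ ((s + ε) * (p - 1)) * N ^ (1 / γ) * ((2:ℝ) ^ (-(k:ℝ) * (t * q / (p - 1) - s - ε)) * A ^ (1 / γ)) := by
  have hp1 : 0 < p - 1 := by linarith
  have hp0 : 0 < p := by linarith
  have e2 : ((2:ℝ) ^ k) = 2 ^ (k:ℝ) := (Real.rpow_natCast 2 k).symm
  have h2 : (0:ℝ) < 2 := by norm_num
  have eg : 1 / γ = 1 / η * (p - 1) := by rw [hγ]; field_simp
  rw [e2, ← Real.rpow_mul h2.le, ← Real.rpow_mul h2.le, Real.mul_rpow (by positivity) (by positivity), ← Real.rpow_mul (by positivity),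
    ← Real.rpow_mul (by positivity), ← eg,
    Real.mul_rpow (by positivity) hA, Real.mul_rpow (by positivity) hN.le, Real.mul_rpow (by positivity) (by positivity),
    ← Real.rpow_mul hR.le, ← Real.rpow_mul h2.le]
  have e3 : (s + ε) * η * (1 / γ) = (s + ε) * (p - 1) := by rw [hγ]; field_simp
  rw [e3]
  calc _ = R ^ ((s + ε) * (p - 1)) * N ^ (1 / γ) * (2 ^ (-(k:ℝ) * (t * q)) * 2 ^ ((k:ℝ) * -(n / p) * (p - 1)) *
        2 ^ ((k:ℝ) * (n + ε * p) * (1 / γ)) * A ^ (1 / γ)) := by ring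
    _ ≤ _ := by
      rw [← Real.rpow_add h2, ← Real.rpow_add h2]
      refine mul_le_mul_of_nonneg_left (mul_le_mul_of_nonneg_right (Real.rpow_le_rpow_of_exponent_le (by norm_num) ?_)
        (by positivity)) (by positivity)
      have e4 : (n + ε * p) * (1 / γ) = (n + s * p + ε * p) / p * (p - 1) := by
        rw [← hηe, eg]; ring
      have e5 : -(k:ℝ) * (t * q) + (k:ℝ) * -(n / p) * (p - 1) + (k:ℝ) * (n + ε * p) * (1 / γ) =
          -(k:ℝ) * ((p - 1) * (t * q / (p - 1) - s - ε)) := by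
        rw [mul_assoc (k:ℝ) (n + ε * p), e4]; field_simp; ring
      rw [e5]
      have : (t * q / (p - 1) - s - ε) ≤ (p - 1) * (t * q / (p - 1) - s - ε) := le_mul_of_one_le_left hτ (by linarith)
      have := mul_le_mul_of_nonneg_left this (Nat.cast_nonneg (α := ℝ) k)
      linarith

theorem yalg {p η L x σ : ℝ} (hp : 2 ≤ p) (hη : p / 2 ≤ η) (hηp : η ≤ p) (hx : 0 < x) (hxL : x ≤ L) (hσ : 0 < σ) :
    ((L ^ (1 / (p - 1))) ^ (p - η) * x ^ (η / (p - 1))) ^ (1 / pC p) ≤ σ * L + x / σ := by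
  have hp1 : 0 < p - 1 := by linarith
  have hp0 : 0 < p := by linarith
  have hL : 0 < L := by linarith
  have e0 : ((L ^ (1 / (p - 1))) ^ (p - η) * x ^ (η / (p - 1))) ^ (1 / pC p) = L ^ ((p - η) / p) * x ^ (η / p) := by
    unfold pC
    rw [Real.mul_rpow (by positivity) (by positivity), ← Real.rpow_mul hL.le, ← Real.rpow_mul hL.le, ← Real.rpow_mul hx.le]
    congr 2 <;> field_simp
  have e1 : L ^ ((p - η) / p) * x ^ (η / p) ≤ L ^ (1 / 2 : ℝ) * x ^ (1 / 2 : ℝ) := by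
    have h2 : x ^ (η / p) = x ^ (η / p - 1 / 2) * x ^ (1 / 2 : ℝ) := by rw [← Real.rpow_add hx]; congr 1; ring
    have h3 : L ^ (1 / 2 : ℝ) = L ^ ((p - η) / p) * L ^ (η / p - 1 / 2) := by
      rw [← Real.rpow_add hL]; congr 1; field_simp; ring
    have h4 : 0 ≤ η / p - 1 / 2 := by
      have : 1 / 2 ≤ η / p := by rw [le_div_iff₀ hp0]; linarith
      linarith
    rw [h2, h3, ← mul_assoc]
    exact mul_le_mul_of_nonneg_right (mul_le_mul_of_nonneg_left (Real.rpow_le_rpow hx.le hxL h4) (by positivity)) (by positivity)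
  rw [e0]
  refine e1.trans ?_
  rw [← Real.sqrt_eq_rpow, ← Real.sqrt_eq_rpow, ← Real.sqrt_mul hL.le]
  refine Real.sqrt_le_iff.2 ⟨by positivity, ?_⟩
  have e5 : (σ * L + x / σ) ^ 2 = (σ * L) ^ 2 + 2 * (L * x) + (x / σ) ^ 2 := by field_simp; ring
  rw [e5]
  have : 0 < L * x := by positivity
  have := sq_nonneg (σ * L)
  have := sq_nonneg (x / σ)
  linarith

theorem npow_bd {N Cν ε μ : ℝ} (hN : 0 < N) (hC : 1 ≤ Cν) (hε : 0 < ε) (h : N ≤ Cν / ε) (hμ0 : 0 ≤ μ) (hμ1 : μ ≤ 1) :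
    N ^ μ ≤ Cν / ε ^ μ := by
  calc N ^ μ ≤ (Cν / ε) ^ μ := Real.rpow_le_rpow hN.le h hμ0
    _ = Cν ^ μ / ε ^ μ := Real.div_rpow (by linarith) hε.le _
    _ ≤ Cν / ε ^ μ := by
      refine div_le_div_of_nonneg_right ?_ (by positivity)
      calc Cν ^ μ ≤ Cν ^ (1:ℝ) := Real.rpow_le_rpow_of_exponent_le hC hμ1
        _ = Cν := Real.rpow_one _

theorem lhs_alg {n p s ε R N X C1 Y F : ℝ} (hn : 0 < n) (hp : 2 ≤ p) (hεp : ε * p < 1)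
    (hR : 0 < R) (hN : 0 < N) (hX0 : 0 ≤ X) (hC1 : 1 ≤ C1) (hY : 0 ≤ Y) (hF : 0 ≤ F)
    (hX : X ≤ ((R / 4) ^ (n + ε * p) * N)⁻¹ * (R ^ (n - s * p) * (C1 * (Y + F ^ pC p)))) :
    X ^ (1 / pC p) ≤ 4 ^ (n + 1) * C1 * ((R ^ ((s + ε) * (p - 1)))⁻¹ * (N ^ (1 / pC p))⁻¹ * (Y ^ (1 / pC p) + F)) := by
  have hp1 : 0 < p - 1 := by linarith
  have hp0 : 0 < p := by linarith
  have hpC : 0 < pC p := by unfold pC; positivity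
  have hpC1 : 1 / pC p ≤ 1 := by
    unfold pC; rw [one_div_div, div_le_one hp0]; linarith
  have e1 : ((R / 4) ^ (n + ε * p) * N)⁻¹ * (R ^ (n - s * p) * (C1 * (Y + F ^ pC p))) =
      (4 ^ (n + ε * p) * C1) * ((R ^ ((s + ε) * p))⁻¹ * N⁻¹ * (Y + F ^ pC p)) := by
    rw [Real.div_rpow hR.le (by norm_num)]
    have : R ^ (n - s * p) = R ^ (n + ε * p) * (R ^ ((s + ε) * p))⁻¹ := by
      rw [← Real.rpow_neg hR.le, ← Real.rpow_add hR]; congr 1; ring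
    rw [this]
    have h1 : R ^ (n + ε * p) ≠ 0 := by positivity
    have h2 : R ^ ((s + ε) * p) ≠ 0 := by positivity
    have h3 : (4:ℝ) ^ (n + ε * p) ≠ 0 := by positivity
    generalize R ^ (n + ε * p) = a at *
    generalize R ^ ((s + ε) * p) = b at *
    generalize (4:ℝ) ^ (n + ε * p) = c at *
    field_simp
  have hc : 4 ^ (n + ε * p) * C1 ≤ 4 ^ (n + 1) * C1 := by
    refine mul_le_mul_of_nonneg_right (Real.rpow_le_rpow_of_exponent_le (by norm_num) (by linarith)) (by linarith)
  have hc1 : 1 ≤ 4 ^ (n + 1) * C1 := by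
    have : (1:ℝ) ≤ 4 ^ (n + 1) := Real.one_le_rpow (by norm_num) (by linarith)
    nlinarith
  rw [e1] at hX
  have hX2 : X ≤ (4 ^ (n + 1) * C1) * ((R ^ ((s + ε) * p))⁻¹ * N⁻¹ * (Y + F ^ pC p)) :=
    hX.trans (mul_le_mul_of_nonneg_right hc (by positivity))
  generalize 4 ^ (n + 1) * C1 = D at *
  have hD : 0 < D := by linarith
  calc X ^ (1 / pC p) ≤ (D * ((R ^ ((s + ε) * p))⁻¹ * N⁻¹ * (Y + F ^ pC p))) ^ (1 / pC p) :=
        Real.rpow_le_rpow hX0 hX2 (by positivity)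
    _ = D ^ (1 / pC p) * ((R ^ ((s + ε) * (p - 1)))⁻¹ * (N ^ (1 / pC p))⁻¹ * (Y + F ^ pC p) ^ (1 / pC p)) := by
        rw [Real.mul_rpow hD.le (by positivity), Real.mul_rpow (by positivity) (by positivity),
          Real.mul_rpow (by positivity) (by positivity), Real.inv_rpow (by positivity), Real.inv_rpow hN.le, ← Real.rpow_mul hR.le]
        have : (s + ε) * p * (1 / pC p) = (s + ε) * (p - 1) := by unfold pC; field_simp
        rw [this]
    _ ≤ D * ((R ^ ((s + ε) * (p - 1)))⁻¹ * (N ^ (1 / pC p))⁻¹ * (Y ^ (1 / pC p) + F)) := by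
        refine mul_le_mul ?_ (mul_le_mul_of_nonneg_left ?_ (by positivity)) (by positivity) hD.le
        · calc D ^ (1 / pC p) ≤ D ^ (1:ℝ) := Real.rpow_le_rpow_of_exponent_le hc1 hpC1
            _ = D := Real.rpow_one _
        · refine (Real.rpow_add_le_add_rpow hY (by positivity) (by positivity) hpC1).trans ?_
          rw [← Real.rpow_mul hF, mul_one_div_cancel hpC.ne', Real.rpow_one]

theorem fpart {n p s ε R N Cν c C3 f0 A r θ : ℝ} (hn : 2 ≤ n) (hp : 2 ≤ p) (hs0 : 0 < s) (hs1 : s < 1) (hε : 0 < ε) (hεp : ε * p < s)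
    (hR : 0 < R) (hN : 0 < N) (hC : 1 ≤ Cν) (hNC : N ≤ Cν / ε) (hc0 : 0 < c) (hc1 : c ≤ 1) (hcN : c ≤ N)
    (hr : 0 < r) (hrd : 1 / r - 1 / pC p = s / n) (hC3 : 0 < C3) (hf0 : 0 ≤ f0) (hA : 0 ≤ A)
    (hf : f0 ≤ C3 * (R ^ n * N * A)) (hθ : θ = (s - ε * (p - 1)) / (n + ε * p)) :
    (R ^ ((s + ε) * (p - 1)))⁻¹ * (N ^ (1 / pC p))⁻¹ * (R ^ (s * p - n / r) * f0 ^ (1 / r)) ≤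
      C3 ^ (1 / r) * Cν / c * ((R ^ (n + ε * p) * N) ^ θ / ε ^ (1 / r - 1 / pC p) * A ^ (1 / r)) := by
  have hp0 : 0 < p := by linarith
  have hE : 0 < n + ε * p := by positivity
  have hθ0 : 0 ≤ θ := by
    rw [hθ]; refine div_nonneg ?_ hE.le
    linarith
  have hθ1 : θ ≤ 1 := by
    rw [hθ, div_le_one hE]
    nlinarith
  have h1 : f0 ^ (1 / r) ≤ C3 ^ (1 / r) * (R ^ (n / r) * N ^ (1 / r) * A ^ (1 / r)) := by
    calc f0 ^ (1 / r) ≤ (C3 * (R ^ n * N * A)) ^ (1 / r) := Real.rpow_le_rpow hf0 hf (by positivity)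
      _ = _ := by
        rw [Real.mul_rpow hC3.le (by positivity), Real.mul_rpow (by positivity) hA, Real.mul_rpow (by positivity) hN.le,
          ← Real.rpow_mul hR.le, mul_one_div]
  have hμ0 : 0 ≤ 1 / r - 1 / pC p := by rw [hrd]; positivity
  have hμ1 : 1 / r - 1 / pC p ≤ 1 := by rw [hrd, div_le_one (by linarith)]; linarith
  have h2 := npow_bd hN hC hε hNC hμ0 hμ1
  have h3 : c ≤ N ^ θ := by
    calc c = c ^ (1:ℝ) := (Real.rpow_one _).symm
      _ ≤ c ^ θ := Real.rpow_le_rpow_of_exponent_ge hc0 hc1 hθ1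
      _ ≤ N ^ θ := Real.rpow_le_rpow hc0.le hcN hθ0
  have e4 : (R ^ (n + ε * p) * N) ^ θ = R ^ (s * p) * (R ^ ((s + ε) * (p - 1)))⁻¹ * N ^ θ := by
    rw [Real.mul_rpow (by positivity) hN.le, ← Real.rpow_mul hR.le, ← Real.rpow_neg hR.le, ← Real.rpow_add hR, hθ]
    congr 2
    field_simp
    ring
  have e5 : R ^ (s * p) = R ^ (s * p - n / r) * R ^ (n / r) := by rw [← Real.rpow_add hR]; congr 1; ring
  have e6 : N ^ (1 / r - 1 / pC p) = N ^ (1 / r) * (N ^ (1 / pC p))⁻¹ := by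
    rw [← Real.rpow_neg hN.le, ← Real.rpow_add hN]; congr 1
  calc _ ≤ (R ^ ((s + ε) * (p - 1)))⁻¹ * (N ^ (1 / pC p))⁻¹ * (R ^ (s * p - n / r) *
        (C3 ^ (1 / r) * (R ^ (n / r) * N ^ (1 / r) * A ^ (1 / r)))) :=
        mul_le_mul_of_nonneg_left (mul_le_mul_of_nonneg_left h1 (by positivity)) (by positivity)
    _ = C3 ^ (1 / r) * (R ^ (s * p) * (R ^ ((s + ε) * (p - 1)))⁻¹) * A ^ (1 / r) * N ^ (1 / r - 1 / pC p) := by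
        rw [e5, e6]; ring
    _ ≤ C3 ^ (1 / r) * (R ^ (s * p) * (R ^ ((s + ε) * (p - 1)))⁻¹) * A ^ (1 / r) * (Cν / ε ^ (1 / r - 1 / pC p)) :=
        mul_le_mul_of_nonneg_left h2 (by positivity)
    _ = C3 ^ (1 / r) * (R ^ (s * p) * (R ^ ((s + ε) * (p - 1)))⁻¹) * A ^ (1 / r) * (Cν / ε ^ (1 / r - 1 / pC p)) * (c / c) := by
        rw [div_self hc0.ne', mul_one]
    _ ≤ C3 ^ (1 / r) * (R ^ (s * p) * (R ^ ((s + ε) * (p - 1)))⁻¹) * A ^ (1 / r) * (Cν / ε ^ (1 / r - 1 / pC p)) * (N ^ θ / c) :=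
        mul_le_mul_of_nonneg_left (div_le_div_of_nonneg_right h3 hc0.le) (by positivity)
    _ = _ := by rw [e4]; ring

theorem upart {ε N Cν P μ γ' pc' S a σ : ℝ} (hP : 0 < P) (hN : 0 < N) (hC : 1 ≤ Cν) (hε : 0 < ε) (hNC : N ≤ Cν / ε)
    (hμ : μ = γ' - pc') (hμ0 : 0 ≤ μ) (hμ1 : μ ≤ 1) (hS : 0 ≤ S) (ha : 0 ≤ a) (hσ : 0 < σ) :
    P⁻¹ * (N ^ pc')⁻¹ * (σ * (P * N ^ γ' * S) + P * N ^ γ' * a / σ) ≤ Cν / σ / ε ^ μ * a + Cν * σ / ε ^ μ * S := by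
  have h2 := npow_bd hN hC hε hNC hμ0 hμ1
  have e6 : N ^ μ = N ^ γ' * (N ^ pc')⁻¹ := by
    rw [← Real.rpow_neg hN.le, ← Real.rpow_add hN, hμ]; congr 1
  calc _ = N ^ μ * (σ * S + a / σ) := by
        rw [e6]; field_simp
    _ ≤ Cν / ε ^ μ * (σ * S + a / σ) := mul_le_mul_of_nonneg_right h2 (by positivity)
    _ = _ := by ring

theorem avg_bd {n : ℕ} (hn : 2 ≤ n) {p q s t ε N R : ℝ} (hp : 2 ≤ p) (hq : 0 < q) (hs0 : 0 < s) (ht0 : 0 < t) (hε : 0 < ε)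
    (hεp : ε * p < 1) (hN : 0 < N) (hNe : nu n p ε (bB n 0 1) = ENNReal.ofReal N) (hR : 0 < R) (x₀ : En n)
    {a : En n × En n → ℝ} (ham : Measurable a) (ha : ∀ z, 0 ≤ a z) {u : En n → ℝ} (hu : Measurable u)
    (hE : ∫⁻ z, ENNReal.ofReal (energyIntegrand n p q s t a u z) < ⊤) (k : ℕ) :
    ∫⁻ z in bB n x₀ (2 ^ k * R), ENNReal.ofReal (Hfun n p q s t ε a u z ^ gammaEx n p s ε * dn n p ε z) < ⊤ ∧
    ⨍ z in bB n x₀ (2 ^ k * R), Hfun n p q s t ε a u z ^ gammaEx n p s ε ∂nu n p ε ≤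
      1 + (R ^ ((n:ℝ) + ε * p) * N)⁻¹ * (∫⁻ z, ENNReal.ofReal (energyIntegrand n p q s t a u z)).toReal := by
  have hp0 : 0 < p := by linarith
  have hr : 0 < 2 ^ k * R := by positivity
  have h := Hg_bd hn hp hq hs0 ht0 hε hεp ha u x₀ (2 ^ k * R)
  rw [nu_scale n p ε x₀ hr, hNe, ← ENNReal.ofReal_mul (by positivity)] at h
  have hlt := lt_of_le_of_lt h (ENNReal.add_lt_top.2 ⟨ENNReal.ofReal_lt_top, hE⟩)
  refine ⟨hlt, ?_⟩
  have hHm : Measurable (fun z => Hfun n p q s t ε a u z ^ gammaEx n p s ε) :=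
    (H_meas (p := p) (q := q) (s := s) (t := t) (ε := ε) ham hu).pow_const _
  rw [avg_eq hN hNe hr x₀ hHm (fun z => Real.rpow_nonneg (H_nonneg ha u z) _)]
  have h2 := ENNReal.toReal_mono (ENNReal.add_lt_top.2 ⟨ENNReal.ofReal_lt_top, hE⟩).ne h
  rw [ENNReal.toReal_add ENNReal.ofReal_ne_top hE.ne, ENNReal.toReal_ofReal (by positivity)] at h2
  have hE0 : 0 ≤ (∫⁻ z, ENNReal.ofReal (energyIntegrand n p q s t a u z)).toReal := ENNReal.toReal_nonneg
  generalize (∫⁻ z, ENNReal.ofReal (energyIntegrand n p q s t a u z)).toReal = E at *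
  have h3 : R ^ ((n:ℝ) + ε * p) * N ≤ (2 ^ k * R) ^ ((n:ℝ) + ε * p) * N := by
    refine mul_le_mul_of_nonneg_right (Real.rpow_le_rpow hR.le ?_ (by positivity)) hN.le
    exact le_mul_of_one_le_left hR.le (one_le_pow₀ (by norm_num))
  have h4 : 0 < R ^ ((n:ℝ) + ε * p) * N := by positivity
  have h5 : 0 < (2 ^ k * R) ^ ((n:ℝ) + ε * p) * N := by positivity
  calc _ ≤ ((2 ^ k * R) ^ ((n:ℝ) + ε * p) * N)⁻¹ * ((2 ^ k * R) ^ ((n:ℝ) + ε * p) * N + E) :=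
        mul_le_mul_of_nonneg_left h2 (by positivity)
    _ = 1 + ((2 ^ k * R) ^ ((n:ℝ) + ε * p) * N)⁻¹ * E := by rw [mul_add, inv_mul_cancel₀ h5.ne']
    _ ≤ _ := add_le_add le_rfl (mul_le_mul_of_nonneg_right (inv_anti₀ h4 h3) hE0)

theorem zero_case {n : ℕ} {p ε γ r R : ℝ} (hγ : 0 < γ) (hr : 0 < r) (x₀ : En n) {H : En n × En n → ℝ} (hH : Measurable H)
    (hH0 : ∀ z, 0 ≤ H z) (hR : 0 < R)
    (h : ∫⁻ z in bB n x₀ R, ENNReal.ofReal (H z ^ γ * dn n p ε z) = 0) :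
    ∫⁻ z in bB n x₀ (R / 4), ENNReal.ofReal (H z ^ r * dn n p ε z) = 0 := by
  have hd := dn_meas n p ε
  have hsub : bB n x₀ (R / 4) ⊆ bB n x₀ R := by
    unfold bB
    exact prod_mono (ball_subset_ball (by linarith)) (ball_subset_ball (by linarith))
  refine le_antisymm ((lintegral_mono_set hsub).trans ?_) bot_le
  have hm : ∀ e : ℝ, Measurable (fun z => ENNReal.ofReal (H z ^ e * dn n p ε z)) :=
    fun e => ((hH.pow_const e).mul hd).ennreal_ofReal
  rw [lintegral_eq_zero_iff (hm γ)] at h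
  refine le_of_eq ?_
  rw [lintegral_eq_zero_iff (hm r)]
  filter_upwards [h] with z hz
  simp only [Pi.zero_apply, ENNReal.ofReal_eq_zero] at hz ⊢
  rcases eq_or_lt_of_le (hH0 z) with h0 | h0
  · rw [← h0, Real.zero_rpow hr.ne', zero_mul]
  · have : 0 < H z ^ γ := by positivity
    have hdz : dn n p ε z ≤ 0 := by
      by_contra hc
      push Not at hc
      have := mul_pos this hc
      linarith
    exact mul_nonpos_of_nonneg_of_nonpos (by positivity) hdz

theorem sum_geo {τ B : ℝ} (hτ : 0 < τ) {g : ℕ → ℝ} (hg0 : ∀ k, 0 ≤ g k) (hg : ∀ k, g k ≤ B) :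
    Summable (fun k : ℕ => (2:ℝ) ^ (-(k:ℝ) * τ) * g k) := by
  have h2 : (2:ℝ) ^ (-τ) < 1 := Real.rpow_lt_one_of_one_lt_of_neg (by norm_num) (by linarith)
  have e : ∀ k : ℕ, (2:ℝ) ^ (-(k:ℝ) * τ) = ((2:ℝ) ^ (-τ)) ^ k := by
    intro k
    rw [← Real.rpow_natCast, ← Real.rpow_mul (by norm_num)]; congr 1; ring
  have hs := (summable_geometric_of_lt_one (by positivity) h2).mul_right B
  refine Summable.of_nonneg_of_le (fun k => mul_nonneg (by positivity) (hg0 k)) (fun k => ?_) hs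
  rw [e]
  exact mul_le_mul_of_nonneg_left (hg k) (by positivity)

set_option maxHeartbeats 1000000 in
theorem main_ineq (n : ℕ) (hn : 2 ≤ n) (p q s t M Λ : ℝ) (hp : 2 ≤ p) (hpq : p ≤ q) (hs0 : 0 < s) (hs1 : s < 1)
    (ht0 : 0 < t) (hhigh : t * q / (s * p) ≤ 1) (hspn : s * p < n) :
    ∃ C : ℝ, 0 < C ∧ ∀ ε : ℝ, 0 < ε → ε < s * (t * q / (s * p) - 1 / pC p) → ε < s / p →
      ∀ a : En n × En n → ℝ, Measurable a → (∀ z, 0 ≤ a z) → (∀ z, a z ≤ M) →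
      ∀ δ₀ : ℝ, 0 < δ₀ → ∀ f : En n → ℝ, Measurable f →
      (∀ (x₀ : En n) (R : ℝ), 0 < R → ∫⁻ x in ball x₀ R, ENNReal.ofReal (|f x| ^ (pStar n p s + δ₀)) < ⊤) →
      ∀ u : En n → ℝ, Measurable u → (∀ x, |u x| ≤ Λ) → IsBoundedWeakSolution n p q s t a u f →
      ∀ (x₀ : En n) (R : ℝ), 0 < R → R ≤ 1 → ∀ σ : ℝ, 0 < σ → σ < 1 →
        (⨍ z in bB n x₀ (R / 4), Hfun n p q s t ε a u z ^ pC p ∂nu n p ε) ^ (1 / pC p) ≤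
          C / σ / ε ^ (1 / gammaEx n p s ε - 1 / pC p) *
            (⨍ z in bB n x₀ R, Hfun n p q s t ε a u z ^ gammaEx n p s ε ∂nu n p ε) ^ (1 / gammaEx n p s ε) +
          C * σ / ε ^ (1 / gammaEx n p s ε - 1 / pC p) *
            ∑' k : ℕ, (2:ℝ) ^ (-(k:ℝ) * (t * q / (p - 1) - s - ε)) *
              (⨍ z in bB n x₀ (2 ^ k * R), Hfun n p q s t ε a u z ^ gammaEx n p s ε ∂nu n p ε) ^ (1 / gammaEx n p s ε) +
          C * (nu n p ε (bB n x₀ R)).toReal ^ thetaEx n p s ε / ε ^ (1 / pStar n p s - 1 / pC p) *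
            (⨍ z in bB n x₀ R, |f z.1| ^ pStar n p s ∂nu n p ε) ^ (1 / pStar n p s) := by
  have hp0 : 0 < p := by linarith
  have hp1 : 0 < p - 1 := by linarith
  have hq : 0 < q := by linarith
  have hn2 : (2:ℝ) ≤ n := by exact_mod_cast hn
  have hn0 : (0:ℝ) < n := by linarith
  have hsp0 : 0 < s * p := by positivity
  have htq : t * q ≤ s * p := by rwa [div_le_one hsp0] at hhigh
  have htq0 : 0 < t * q := by positivity
  have hom := om_pos n
  have hr := pStar_pos hn hp hs0
  have hpC : 0 < pC p := by unfold pC; positivity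
  have hK0 : 1 ≤ 1 + |M| * (2 * |Λ|) ^ (q - p) := by
    have : 0 ≤ |M| * (2 * |Λ|) ^ (q - p) := by positivity
    linarith
  obtain ⟨K0, hK0e⟩ : ∃ K0, K0 = 1 + |M| * (2 * |Λ|) ^ (q - p) := ⟨_, rfl⟩
  rw [← hK0e] at hK0
  obtain ⟨C0, hC0, hmain⟩ := energy_main n hn hp hs0 hs1 hspn htq0 htq hK0
  obtain ⟨c, Cν, hc0, hc1, hCν, hnu⟩ := nu_bounds n hn
  have hrd := pst_diff n hn hp hs0
  obtain ⟨C1, hC1e⟩ : ∃ C1, C1 = K0 * (1 + C0) := ⟨_, rfl⟩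
  have hC1 : 1 ≤ C1 := by rw [hC1e]; nlinarith
  obtain ⟨C3, hC3e⟩ : ∃ C3, C3 = 2 ^ (n:ℝ) / om n := ⟨_, rfl⟩
  have hC3 : 0 < C3 := by rw [hC3e]; positivity
  obtain ⟨D, hDe⟩ : ∃ D : ℝ, D = 4 ^ ((n:ℝ) + 1) * C1 := ⟨_, rfl⟩
  have hD : 0 < D := by rw [hDe]; positivity
  obtain ⟨C4, hC4e⟩ : ∃ C4, C4 = C3 ^ (1 / pStar n p s) * Cν / c := ⟨_, rfl⟩
  have hC4 : 0 < C4 := by rw [hC4e]; positivity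
  refine ⟨D * (Cν + C4), by positivity, ?_⟩
  intro ε hε hε1 hε2 a ham ha0 haM δ₀ hδ f hf hfl u hu hub hw x₀ R hR hR1 σ hσ _
  have hεp : ε * p < s := (lt_div_iff₀ hp0).1 hε2
  have hεp1 : ε * p < 1 := by linarith
  obtain ⟨N, hN, hNe, hcN, hNC⟩ := hnu p ε hp hε hεp1
  obtain ⟨x1, x2, x3, x4, x5, x6, x7⟩ := exps n hn hp hs0 hspn hε hε2
  obtain ⟨hg0, hg1⟩ := gam_bd n hn hp hs0 hε
  have hgd := gam_diff n hn hp hs0 hε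
  have hge := gam_eq n (p := p) (s := s) (ε := ε)
  have hτ : 0 < t * q / (p - 1) - s - ε := by
    have e1 : s * (t * q / (s * p) - 1 / pC p) = (t * q - s * (p - 1)) / p := by unfold pC; field_simp
    rw [e1, lt_div_iff₀ hp0] at hε1
    have : s + ε < t * q / (p - 1) := by rw [lt_div_iff₀ hp1]; linarith
    linarith
  have hηe : ((n:ℝ) + ε * p) / etaEx n p s ε = (n + s * p + ε * p) / p := by
    have hD : 0 < n + s * p + ε * p := by positivity
    have hE : 0 < n + ε * p := by positivity
    have e0 : etaEx n p s ε = p * (n + ε * p) / (n + s * p + ε * p) := by unfold etaEx; congr 1; ring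
    rw [e0]; field_simp
  have hηpos : 0 < etaEx n p s ε := by linarith
  have hA := adm_sc hn hp hpq hs0 hs1 ht0 htq hR hR1 x₀ ham ha0 haM hu hub hf hδ (hfl x₀ R hR) hw
  rw [← hK0e] at hA
  have hffin := f_fin hr.le hδ.le (hfl x₀ R hR)
  have hHm : Measurable (Hfun n p q s t ε a u) := H_meas ham hu
  have hH0 : ∀ z, 0 ≤ Hfun n p q s t ε a u z := H_nonneg ha0 u
  have hav := avg_bd hn hp hq hs0 ht0 hε hεp1 hN hNe hR x₀ ham ha0 hu hw.1
  have hLe := avg_eq hN hNe (r := R / 4) (by positivity) x₀ (hHm.pow_const (pC p)) (fun z => Real.rpow_nonneg (hH0 z) _)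
  have hAinv0 := avg_inv hN hNe hR x₀ (hHm.pow_const (gammaEx n p s ε)) (fun z => Real.rpow_nonneg (hH0 z) _)
    (by simpa using (hav 0).1)
  have hFbd := F_bd hn hp hε hεp1 hR hN hNe x₀ hf hffin
  have hnuR : (nu n p ε (bB n x₀ R)).toReal = R ^ ((n:ℝ) + ε * p) * N := by
    rw [nu_scale n p ε x₀ hR, hNe, ← ENNReal.ofReal_mul (by positivity), ENNReal.toReal_ofReal (by positivity)]
  have hQ := fun k => Q_bd (q := q) (t := t) hn hp hs0 hε hεp1 hR rfl hηpos.le (e := s * n / (n + ε * p) * etaEx n p s ε)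
    (by rw [x6]; ring) (by positivity) hN hNe x₀ ham ha0 hu k (hav k).1
  rw [hnuR]
  obtain ⟨A, hAe⟩ : ∃ A : ℕ → ℝ, A = fun k : ℕ => ⨍ z in bB n x₀ (2 ^ k * R), Hfun n p q s t ε a u z ^ gammaEx n p s ε ∂nu n p ε := ⟨_, rfl⟩
  have hAk : ∀ k : ℕ, ⨍ z in bB n x₀ (2 ^ k * R), Hfun n p q s t ε a u z ^ gammaEx n p s ε ∂nu n p ε = A k := fun k => by rw [hAe]
  have hA0e : ⨍ z in bB n x₀ R, Hfun n p q s t ε a u z ^ gammaEx n p s ε ∂nu n p ε = A 0 := by rw [hAe]; simp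
  have hAnn : ∀ k, 0 ≤ A k := by
    intro k; rw [← hAk]; exact avg_nonneg (fun z => Real.rpow_nonneg (hH0 z) _)
  have hAbd : ∀ k, A k ≤ 1 + (R ^ ((n:ℝ) + ε * p) * N)⁻¹ * (∫⁻ z, ENNReal.ofReal (energyIntegrand n p q s t a u z)).toReal := by
    intro k; rw [← hAk]; exact (hav k).2
  have hAf0 : 0 ≤ ⨍ z in bB n x₀ R, |f z.1| ^ pStar n p s ∂nu n p ε := avg_nonneg (fun z => by positivity)
  have hL0 : 0 ≤ ⨍ z in bB n x₀ (R / 4), Hfun n p q s t ε a u z ^ pC p ∂nu n p ε := avg_nonneg (fun z => Real.rpow_nonneg (hH0 z) _)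
  have hsum := sum_geo hτ (g := fun k => A k ^ (1 / gammaEx n p s ε)) (fun k => Real.rpow_nonneg (hAnn k) _)
    (fun k => Real.rpow_le_rpow (hAnn k) (hAbd k) (by positivity))
  rw [hA0e]
  simp_rw [hAk]
  obtain ⟨S, hSe⟩ : ∃ S : ℝ, S = ∑' k : ℕ, (2:ℝ) ^ (-(k:ℝ) * (t * q / (p - 1) - s - ε)) * A k ^ (1 / gammaEx n p s ε) := ⟨_, rfl⟩
  rw [← hSe]
  have hSN : ∀ m, ∑ k ∈ Finset.range m, (2:ℝ) ^ (-(k:ℝ) * (t * q / (p - 1) - s - ε)) * A k ^ (1 / gammaEx n p s ε) ≤ S := by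
    intro m
    rw [hSe]
    exact hsum.sum_le_tsum _ (fun k _ => mul_nonneg (by positivity) (Real.rpow_nonneg (hAnn k) _))
  have hS0 : A 0 ^ (1 / gammaEx n p s ε) ≤ S := by
    have := hSN 1
    simpa using this
  have hS : 0 ≤ S := (Real.rpow_nonneg (hAnn 0) _).trans hS0
  generalize hAfe : ⨍ z in bB n x₀ R, |f z.1| ^ pStar n p s ∂nu n p ε = Af at *
  rcases eq_or_lt_of_le (hAnn 0) with hz | hz
  · -- degenerate case
    rw [hA0e, ← hz, mul_zero, ENNReal.ofReal_zero] at hAinv0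
    have h0 := zero_case hg0 hpC x₀ hHm hH0 hR hAinv0
    rw [hLe, h0, ENNReal.toReal_zero, mul_zero, Real.zero_rpow (by positivity)]
    have := hAnn 0
    positivity
  -- positivity of all averages
  have hApos : ∀ k, 0 < A k := by
    intro k
    have h1 := avg_inv hN hNe (r := 2 ^ k * R) (by positivity) x₀ (hHm.pow_const (gammaEx n p s ε))
      (fun z => Real.rpow_nonneg (hH0 z) _) (hav k).1
    have hsub : bB n x₀ R ⊆ bB n x₀ (2 ^ k * R) := by
      have : R ≤ 2 ^ k * R := le_mul_of_one_le_left hR.le (one_le_pow₀ (by norm_num))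
      unfold bB
      exact prod_mono (ball_subset_ball this) (ball_subset_ball this)
    have h2 := lintegral_mono_set (μ := volume) (f := fun z => ENNReal.ofReal (Hfun n p q s t ε a u z ^ gammaEx n p s ε * dn n p ε z)) hsub
    rw [h1, hAinv0, hA0e, hAk k] at h2
    have h3 : 0 < R ^ ((n:ℝ) + ε * p) * N * A 0 := by positivity
    have h4 := lt_of_lt_of_le (ENNReal.ofReal_pos.2 h3) h2
    rw [ENNReal.ofReal_pos] at h4
    by_contra hc
    have : A k = 0 := le_antisymm (not_lt.1 hc) (hAnn k)
    rw [this, mul_zero] at h4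
    exact lt_irrefl _ h4
  obtain ⟨f0, hf0e⟩ : ∃ f0 : ℝ, f0 = (∫⁻ x in ball x₀ R, ENNReal.ofReal (|f x| ^ pStar n p s)).toReal := ⟨_, rfl⟩
  have hf0 : 0 ≤ f0 := by rw [hf0e]; exact ENNReal.toReal_nonneg
  rw [← hf0e, ← hC3e] at hFbd
  obtain ⟨F, hFe⟩ : ∃ F : ℝ, F = R ^ (s * p - n / pStar n p s) * f0 ^ (1 / pStar n p s) := ⟨_, rfl⟩
  have hF0 : 0 ≤ F := by rw [hFe]; positivity
  have hFF : ∫⁻ x in BB n, ENNReal.ofReal (|ft p s x₀ R f x| ^ pStar n p s) ≤ ENNReal.ofReal (F ^ pStar n p s) := by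
    rw [ft_lint hR, ← ENNReal.ofReal_toReal hffin.ne, ← hf0e, ← ENNReal.ofReal_mul (by positivity)]
    refine ENNReal.ofReal_le_ofReal (le_of_eq ?_)
    rw [hFe, Real.mul_rpow (by positivity) (by positivity), ← Real.rpow_mul hR.le, ← Real.rpow_mul hf0, one_div_mul_cancel hr.ne',
      Real.rpow_one]
    congr 2
    field_simp
  obtain ⟨P, hPe⟩ : ∃ P : ℝ, P = R ^ ((s + ε) * (p - 1)) := ⟨_, rfl⟩
  have hP : 0 < P := by rw [hPe]; positivity
  obtain ⟨L, hL⟩ : ∃ L : ℝ, L = P * N ^ (1 / gammaEx n p s ε) * S := ⟨_, rfl⟩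
  obtain ⟨x, hx⟩ : ∃ x : ℝ, x = P * N ^ (1 / gammaEx n p s ε) * A 0 ^ (1 / gammaEx n p s ε) := ⟨_, rfl⟩
  have hx0 : 0 < x := by rw [hx]; positivity
  have hxL : x ≤ L := by rw [hx, hL]; exact mul_le_mul_of_nonneg_left hS0 (by positivity)
  have hLp : 0 < L := by linarith
  obtain ⟨Q, hQe⟩ : ∃ Q : ℕ → ℝ, Q = fun k : ℕ => R ^ ((s + ε) * etaEx n p s ε) * ((2:ℝ) ^ k) ^ ((n:ℝ) + ε * p) * N * A k := ⟨_, rfl⟩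
  have hQ0 : Q 0 = x ^ (etaEx n p s ε / (p - 1)) := by
    have hAn := hAnn 0
    rw [hQe, hx, hPe]
    simp only [pow_zero, Real.one_rpow, mul_one]
    rw [← hge, Real.mul_rpow (by positivity) (by positivity), Real.mul_rpow (by positivity) (by positivity), ← Real.rpow_mul hR.le,
      ← Real.rpow_mul hN.le, ← Real.rpow_mul hAn, one_div_mul_cancel hg0.ne', Real.rpow_one, Real.rpow_one]
    congr 3
    rw [hge]; field_simp
  have hfinal := hmain (etaEx n p s ε) (s + ε) (s * n / (n + ε * p)) (L ^ (1 / (p - 1))) F Q _ _ _ hA x1 x2 x3 x4 x5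
    (by linarith) x6 x7 (by
      rw [x6]
      have : 0 ≤ (s + ε) * (p - etaEx n p s ε) := mul_nonneg (by linarith) (by linarith)
      have : s * p ≤ p := mul_le_of_le_one_left hp0.le hs1.le
      linarith) (by positivity)
    (fun j => by rw [hQe]; have := hApos j; positivity)
    (fun j => by rw [hQe]; have := hQ j; rw [hAk] at this; exact this)
    (by
      intro m
      rw [← Real.rpow_mul hLp.le, one_div_mul_cancel hp1.ne', Real.rpow_one, hL]
      refine le_trans ?_ (mul_le_mul_of_nonneg_left (hSN m) (by positivity))
      rw [Finset.mul_sum]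
      refine Finset.sum_le_sum (fun k _ => ?_)
      rw [hQe, hPe]
      exact term_alg k hp hηpos hge hηe hτ.le hR hN (hAnn k))
    hF0 hFF
  have hLb := L_bd hn hp hpq hs0 ht0 htq hR hK0 x₀ hA hfinal
  rw [hQ0] at hLb
  obtain ⟨Y, hY⟩ : ∃ Y : ℝ, Y = (L ^ (1 / (p - 1))) ^ (p - etaEx n p s ε) * x ^ (etaEx n p s ε / (p - 1)) := ⟨_, rfl⟩
  rw [← hY] at hLb
  have hY0 : 0 ≤ Y := by rw [hY]; positivity
  have hYb := yalg hp x2 x3 hx0 hxL hσ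
  rw [← hY, hL, hx] at hYb
  have hX : ⨍ z in bB n x₀ (R / 4), Hfun n p q s t ε a u z ^ pC p ∂nu n p ε ≤
      ((R / 4) ^ ((n:ℝ) + ε * p) * N)⁻¹ * (R ^ ((n:ℝ) - s * p) * (C1 * (Y + F ^ pC p))) := by
    rw [hLe]
    refine mul_le_mul_of_nonneg_left ?_ (by positivity)
    have e : ∀ z, Hfun n p q s t ε a u z ^ pC p * dn n p ε z = energyIntegrand n p q s t a u z := by
      intro z; rw [H_pC hp ha0, G_dn hn hp hq hs0 ht0 hεp1]
    simp_rw [e]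
    refine (ENNReal.toReal_mono ENNReal.ofReal_ne_top hLb).trans ?_
    rw [ENNReal.toReal_ofReal (by positivity), mul_assoc]
    refine mul_le_mul_of_nonneg_left ?_ (by positivity)
    rw [hC1e, mul_assoc]
    refine mul_le_mul_of_nonneg_left (mul_le_mul_of_nonneg_right (by linarith) (by positivity)) (by linarith)
  have hfin1 := lhs_alg hn0 hp hεp1 hR hN hL0 hC1 hY0 hF0 hX
  rw [← hDe, ← hPe] at hfin1
  have hfp := fpart hn2 hp hs0 hs1 hε hεp hR hN hCν hNC hc0 hc1 hcN hr hrd hC3 hf0 hAf0 hFbd (θ := thetaEx n p s ε) rfl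
  rw [← hFe, ← hPe, ← hC4e] at hfp
  have hμ0 : 0 ≤ 1 / gammaEx n p s ε - 1 / pC p := by rw [hgd]; positivity
  have hμ1 : 1 / gammaEx n p s ε - 1 / pC p ≤ 1 := by
    have : 0 < ε * p := by positivity
    have hh : s * (p - 1) = s * p - s := by ring
    rw [hgd, div_le_one (by positivity), hh]; linarith
  have hup := upart hP hN hCν hε hNC rfl hμ0 hμ1 hS (Real.rpow_nonneg (hAnn 0) (1 / gammaEx n p s ε)) hσ
  have hcoef : 0 ≤ P⁻¹ * (N ^ (1 / pC p))⁻¹ := by positivity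
  have hstep := mul_le_mul_of_nonneg_left hYb hcoef
  generalize hv0 : A 0 ^ (1 / gammaEx n p s ε) = v at *
  have hv : 0 ≤ v := by rw [← hv0]; exact Real.rpow_nonneg (hAnn 0) _
  have hw0 : 0 ≤ Af ^ (1 / pStar n p s) := by positivity
  have ht1 : 0 ≤ (R ^ ((n:ℝ) + ε * p) * N) ^ thetaEx n p s ε / ε ^ (1 / pStar n p s - 1 / pC p) * Af ^ (1 / pStar n p s) := by positivity
  have ht2 : 0 ≤ 1 / σ / ε ^ (1 / gammaEx n p s ε - 1 / pC p) * v + σ / ε ^ (1 / gammaEx n p s ε - 1 / pC p) * S := by positivity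
  refine hfin1.trans ?_
  rw [mul_add]
  calc _ ≤ D * ((Cν / σ / ε ^ (1 / gammaEx n p s ε - 1 / pC p) * v + Cν * σ / ε ^ (1 / gammaEx n p s ε - 1 / pC p) * S) +
        C4 * ((R ^ ((n:ℝ) + ε * p) * N) ^ thetaEx n p s ε / ε ^ (1 / pStar n p s - 1 / pC p) * Af ^ (1 / pStar n p s))) :=
        mul_le_mul_of_nonneg_left (add_le_add (hstep.trans hup) hfp) hD.le
    _ = D * Cν * (1 / σ / ε ^ (1 / gammaEx n p s ε - 1 / pC p) * v + σ / ε ^ (1 / gammaEx n p s ε - 1 / pC p) * S) +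
        D * C4 * ((R ^ ((n:ℝ) + ε * p) * N) ^ thetaEx n p s ε / ε ^ (1 / pStar n p s - 1 / pC p) * Af ^ (1 / pStar n p s)) := by ring
    _ ≤ D * (Cν + C4) * (1 / σ / ε ^ (1 / gammaEx n p s ε - 1 / pC p) * v + σ / ε ^ (1 / gammaEx n p s ε - 1 / pC p) * S) +
        D * (Cν + C4) * ((R ^ ((n:ℝ) + ε * p) * N) ^ thetaEx n p s ε / ε ^ (1 / pStar n p s - 1 / pC p) * Af ^ (1 / pStar n p s)) := by
        refine add_le_add (mul_le_mul_of_nonneg_right (mul_le_mul_of_nonneg_left (by linarith) hD.le) ht2)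
          (mul_le_mul_of_nonneg_right (mul_le_mul_of_nonneg_left (by linarith) hD.le) ht1)
    _ = _ := by ring

/-- **Corollary 3.7, scale-invariant reverse Hölder inequality**: under
(A1)–(A3), for `ε ∈ (0, min{s(tq/(sp) − 1/p'), s/p})`, `H = G^{(p−1)/p}`,
`γ = p'(n+εp)/(n+sp+εp) < p'`, and any ball `B = B_R(x₀)` with `R ≤ 1`, there is `C`
(depending only on `n,p,q,s,t,M,‖u‖_∞`) such that for any bounded weak solution `u` and
any `σ ∈ (0,1)`:
`(⨍_{(1/4)𝓑} H^{p'} dν)^{1/p'} ≤ Cσ^{−1}ε^{−(1/γ−1/p')}(⨍_𝓑 H^γ dν)^{1/γ}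
 + Cσ ε^{−(1/γ−1/p')} Σ_k α_k (⨍_{2^k𝓑} H^γ dν)^{1/γ}
 + C [ν(𝓑)]^θ ε^{−(1/p_*−1/p')}(⨍_𝓑 F^{p_*} dν)^{1/p_*}`,
with `α_k = 2^{−k(tq/(p−1)−s−ε)}` and `θ = (s−ε(p−1))/(n+εp)`. -/
theorem stmt_10 (n : ℕ) (hn : 2 ≤ n) (p q s t M Λ : ℝ)
    (hp : 2 ≤ p) (hpq : p ≤ q)
    (hs0 : 0 < s) (hs1 : s < 1) (ht0 : 0 < t) (ht1 : t < 1) (hts : t ≤ s)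
    (hlow : 1 / pC p ≤ t * q / (s * p)) (hhigh : t * q / (s * p) ≤ 1)
    (hspn : s * p < n) :
    ∃ C : ℝ, 0 < C ∧
      ∀ ε : ℝ, 0 < ε → ε < s * (t * q / (s * p) - 1 / pC p) → ε < s / p →
      ∀ a : En n × En n → ℝ, Measurable a →
        (∀ z, 0 ≤ a z) → (∀ z, a z ≤ M) → (∀ x y, a (x, y) = a (y, x)) →
      ∀ δ₀ : ℝ, 0 < δ₀ →
      ∀ f : En n → ℝ, Measurable f →
        (∀ (x₀ : En n) (R : ℝ), 0 < R →
          (∫⁻ x in ball x₀ R, ENNReal.ofReal (|f x| ^ (pStar n p s + δ₀))) < ⊤) →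
      ∀ u : En n → ℝ, MemWsp n s p u → (∀ x, |u x| ≤ Λ) →
        IsBoundedWeakSolution n p q s t a u f →
      ∀ (x₀ : En n) (R : ℝ), 0 < R → R ≤ 1 →
      ∀ σ : ℝ, 0 < σ → σ < 1 →
        (⨍ z in bB n x₀ (R / 4), Hfun n p q s t ε a u z ^ pC p ∂nu n p ε) ^ (1 / pC p) ≤
          C / σ / ε ^ (1 / gammaEx n p s ε - 1 / pC p) *
              (⨍ z in bB n x₀ R, Hfun n p q s t ε a u z ^ gammaEx n p s ε ∂nu n p ε) ^
                (1 / gammaEx n p s ε)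
            + C * σ / ε ^ (1 / gammaEx n p s ε - 1 / pC p) *
                ∑' k : ℕ,
                  (2 : ℝ) ^ (-(k : ℝ) * (t * q / (p - 1) - s - ε)) *
                    (⨍ z in bB n x₀ (2 ^ k * R),
                        Hfun n p q s t ε a u z ^ gammaEx n p s ε ∂nu n p ε) ^
                      (1 / gammaEx n p s ε)
            + C * (nu n p ε (bB n x₀ R)).toReal ^ thetaEx n p s ε
                / ε ^ (1 / pStar n p s - 1 / pC p) *
                (⨍ z in bB n x₀ R, |f z.1| ^ pStar n p s ∂nu n p ε) ^ (1 / pStar n p s) := by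
  obtain ⟨C, hC, h⟩ := main_ineq n hn p q s t M Λ hp hpq hs0 hs1 ht0 hhigh hspn
  refine ⟨C, hC, fun ε h1 h2 h3 a h4 h5 h6 _ δ₀ h7 f h8 h9 u h10 h11 h12 x₀ R h13 h14 σ h15 h16 => ?_⟩
  exact h ε h1 h2 h3 a h4 h5 h6 δ₀ h7 f h8 h9 u h10.1 h11 h12 x₀ R h13 h14 σ h15 h16

end
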